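/- Let K be a number field, let p be a prime number, and let C₁ and C₂ be finite-dimensional central simple algebras over K such that p divides dim_K C₁ and p divides dim_K C₂. Then there exists a field extension L of K with [L : K] = p that admits a K-algebra embedding into C₁ and also admits a K-algebra embedding into C₂. -/

import Mathlib

set_option linter.all false
set_option linter.unusedVariables false
set_option linter.unusedSimpArgs false
namespace Prf
open Polynomial

/-! ## Group counting lemmas -/
section herbrand
variable {W : Type*} [AddCommGroup W]

lemma index_comp_aux (f g : W →+ W) :
    (f.comp g).range.index * (Nat.card f.ker * Nat.card g.ker)
     = f.range.index * g.range.index * Nat.card (f.comp g).ker := by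
  have h1 : (f.comp g).range = g.range.map f := by
    ext x; simp [AddMonoidHom.mem_range]
  have h2 : f.range = (⊤ : AddSubgroup W).map f := by
    ext x; simp [AddMonoidHom.mem_range]
  have h3 : (g.range.map f).relIndex ((⊤ : AddSubgroup W).map f)
      * f.range.index = (f.comp g).range.index := by
    rw [← h2, ← h1]
    apply AddSubgroup.relIndex_mul_index
    rw [h1, h2]; exact AddSubgroup.map_mono le_top
  rw [AddSubgroup.relIndex_map_map, top_sup_eq, AddSubgroup.relIndex_top_right] at h3
  have h4 : (AddMonoidHom.range g).relIndex (AddMonoidHom.range g ⊔ AddMonoidHom.ker f)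
     * (AddMonoidHom.range g ⊔ AddMonoidHom.ker f).index = (AddMonoidHom.range g).index :=
    AddSubgroup.relIndex_mul_index le_sup_left
  rw [AddSubgroup.relIndex_sup_left] at h4
  have h5 := AddSubgroup.card_mul_index ((AddMonoidHom.range g).addSubgroupOf (AddMonoidHom.ker f))
  have h6 : Nat.card (f.comp g).ker = Nat.card (AddMonoidHom.ker g) *
      Nat.card ((AddMonoidHom.range g).addSubgroupOf (AddMonoidHom.ker f)) := by
    have := AddSubgroup.card_mul_index ((AddMonoidHom.ker g).addSubgroupOf (f.comp g).ker)
    rw [← this]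
    congr 1
    · apply Nat.card_congr
      refine (AddSubgroup.addSubgroupOfEquivOfLe ?_).toEquiv
      intro x hx
      rw [AddMonoidHom.mem_ker] at hx ⊢
      simp [hx]
    · change (AddMonoidHom.ker g).relIndex (f.comp g).ker = _
      rw [AddSubgroup.relIndex_ker]
      apply Nat.card_congr
      have : AddSubgroup.map g (f.comp g).ker = AddMonoidHom.range g ⊓ AddMonoidHom.ker f := by
        ext x
        simp only [AddSubgroup.mem_map, AddMonoidHom.mem_ker, AddSubgroup.mem_inf, AddMonoidHom.mem_range]
        constructor
        · rintro ⟨y, hy, rfl⟩; exact ⟨⟨y, rfl⟩, hy⟩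
        · rintro ⟨⟨y, rfl⟩, hy⟩; exact ⟨y, hy, rfl⟩
      rw [this]
      rw [← AddSubgroup.inf_addSubgroupOf_right]
      exact (AddSubgroup.addSubgroupOfEquivOfLe inf_le_right).symm.toEquiv
  change _ * (AddMonoidHom.range g).relIndex (AddMonoidHom.ker f) = _ at h5
  rw [h6, ← h3, ← h4, ← h5]
  ring

/-- cokernel size -/
noncomputable def ix (f : Module.End ℤ W) : ℕ := Nat.card (W ⧸ LinearMap.range f)
/-- kernel size -/
noncomputable def kc (f : Module.End ℤ W) : ℕ := Nat.card (LinearMap.ker f)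

lemma index_comp (f g : Module.End ℤ W) :
    ix (f * g) * (kc f * kc g) = ix f * ix g * kc (f * g) :=
  index_comp_aux f.toAddMonoidHom g.toAddMonoidHom

lemma ix_congr {W' : Type*} [AddCommGroup W'] (e : W ≃ₗ[ℤ] W') (q : ℕ) :
    ix (q : Module.End ℤ W) = ix (q : Module.End ℤ W') ∧
    kc (q : Module.End ℤ W) = kc (q : Module.End ℤ W') := by
  constructor
  · apply Nat.card_congr
    refine (Submodule.Quotient.equiv _ _ e ?_).toEquiv
    ext x
    simp only [Submodule.mem_map, LinearMap.mem_range]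
    constructor
    · rintro ⟨y, ⟨z, rfl⟩, rfl⟩
      exact ⟨e z, by simp⟩
    · rintro ⟨y, rfl⟩
      exact ⟨_, ⟨e.symm y, rfl⟩, by simp⟩
  · apply Nat.card_congr
    refine e.toEquiv.subtypeEquiv ?_
    intro a
    simp only [LinearMap.mem_ker, Module.End.natCast_apply]
    rw [← map_eq_zero_iff e e.injective]; simp

lemma kc_ne_zero_of_finite [Finite W] (f : Module.End ℤ W) : ix f = kc f := by
  have h1 := (LinearMap.range f).card_eq_card_quotient_mul_card
  have h2 := (LinearMap.ker f).card_eq_card_quotient_mul_card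
  have h3 := Nat.card_congr f.quotKerEquivRange.toEquiv
  rw [h3] at h2
  have : Nat.card (LinearMap.range f) ≠ 0 := Nat.card_pos.ne'
  unfold ix kc
  rw [h1, mul_comm] at h2
  have := Nat.eq_of_mul_eq_mul_right (Nat.pos_of_ne_zero this) h2
  exact this

/-- `q`-index of a finitely generated abelian group. -/
lemma index_nsmul [Module.Finite ℤ W] (q : ℕ) (hq : q ≠ 0) :
    ix (q : Module.End ℤ W) = q ^ Module.finrank ℤ W * kc (q : Module.End ℤ W) ∧
    kc (q : Module.End ℤ W) ≠ 0 := by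
  let T := Submodule.torsion ℤ W
  have : Module.Finite ℤ (W ⧸ T) := inferInstance
  have : Module.Free ℤ (W ⧸ T) := Module.free_of_finite_type_torsion_free'
  obtain ⟨g, hg⟩ := Module.projective_lifting_property T.mkQ LinearMap.id T.mkQ_surjective
  have hfin : Finite T := by
    have : Module.Finite ℤ T := inferInstance
    exact Module.finite_of_fg_torsion T (Submodule.torsion_isTorsion)
  have hg' : ∀ y, T.mkQ (g y) = y := fun y => LinearMap.congr_fun hg y
  have e1 : W ≃ₗ[ℤ] T × (W ⧸ T) := by
    refine LinearEquiv.symm (LinearEquiv.ofBijective (LinearMap.coprod T.subtype g) ⟨?_, ?_⟩)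
    · rw [← LinearMap.ker_eq_bot, LinearMap.ker_eq_bot']
      rintro ⟨t, y⟩ h
      simp only [LinearMap.coprod_apply, Submodule.subtype_apply] at h
      have hy : y = 0 := by
        have := congrArg T.mkQ h
        rw [map_add, hg', map_zero] at this
        have h0 : T.mkQ (t : W) = 0 := by simp
        rwa [h0, zero_add] at this
      subst hy
      simp at h
      simp [h]
    · intro w
      refine ⟨(⟨w - g (T.mkQ w), ?_⟩, T.mkQ w), by simp⟩
      rw [← Submodule.Quotient.mk_eq_zero, ← Submodule.mkQ_apply, map_sub, hg', sub_self]
  have e2 : W ≃ₗ[ℤ] T × (Fin (Module.finrank ℤ (W ⧸ T)) → ℤ) :=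
    e1.trans (LinearEquiv.prodCongr (LinearEquiv.refl ℤ T)
      (Module.finBasis ℤ (W ⧸ T)).equivFun)
  have hr : Module.finrank ℤ W = Module.finrank ℤ (W ⧸ T) := by
    have := Submodule.finrank_quotient_add_finrank T
    have h0 : Module.finrank ℤ T = 0 := by
      rw [Module.finrank_eq_zero_iff_isTorsion]
      exact Submodule.torsion_isTorsion
    omega
  set n := Module.finrank ℤ (W ⧸ T)
  rw [(ix_congr e2 q).1, (ix_congr e2 q).2, hr]
  have hk : kc (q : Module.End ℤ (T × (Fin n → ℤ))) = kc (q : Module.End ℤ T) := by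
    apply Nat.card_congr
    refine ⟨fun x => ⟨x.1.1, ?_⟩, fun x => ⟨(x.1, 0), ?_⟩, ?_, ?_⟩
    · have := x.2
      simp only [LinearMap.mem_ker, Module.End.natCast_apply, Prod.ext_iff] at this ⊢
      exact this.1
    · have := x.2
      simp only [LinearMap.mem_ker, Module.End.natCast_apply, Prod.ext_iff] at this ⊢
      simpa using this
    · intro x
      have := x.2
      simp only [LinearMap.mem_ker, Module.End.natCast_apply, Prod.ext_iff] at this
      have h2 : x.1.2 = 0 := by
        have := this.2
        ext i
        have := congrFun this i
        simpa [hq] using this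
      apply Subtype.ext; apply Prod.ext
      · rfl
      · exact h2.symm
    · intro x; rfl
  have hi : ix (q : Module.End ℤ (T × (Fin n → ℤ))) = ix (q : Module.End ℤ T) * q ^ n := by
    let φ : (T × (Fin n → ℤ)) →ₗ[ℤ] (T ⧸ LinearMap.range (q : Module.End ℤ T)) × (Fin n → ZMod q) :=
      LinearMap.prodMap (Submodule.mkQ _)
        (LinearMap.pi fun i => (Int.castAddHom (ZMod q)).toIntLinearMap ∘ₗ LinearMap.proj i)
    have hφ : Function.Surjective φ := by
      rintro ⟨x, y⟩
      obtain ⟨x, rfl⟩ := Submodule.mkQ_surjective _ x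
      choose z hz using fun i => ZMod.intCast_surjective (y i)
      refine ⟨(x, z), ?_⟩
      ext i
      · simp [φ]
      · simp [φ, hz]
    have hker : LinearMap.ker φ = LinearMap.range (q : Module.End ℤ (T × (Fin n → ℤ))) := by
      ext ⟨x, y⟩
      simp only [LinearMap.mem_ker, LinearMap.mem_range, φ, LinearMap.prodMap_apply, Prod.mk_eq_zero,
        Submodule.mkQ_apply, Submodule.Quotient.mk_eq_zero, Module.End.natCast_apply]
      constructor
      · rintro ⟨⟨t, ht⟩, h2⟩
        have : ∀ i, ∃ z : ℤ, y i = q * z := fun i => by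
          have := congrFun h2 i
          simp at this
          exact (ZMod.intCast_zmod_eq_zero_iff_dvd _ _).1 this
        choose z hz using this
        refine ⟨(t, z), ?_⟩
        ext i
        · exact congrArg _ ht
        · simp [hz]
      · rintro ⟨⟨t, z⟩, h⟩
        rw [Prod.ext_iff] at h
        refine ⟨⟨t, h.1⟩, ?_⟩
        ext i
        have h2 := congrFun h.2 i
        simp at h2
        simp [← h2]
    have := Nat.card_congr (φ.quotKerEquivOfSurjective hφ).toEquiv
    rw [hker] at this
    unfold ix
    rw [this, Nat.card_prod, Nat.card_fun]
    simp
  rw [hi, hk, kc_ne_zero_of_finite]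
  exact ⟨mul_comm _ _, Nat.card_pos.ne'⟩

lemma list_prod_range {R : Type*} [CommMonoid R] (f : ℕ → R) (n : ℕ) :
    ((List.range n).map f).prod = ∏ i ∈ Finset.range n, f i := by
  induction n with
  | zero => simp
  | succ n ih => simp [List.range_succ, Finset.prod_range_succ, ih]

lemma kc_mul_ne_zero (f g : Module.End ℤ W) (hf : kc f ≠ 0) (hg : kc g ≠ 0) : kc (f * g) ≠ 0 := by
  unfold kc at *
  have h1 : Finite (LinearMap.ker f) := Nat.finite_of_card_ne_zero hf
  have h2 : Finite (LinearMap.ker g) := Nat.finite_of_card_ne_zero hg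
  have : Finite (LinearMap.ker (f * g)) := by
    have h3 : (LinearMap.ker (f * g)) = (LinearMap.ker f).comap g := rfl
    rw [h3]
    have h4 : ((LinearMap.ker f : Submodule ℤ W) : Set W).Finite := h1
    have h5 : (g ⁻¹' ((LinearMap.ker f : Submodule ℤ W) : Set W)).Finite := by
      refine Set.Finite.preimage' h4 fun b _ => ?_
      by_cases hb : ∃ a, g a = b
      · obtain ⟨a, rfl⟩ := hb
        have h6 : ((LinearMap.ker g : Submodule ℤ W) : Set W).Finite := h2
        refine (h6.image (fun x => a + x)).subset ?_
        intro x hx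
        refine ⟨x - a, ?_, by simp⟩
        simp at hx
        simp [hx]
      · convert Set.finite_empty
        ext x
        simp
        exact fun h => hb ⟨x, h⟩
    exact h5
  exact Nat.card_pos.ne'

lemma pow_q_eq_one (q : ℕ) (s : Module.End ℤ W)
    (hs : ∑ i ∈ Finset.range q, s ^ i = 0) : s ^ q = 1 := by
  have := geom_sum_mul s q
  rw [hs, zero_mul] at this
  exact (sub_eq_zero.1 this.symm)

lemma prod_one_sub_pow (q : ℕ) (hq : q.Prime) (s : Module.End ℤ W)
    (hs : ∑ i ∈ Finset.range q, s ^ i = 0) :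
    ((List.range (q-1)).map fun i => (1 - s ^ (i+1))).prod = (q : Module.End ℤ W) := by
  have : Fact q.Prime := ⟨hq⟩
  let P : ℤ[X] := ((List.range (q-1)).map fun i => (1 - (X : ℤ[X]) ^ (i+1))).prod
  obtain ⟨ζ, hζ⟩ : ∃ ζ : ℂ, IsPrimitiveRoot ζ q := ⟨_, Complex.isPrimitiveRoot_exp q hq.ne_zero⟩
  have h1 : aeval ζ (P - C (q : ℤ)) = 0 := by
    have h2 : aeval ζ P = ∏ i ∈ Finset.range (q-1), (1 - ζ ^ (i+1)) := by
      simp only [P, map_list_prod, List.map_map]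
      rw [← list_prod_range]
      congr 1
      apply List.map_congr_left
      intro i _
      simp
    have h3 := hζ
    rw [← Nat.sub_add_cancel hq.one_le] at h3
    have h4 := h3.prod_one_sub_pow_eq_order
    rw [map_sub, h2, h4]
    simp [hq.one_le]
  have h3 : cyclotomic q ℤ ∣ P - C (q : ℤ) := by
    rw [cyclotomic_eq_minpoly hζ hq.pos]
    exact minpoly.isIntegrallyClosed_dvd (hζ.isIntegral hq.pos) h1
  obtain ⟨R, hR⟩ := h3
  have h4 := congrArg (aeval s) hR
  rw [map_mul, cyclotomic_prime, map_sum] at h4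
  simp only [map_pow, aeval_X] at h4
  rw [hs, zero_mul, map_sub, sub_eq_zero] at h4
  simp only [P, map_list_prod, List.map_map] at h4
  convert h4 using 1
  · congr 1
    apply List.map_congr_left
    intro i _
    simp
  · simp

lemma range_ker_one_sub_pow (q : ℕ) (hq : q.Prime) (s : Module.End ℤ W)
    (hs : s ^ q = 1) (i : ℕ) (hi : 0 < i) (hiq : i < q) :
    ix (1 - s ^ i) = ix (1 - s) ∧ kc (1 - s ^ i) = kc (1 - s) := by
  have key : ∀ (t : Module.End ℤ W) (j : ℕ), LinearMap.range (1 - t ^ j) ≤ LinearMap.range (1 - t) ∧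
      LinearMap.ker (1 - t) ≤ LinearMap.ker (1 - t ^ j) := by
    intro t j
    constructor
    · rintro _ ⟨x, rfl⟩
      rw [← mul_neg_geom_sum t j]
      exact ⟨_, rfl⟩
    · intro x hx
      rw [LinearMap.mem_ker] at hx ⊢
      rw [← geom_sum_mul_neg t j, Module.End.mul_apply, hx, map_zero]
  obtain ⟨j, hj⟩ : ∃ j : ℕ, (s ^ i) ^ j = s := by
    have hc : Nat.Coprime i q := (Nat.coprime_comm.1 ((Nat.Prime.coprime_iff_not_dvd hq).2
      (fun h => by have := Nat.le_of_dvd hi h; omega)))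
    obtain ⟨j, hj⟩ := Nat.exists_mul_mod_eq_one_of_coprime hc hq.one_lt
    refine ⟨j, ?_⟩
    rw [← pow_mul]
    rw [← Nat.div_add_mod (i * j) q, hj.2, pow_add, pow_mul, hs]
    simp
  have h1 := key s i
  have h2 := key (s ^ i) j
  rw [hj] at h2
  unfold ix kc
  rw [le_antisymm h1.1 h2.1, le_antisymm h2.2 h1.2]
  exact ⟨rfl, rfl⟩

lemma herbrand [Module.Finite ℤ W] (q : ℕ) (hq : q.Prime) (s : Module.End ℤ W)
    (hs : ∑ i ∈ Finset.range q, s ^ i = 0) :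
    ix (1 - s) ^ (q - 1) = q ^ Module.finrank ℤ W * kc (1 - s) ^ (q-1) ∧ kc (1 - s) ≠ 0 := by
  have h1 := prod_one_sub_pow q hq s hs
  have h2 := index_nsmul (W := W) q hq.ne_zero
  have hsq := pow_q_eq_one q s hs
  have hk1 : kc (1 - s) ≠ 0 := by
    have hle : LinearMap.ker (1 - s) ≤ LinearMap.ker (q : Module.End ℤ W) := by
      intro x hx
      have hx' : s x = x := by
        have h0 : x - s x = 0 := hx
        exact (sub_eq_zero.1 h0).symm
      have hp : ∀ i : ℕ, (s ^ i) x = x := by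
        intro i
        induction i with
        | zero => simp
        | succ n ih => rw [pow_succ, Module.End.mul_apply, hx', ih]
      have := LinearMap.congr_fun hs x
      simp only [LinearMap.sum_apply, hp] at this
      simpa using this
    have : Finite (LinearMap.ker (q : Module.End ℤ W)) := Nat.finite_of_card_ne_zero h2.2
    have : Finite (LinearMap.ker (1 - s)) :=
      Finite.of_injective _ (Submodule.inclusion_injective hle)
    exact Nat.card_pos.ne'
  have h3 : ∀ n : ℕ, n ≤ q - 1 →
      ix ((List.range n).map fun i => (1 - s ^ (i+1))).prod * kc (1 - s) ^ n
      = ix (1 - s) ^ n * kc ((List.range n).map fun i => (1 - s ^ (i+1))).prod ∧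
      kc ((List.range n).map fun i => (1 - s ^ (i+1))).prod ≠ 0 := by
    intro n
    induction n with
    | zero =>
      intro _
      simp only [List.range_zero, List.map_nil, List.prod_nil, pow_zero, mul_one, one_mul]
      unfold ix kc
      have e1 : LinearMap.range (1 : Module.End ℤ W) = ⊤ := LinearMap.range_id
      have e2 : LinearMap.ker (1 : Module.End ℤ W) = ⊥ := LinearMap.ker_id
      rw [e1, e2, Nat.card_unique, Nat.card_unique]
      simp
    | succ n ih =>
      intro hn
      obtain ⟨ih, ih0⟩ := ih (by omega)
      rw [List.range_succ, List.map_append, List.prod_append]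
      simp only [List.map_cons, List.map_nil, List.prod_cons, List.prod_nil, mul_one]
      set f := ((List.range n).map fun i => (1 - s ^ (i+1))).prod
      have h4 := index_comp f (1 - s ^ (n+1))
      obtain ⟨h5, h6⟩ := range_ker_one_sub_pow q hq s hsq (n+1) (by omega) (by omega)
      refine ⟨?_, kc_mul_ne_zero _ _ ih0 (h6 ▸ hk1)⟩
      rw [h5, h6] at h4
      apply Nat.eq_of_mul_eq_mul_right (Nat.pos_of_ne_zero ih0)
      calc _ = (ix (f * (1 - s ^ (n+1))) * (kc f * kc (1 - s))) * kc (1 - s) ^ n := by ring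
        _ = (ix f * kc (1 - s) ^ n) * ix (1-s) * kc (f * (1 - s ^ (n+1))) := by rw [h4]; ring
        _ = _ := by rw [ih]; ring
  have h4 := (h3 (q-1) le_rfl).1
  rw [h1, h2.1] at h4
  refine ⟨?_, hk1⟩
  apply Nat.eq_of_mul_eq_mul_right (Nat.pos_of_ne_zero h2.2)
  rw [← h4]; ring
end herbrand

section lin
variable {G : Type*} [CommGroup G]

lemma lin_lower {ι : Type*} [Fintype ι] (q : ℕ) (hq : q.Prime) (N : Subgroup G) (hN : N.index ≠ 0)
    (g : ι → G) (h : ∀ c : ι → ℤ, ∏ i, g i ^ c i ∈ N → ∀ i, (q : ℤ) ∣ c i) :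
    q ^ Fintype.card ι ≤ N.index := by
  classical
  have : Finite (G ⧸ N) := Nat.finite_of_card_ne_zero hN
  let φ : (ι → Fin q) → G ⧸ N := fun c => QuotientGroup.mk (∏ i, g i ^ ((c i : ℕ) : ℤ))
  have hφ : Function.Injective φ := by
    intro c d hcd
    have := QuotientGroup.eq.1 hcd
    rw [← Finset.prod_inv_distrib, ← Finset.prod_mul_distrib] at this
    have h2 := h (fun i => (d i : ℕ) - (c i : ℕ)) (by
      convert this using 2 with i
      rw [zpow_sub, mul_comm])
    ext i
    have h3 := h2 i
    obtain ⟨k, hk⟩ := h3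
    have h4 := (c i).2
    have h5 := (d i).2
    have hk0 : k = 0 := by
      have a1 : (q:ℤ) * k < q * 1 := by omega
      have a2 : (q:ℤ) * (-1) < q * k := by omega
      have := lt_of_mul_lt_mul_left a1 (by positivity)
      have := lt_of_mul_lt_mul_left a2 (by positivity)
      omega
    subst hk0
    omega
  have h2 := Nat.card_le_card_of_injective φ hφ
  rw [Nat.card_fun, Nat.card_eq_fintype_card (α := ι), Nat.card_eq_fintype_card (α := Fin q),
    Fintype.card_fin] at h2
  exact h2

lemma lin_upper {ι : Type*} [Fintype ι] (q : ℕ) (hq : q.Prime) (N : Subgroup G)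
    (hN : ∀ x : G, x ^ q ∈ N)
    (g : ι → G) (h : ∀ x : G, ∃ c : ι → ℤ, x * ∏ i, g i ^ c i ∈ N) :
    N.index ≤ q ^ Fintype.card ι ∧ N.index ≠ 0 := by
  classical
  have hq0 : (q : ℤ) ≠ 0 := by exact_mod_cast hq.ne_zero
  let φ : (ι → Fin q) → G ⧸ N := fun c => QuotientGroup.mk (∏ i, g i ^ ((c i : ℕ) : ℤ))
  have hφ : Function.Surjective φ := by
    intro x
    obtain ⟨x, rfl⟩ := QuotientGroup.mk_surjective x
    obtain ⟨c, hc⟩ := h x⁻¹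
    have hpos : ∀ i, 0 ≤ c i % q := fun i => Int.emod_nonneg _ hq0
    have hlt : ∀ i, c i % q < q := fun i => Int.emod_lt_of_pos _ (by exact_mod_cast hq.pos)
    refine ⟨fun i => ⟨(c i % q).toNat, by have := hpos i; have := hlt i; omega⟩, ?_⟩
    refine Eq.symm (QuotientGroup.eq.2 ?_)
    have : (x⁻¹ * ∏ i, g i ^ c i) * ((∏ i, g i ^ (c i / q)) ^ q)⁻¹ ∈ N :=
      N.mul_mem hc (N.inv_mem (hN _))
    convert this using 1
    rw [mul_assoc, ← Finset.prod_pow, ← Finset.prod_inv_distrib, ← Finset.prod_mul_distrib]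
    congr 1
    apply Finset.prod_congr rfl
    intro i _
    simp only
    rw [Int.toNat_of_nonneg (hpos i), Int.emod_def, zpow_sub, mul_comm (q : ℤ), zpow_mul]
    simp
  have : Finite (G ⧸ N) := Finite.of_surjective φ hφ
  have h2 := Nat.card_le_card_of_surjective φ hφ
  rw [Nat.card_fun, Nat.card_eq_fintype_card (α := ι), Nat.card_eq_fintype_card (α := Fin q),
    Fintype.card_fin] at h2
  refine ⟨h2, Nat.card_pos.ne'⟩
end lin
end Prf
set_option linter.all false
set_option linter.unusedVariables false
set_option linter.unusedSimpArgs false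
namespace Prf
open Polynomial

/-! ## Norm forms -/

/-- `∏ y(ζ^i X)` -/
noncomputable def npol {E : Type*} [Field E] (ζ : E) (q : ℕ) (y : E[X]) : E[X] :=
  ∏ i ∈ Finset.range q, y.comp (C (ζ ^ i) * X)

/-- `b` is a norm from `E[X]/(X^q - a)` -/
def NF {E : Type*} [Field E] (ζ : E) (q : ℕ) (a b : E) : Prop :=
  ∃ y : E[X], (X ^ q - C a) ∣ npol ζ q y - C b

section
variable {E : Type*} [Field E] {ζ : E} {q : ℕ} {a b c : E}

lemma npol_mul (y z : E[X]) : npol ζ q (y * z) = npol ζ q y * npol ζ q z := by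
  simp [npol, Finset.prod_mul_distrib]

lemma NF.mul {b' : E} (h : NF ζ q a b) (h' : NF ζ q a b') : NF ζ q a (b * b') := by
  obtain ⟨y, hy⟩ := h
  obtain ⟨z, hz⟩ := h'
  refine ⟨y * z, ?_⟩
  rw [npol_mul, C_mul]
  have : npol ζ q y * npol ζ q z - C b * C b' = (npol ζ q y - C b) * npol ζ q z
    + C b * (npol ζ q z - C b') := by ring
  rw [this]
  exact dvd_add (hy.mul_right _) (hz.mul_left _)

lemma NF_pow (c : E) : NF ζ q a (c ^ q) := by
  refine ⟨C c, ?_⟩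
  simp [npol]

lemma NF.pow (h : NF ζ q a b) (n : ℕ) : NF ζ q a (b ^ n) := by
  induction n with
  | zero => simpa using NF_pow (ζ := ζ) (q := q) (a := a) (1 : E)
  | succ n ih => rw [pow_succ]; exact ih.mul h

lemma NF.inv (hq : q ≠ 0) (hb : b ≠ 0) (h : NF ζ q a b) : NF ζ q a b⁻¹ := by
  have : b⁻¹ = b ^ (q - 1) * (b⁻¹) ^ q := by
    obtain ⟨n, rfl⟩ := Nat.exists_eq_succ_of_ne_zero hq
    simp [pow_succ]
    field_simp
  rw [this]
  exact (h.pow _).mul (NF_pow _)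

lemma NF.map {F : Type*} [Field F] (f : E →+* F) (h : NF ζ q a b) : NF (f ζ) q (f a) (f b) := by
  obtain ⟨y, hy⟩ := h
  refine ⟨y.map f, ?_⟩
  have := Polynomial.map_dvd f hy
  simpa [npol, Polynomial.map_prod, Polynomial.map_comp] using this

lemma modulus_comp (i : ℕ) (hζ : ζ ^ q = 1) :
    (X ^ q - C a : E[X]).comp (C (ζ ^ i) * X) = X ^ q - C a := by
  simp only [sub_comp, X_pow_comp, C_comp, mul_pow]
  rw [← C_pow, ← pow_mul, mul_comm i q, pow_mul, hζ]
  simp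

lemma NF.exists_lt (hq : q ≠ 0) (hζ : ζ ^ q = 1) (h : NF ζ q a b) :
    ∃ y : E[X], y.degree < q ∧ (X ^ q - C a) ∣ npol ζ q y - C b := by
  obtain ⟨y, hy⟩ := h
  have hm : (X ^ q - C a : E[X]).Monic := monic_X_pow_sub_C a hq
  refine ⟨y %ₘ (X ^ q - C a), ?_, ?_⟩
  · have := degree_modByMonic_lt y hm
    rwa [degree_X_pow_sub_C (Nat.pos_of_ne_zero hq)] at this
  · have key : (X ^ q - C a) ∣ npol ζ q y - npol ζ q (y %ₘ (X ^ q - C a)) := by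
      rw [← Ideal.mem_span_singleton, ← Ideal.Quotient.mk_eq_mk_iff_sub_mem]
      unfold npol
      rw [map_prod, map_prod]
      apply Finset.prod_congr rfl
      intro i _
      rw [Ideal.Quotient.mk_eq_mk_iff_sub_mem, Ideal.mem_span_singleton, ← sub_comp]
      have h2 : (X ^ q - C a) ∣ y - y %ₘ (X ^ q - C a) := by
        rw [modByMonic_eq_sub_mul_div]
        simp
      obtain ⟨r, hr⟩ := h2
      rw [hr, mul_comp, modulus_comp i hζ]
      exact dvd_mul_right _ _
    have := dvd_sub hy key
    simpa using this

lemma NF.exists_aeval (hq : q ≠ 0) (hζ : ζ ^ q = 1) (h : NF ζ q a b) :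
    ∃ y : E[X], y.degree < q ∧ ∀ (F : Type _) [Field F] [Algebra E F] (θ : F),
      θ ^ q = algebraMap E F a → 
        ∏ i ∈ Finset.range q, aeval (algebraMap E F ζ ^ i * θ) y = algebraMap E F b := by
  obtain ⟨y, h1, h2⟩ := h.exists_lt hq hζ
  refine ⟨y, h1, fun F _ _ θ hθ => ?_⟩
  have := map_dvd (aeval θ (R := E)) h2
  simp only [map_sub, map_pow, aeval_X, aeval_C, hθ, sub_self, zero_dvd_iff, sub_eq_zero, npol, map_prod,
    aeval_comp, map_mul] at this
  exact this

lemma NF_of_aeval {F : Type*} [Field F] [Algebra E F] (hirr : Irreducible (X ^ q - C a : E[X]))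
    (hq : q ≠ 0) (θ : F) (hθ : θ ^ q = algebraMap E F a) (y : E[X])
    (hy : ∏ i ∈ Finset.range q, aeval (algebraMap E F ζ ^ i * θ) y = algebraMap E F b) :
    NF ζ q a b := by
  refine ⟨y, ?_⟩
  have hmin : minpoly E θ = X ^ q - C a := by
    symm
    apply minpoly.eq_of_irreducible_of_monic hirr
    · simp [hθ]
    · exact monic_X_pow_sub_C a hq
  rw [← hmin]
  apply minpoly.dvd
  simp only [npol, map_sub, map_prod, aeval_comp, map_mul, aeval_C, aeval_X, map_pow, hy, sub_self]

lemma NF.of_mul_pow (hc : c ≠ 0) (h : NF ζ q a b) : NF ζ q (a * c ^ q) b := by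
  obtain ⟨y, hy⟩ := h
  refine ⟨y.comp (C c⁻¹ * X), ?_⟩
  obtain ⟨r, hr⟩ := hy
  refine ⟨C ((c⁻¹)^q) * r.comp (C c⁻¹ * X), ?_⟩
  have := congrArg (fun p => p.comp (C c⁻¹ * X)) hr
  simp only [sub_comp, mul_comp, X_pow_comp, C_comp, npol, prod_comp, comp_assoc] at this
  have h2 : ∏ i ∈ Finset.range q, y.comp ((C (ζ ^ i)* X).comp (C c⁻¹ * X)) = npol ζ q (y.comp (C c⁻¹ * X)) := by
    unfold npol
    apply Finset.prod_congr rfl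
    intro i _
    rw [comp_assoc]
    congr 1
    simp
    ring
  simp only [mul_comp, C_comp, X_comp] at h2
  simp only [X_comp] at this
  rw [h2] at this
  rw [this]
  have h3 : (C c⁻¹ * X) ^ q - C a = (X ^ q - C (a * c ^ q)) * C (c⁻¹ ^ q) := by
    rw [mul_pow, sub_mul, ← C_mul, ← C_pow, mul_comm, mul_assoc, ← mul_pow, mul_inv_cancel₀ hc]
    simp
  rw [h3]; ring

lemma NF_of_isPow (hζ : IsPrimitiveRoot ζ q) (hq : q ≠ 0) (hc : c ≠ 0) (b : E) : NF ζ q (c ^ q) b := by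
  classical
  have hinj : Set.InjOn (fun i : ℕ => ζ ^ i * c) (Finset.range q : Set ℕ) := by
    intro i hi j hj hij
    exact hζ.pow_inj (by simpa using hi) (by simpa using hj) (mul_right_cancel₀ hc hij)
  let y := Lagrange.interpolate (Finset.range q) (fun i : ℕ => ζ ^ i * c) (fun i => if i = 0 then b else 1)
  have hy : ∀ i < q, eval (ζ ^ i * c) y = if i = 0 then b else 1 := fun i hi =>
    Lagrange.eval_interpolate_at_node (s := Finset.range q) (v := fun i : ℕ => ζ ^ i * c)
      (fun i => if i = 0 then b else 1) hinj (by simpa using hi)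
  refine ⟨y, ?_⟩
  have hprod : (X ^ q - C (c ^ q) : E[X]) = ∏ j ∈ Finset.range q, (X - C (ζ ^ j * c)) := by
    rw [X_pow_sub_C_eq_prod hζ (Nat.pos_of_ne_zero hq) rfl]
  rw [hprod]
  apply Finset.prod_dvd_of_coprime
  · intro i hi j hj hij
    apply isCoprime_X_sub_C_of_isUnit_sub
    rw [isUnit_iff_ne_zero, sub_ne_zero]
    exact fun h => hij (hinj hi hj h)
  · intro j hj
    rw [dvd_iff_isRoot, IsRoot, eval_sub, eval_C, sub_eq_zero, npol, eval_prod]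
    have hj' : j < q := by simpa using hj
    have hmod : ∀ i, eval (ζ ^ j * c) (y.comp (C (ζ ^ i) * X)) = if (i + j) % q = 0 then b else 1 := by
      intro i
      rw [eval_comp]
      simp only [eval_mul, eval_C, eval_X]
      rw [← hy _ (Nat.mod_lt _ (Nat.pos_of_ne_zero hq)), ← mul_assoc, ← pow_add]
      congr 2
      rw [← pow_mod_orderOf, ← hζ.eq_orderOf]
    simp_rw [hmod]
    obtain ⟨i0, hi0, hi1⟩ : ∃ i0 < q, (i0 + j) % q = 0 := by
      by_cases h0 : j = 0
      · exact ⟨0, by omega, by simp [h0]⟩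
      · exact ⟨q - j, by omega, by rw [Nat.sub_add_cancel hj'.le]; simp⟩
    rw [Finset.prod_eq_single_of_mem i0 (by simpa using hi0), if_pos hi1]
    intro i hi hne
    rw [if_neg]
    intro h
    apply hne
    have hi' : i < q := by simpa using hi
    have h2 : (i0 + j) ≡ (i + j) [MOD q] := by rw [Nat.ModEq, h, hi1]
    have h3 := Nat.ModEq.add_right_cancel' j h2
    rw [Nat.ModEq, Nat.mod_eq_of_lt hi0, Nat.mod_eq_of_lt hi'] at h3
    exact h3.symm

lemma irr_of_not_pow (hq : q.Prime) (h : ∀ c, c ^ q ≠ a) : Irreducible (X ^ q - C a : E[X]) :=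
  X_pow_sub_C_irreducible_of_prime hq h

lemma aeval_comm_op {W : Type*} [AddCommGroup W] [Module E W] (x y : Module.End E W)
    (hyx : y * x = ζ • (x * y)) (p : E[X]) : y * aeval x p = aeval x (p.comp (C ζ * X)) * y := by
  induction p using Polynomial.induction_on' with
  | add p r hp hr => simp [mul_add, add_mul, hp, hr]
  | monomial n r =>
    have h1 : ∀ n : ℕ, y * x ^ n = ζ ^ n • (x ^ n * y) := by
      intro n
      induction n with
      | zero => simp
      | succ n ih =>
        rw [pow_succ, ← mul_assoc, ih, smul_mul_assoc, mul_assoc, hyx, mul_smul_comm, smul_smul, mul_assoc,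
          pow_succ]
    rw [← C_mul_X_pow_eq_monomial]
    simp only [map_mul, aeval_C, map_pow, aeval_X, mul_comp, C_comp, X_pow_comp, mul_pow, aeval_comp]
    rw [← mul_assoc, ← Algebra.commutes, mul_assoc, h1, ← map_pow]
    simp only [Algebra.algebraMap_eq_smul_one, smul_mul_assoc, one_mul, mul_assoc, mul_smul_comm]

/-- The operator lemma. -/
lemma NF_of_op (hζ : IsPrimitiveRoot ζ q) (hq : q.Prime) (ha : a ≠ 0)
    {W : Type*} [AddCommGroup W] [Module E W] (hW : Module.finrank E W = q) (x y : Module.End E W)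
    (hx : x ^ q = a • 1) (hy : y ^ q = b • 1) (hyx : y * x = ζ • (x * y)) : NF ζ q a b := by
  by_cases hpow : ∃ c, c ^ q = a
  · obtain ⟨c, rfl⟩ := hpow
    exact NF_of_isPow hζ hq.ne_zero (fun h => ha (by simp [h, hq.ne_zero])) b
  push Not at hpow
  have hirr := irr_of_not_pow hq hpow
  have hfd : FiniteDimensional E W := Module.finite_of_finrank_pos (by rw [hW]; exact hq.pos)
  have : Nontrivial W := Module.nontrivial_of_finrank_pos (R := E) (by rw [hW]; exact hq.pos)
  obtain ⟨w, hw⟩ := exists_ne (0 : W)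
  have hxa : aeval x (X ^ q - C a) = 0 := by
    simp [hx, Algebra.algebraMap_eq_smul_one]
  have key : ∀ p : E[X], aeval x p w = 0 → (X ^ q - C a) ∣ p := by
    intro p hp
    by_contra hnd
    obtain ⟨u, v, huv⟩ := (hirr.coprime_iff_not_dvd (n := p)).2 hnd
    apply hw
    have := congrArg (fun r => aeval x r w) huv
    simpa [map_add, map_mul, hp, hx, Algebra.algebraMap_eq_smul_one] using this.symm
  let φ : degreeLT E q →ₗ[E] W :=
    { toFun := fun p => aeval x (p : E[X]) w
      map_add' := by intros; simp
      map_smul' := by intros; simp }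
  have hφ : Function.Injective φ := by
    rw [← LinearMap.ker_eq_bot, LinearMap.ker_eq_bot']
    rintro ⟨p, hp⟩ h
    have h1 := key p h
    rw [mem_degreeLT] at hp
    have := eq_zero_of_dvd_of_degree_lt h1 (by rwa [degree_X_pow_sub_C hq.pos])
    simpa using this
  have hfr : Module.finrank E (degreeLT E q) = Module.finrank E W := by
    rw [hW, (degreeLTEquiv E q).finrank_eq]; simp
  have : FiniteDimensional E (degreeLT E q) := (degreeLTEquiv E q).symm.finiteDimensional
  have hsurj := (LinearMap.injective_iff_surjective_of_finrank_eq_finrank hfr).1 hφ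
  obtain ⟨⟨f, _⟩, hf⟩ := hsurj (y w)
  have hf : aeval x f w = y w := hf
  have hk : ∀ k : ℕ, (y ^ k) w = aeval x (npol ζ k f) w := by
    intro k
    induction k with
    | zero => simp [npol]
    | succ k ih =>
      rw [pow_succ', Module.End.mul_apply, ih, ← Module.End.mul_apply, aeval_comm_op x y hyx,
        Module.End.mul_apply, ← hf, ← Module.End.mul_apply, ← map_mul]
      congr 2
      unfold npol
      rw [Finset.prod_range_succ', prod_comp]
      congr 1
      · apply Finset.prod_congr rfl
        intro i _
        rw [comp_assoc]
        congr 1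
        simp [pow_succ]
        ring
      · simp
  refine ⟨f, key _ ?_⟩
  rw [map_sub, LinearMap.sub_apply, ← hk q, hy]
  simp [Algebra.algebraMap_eq_smul_one]

lemma NF.symm (hζ : IsPrimitiveRoot ζ q) (hq : q.Prime) (ha : a ≠ 0) (hb : b ≠ 0) (h : NF ζ q a b) :
    NF ζ q b a := by
  obtain ⟨y, hy⟩ := h
  let A := AdjoinRoot (X ^ q - C a : E[X])
  have hm : (X ^ q - C a : E[X]).Monic := monic_X_pow_sub_C a hq.ne_zero
  have hfr : Module.finrank E A = q := by
    rw [(AdjoinRoot.powerBasis' hm).finrank]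
    simp [AdjoinRoot.powerBasis'_dim]
  let r : A := AdjoinRoot.root _
  have hr : r ^ q = algebraMap E A a := by
    have := AdjoinRoot.eval₂_root (X ^ q - C a : E[X])
    simp only [eval₂_sub, eval₂_X_pow, eval₂_C, sub_eq_zero] at this
    exact this
  have hXr : AdjoinRoot.mk (X ^ q - C a : E[X]) X = r := AdjoinRoot.mk_X
  have hζr : (algebraMap E A ζ * r) ^ q = algebraMap E A a := by
    rw [mul_pow, hr, ← map_pow, hζ.pow_eq_one, map_one, one_mul]
  let σ : A →ₐ[E] A := AdjoinRoot.liftAlgHom _ (Algebra.ofId E A) (algebraMap E A ζ * r) (by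
    simp only [eval₂_sub, eval₂_X_pow, eval₂_C, sub_eq_zero, hζr]; rfl)
  have hσr : σ r = algebraMap E A ζ * r := by
    exact AdjoinRoot.liftAlgHom_root ..
  have hmk : ∀ p, AdjoinRoot.mk (X ^ q - C a : E[X]) p = aeval r p := fun p => (AdjoinRoot.aeval_eq p).symm
  have hσ : ∀ p, σ (AdjoinRoot.mk _ p) = AdjoinRoot.mk _ (p.comp (C ζ * X)) := by
    intro p
    rw [hmk, hmk, aeval_comp, map_mul, aeval_C, aeval_X, ← aeval_algHom_apply, hσr]
  let Y : Module.End E A := LinearMap.mulLeft E (AdjoinRoot.mk _ y) * σ.toLinearMap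
  have hYa : ∀ z, Y z = AdjoinRoot.mk _ y * σ z := fun z => rfl
  let ri : A := algebraMap E A a⁻¹ * r ^ (q - 1)
  have hri : ri * r = 1 := by
    simp only [ri]
    rw [mul_assoc, ← pow_succ, Nat.sub_add_cancel hq.one_le, hr, ← map_mul, inv_mul_cancel₀ ha, map_one]
  have hri2 : ri ^ q = algebraMap E A a⁻¹ := by
    have h1 : ri ^ q * r ^ q = 1 := by rw [← mul_pow, hri, one_pow]
    calc ri ^ q = ri ^ q * (r ^ q * algebraMap E A a⁻¹) := by
          rw [hr, ← map_mul, mul_inv_cancel₀ ha, map_one, mul_one]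
      _ = _ := by rw [← mul_assoc, h1, one_mul]
  let Xi : Module.End E A := LinearMap.mulLeft E ri
  have hXi : Xi ^ q = a⁻¹ • 1 := by
    ext z
    simp only [Xi, LinearMap.pow_mulLeft, hri2]
    simp [Algebra.smul_def]
  have hYk : ∀ (k : ℕ) p, (Y ^ k) (AdjoinRoot.mk _ p)
      = AdjoinRoot.mk _ (npol ζ k y * p.comp (C (ζ ^ k) * X)) := by
    intro k
    induction k with
    | zero => intro p; simp [npol]
    | succ k ih =>
      intro p
      rw [pow_succ', Module.End.mul_apply, ih, hYa, hσ, ← map_mul]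
      congr 1
      rw [mul_comp, comp_assoc]
      have e1 : (C (ζ ^ k) * X).comp (C ζ * X) = C (ζ ^ (k+1)) * X := by
        simp [pow_succ]; ring
      have e2 : y * (npol ζ k y).comp (C ζ * X) = npol ζ (k+1) y := by
        unfold npol
        rw [Finset.prod_range_succ', prod_comp, mul_comm]
        congr 1
        · apply Finset.prod_congr rfl
          intro i _
          rw [comp_assoc]
          congr 1
          simp [pow_succ]
          ring
        · simp
      rw [e1, ← mul_assoc, e2]
  have hnb : AdjoinRoot.mk (X ^ q - C a : E[X]) (npol ζ q y) = algebraMap E A b := by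
    have := AdjoinRoot.mk_eq_mk.2 hy
    rw [this]; rfl
  have hY : Y ^ q = b • 1 := by
    apply LinearMap.ext
    intro z
    obtain ⟨p, rfl⟩ := AdjoinRoot.mk_surjective z
    rw [hYk, hζ.pow_eq_one, map_mul, hnb]
    simp [Algebra.smul_def]
  have hc : Xi * Y = ζ • (Y * Xi) := by
    apply LinearMap.ext
    intro z
    have e1 : σ ri * (algebraMap E A ζ * r) = 1 := by
      rw [← hσr, ← map_mul, hri, map_one]
    have e2 : ri = algebraMap E A ζ * σ ri := by
      calc ri = ri * (σ ri * (algebraMap E A ζ * r)) := by rw [e1, mul_one]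
        _ = (ri * r) * (algebraMap E A ζ * σ ri) := by ring
        _ = _ := by rw [hri, one_mul]
    simp only [Module.End.mul_apply, LinearMap.smul_apply, hYa, Xi, LinearMap.mulLeft_apply, map_mul]
    rw [Algebra.smul_def (A := A)]
    conv_lhs => rw [e2]
    ring
  have := NF_of_op hζ hq hb hfr Y Xi hY hXi hc
  simpa using this.inv hq.ne_zero (inv_ne_zero ha)

/-! ### explicit norm form -/

lemma npol_coeff_eq_zero (hζ : IsPrimitiveRoot ζ q) (hq : q ≠ 0) (y : E[X]) (n : ℕ) (hn : ¬ q ∣ n) :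
    (npol ζ q y).coeff n = 0 := by
  have h1 : (npol ζ q y).comp (C ζ * X) = npol ζ q y := by
    obtain ⟨k, rfl⟩ := Nat.exists_eq_succ_of_ne_zero hq
    unfold npol
    rw [prod_comp, Finset.prod_range_succ, Finset.prod_range_succ']
    congr 1
    · apply Finset.prod_congr rfl
      intro i _
      rw [comp_assoc]
      congr 1
      simp [pow_succ]
      ring
    · rw [comp_assoc]
      congr 1
      simp only [mul_comp, C_comp, X_comp, ← mul_assoc, ← C_mul, ← pow_succ]
      rw [hζ.pow_eq_one, pow_zero]
  have h2 := congrArg (fun p => p.coeff n) h1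
  simp only [comp_C_mul_X_coeff] at h2
  have h3 : (ζ ^ n - 1) * (npol ζ q y).coeff n = 0 := by linear_combination h2
  rcases mul_eq_zero.1 h3 with h | h
  · exact absurd (hζ.pow_eq_one_iff_dvd n |>.1 (sub_eq_zero.1 h)) hn
  · exact h

/-- explicit norm form of `∑ y i X^i` -/
noncomputable def nform (ζ : E) (q : ℕ) (a : E) (y : Fin q → E) : E :=
  ∑ j ∈ Finset.range q, a ^ j * (npol ζ q (∑ i, C (y i) * X ^ (i : ℕ))).coeff (q * j)

lemma npol_natDegree_lt (hq : q ≠ 0) (y : E[X]) (hy : y.degree < q) : (npol ζ q y).natDegree < q * q := by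
  have hy' : y.natDegree ≤ q - 1 := by
    by_cases h0 : y = 0
    · simp [h0]
    have := (natDegree_lt_iff_degree_lt h0).2 hy
    omega
  have : (npol ζ q y).natDegree ≤ q * (q - 1) := by
    unfold npol
    refine (natDegree_prod_le _ _).trans ?_
    calc _ ≤ ∑ i ∈ Finset.range q, (q - 1) := by
          apply Finset.sum_le_sum
          intro i _
          refine natDegree_comp_le.trans ?_
          have : (C (ζ ^ i) * X : E[X]).natDegree ≤ 1 := (natDegree_C_mul_le _ _).trans natDegree_X_le
          calc _ ≤ y.natDegree * 1 := Nat.mul_le_mul_left _ this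
            _ ≤ _ := by omega
      _ = _ := by simp
  have h2 : q * (q-1) < q * q := Nat.mul_lt_mul_of_pos_left (by omega) (by omega)
  omega

lemma dvd_npol_sub (hζ : IsPrimitiveRoot ζ q) (hq : q ≠ 0) (a : E) (y : E[X]) (hy : y.degree < q) :
    X ^ q - C a ∣ npol ζ q y - C (∑ j ∈ Finset.range q, a ^ j * (npol ζ q y).coeff (q * j)) := by
  have h1 : npol ζ q y = ∑ j ∈ Finset.range q, C ((npol ζ q y).coeff (q * j)) * (X ^ q) ^ j := by
    ext n
    simp only [finset_sum_coeff, ← pow_mul, coeff_C_mul, coeff_X_pow]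
    by_cases hn : q ∣ n
    · obtain ⟨k, rfl⟩ := hn
      by_cases hk : k < q
      · rw [Finset.sum_eq_single_of_mem k (by simpa using hk)]
        · simp
        · intro j _ hj
          rw [if_neg, mul_zero]
          intro h
          exact hj (Nat.eq_of_mul_eq_mul_left (Nat.pos_of_ne_zero hq) h).symm
      · rw [coeff_eq_zero_of_natDegree_lt]
        · symm
          apply Finset.sum_eq_zero
          intro j hj
          rw [if_neg, mul_zero]
          intro h
          have := (Nat.eq_of_mul_eq_mul_left (Nat.pos_of_ne_zero hq) h)
          simp at hj
          omega
        · refine (npol_natDegree_lt hq y hy).trans_le ?_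
          exact Nat.mul_le_mul_left _ (by omega)
    · rw [npol_coeff_eq_zero hζ hq y n hn]
      symm
      apply Finset.sum_eq_zero
      intro j hj
      rw [if_neg, mul_zero]
      rintro rfl
      exact hn (dvd_mul_right _ _)
  have h2 : npol ζ q y - C (∑ j ∈ Finset.range q, a ^ j * (npol ζ q y).coeff (q * j))
     = ∑ j ∈ Finset.range q, C ((npol ζ q y).coeff (q * j)) * ((X ^ q) ^ j - (C a) ^ j) := by
    conv_lhs => rw [h1]
    rw [map_sum, ← Finset.sum_sub_distrib]
    conv_lhs => rw [← h1]
    apply Finset.sum_congr rfl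
    intro j _
    rw [C_mul, C_pow]; ring
  rw [h2]
  apply Finset.dvd_sum
  intro j _
  exact (sub_dvd_pow_sub_pow _ _ _).mul_left _

lemma sum_degree_lt (hq : q ≠ 0) (y : Fin q → E) : (∑ i, C (y i) * X ^ (i : ℕ) : E[X]).degree < q := by
  refine (degree_sum_le _ _).trans_lt ?_
  rw [Finset.sup_lt_iff (by exact WithBot.bot_lt_coe _)]
  intro i _
  exact (degree_C_mul_X_pow_le _ _).trans_lt (by exact_mod_cast i.2)

lemma NF_nform (hζ : IsPrimitiveRoot ζ q) (hq : q ≠ 0) (a : E) (y : Fin q → E) :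
    NF ζ q a (nform ζ q a y) :=
  ⟨_, dvd_npol_sub hζ hq a _ (sum_degree_lt hq y)⟩

lemma NF.exists_nform (hζ : IsPrimitiveRoot ζ q) (hq : q ≠ 0) (h : NF ζ q a b) :
    ∃ y : Fin q → E, nform ζ q a y = b := by
  obtain ⟨y, h1, h2⟩ := h.exists_lt hq hζ.pow_eq_one
  refine ⟨fun i => y.coeff i, ?_⟩
  have hy : (∑ i : Fin q, C (y.coeff i) * X ^ (i : ℕ) : E[X]) = y := by
    rw [Fin.sum_univ_eq_sum_range (fun i => C (y.coeff i) * X ^ i) q]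
    symm
    by_cases h0 : y = 0
    · simp [h0]
    exact y.as_sum_range_C_mul_X_pow' ((natDegree_lt_iff_degree_lt h0).2 h1)
  unfold nform
  rw [hy]
  have h3 := dvd_npol_sub hζ hq a y h1
  have h4 := dvd_sub h2 h3
  rw [sub_sub_sub_cancel_left, ← C_sub] at h4
  have h5 := eq_zero_of_dvd_of_degree_lt h4 (by
    rw [degree_X_pow_sub_C (Nat.pos_of_ne_zero hq)]
    exact degree_C_le.trans_lt (by exact_mod_cast Nat.pos_of_ne_zero hq))
  rw [C_eq_zero, sub_eq_zero] at h5
  exact h5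

lemma nform_map {F : Type*} [Field F] (f : E →+* F) (y : Fin q → E) :
    nform (f ζ) q (f a) (fun i => f (y i)) = f (nform ζ q a y) := by
  unfold nform
  rw [map_sum]
  apply Finset.sum_congr rfl
  intro j _
  rw [map_mul, map_pow, ← coeff_map]
  congr 2
  simp [npol, Polynomial.map_prod, Polynomial.map_comp, Polynomial.map_sum]

lemma nform_continuous [TopologicalSpace E] [IsTopologicalRing E] :
    Continuous (fun y : Fin q → E => nform ζ q a y) := by
  unfold nform
  have key : ∀ (s : Finset ℕ) (n : ℕ), Continuous (fun y : Fin q → E =>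
      (∏ i ∈ s, (∑ i, C (y i) * X ^ (i : ℕ) : E[X]).comp (C (ζ ^ i) * X)).coeff n) := by
    classical
    intro s
    induction s using Finset.induction_on with
    | empty => intro n; simp only [Finset.prod_empty]; exact continuous_const
    | insert i s hi ih =>
      intro n
      simp only [Finset.prod_insert hi, coeff_mul]
      apply continuous_finset_sum
      intro p _
      refine Continuous.mul ?_ (ih _)
      simp only [comp_C_mul_X_coeff, finset_sum_coeff, coeff_C_mul]
      fun_prop
  apply continuous_finset_sum
  intro j _
  exact continuous_const.mul (key _ _)
end
end Prf
set_option linter.all false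
set_option linter.unusedVariables false
set_option linter.unusedSimpArgs false
namespace Prf
open Polynomial NumberField IsDedekindDomain

section ord
variable {K : Type} [Field K] [NumberField K]

/-- Additive valuation of a unit of `K` at a finite place. -/
noncomputable def od (v : HeightOneSpectrum (𝓞 K)) (x : Kˣ) : ℤ :=
  -(Multiplicative.toAdd (v.valuationOfNeZero x))

variable (v : HeightOneSpectrum (𝓞 K))

lemma od_spec (x : Kˣ) : v.valuation K (x : K) = WithZero.exp (-(od v x)) := by
  rw [← HeightOneSpectrum.valuationOfNeZero_eq]
  simp [od, WithZero.exp]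

lemma od_eq_iff (x : Kˣ) (n : ℤ) : od v x = n ↔ v.valuation K (x : K) = WithZero.exp (-n) := by
  rw [od_spec]; simp

@[simp] lemma od_mul (x y : Kˣ) : od v (x * y) = od v x + od v y := by
  simp [od]; ring

@[simp] lemma od_one : od v (1 : Kˣ) = 0 := by simp [od]

@[simp] lemma od_inv (x : Kˣ) : od v x⁻¹ = - od v x := by simp [od]

@[simp] lemma od_div (x y : Kˣ) : od v (x / y) = od v x - od v y := by
  simp [od]; ring

@[simp] lemma od_pow (x : Kˣ) (n : ℕ) : od v (x ^ n) = n * od v x := by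
  simp [od]

@[simp] lemma od_zpow (x : Kˣ) (n : ℤ) : od v (x ^ n) = n * od v x := by
  simp [od]

lemma od_prod {ι : Type*} (s : Finset ι) (f : ι → Kˣ) :
    od v (∏ i ∈ s, f i) = ∑ i ∈ s, od v (f i) := by
  classical
  induction s using Finset.induction_on with
  | empty => simp
  | insert a s ha ih => rw [Finset.prod_insert ha, Finset.sum_insert ha, od_mul, ih]

lemma od_nonneg_iff (x : Kˣ) : 0 ≤ od v x ↔ v.valuation K (x : K) ≤ 1 := by
  rw [od_spec, ← WithZero.exp_zero, WithZero.exp_le_exp]; simp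

lemma od_pos_iff (x : Kˣ) : 0 < od v x ↔ v.valuation K (x : K) < 1 := by
  rw [od_spec, ← WithZero.exp_zero, WithZero.exp_lt_exp]; simp

lemma od_zero_iff (x : Kˣ) : od v x = 0 ↔ v.valuation K (x : K) = 1 := by
  rw [od_eq_iff]; simp

lemma od_support (x : Kˣ) : {v : HeightOneSpectrum (𝓞 K) | od v x ≠ 0}.Finite := by
  have h1 := HeightOneSpectrum.Support.finite (𝓞 K) (x : K)
  have h2 := HeightOneSpectrum.Support.finite (𝓞 K) ((x⁻¹ : Kˣ) : K)
  refine (h1.union h2).subset ?_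
  intro v hv
  rcases lt_or_gt_of_ne (show od v x ≠ 0 from hv) with h | h
  · left
    show 1 < v.valuation K (x : K)
    rw [od_spec, ← WithZero.exp_zero, WithZero.exp_lt_exp]; linarith
  · right
    show 1 < v.valuation K ((x⁻¹ : Kˣ) : K)
    rw [od_spec, ← WithZero.exp_zero, WithZero.exp_lt_exp, od_inv]; linarith

lemma exists_unif : ∃ x : Kˣ, od v x = 1 := by
  obtain ⟨x, hx⟩ := v.valuation_exists_uniformizer K
  have h0 : x ≠ 0 := by
    rintro rfl
    rw [map_zero] at hx
    exact WithZero.exp_ne_zero hx.symm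
  exact ⟨Units.mk0 x h0, by rw [od_eq_iff]; simpa using hx⟩

/-- `S`-units. -/
def US (S : Finset (HeightOneSpectrum (𝓞 K))) : Subgroup Kˣ where
  carrier := {u | ∀ v ∉ S, od v u = 0}
  mul_mem' := by intro a b ha hb v hv; rw [od_mul, ha v hv, hb v hv]; rfl
  one_mem' := by intro v _; simp
  inv_mem' := by intro a ha v hv; rw [od_inv, ha v hv]; rfl

lemma mem_US {S : Finset (HeightOneSpectrum (𝓞 K))} {u : Kˣ} :
    u ∈ US S ↔ ∀ v ∉ S, od v u = 0 := Iff.rfl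

lemma US_mono {S T : Finset (HeightOneSpectrum (𝓞 K))} (h : S ⊆ T) : US S ≤ US T :=
  fun _ hu v hv => hu v (fun hS => hv (h hS))

lemma exists_mem_US (x : Kˣ) : ∃ S : Finset (HeightOneSpectrum (𝓞 K)), x ∈ US S := by
  refine ⟨(od_support x).toFinset, fun v hv => ?_⟩
  by_contra h
  exact hv (by simpa using h)

lemma unit_mem_US (u : (𝓞 K)ˣ) : Units.map (algebraMap (𝓞 K) K).toMonoidHom u ∈
    US (∅ : Finset (HeightOneSpectrum (𝓞 K))) := by
  intro v _
  have := v.valuation_of_unit_eq (K := K) u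
  rw [od]
  erw [this]; rfl

lemma exists_unit_of_mem (u : Kˣ) (hu : u ∈ US (∅ : Finset (HeightOneSpectrum (𝓞 K)))) :
    ∃ x : (𝓞 K)ˣ, Units.map (algebraMap (𝓞 K) K).toMonoidHom x = u := by
  have h : ∀ u : Kˣ, u ∈ US (∅ : Finset (HeightOneSpectrum (𝓞 K))) →
      ∃ x : 𝓞 K, algebraMap (𝓞 K) K x = u := by
    intro u hu
    refine HeightOneSpectrum.mem_integers_of_valuation_le_one K (u : K) (fun v => ?_)
    rw [← od_nonneg_iff, hu v (by simp)]
  obtain ⟨x, hx⟩ := h u hu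
  obtain ⟨y, hy⟩ := h u⁻¹ ((US ∅).inv_mem hu)
  have hinj := IsFractionRing.injective (𝓞 K) K
  refine ⟨⟨x, y, hinj ?_, hinj ?_⟩, ?_⟩
  · rw [map_mul, hx, hy]; simp
  · rw [map_mul, hx, hy]; simp
  · ext; simpa using hx

/-- some power of a prime is principal -/
lemma exists_principal_pow : ∃ c : Kˣ, 0 < od v c ∧ ∀ v' ≠ v, od v' c = 0 := by
  classical
  have hne : v.asIdeal ∈ nonZeroDivisors (Ideal (𝓞 K)) := mem_nonZeroDivisors_of_ne_zero v.ne_bot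
  set I : nonZeroDivisors (Ideal (𝓞 K)) := ⟨v.asIdeal, hne⟩
  set h := Fintype.card (ClassGroup (𝓞 K)) with hh
  have hpos : 0 < h := Fintype.card_pos
  have h1 : ClassGroup.mk0 (I ^ h) = 1 := by rw [map_pow, hh, pow_card_eq_one]
  obtain ⟨c, hc⟩ := ((ClassGroup.mk0_eq_one_iff (I ^ h).2).1 h1).principal
  replace hc : v.asIdeal ^ h = Ideal.span {c} := hc
  have hc0 : c ≠ 0 := by
    rintro rfl
    have : v.asIdeal ^ h = ⊥ := by rw [hc]; simp
    exact v.ne_bot (eq_zero_of_pow_eq_zero this)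
  have hcK : algebraMap (𝓞 K) K c ≠ 0 := by simpa using hc0
  refine ⟨Units.mk0 _ hcK, ?_, ?_⟩
  · rw [od_pos_iff]
    simp only [Units.val_mk0]
    rw [HeightOneSpectrum.valuation_lt_one_iff_mem]
    have : c ∈ v.asIdeal ^ h := by rw [hc]; exact Ideal.mem_span_singleton_self c
    exact Ideal.pow_le_self hpos.ne' this
  · intro v' hv'
    rw [od_zero_iff]
    simp only [Units.val_mk0]
    rw [HeightOneSpectrum.valuation_eq_one_iff_notMem]
    intro hmem
    have h2 : v.asIdeal ^ h ≤ v'.asIdeal := by rw [hc, Ideal.span_singleton_le_iff_mem]; exact hmem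
    have h3 := v'.isPrime.le_of_pow_le h2
    exact hv' (HeightOneSpectrum.ext (v.isMaximal.eq_of_le v'.isPrime.ne_top h3).symm)

end ord

section rank
variable {K : Type} [Field K] [NumberField K]

lemma US_empty_rank : Module.Finite ℤ (Additive (US (∅ : Finset (HeightOneSpectrum (𝓞 K))))) ∧
    Module.finrank ℤ (Additive (US (∅ : Finset (HeightOneSpectrum (𝓞 K))))) = Units.rank K := by
  let f : (𝓞 K)ˣ →* US (∅ : Finset (HeightOneSpectrum (𝓞 K))) :=
    (Units.map (algebraMap (𝓞 K) K).toMonoidHom).codRestrict _ unit_mem_US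
  have hf : Function.Bijective f := by
    constructor
    · intro x y h
      have : algebraMap (𝓞 K) K x = algebraMap (𝓞 K) K y := by
        have := congrArg (fun z : US (∅ : Finset (HeightOneSpectrum (𝓞 K))) => ((z : Kˣ) : K)) h
        simpa [f] using this
      exact Units.ext (IsFractionRing.injective (𝓞 K) K this)
    · rintro ⟨u, hu⟩
      obtain ⟨x, hx⟩ := exists_unit_of_mem u hu
      exact ⟨x, Subtype.ext hx⟩
  let e : Additive (𝓞 K)ˣ ≃ₗ[ℤ] Additive (US (∅ : Finset (HeightOneSpectrum (𝓞 K)))) :=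
    (MulEquiv.toAdditive (MulEquiv.ofBijective f hf)).toIntLinearEquiv
  exact ⟨Module.Finite.equiv e, by rw [← e.finrank_eq, Units.finrank_eq]⟩

lemma US_rank_aux (S : Finset (HeightOneSpectrum (𝓞 K))) : Module.Finite ℤ (Additive (US S)) ∧
    Module.finrank ℤ (Additive (US S)) = S.card + Units.rank K := by
  classical
  induction S using Finset.induction_on with
  | empty => simpa using US_empty_rank
  | insert v S hv ih =>
    let f : Additive (US (insert v S)) →ₗ[ℤ] ℤ :=
      AddMonoidHom.toIntLinearMap
        { toFun := fun x => od v ((Additive.toMul x : US (insert v S)) : Kˣ)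
          map_zero' := by simp
          map_add' := by intro x y; simp }
    have hfa : ∀ x, f x = od v ((Additive.toMul x : US (insert v S)) : Kˣ) := fun x => rfl
    let g : Additive (US S) →ₗ[ℤ] Additive (US (insert v S)) :=
      (MonoidHom.toAdditive (Subgroup.inclusion (US_mono (Finset.subset_insert v S)))).toIntLinearMap
    have hg : Function.Injective g := by
      intro x y h
      exact Subgroup.inclusion_injective (US_mono (Finset.subset_insert v S)) h
    have hk : LinearMap.ker f = LinearMap.range g := by
      ext x
      rw [LinearMap.mem_ker, LinearMap.mem_range, hfa]
      constructor
      · intro h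
        refine ⟨Additive.ofMul ⟨((Additive.toMul x : US (insert v S)) : Kˣ), fun w hw => ?_⟩, rfl⟩
        by_cases hwv : w = v
        · rw [hwv, h]
        · exact (Additive.toMul x).2 w (by simp [hwv, hw])
      · rintro ⟨y, rfl⟩
        exact (Additive.toMul y).2 v hv
    obtain ⟨hfin, hrk⟩ := ih
    let e := LinearEquiv.ofInjective g hg
    have hkf : Module.Finite ℤ (LinearMap.ker f) := by rw [hk]; exact Module.Finite.equiv e
    have hkr : Module.finrank ℤ (LinearMap.ker f) = S.card + Units.rank K := by
      rw [hk, ← e.finrank_eq, hrk]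
    have hfin' : Module.Finite ℤ (Additive (US (insert v S))) := by
      have : Module.Finite ℤ (Additive (US (insert v S)) ⧸ LinearMap.ker f) :=
        Module.Finite.equiv f.quotKerEquivRange.symm
      exact Module.Finite.of_submodule_quotient (LinearMap.ker f)
    refine ⟨hfin', ?_⟩
    have h1 := Submodule.finrank_quotient_add_finrank (LinearMap.ker f)
    rw [f.quotKerEquivRange.finrank_eq] at h1
    have h2 : Module.finrank ℤ (LinearMap.range f) = 1 := by
      obtain ⟨c, hc, hc'⟩ := exists_principal_pow v
      have hcm : c ∈ US (insert v S) := fun w hw => hc' w (by simp at hw; tauto)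
      have hle : Module.finrank ℤ (LinearMap.range f) ≤ 1 := by
        simpa using Submodule.finrank_le (LinearMap.range f)
      have hne : Module.finrank ℤ (LinearMap.range f) ≠ 0 := by
        intro h0
        have h3 : LinearMap.range f = ⊥ := by
          exact Submodule.finrank_eq_zero.1 h0
        have h4 : f (Additive.ofMul ⟨c, hcm⟩) = 0 := by
          have : f (Additive.ofMul ⟨c, hcm⟩) ∈ LinearMap.range f := ⟨_, rfl⟩
          rw [h3] at this; simpa using this
        rw [hfa] at h4
        have h5 : od v c = 0 := h4
        omega
      omega
    rw [Finset.card_insert_of_notMem hv]; omega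

instance US_finite (S : Finset (HeightOneSpectrum (𝓞 K))) : Module.Finite ℤ (Additive (US S)) :=
  (US_rank_aux S).1

lemma US_rank [IsTotallyComplex K] (S : Finset (HeightOneSpectrum (𝓞 K))) :
    Module.finrank ℤ (Additive (US S)) + 1 = S.card + InfinitePlace.nrComplexPlaces K := by
  rw [(US_rank_aux S).2, Units.rank]
  have h1 := InfinitePlace.card_eq_nrRealPlaces_add_nrComplexPlaces K
  have h2 := IsTotallyComplex.nrRealPlaces_eq_zero K
  have h3 : 0 < Fintype.card (InfinitePlace K) := Fintype.card_pos
  omega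

lemma US_pow_index [IsTotallyComplex K] {q : ℕ} (hq : q.Prime) {ζ : K} (hζ : IsPrimitiveRoot ζ q)
    (S : Finset (HeightOneSpectrum (𝓞 K))) :
    (powMonoidHom q : US S →* US S).range.index = q ^ (S.card + InfinitePlace.nrComplexPlaces K) := by
  have hq0 := hq.ne_zero
  obtain ⟨h1, h2⟩ := index_nsmul (W := Additive (US S)) q hq.ne_zero
  have h3 : (powMonoidHom q : US S →* US S).range.index = ix (q : Module.End ℤ (Additive (US S))) := by
    rw [ix, Subgroup.index, ← Nat.card_congr (Additive.ofMul.symm : Additive _ ≃ _)]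
    refine Nat.card_congr ?_
    refine Quotient.congr (Equiv.refl _) ?_
    intro x y
    rw [QuotientGroup.leftRel_apply, Submodule.quotientRel_def]
    simp only [MonoidHom.mem_range, LinearMap.mem_range, Equiv.refl_apply]
    constructor
    · rintro ⟨z, hz⟩
      refine ⟨Additive.ofMul z⁻¹, ?_⟩
      have : (q : Module.End ℤ (Additive (US S))) (Additive.ofMul z⁻¹) = q • (Additive.ofMul z⁻¹) := by simp
      rw [this]
      apply Additive.toMul.injective
      show (z⁻¹)^q = x / y
      rw [inv_pow]; 
      have hz' : z ^ q = x⁻¹ * y := hz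
      rw [hz', mul_inv_rev, inv_inv, div_eq_mul_inv, mul_comm]
    · rintro ⟨z, hz⟩
      refine ⟨(Additive.toMul z)⁻¹, ?_⟩
      have : (q : Module.End ℤ (Additive (US S))) z = q • z := by simp
      rw [this] at hz
      have hz' : (Additive.toMul z) ^ q = x / y := hz
      show ((Additive.toMul z)⁻¹)^q = _
      rw [inv_pow, hz', inv_div, div_eq_mul_inv, mul_comm]
  have h4 : kc (q : Module.End ℤ (Additive (US S))) = q := by
    rw [kc]
    have : Nat.card (rootsOfUnity q K) = q := by
      have : NeZero q := ⟨hq0⟩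
      exact hζ.card_rootsOfUnity
    conv_rhs => rw [← this]
    have hmem : ∀ x : Kˣ, x ^ q = 1 → x ∈ US S := by
      intro x hx v _
      have : (q : ℤ) * od v x = 0 := by rw [← od_pow, hx, od_one]
      simpa [hq0] using this
    refine Nat.card_congr
      { toFun := fun x => ⟨((Additive.toMul x.1 : US S) : Kˣ), ?_⟩
        invFun := fun x => ⟨Additive.ofMul ⟨x.1, hmem _ ((mem_rootsOfUnity q x.1).1 x.2)⟩, ?_⟩
        left_inv := fun x => rfl
        right_inv := fun x => rfl }
    · rw [mem_rootsOfUnity]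
      have h := x.2
      rw [LinearMap.mem_ker] at h
      have h' : q • x.1 = 0 := by rwa [Module.End.natCast_apply] at h
      have h'' : (Additive.toMul x.1 : US S) ^ q = 1 := h'
      exact congrArg Subtype.val h''
    · rw [LinearMap.mem_ker]
      have : (⟨x.1, hmem _ ((mem_rootsOfUnity q x.1).1 x.2)⟩ : US S) ^ q = 1 :=
        Subtype.ext ((mem_rootsOfUnity q x.1).1 x.2)
      simp
      exact this
  rw [h3, h1, h4, ← US_rank S, pow_succ]

end rank
end Prf
set_option linter.all false
set_option linter.unusedVariables false
set_option linter.unusedSimpArgs false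
namespace Prf
open Polynomial NumberField IsDedekindDomain

section above
variable {K : Type} [Field K] [NumberField K] {L : Type} [Field L] [NumberField L] [Algebra K L]

variable (K) in
/-- The place of `K` below a place of `L`. -/
noncomputable def below (w : HeightOneSpectrum (𝓞 L)) : HeightOneSpectrum (𝓞 K) := w.under (𝓞 K)

instance below_liesOver (w : HeightOneSpectrum (𝓞 L)) : w.asIdeal.LiesOver (below K w).asIdeal :=
  ⟨rfl⟩

variable (K) in
/-- ramification index -/
noncomputable def ram (w : HeightOneSpectrum (𝓞 L)) : ℕ :=
  (below K w).asIdeal.ramificationIdx' w.asIdeal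

lemma ram_ne_zero (w : HeightOneSpectrum (𝓞 L)) : ram K w ≠ 0 :=
  Ideal.IsDedekindDomain.ramificationIdx'_ne_zero_of_liesOver w.asIdeal (below K w).ne_bot

lemma val_map (w : HeightOneSpectrum (𝓞 L)) (x : K) :
    w.valuation L (algebraMap K L x) = (below K w).valuation K x ^ ram K w :=
  (HeightOneSpectrum.valuation_liesOver L (below K w) w x).symm

lemma val_map_lt (w : HeightOneSpectrum (𝓞 L)) (x y : K) :
    w.valuation L (algebraMap K L x) < w.valuation L (algebraMap K L y) ↔
      (below K w).valuation K x < (below K w).valuation K y := by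
  rw [val_map, val_map]
  exact pow_lt_pow_iff_left₀ zero_le' zero_le' (ram_ne_zero w)

lemma val_map_lt_one (w : HeightOneSpectrum (𝓞 L)) (x : K) :
    w.valuation L (algebraMap K L x) < 1 ↔ (below K w).valuation K x < 1 := by
  have := val_map_lt w x 1
  simpa using this

variable (L) in
/-- embedding of unit groups -/
noncomputable def um : Kˣ →* Lˣ := Units.map (algebraMap K L).toMonoidHom

@[simp] lemma um_coe (x : Kˣ) : ((um L x : Lˣ) : L) = algebraMap K L x := rfl

lemma um_inj : Function.Injective (um L : Kˣ →* Lˣ) := by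
  intro x y h
  have := congrArg (fun z : Lˣ => (z : L)) h
  exact Units.ext ((algebraMap K L).injective this)

lemma od_um (w : HeightOneSpectrum (𝓞 L)) (x : Kˣ) :
    od w (um L x) = ram K w * od (below K w) x := by
  rw [od_eq_iff, um_coe, val_map, od_spec, ← WithZero.exp_nsmul]
  simp

lemma exists_above (v : HeightOneSpectrum (𝓞 K)) : ∃ w : HeightOneSpectrum (𝓞 L), below K w = v := by
  obtain ⟨Q, hQ, hQ'⟩ := Ideal.exists_ideal_over_prime_of_isIntegral v.asIdeal (⊥ : Ideal (𝓞 L))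
    (by rw [Ideal.comap_bot_of_injective _ (FaithfulSMul.algebraMap_injective (𝓞 K) (𝓞 L))]; exact bot_le) 
  refine ⟨⟨Q, hQ'.1, ?_⟩, HeightOneSpectrum.ext hQ'.2⟩
  rintro rfl
  have h := hQ'.2
  rw [Ideal.comap_bot_of_injective _ (FaithfulSMul.algebraMap_injective (𝓞 K) (𝓞 L))] at h
  exact v.ne_bot h.symm

lemma aboveSet_ncard (v : HeightOneSpectrum (𝓞 K)) :
    {w : HeightOneSpectrum (𝓞 L) | below K w = v}.Finite ∧
    {w : HeightOneSpectrum (𝓞 L) | below K w = v}.ncard = (v.asIdeal.primesOver (𝓞 L)).ncard := by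
  have h : Set.BijOn HeightOneSpectrum.asIdeal {w : HeightOneSpectrum (𝓞 L) | below K w = v}
      (v.asIdeal.primesOver (𝓞 L)) := by
    refine ⟨?_, ?_, ?_⟩
    · rintro w rfl
      exact ⟨w.isPrime, inferInstance⟩
    · intro w _ w' _ h
      exact HeightOneSpectrum.ext h
    · rintro Q ⟨h1, h2⟩
      refine ⟨⟨Q, h1, ?_⟩, HeightOneSpectrum.ext h2.over.symm, rfl⟩
      rintro rfl
      have := h2.over
      rw [Ideal.under_def, Ideal.comap_bot_of_injective _ (FaithfulSMul.algebraMap_injective (𝓞 K) (𝓞 L))] at this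
      exact v.ne_bot this
  have hfin : (v.asIdeal.primesOver (𝓞 L)).Finite := by
    have := v.isMaximal
    exact Algebra.QuasiFinite.finite_primesOver v.asIdeal
  refine ⟨Set.Finite.of_finite_image (by rw [h.image_eq]; exact hfin) h.injOn, ?_⟩
  rw [← h.image_eq, Set.ncard_image_of_injOn h.injOn]

variable (L) in
/-- places above -/
noncomputable def above (S : Finset (HeightOneSpectrum (𝓞 K))) : Finset (HeightOneSpectrum (𝓞 L)) :=
  ((S.finite_toSet.biUnion fun v _ => (aboveSet_ncard (L := L) v).1)).toFinset

@[simp] lemma mem_above {S : Finset (HeightOneSpectrum (𝓞 K))} {w : HeightOneSpectrum (𝓞 L)} :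
    w ∈ above L S ↔ below K w ∈ S := by
  simp [above]

lemma card_above (S : Finset (HeightOneSpectrum (𝓞 K))) :
    (above L S).card = ∑ v ∈ S, (v.asIdeal.primesOver (𝓞 L)).ncard := by
  classical
  rw [Finset.card_eq_sum_card_fiberwise (f := below K) (t := S) (fun w hw => by simpa using hw)]
  refine Finset.sum_congr rfl fun v hv => ?_
  rw [← (aboveSet_ncard v).2, ← Set.ncard_coe_finset]
  congr 1
  ext w
  simp
  intro h; rw [h]; exact hv

/-- Galois action on places -/
noncomputable def gw (σ : L ≃ₐ[K] L) (w : HeightOneSpectrum (𝓞 L)) : HeightOneSpectrum (𝓞 L) :=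
  HeightOneSpectrum.comap (galRestrict (𝓞 K) K L (𝓞 L) σ : 𝓞 L →+* 𝓞 L)
    (galRestrict (𝓞 K) K L (𝓞 L) σ).surjective w

lemma gw_mem (σ : L ≃ₐ[K] L) (w : HeightOneSpectrum (𝓞 L)) (n : ℕ) (x : 𝓞 L) :
    x ∈ (gw σ w).asIdeal ^ n ↔ galRestrict (𝓞 K) K L (𝓞 L) σ x ∈ w.asIdeal ^ n := by
  set e := galRestrict (𝓞 K) K L (𝓞 L) σ
  have h1 : (gw σ w).asIdeal = w.asIdeal.map e.symm := by
    ext y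
    show e y ∈ w.asIdeal ↔ _
    have := Ideal.map_symm (I := w.asIdeal) (e : 𝓞 L ≃+* 𝓞 L)
    constructor
    · intro h
      have := Ideal.mem_map_of_mem e.symm h
      simpa using this
    · intro h
      rw [Ideal.mem_map_iff_of_surjective _ e.symm.surjective] at h
      obtain ⟨z, hz, rfl⟩ := h
      simpa using hz
  rw [h1, ← Ideal.map_pow, Ideal.mem_map_iff_of_surjective _ e.symm.surjective]
  constructor
  · rintro ⟨z, hz, rfl⟩
    simpa using hz
  · intro h
    exact ⟨e x, h, by simp⟩

lemma gw_int (σ : L ≃ₐ[K] L) (w : HeightOneSpectrum (𝓞 L)) (x : 𝓞 L) :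
    (gw σ w).intValuation x = w.intValuation (galRestrict (𝓞 K) K L (𝓞 L) σ x) := by
  by_cases hx : x = 0
  · simp [hx]
  have hx' : galRestrict (𝓞 K) K L (𝓞 L) σ x ≠ 0 := by simpa using hx
  rw [HeightOneSpectrum.intValuation_eq_exp_neg_multiplicity _ hx,
    HeightOneSpectrum.intValuation_eq_exp_neg_multiplicity _ hx']
  congr 3
  refine multiplicity_eq_of_emultiplicity_eq (emultiplicity_eq_emultiplicity_iff.2 fun n => ?_)
  rw [Ideal.dvd_span_singleton, Ideal.dvd_span_singleton, gw_mem]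

lemma gw_val (σ : L ≃ₐ[K] L) (w : HeightOneSpectrum (𝓞 L)) (x : L) :
    (gw σ w).valuation L x = w.valuation L (σ x) := by
  obtain ⟨a, b, hb, rfl⟩ := IsFractionRing.div_surjective (A := 𝓞 L) x
  rw [map_div₀, map_div₀, map_div₀, ← algebraMap_galRestrict_apply (𝓞 K),
    ← algebraMap_galRestrict_apply (𝓞 K)]
  simp only [HeightOneSpectrum.valuation_of_algebraMap, gw_int]

lemma gw_od (σ : L ≃ₐ[K] L) (w : HeightOneSpectrum (𝓞 L)) (x : Lˣ) :
    od (gw σ w) x = od w (Units.map (σ : L →* L) x) := by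
  rw [od_eq_iff, gw_val]
  exact od_spec w (Units.map (σ : L →* L) x)

@[simp] lemma below_gw (σ : L ≃ₐ[K] L) (w : HeightOneSpectrum (𝓞 L)) :
    below K (gw σ w) = below K w := by
  apply HeightOneSpectrum.ext
  ext x
  show galRestrict (𝓞 K) K L (𝓞 L) σ (algebraMap (𝓞 K) (𝓞 L) x) ∈ w.asIdeal ↔ 
    algebraMap (𝓞 K) (𝓞 L) x ∈ w.asIdeal
  simp

lemma gw_trans [IsGalois K L] (w w' : HeightOneSpectrum (𝓞 L)) (h : below K w = below K w') :
    ∃ σ : L ≃ₐ[K] L, gw σ w = w' := by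
  obtain ⟨σ, hσ⟩ := Ideal.exists_comap_galRestrict_eq (𝓞 K) K L (𝓞 L) (p := (below K w).asIdeal)
    (P₁ := w.asIdeal) (P₂ := w'.asIdeal) ⟨w.isPrime, inferInstance⟩
    ⟨w'.isPrime, by rw [h]; infer_instance⟩
  exact ⟨σ, HeightOneSpectrum.ext hσ⟩

lemma primesOver_ncard_pos (v : HeightOneSpectrum (𝓞 K)) :
    1 ≤ (v.asIdeal.primesOver (𝓞 L)).ncard := by
  rw [← (aboveSet_ncard v).2]
  obtain ⟨w, hw⟩ := exists_above (L := L) v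
  rw [Nat.one_le_iff_ne_zero, ← Nat.pos_iff_ne_zero, Set.ncard_pos (aboveSet_ncard v).1]
  exact ⟨w, hw⟩

/-- if only one place is above then it is Galois stable -/
lemma gw_fix (v : HeightOneSpectrum (𝓞 K)) (h : (v.asIdeal.primesOver (𝓞 L)).ncard = 1)
    (w : HeightOneSpectrum (𝓞 L)) (hw : below K w = v) (σ : L ≃ₐ[K] L) : gw σ w = w := by
  rw [← (aboveSet_ncard v).2, Set.ncard_eq_one] at h
  obtain ⟨a, ha⟩ := h
  have h1 : w ∈ ({a} : Set _) := by rw [← ha]; exact hw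
  have h2 : gw σ w ∈ ({a} : Set _) := by rw [← ha]; simpa using hw
  rw [Set.mem_singleton_iff] at h1 h2
  rw [h2, h1]

lemma efg [IsGalois K L] (w : HeightOneSpectrum (𝓞 L)) :
    ((below K w).asIdeal.primesOver (𝓞 L)).ncard * (ram K w * (w.asIdeal.inertiaDeg (𝓞 K)))
      = Module.finrank K L := by
  have hm := (below K w).isMaximal
  let : MulSemiringAction Gal(L/K) (𝓞 L) := IsIntegralClosure.MulSemiringAction (𝓞 K) K L (𝓞 L)
  have : IsGaloisGroup Gal(L/K) (𝓞 K) (𝓞 L) := IsGaloisGroup.of_isFractionRing _ _ _ K L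
  have := Ideal.ncard_primesOver_mul_ramificationIdxIn_mul_inertiaDegIn (below K w).asIdeal (𝓞 L) Gal(L/K)
  rw [Ideal.ramificationIdxIn_eq_ramificationIdx (below K w).asIdeal w.asIdeal Gal(L/K),
    Ideal.inertiaDegIn_eq_inertiaDeg (below K w).asIdeal w.asIdeal Gal(L/K),
    IsGalois.card_aut_eq_finrank] at this
  rw [← this, ram, Ideal.ramificationIdx'_eq_ramificationIdx _ _ (below K w).ne_bot]

end above
end Prf
set_option linter.all false
set_option linter.unusedVariables false
set_option linter.unusedSimpArgs false
namespace Prf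
open Polynomial NumberField IsDedekindDomain

section genval
variable {F : Type*} [Field F] {Γ : Type*} [LinearOrderedCommGroupWithZero Γ] (w : Valuation F Γ)
  {q : ℕ} {ζ : F}

lemma val_root {μ : F} (hq : q ≠ 0) (h : μ ^ q = 1) : w μ = 1 := by
  have : w μ ^ q = 1 := by rw [← map_pow, h, map_one]
  exact (pow_eq_one_iff_of_nonneg zero_le' hq).1 this

lemma val_pow_sub_one_le {μ : F} (h : w μ = 1) (n : ℕ) : w (μ ^ n - 1) ≤ w (μ - 1) := by
  rw [← mul_geom_sum, map_mul]
  refine mul_le_of_le_one_right' ?_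
  refine Valuation.map_sum_le _ fun i _ => ?_
  rw [map_pow, h, one_pow]

lemma val_zeta_pow (hq : q.Prime) (hζ : IsPrimitiveRoot ζ q) {μ : F} (hμ : μ ^ q = 1) (h1 : μ ≠ 1) :
    w (μ - 1) = w (ζ - 1) := by
  have : NeZero q := ⟨hq.ne_zero⟩
  obtain ⟨i, hi, rfl⟩ := hζ.eq_pow_of_pow_eq_one hμ
  have hp : IsPrimitiveRoot (ζ ^ i) q := by
    have : Fact q.Prime := ⟨hq⟩
    rw [← orderOf_eq_prime hμ h1]
    exact IsPrimitiveRoot.orderOf _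
  obtain ⟨j, hj, hj'⟩ := hp.eq_pow_of_pow_eq_one hζ.pow_eq_one
  apply le_antisymm
  · exact val_pow_sub_one_le w (val_root w hq.ne_zero hζ.pow_eq_one) i
  · conv_lhs => rw [← hj']
    exact val_pow_sub_one_le w (val_root w hq.ne_zero hμ) j

lemma val_q (hq : q.Prime) (hζ : IsPrimitiveRoot ζ q) : w (q : F) = w (ζ - 1) ^ (q - 1) := by
  obtain ⟨n, rfl⟩ : ∃ n, q = n + 1 := ⟨q - 1, (Nat.succ_pred_prime hq).symm⟩
  have h := hζ.prod_one_sub_pow_eq_order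
  push_cast
  rw [← h, map_prod]
  show _ = w (ζ - 1) ^ n
  conv_rhs => rw [← Finset.card_range n, ← Finset.prod_const]
  refine Finset.prod_congr rfl fun k hk => ?_
  rw [Valuation.map_sub_swap]
  refine val_zeta_pow w hq hζ ?_ ?_
  · rw [← pow_mul, mul_comm, pow_mul, hζ.pow_eq_one, one_pow]
  · exact hζ.pow_ne_one_of_pos_of_lt (by omega) (by simp at hk; omega)

lemma val_zeta_le (hq : q.Prime) (hζ : IsPrimitiveRoot ζ q) : w (ζ - 1) ≤ 1 := by
  refine (w.map_sub _ _).trans ?_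
  rw [val_root w hq.ne_zero hζ.pow_eq_one]; simp

lemma val_q_one (hq : q.Prime) (hζ : IsPrimitiveRoot ζ q) (h : w (q : F) = 1) : w (ζ - 1) = 1 := by
  rw [val_q w hq hζ] at h
  exact (pow_eq_one_iff_of_nonneg zero_le' (by have := hq.two_le; omega)).1 h

lemma val_close (hq : q.Prime) (hζ : IsPrimitiveRoot ζ q) {η : F}
    (h : w (η ^ q - 1) < w (ζ - 1) ^ q) : ∃ μ : F, μ ^ q = 1 ∧ w (η - μ) < w (ζ - 1) := by
  by_contra! hc
  have h1 := X_pow_sub_one_eq_prod hq.pos hζ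
  have h2 := congrArg (Polynomial.eval η) h1
  simp only [eval_sub, eval_pow, eval_X, eval_one, eval_prod, eval_C] at h2
  rw [h2, map_prod] at h
  have h3 : w (ζ - 1) ^ q ≤ ∏ i ∈ nthRootsFinset q (1 : F), w (η - i) := by
    have h4 : w (ζ - 1) ^ q = ∏ _i ∈ nthRootsFinset q (1 : F), w (ζ - 1) := by
      rw [Finset.prod_const, hζ.card_nthRootsFinset]
    rw [h4]
    refine Finset.prod_le_prod (fun i _ => (zero_le' : 0 ≤ w (ζ - 1))) fun i hi => ?_
    exact hc i ((mem_nthRootsFinset hq.pos 1).1 hi)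
  exact absurd h (not_lt.2 h3)

end genval

section PV
variable {K : Type} [Field K] [NumberField K] {q : ℕ} {ζ : K}

lemma val_one_of_near (v : HeightOneSpectrum (𝓞 K)) {n : ℕ} {a : K}
    (ha : v.valuation K (a - 1) < WithZero.exp (-(n : ℤ))) : v.valuation K a = 1 := by
  have h : v.valuation K (a - 1) < 1 := by
    refine lt_of_lt_of_le ha ?_
    rw [← WithZero.exp_zero, WithZero.exp_le_exp]; simp
  have := Valuation.map_add_eq_of_lt_right (v.valuation K) (x := a - 1) (y := 1) (by simpa using h)
  simpa using this

/-- elements close to one -/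
noncomputable def nr (v : HeightOneSpectrum (𝓞 K)) (n : ℕ) : Subgroup Kˣ where
  carrier := {z | v.valuation K ((z : K) - 1) < WithZero.exp (-(n : ℤ))}
  mul_mem' := by
    intro a b ha hb
    simp only [Set.mem_ofPred_eq] at ha hb ⊢
    have h1 : v.valuation K (a : K) = 1 := val_one_of_near v ha
    have h2 : ((a * b : Kˣ) : K) - 1 = a * (b - 1) + (a - 1) := by push_cast; ring
    rw [h2]
    exact Valuation.map_add_lt _ (by rw [map_mul, h1, one_mul]; exact hb) ha
  one_mem' := by simp
  inv_mem' := by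
    intro a ha
    simp only [Set.mem_ofPred_eq] at ha ⊢
    have h1 : v.valuation K (a : K) = 1 := val_one_of_near v ha
    have h2 : ((a⁻¹ : Kˣ) : K) - 1 = (a : K)⁻¹ * (1 - a) := by
      push_cast; field_simp
    rw [h2, map_mul, map_inv₀, h1, Valuation.map_sub_swap]; simpa using ha

lemma mem_nr {v : HeightOneSpectrum (𝓞 K)} {n : ℕ} {z : Kˣ} :
    z ∈ nr v n ↔ v.valuation K ((z : K) - 1) < WithZero.exp (-(n : ℤ)) := Iff.rfl

open Classical in
/-- exponent of the radius of `PV` -/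
noncomputable def NV (ζ : K) (q : ℕ) (v : HeightOneSpectrum (𝓞 K)) : ℕ :=
  if h : ζ - 1 = 0 then 0 else q * (od v (Units.mk0 (ζ - 1) h)).toNat

lemma NV_spec (hq : q.Prime) (hζ : IsPrimitiveRoot ζ q) (v : HeightOneSpectrum (𝓞 K)) :
    WithZero.exp (-(NV ζ q v : ℤ)) = v.valuation K (ζ - 1) ^ q := by
  have h : ζ - 1 ≠ 0 := sub_ne_zero.2 (hζ.ne_one hq.one_lt)
  rw [NV, dif_neg h]
  have h1 := od_spec v (Units.mk0 (ζ - 1) h)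
  simp only [Units.val_mk0] at h1
  have h2 : 0 ≤ od v (Units.mk0 (ζ - 1) h) := by
    rw [od_nonneg_iff]; exact val_zeta_le _ hq hζ
  rw [h1, ← WithZero.exp_nsmul]
  push_cast
  rw [Int.toNat_of_nonneg h2]
  simp

/-- elements that are close to `q`-th powers -/
noncomputable def PV (ζ : K) (q : ℕ) (v : HeightOneSpectrum (𝓞 K)) : Subgroup Kˣ :=
  nr v (NV ζ q v) ⊔ (powMonoidHom q : Kˣ →* Kˣ).range

lemma pow_mem_PV (v : HeightOneSpectrum (𝓞 K)) (x : Kˣ) : x ^ q ∈ PV ζ q v :=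
  Subgroup.mem_sup_right ⟨x, rfl⟩

lemma near_mem_PV (hq : q.Prime) (hζ : IsPrimitiveRoot ζ q) (v : HeightOneSpectrum (𝓞 K)) (x : Kˣ)
    (hx : v.valuation K ((x : K) - 1) < v.valuation K (ζ - 1) ^ q) : x ∈ PV ζ q v :=
  Subgroup.mem_sup_left (by rwa [mem_nr, NV_spec hq hζ])

lemma mem_PV (hq : q.Prime) (hζ : IsPrimitiveRoot ζ q) (v : HeightOneSpectrum (𝓞 K)) (x : Kˣ) :
    x ∈ PV ζ q v ↔ ∃ b y : Kˣ, v.valuation K ((b : K) - 1) < v.valuation K (ζ - 1) ^ q ∧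
      x = b * y ^ q := by
  rw [PV, Subgroup.mem_sup]
  constructor
  · rintro ⟨b, hb, _, ⟨y, rfl⟩, rfl⟩
    exact ⟨b, y, by rwa [mem_nr, NV_spec hq hζ] at hb, rfl⟩
  · rintro ⟨b, y, hb, rfl⟩
    exact ⟨b, by rwa [mem_nr, NV_spec hq hζ], _, ⟨y, rfl⟩, rfl⟩

lemma PV_od (hq : q.Prime) (hζ : IsPrimitiveRoot ζ q) {v : HeightOneSpectrum (𝓞 K)} {x : Kˣ}
    (hx : x ∈ PV ζ q v) : (q : ℤ) ∣ od v x := by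
  obtain ⟨b, y, hb, rfl⟩ := (mem_PV hq hζ v x).1 hx
  have h1 : od v b = 0 := by
    rw [od_zero_iff]
    rw [← NV_spec hq hζ] at hb
    exact val_one_of_near v hb
  rw [od_mul, h1, od_pow, zero_add]
  exact dvd_mul_right _ _

lemma mem_PV_good (hq : q.Prime) (hζ : IsPrimitiveRoot ζ q) {v : HeightOneSpectrum (𝓞 K)}
    (hv : v.valuation K (q : K) = 1) (x : Kˣ) :
    x ∈ PV ζ q v ↔ ∃ b y : Kˣ, v.valuation K ((b : K) - 1) < 1 ∧ x = b * y ^ q := by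
  rw [mem_PV hq hζ, val_q_one _ hq hζ hv, one_pow]

variable {L : Type} [Field L] [NumberField L] [Algebra K L]

lemma PV_um (hq : q.Prime) (hζ : IsPrimitiveRoot ζ q) (w : HeightOneSpectrum (𝓞 L)) {x : Kˣ}
    (hx : x ∈ PV ζ q (below K w)) : um L x ∈ PV (algebraMap K L ζ) q w := by
  obtain ⟨b, y, hb, rfl⟩ := (mem_PV hq hζ _ x).1 hx
  refine (mem_PV hq (hζ.map_of_injective (algebraMap K L).injective) _ _).2
    ⟨um L b, um L y, ?_, by simp⟩
  rw [um_coe, ← map_one (algebraMap K L), ← map_sub, ← map_sub, ← map_pow, ← map_pow, val_map_lt, map_pow]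
  exact hb

lemma split_of_PV [IsGalois K L] (hq : q.Prime) (hζ : IsPrimitiveRoot ζ q)
    (hfin : Module.finrank K L = q) {x : Kˣ} {θ : L} (hθ : θ ^ q = algebraMap K L x)
    {σ : L ≃ₐ[K] L} (hσ : σ θ = algebraMap K L ζ * θ) {v : HeightOneSpectrum (𝓞 K)}
    (hx : x ∈ PV ζ q v) : (v.asIdeal.primesOver (𝓞 L)).ncard = q := by
  obtain ⟨w, hw⟩ := exists_above (L := L) v
  have he := efg (K := K) w
  rw [hw, hfin] at he
  rcases (Nat.dvd_prime hq).1 (Dvd.intro _ he) with h1 | h1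
  swap
  · exact h1
  exfalso
  have hfix := gw_fix v h1 w hw σ
  have hval : ∀ y, w.valuation L (σ y) = w.valuation L y := fun y => by
    rw [← gw_val, hfix]
  have hζ' := hζ.map_of_injective (algebraMap K L).injective
  obtain ⟨b, y, hb, rfl⟩ := (mem_PV hq hζ v x).1 hx
  have hy : algebraMap K L y ≠ 0 := by simp
  set η : L := θ / algebraMap K L y with hη
  have h2 : η ^ q = algebraMap K L b := by
    rw [hη, div_pow, hθ]
    rw [Units.val_mul, Units.val_pow_eq_pow_val, map_mul, map_pow]; field_simp
  have h3 : w.valuation L (η ^ q - 1) < w.valuation L (algebraMap K L ζ - 1) ^ q := by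
    rw [h2, ← map_one (algebraMap K L), ← map_sub, ← map_sub, ← map_pow, ← map_pow, val_map_lt,
      map_pow, hw]
    exact hb
  obtain ⟨μ, hμ, hμ'⟩ := val_close (w.valuation L) hq hζ' h3
  have hμ1 : w.valuation L μ = 1 := val_root _ hq.ne_zero hμ
  have : NeZero q := ⟨hq.ne_zero⟩
  obtain ⟨i, hi, rfl⟩ := hζ'.eq_pow_of_pow_eq_one hμ
  have h4 : w.valuation L (algebraMap K L ζ * η - algebraMap K L ζ ^ i)
      < w.valuation L (algebraMap K L ζ - 1) := by
    have := hval (η - algebraMap K L ζ ^ i)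
    rw [map_sub, map_pow, σ.commutes, hη, map_div₀, σ.commutes, hσ, mul_div_assoc, ← hη] at this
    rw [this]; exact hμ'
  have h5 : w.valuation L (algebraMap K L ζ * (η - algebraMap K L ζ ^ i))
      < w.valuation L (algebraMap K L ζ - 1) := by
    rw [map_mul, val_root _ hq.ne_zero hζ'.pow_eq_one, one_mul]; exact hμ'
  have h6 := Valuation.map_sub_lt _ h4 h5
  have h7 : (algebraMap K L ζ * η - algebraMap K L ζ ^ i) -
      (algebraMap K L ζ * (η - algebraMap K L ζ ^ i)) =
      (algebraMap K L ζ - 1) * algebraMap K L ζ ^ i := by ring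
  rw [h7, map_mul, hμ1, mul_one] at h6
  exact lt_irrefl _ h6

lemma val_of_liesOver_one (w : HeightOneSpectrum (𝓞 L)) {x : K}
    (h : (below K w).valuation K x = 1) : w.valuation L (algebraMap K L x) = 1 := by
  rw [val_map, h, one_pow]

lemma unram [IsGalois K L] (hq : q.Prime) (hζ : IsPrimitiveRoot ζ q)
    (hfin : Module.finrank K L = q) {x : Kˣ} {θ : L} (hθ : θ ^ q = algebraMap K L x)
    {σ : L ≃ₐ[K] L} (hσ : σ θ = algebraMap K L ζ * θ) (w : HeightOneSpectrum (𝓞 L))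
    (hv : (below K w).valuation K (q : K) = 1) (hx : od (below K w) x = 0) : ram K w = 1 := by
  have he := efg (K := K) w
  rw [hfin] at he
  by_contra hr
  have hr1 : ram K w = q := by
    have : ram K w ∣ q := ⟨((below K w).asIdeal.primesOver (𝓞 L)).ncard *
      w.asIdeal.inertiaDeg (𝓞 K), by conv_lhs => rw [← he]
                                     ring⟩
    exact ((Nat.dvd_prime hq).1 this).resolve_left hr
  have h1 : ((below K w).asIdeal.primesOver (𝓞 L)).ncard * w.asIdeal.inertiaDeg (𝓞 K) = 1 := by
    have := hq.pos
    rw [hr1] at he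
    have h2 : q * (((below K w).asIdeal.primesOver (𝓞 L)).ncard * w.asIdeal.inertiaDeg (𝓞 K))
      = q * 1 := by linarith
    exact Nat.eq_of_mul_eq_mul_left this h2
  obtain ⟨hg, hf⟩ := Nat.eq_one_of_mul_eq_one_right h1, Nat.eq_one_of_mul_eq_one_left h1
  have hfix := gw_fix _ hg w rfl σ
  have hval : ∀ y, w.valuation L (σ y) = w.valuation L y := fun y => by
    rw [← gw_val, hfix]
  have hζ' := hζ.map_of_injective (algebraMap K L).injective
  have hθ1 : w.valuation L θ = 1 := by
    have : w.valuation L θ ^ q = 1 := by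
      rw [← map_pow, hθ, val_of_liesOver_one]
      exact (od_zero_iff _ _).1 hx
    exact (pow_eq_one_iff_of_nonneg zero_le' hq.ne_zero).1 this
  obtain ⟨a, ha⟩ := w.exists_valuation_sub_lt_of_integer (K := L) (x := θ) hθ1.le 1
  have : (below K w).asIdeal.IsMaximal := (below K w).isMaximal
  rw [Ideal.inertiaDeg_eq_of_isMaximal (below K w).asIdeal w.asIdeal] at hf
  obtain ⟨c, hc⟩ : ∃ c : 𝓞 K, a - algebraMap (𝓞 K) (𝓞 L) c ∈ w.asIdeal := by
    letI : Field (𝓞 K ⧸ (below K w).asIdeal) := Ideal.Quotient.field _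
    have hb := finrank_eq_one_iff_of_nonzero' (K := 𝓞 K ⧸ (below K w).asIdeal)
      (1 : 𝓞 L ⧸ w.asIdeal) (by
        have : Nontrivial (𝓞 L ⧸ w.asIdeal) := Ideal.Quotient.nontrivial_iff.2 w.isPrime.ne_top
        exact one_ne_zero)
    obtain ⟨c, hc⟩ := hb.1 hf (Ideal.Quotient.mk _ a)
    obtain ⟨c, rfl⟩ := Ideal.Quotient.mk_surjective c
    refine ⟨c, ?_⟩
    rw [← Ideal.Quotient.eq, ← hc, Algebra.smul_def, mul_one]
    rfl
  have hd : w.valuation L (algebraMap (𝓞 L) L (a - algebraMap (𝓞 K) (𝓞 L) c)) < 1 := by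
    rwa [w.valuation_lt_one_iff_mem]
  set d : K := algebraMap (𝓞 K) K c with hdd
  have hd' : algebraMap (𝓞 L) L (algebraMap (𝓞 K) (𝓞 L) c) = algebraMap K L d := by
    rw [hdd, ← IsScalarTower.algebraMap_apply, ← IsScalarTower.algebraMap_apply]
  rw [map_sub, hd'] at hd
  have h2 : w.valuation L (θ - algebraMap K L d) < 1 := by
    have := Valuation.map_sub_lt _ hd ha
    convert this using 2
    ring
  have h3 : w.valuation L (algebraMap K L ζ * θ - algebraMap K L d) < 1 := by
    have := hval (θ - algebraMap K L d)
    rw [map_sub, σ.commutes, hσ] at this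
    rw [this]; exact h2
  have h4 := Valuation.map_sub_lt _ h3 h2
  have h5 : algebraMap K L ζ * θ - algebraMap K L d - (θ - algebraMap K L d) =
    (algebraMap K L ζ - 1) * θ := by ring
  have h6 : w.valuation L (q : L) = 1 := by
    rw [← map_natCast (algebraMap K L)]; exact val_of_liesOver_one w hv
  rw [h5, map_mul, hθ1, mul_one, val_q_one _ hq hζ' h6] at h4
  exact lt_irrefl _ h4

end PV
end Prf
set_option linter.all false
set_option linter.unusedVariables false
set_option linter.unusedSimpArgs false
namespace Prf
open Polynomial NumberField IsDedekindDomain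

/-- Kummer extension data -/
structure Kum (K L : Type) [Field K] [Field L] [Algebra K L] (ζ : K) (q : ℕ) (x : Kˣ) where
  θ : Lˣ
  σ : L ≃ₐ[K] L
  hθ : (θ : L) ^ q = algebraMap K L x
  hσ : σ θ = algebraMap K L ζ * θ
  fin : Module.finrank K L = q
  adj : ∀ y : L, ∃ f : K[X], aeval (θ : L) f = y
  card : Nat.card (L ≃ₐ[K] L) = q

section
variable {K : Type} [Field K] [NumberField K] {q : ℕ} {ζ : K}

theorem exists_kum (hq : q.Prime) (hζ : IsPrimitiveRoot ζ q) (x : Kˣ) (hx : ∀ c : K, c ^ q ≠ x) :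
    ∃ (L : Type) (_ : Field L) (_ : NumberField L) (_ : Algebra K L) (_ : IsGalois K L),
      Nonempty (Kum K L ζ q x) := by
  have H := irr_of_not_pow hq hx
  have : Fact (Irreducible (X ^ q - C (x : K))) := ⟨H⟩
  have : NeZero q := ⟨hq.ne_zero⟩
  have hne : (primitiveRoots q K).Nonempty := ⟨ζ, (mem_primitiveRoots hq.pos).2 hζ⟩
  letI : Algebra K (AdjoinRoot (X ^ q - C (x : K))) := inferInstance
  have hS := isSplittingField_AdjoinRoot_X_pow_sub_C hne H
  have hG := isGalois_of_isSplittingField_X_pow_sub_C hne H (AdjoinRoot (X ^ q - C (x : K)))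
  have hF := finrank_of_isSplittingField_X_pow_sub_C hne H (AdjoinRoot (X ^ q - C (x : K)))
  have : Module.Finite K (AdjoinRoot (X ^ q - C (x : K))) :=
    Module.finite_of_finrank_pos (by rw [hF]; exact hq.pos)
  refine ⟨AdjoinRoot (X ^ q - C (x : K)), inferInstance, NumberField.of_module_finite K _,
    inferInstance, hG, ?_⟩
  have h0 : (AdjoinRoot.root (X ^ q - C (x : K))) ^ q =
      algebraMap K (AdjoinRoot (X ^ q - C (x : K))) x := root_X_pow_sub_C_pow q (x : K)
  refine ⟨⟨Units.mk0 (AdjoinRoot.root _) ?_, autAdjoinRootXPowSubCEquiv hne H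
    (rootsOfUnity.mkOfPowEq ζ hζ.pow_eq_one), ?_, ?_, hF, ?_, ?_⟩⟩
  · intro h
    rw [h, zero_pow hq.ne_zero] at h0
    exact x.ne_zero ((algebraMap K (AdjoinRoot (X ^ q - C (x : K)))).injective (by rw [← h0, map_zero]))
  · exact h0
  · rw [Units.val_mk0, autAdjoinRootXPowSubCEquiv_root, Algebra.smul_def]
    rfl
  · intro y
    obtain ⟨f, rfl⟩ := AdjoinRoot.mk_surjective y
    exact ⟨f, by rw [Units.val_mk0, AdjoinRoot.aeval_eq]⟩
  · rw [IsGalois.card_aut_eq_finrank, hF]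

variable {L : Type} [Field L] [NumberField L] [Algebra K L] [IsGalois K L] {x : Kˣ}

namespace Kum

lemma gen (M : Kum K L ζ q x) (hq : q.Prime) (hζ : IsPrimitiveRoot ζ q) (τ : L ≃ₐ[K] L) :
    τ ∈ Subgroup.zpowers M.σ := by
  have : Fact q.Prime := ⟨hq⟩
  have h1 : M.σ ≠ 1 := by
    intro h
    have := M.hσ
    rw [h] at this
    have h2 : algebraMap K L ζ = 1 := by
      have h3 : (1 : L) * M.θ = algebraMap K L ζ * M.θ := by rw [one_mul]; exact this
      exact (mul_right_cancel₀ M.θ.ne_zero h3).symm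
    exact hζ.ne_one hq.one_lt ((algebraMap K L).injective (by rw [h2, map_one]))
  exact mem_zpowers_of_prime_card M.card h1

lemma isCyclic (M : Kum K L ζ q x) (hq : q.Prime) (hζ : IsPrimitiveRoot ζ q) :
    IsCyclic (L ≃ₐ[K] L) := ⟨M.σ, M.gen hq hζ⟩

lemma order (M : Kum K L ζ q x) (hq : q.Prime) (hζ : IsPrimitiveRoot ζ q) : orderOf M.σ = q := by
  rw [orderOf_eq_card_of_forall_mem_zpowers (M.gen hq hζ), M.card]

lemma gen_pow (M : Kum K L ζ q x) (hq : q.Prime) (hζ : IsPrimitiveRoot ζ q) (τ : L ≃ₐ[K] L) :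
    ∃ i < q, M.σ ^ i = τ := by
  classical
  have := (mem_zpowers_iff_mem_range_orderOf).1 (M.gen hq hζ τ)
  rw [M.order hq hζ] at this
  simpa using this

lemma sigma_pow_theta (M : Kum K L ζ q x) (i : ℕ) :
    (M.σ ^ i) M.θ = algebraMap K L ζ ^ i * M.θ := by
  induction i with
  | zero => simp
  | succ n ih => rw [pow_succ', AlgEquiv.mul_apply, ih, map_mul, map_pow, M.σ.commutes, M.hσ]; ring

lemma sigma_pow_aeval (M : Kum K L ζ q x) (i : ℕ) (f : K[X]) :
    (M.σ ^ i) (aeval (M.θ : L) f) = aeval (algebraMap K L ζ ^ i * M.θ) f := by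
  rw [← M.sigma_pow_theta, Polynomial.aeval_algHom_apply]

lemma norm_eq (M : Kum K L ζ q x) (hq : q.Prime) (hζ : IsPrimitiveRoot ζ q) (y : L) :
    algebraMap K L (Algebra.norm K y) = ∏ i ∈ Finset.range q, (M.σ ^ i) y := by
  rw [Algebra.norm_eq_prod_automorphisms]
  symm
  refine Finset.prod_bij (fun i _ => M.σ ^ i) (by simp) ?_ ?_ (fun _ _ => rfl)
  · intro i hi j hj h
    refine pow_injOn_Iio_orderOf ?_ ?_ h <;> rw [M.order hq hζ, Set.mem_Iio] 
    exacts [Finset.mem_range.1 hi, Finset.mem_range.1 hj]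
  · intro τ _
    obtain ⟨i, hi, rfl⟩ := M.gen_pow hq hζ τ
    exact ⟨i, by simpa using hi, rfl⟩

lemma NF_norm (M : Kum K L ζ q x) (hq : q.Prime) (hζ : IsPrimitiveRoot ζ q)
    (hx : ∀ c : K, c ^ q ≠ x) (y : L) : NF ζ q (x : K) (Algebra.norm K y) := by
  obtain ⟨f, rfl⟩ := M.adj y
  refine NF_of_aeval (irr_of_not_pow hq hx) hq.ne_zero (M.θ : L) M.hθ f ?_
  rw [M.norm_eq hq hζ]
  refine Finset.prod_congr rfl fun i _ => ?_
  rw [M.sigma_pow_aeval]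

lemma exists_norm (M : Kum K L ζ q x) (hq : q.Prime) (hζ : IsPrimitiveRoot ζ q) {b : K}
    (h : NF ζ q (x : K) b) : ∃ y : L, Algebra.norm K y = b := by
  obtain ⟨f, -, hf⟩ := NF.exists_aeval hq.ne_zero hζ.pow_eq_one h
  refine ⟨aeval (M.θ : L) f, (algebraMap K L).injective ?_⟩
  rw [M.norm_eq hq hζ, ← hf L M.θ M.hθ]
  refine Finset.prod_congr rfl fun i _ => ?_
  rw [M.sigma_pow_aeval]

lemma hilbert90 (M : Kum K L ζ q x) (hq : q.Prime) (hζ : IsPrimitiveRoot ζ q) {y : L}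
    (h : Algebra.norm K y = 1) : ∃ z : Lˣ, (z : L) / M.σ z = y := by
  have := M.isCyclic hq hζ
  exact groupCohomology.exists_div_of_norm_eq_one (M.gen hq hζ) h

lemma fixed (M : Kum K L ζ q x) (hq : q.Prime) (hζ : IsPrimitiveRoot ζ q) {y : L}
    (h : M.σ y = y) : ∃ z : K, algebraMap K L z = y := by
  have : y ∈ Set.range (algebraMap K L) := by
    rw [IsGalois.mem_range_algebraMap_iff_fixed]
    intro τ
    obtain ⟨i, -, rfl⟩ := M.gen_pow hq hζ τ
    induction i with
    | zero => rfl
    | succ n ih => rw [pow_succ, AlgEquiv.mul_apply, h, ih]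
  exact this

end Kum
end
end Prf
set_option linter.all false
set_option linter.unusedVariables false
set_option linter.unusedSimpArgs false
namespace Prf
open Polynomial NumberField IsDedekindDomain

section grp
variable {G : Type*} [CommGroup G]

lemma relIndex_le_map {α : Type*} [Finite α] (A B : Subgroup G) (f : A → α)
    (h : ∀ x y : A, f x = f y → (x : G)⁻¹ * y ∈ B) :
    B.relIndex A ≠ 0 ∧ B.relIndex A ≤ Nat.card α := by
  rw [Subgroup.relIndex, Subgroup.index]
  let g : A ⧸ B.subgroupOf A → α := fun x => f x.out
  have hg : Function.Injective g := by
    intro x y hxy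
    have := h _ _ hxy
    rw [← Quotient.out_eq x, ← Quotient.out_eq y]
    refine QuotientGroup.eq.2 ?_
    rw [Subgroup.mem_subgroupOf]
    simpa using this
  have := Finite.of_injective g hg
  exact ⟨Nat.card_pos.ne', Nat.card_le_card_of_injective g hg⟩

lemma index_sup_pow (H : Subgroup G) (hH : H.index ≠ 0) (q : ℕ) :
    (H ⊔ (powMonoidHom q : G →* G).range).index = H.relIndex (H.comap (powMonoidHom q)) := by
  have h1 := Subgroup.relIndex_mul_index (H := H) (K := H ⊔ (powMonoidHom q : G →* G).range) le_sup_left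
  rw [Subgroup.relIndex_sup_left, ← Subgroup.index_comap] at h1
  have hle : H ≤ H.comap (powMonoidHom q) := fun x hx => H.pow_mem hx q
  have h2 := Subgroup.relIndex_mul_index hle
  have h3 : (H.comap (powMonoidHom q : G →* G)).index ≠ 0 := by
    intro h; rw [h, mul_zero] at h2; exact hH h2.symm
  refine mul_left_cancel₀ h3 ?_
  rw [h1, ← h2, mul_comm]

end grp

section
variable {K : Type} [Field K] [NumberField K] {q : ℕ} {ζ : K}

/-- units at v -/
noncomputable def UV (v : HeightOneSpectrum (𝓞 K)) : Subgroup Kˣ where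
  carrier := {x | od v x = 0}
  mul_mem' := by
    intro a b ha hb
    simp only [Set.mem_ofPred_eq] at *
    rw [od_mul, ha, hb, add_zero]
  one_mem' := by simp
  inv_mem' := by
    intro a ha
    simp only [Set.mem_ofPred_eq] at *
    rw [od_inv, ha, neg_zero]

lemma mem_UV {v : HeightOneSpectrum (𝓞 K)} {x : Kˣ} : x ∈ UV v ↔ od v x = 0 := Iff.rfl

lemma nr_le_UV (v : HeightOneSpectrum (𝓞 K)) (n : ℕ) : nr v n ≤ UV v := fun x hx => by
  rw [mem_UV, od_zero_iff]; exact val_one_of_near v hx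

/-- residue map -/
noncomputable def res (v : HeightOneSpectrum (𝓞 K)) (x : K) (h : v.valuation K x ≤ 1) :
    𝓞 K ⧸ v.asIdeal :=
  Ideal.Quotient.mk _ (v.exists_valuation_sub_lt_of_integer h 1).choose

lemma res_eq (v : HeightOneSpectrum (𝓞 K)) {x y : K} (hx : v.valuation K x ≤ 1)
    (hy : v.valuation K y ≤ 1) (h : res v x hx = res v y hy) : v.valuation K (x - y) < 1 := by
  have h1 := (v.exists_valuation_sub_lt_of_integer hx 1).choose_spec
  have h2 := (v.exists_valuation_sub_lt_of_integer hy 1).choose_spec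
  set a := (v.exists_valuation_sub_lt_of_integer hx 1).choose
  set b := (v.exists_valuation_sub_lt_of_integer hy 1).choose
  have h3 : a - b ∈ v.asIdeal := Ideal.Quotient.eq.1 h
  rw [← v.valuation_lt_one_iff_mem (K := K)] at h3
  change v.valuation K (algebraMap (𝓞 K) K (a - b)) < 1 at h3
  rw [map_sub] at h3
  have h4 := Valuation.map_add_lt _ (Valuation.map_sub_lt _ h2 h1) h3
  refine lt_of_eq_of_lt ?_ h4
  congr 1; ring

instance fin_res (v : HeightOneSpectrum (𝓞 K)) : Finite (𝓞 K ⧸ v.asIdeal) :=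
  Ideal.finiteQuotientOfFreeOfNeBot _ v.ne_bot

/-- cardinality of the residue field -/
noncomputable def kn (v : HeightOneSpectrum (𝓞 K)) : ℕ := Nat.card (𝓞 K ⧸ v.asIdeal)

lemma kn_pos (v : HeightOneSpectrum (𝓞 K)) : 0 < kn v := Nat.card_pos

lemma exp_lt_iff {x : WithZero (Multiplicative ℤ)} (n : ℤ) :
    x < WithZero.exp n ↔ x ≤ WithZero.exp (n - 1) := by
  rcases eq_or_ne x 0 with rfl | h
  · simp
  · obtain ⟨y, rfl⟩ : ∃ y, WithZero.exp y = x := ⟨WithZero.log x, WithZero.exp_log h⟩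
    rw [WithZero.exp_lt_exp, WithZero.exp_le_exp]; omega

lemma nr_zero_index (v : HeightOneSpectrum (𝓞 K)) :
    (nr v 0).relIndex (UV v) ≠ 0 := by
  refine (relIndex_le_map (UV v) (nr v 0) (α := 𝓞 K ⧸ v.asIdeal)
    (fun x => res v (x : Kˣ) ((od_zero_iff v x.1).1 x.2).le) ?_).1
  intro x y h
  have h1 := res_eq v _ _ h
  have hx : v.valuation K (x : Kˣ) = 1 := (od_zero_iff v x.1).1 x.2
  rw [mem_nr]
  have : (((x : Kˣ)⁻¹ * y : Kˣ) : K) - 1 = ((x : Kˣ) : K)⁻¹ * (((y : Kˣ) : K) - ((x : Kˣ) : K)) := by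
    push_cast; field_simp
  rw [this, map_mul, map_inv₀, hx, Valuation.map_sub_swap]
  simpa using h1

lemma nr_succ_index (v : HeightOneSpectrum (𝓞 K)) (n : ℕ) :
    (nr v (n + 1)).relIndex (nr v n) ≠ 0 ∧ (nr v (n + 1)).relIndex (nr v n) ≤ kn v := by
  obtain ⟨π, hπ⟩ := exists_unif v
  have hπ' : v.valuation K π = WithZero.exp (-1) := (od_eq_iff v π 1).1 hπ
  have key : ∀ z : K, v.valuation K (z * (π : K)⁻¹ ^ (n + 1)) =
      v.valuation K z * WithZero.exp ((n : ℤ) + 1) := by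
    intro z
    rw [map_mul, map_pow, map_inv₀, hπ', ← WithZero.exp_neg, ← WithZero.exp_nsmul]
    simp
  have h1 : ∀ x : nr v n, v.valuation K (((x : Kˣ) - 1 : K) * (π : K)⁻¹ ^ (n + 1)) ≤ 1 := by
    intro x
    have := x.2
    rw [mem_nr, exp_lt_iff] at this
    rw [key]
    calc _ ≤ WithZero.exp (-(n : ℤ) - 1) * WithZero.exp ((n : ℤ) + 1) := by gcongr
      _ = 1 := by rw [← WithZero.exp_add]; simp
  refine relIndex_le_map (nr v n) (nr v (n + 1)) (fun x => res v _ (h1 x)) ?_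
  intro x y h
  have h2 := res_eq v _ _ h
  rw [← sub_mul, key] at h2
  have hx : v.valuation K (x : Kˣ) = 1 := val_one_of_near v x.2
  rw [mem_nr]
  have : (((x : Kˣ)⁻¹ * y : Kˣ) : K) - 1 = ((x : Kˣ) : K)⁻¹ * (((y : Kˣ) : K) - ((x : Kˣ) : K)) := by
    push_cast; field_simp
  rw [this, map_mul, map_inv₀, hx, Valuation.map_sub_swap]
  rw [sub_sub_sub_cancel_right] at h2
  rw [inv_one, one_mul]
  have h3 : (0 : WithZero (Multiplicative ℤ)) < WithZero.exp ((n : ℤ) + 1) := WithZero.exp_pos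
  rw [← mul_lt_mul_iff_left₀ h3, ← WithZero.exp_add]
  push_cast
  simpa using h2

lemma nr_anti (v : HeightOneSpectrum (𝓞 K)) {m n : ℕ} (h : m ≤ n) : nr v n ≤ nr v m := by
  intro x hx
  rw [mem_nr] at *
  refine hx.trans_le ?_
  rw [WithZero.exp_le_exp]; omega

lemma nr_add_index (v : HeightOneSpectrum (𝓞 K)) (n d : ℕ) :
    (nr v (n + d)).relIndex (nr v n) ≠ 0 ∧ (nr v (n + d)).relIndex (nr v n) ≤ kn v ^ d := by
  induction d with
  | zero => simp
  | succ d ih =>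
    rw [← add_assoc, ← Subgroup.relIndex_mul_relIndex (nr v (n + d + 1)) (nr v (n + d)) (nr v n)
      (nr_anti v (by omega)) (nr_anti v (by omega))]
    obtain ⟨h1, h2⟩ := nr_succ_index v (n + d)
    exact ⟨mul_ne_zero h1 ih.1, by rw [pow_succ']; exact Nat.mul_le_mul h2 ih.2⟩

lemma nr_UV_index (v : HeightOneSpectrum (𝓞 K)) (n : ℕ) : (nr v n).relIndex (UV v) ≠ 0 := by
  rw [← Subgroup.relIndex_mul_relIndex (nr v n) (nr v 0) (UV v) (nr_anti v (by omega))
    (nr_le_UV v 0)]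
  refine mul_ne_zero ?_ (nr_zero_index v)
  simpa using (nr_add_index v 0 n).1

/-- order of `ζ - 1` -/
noncomputable def LV (ζ : K) (v : HeightOneSpectrum (𝓞 K)) : ℕ := NV ζ 1 v

lemma NV_eq (v : HeightOneSpectrum (𝓞 K)) : NV ζ q v = q * LV ζ v := by
  unfold LV NV; split_ifs <;> simp

lemma LV_spec (hq : q.Prime) (hζ : IsPrimitiveRoot ζ q) (v : HeightOneSpectrum (𝓞 K)) :
    WithZero.exp (-(LV ζ v : ℤ)) = v.valuation K (ζ - 1) := by
  have h := NV_spec hq hζ v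
  rw [NV_eq] at h
  have h2 : WithZero.exp (-((q * LV ζ v : ℕ) : ℤ)) = WithZero.exp (-(LV ζ v : ℤ)) ^ q := by
    rw [← WithZero.exp_nsmul]; simp
  rw [h2] at h
  exact (pow_left_inj₀ zero_le' zero_le' hq.ne_zero).1 h

lemma LV_good (hq : q.Prime) (hζ : IsPrimitiveRoot ζ q) {v : HeightOneSpectrum (𝓞 K)}
    (hv : v.valuation K (q : K) = 1) : LV ζ v = 0 := by
  have := LV_spec hq hζ v
  rw [val_q_one _ hq hζ hv, ← WithZero.exp_zero, WithZero.exp_inj] at this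
  omega

lemma PV_UV (hq : q.Prime) (hζ : IsPrimitiveRoot ζ q) (v : HeightOneSpectrum (𝓞 K)) :
    (PV ζ q v).relIndex (UV v) ≠ 0 ∧
    (PV ζ q v).relIndex (UV v) ≤ q * kn v ^ ((q - 1) * LV ζ v) := by
  set H : Subgroup (UV v) := (nr v (NV ζ q v)).subgroupOf (UV v) with hH
  have hHi : H.index ≠ 0 := nr_UV_index v _
  have h1 := index_sup_pow H hHi q
  have h2 : H ⊔ (powMonoidHom q : UV v →* UV v).range ≤ (PV ζ q v).subgroupOf (UV v) := by
    refine sup_le ?_ ?_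
    · exact Subgroup.comap_mono le_sup_left
    · rintro _ ⟨x, rfl⟩
      exact pow_mem_PV v (x : Kˣ)
  have h3 : (H ⊔ (powMonoidHom q : UV v →* UV v).range).index ≠ 0 := fun h =>
    hHi (by rw [← Subgroup.relIndex_mul_index (H := H) le_sup_left, h, mul_zero])
  have h4 : ((PV ζ q v).subgroupOf (UV v)).index ≠ 0 := fun h => by
    rw [← Subgroup.relIndex_mul_index h2, h, mul_zero] at h3; exact h3 rfl
  refine ⟨h4, ?_⟩
  have h5 : (PV ζ q v).relIndex (UV v) ≤ (H ⊔ (powMonoidHom q : UV v →* UV v).range).index := by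
    rw [← Subgroup.relIndex_mul_index h2]
    refine Nat.le_mul_of_pos_left _ (Nat.pos_of_ne_zero ?_)
    intro h
    rw [← Subgroup.relIndex_mul_index h2, h, zero_mul] at h3; exact h3 rfl
  refine h5.trans ?_
  rw [h1]
  have hζ0 : ζ ≠ 0 := hζ.ne_zero hq.ne_zero
  have hz : Units.mk0 ζ hζ0 ∈ UV v := by
    rw [mem_UV, od_zero_iff]; exact val_root _ hq.ne_zero hζ.pow_eq_one
  set z : UV v := ⟨Units.mk0 ζ hζ0, hz⟩ with hzz
  set H1 : Subgroup (UV v) := (nr v (LV ζ v)).subgroupOf (UV v) with hH1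
  have hzq : z ^ q = 1 := by
    ext; simp [hzz, hζ.pow_eq_one]
  have : NeZero q := ⟨hq.ne_zero⟩
  have h6 : H.comap (powMonoidHom q) ≤ Subgroup.zpowers z ⊔ H1 := by
    intro x hx
    rw [Subgroup.mem_comap, powMonoidHom_apply, hH, Subgroup.mem_subgroupOf, mem_nr,
      NV_spec hq hζ] at hx
    have hx' : v.valuation K (((x : Kˣ) : K) ^ q - 1) < v.valuation K (ζ - 1) ^ q := hx
    obtain ⟨μ, hμ, hμ'⟩ := val_close _ hq hζ hx'
    obtain ⟨i, -, rfl⟩ := hζ.eq_pow_of_pow_eq_one hμ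
    refine Subgroup.mem_sup.2 ⟨z ^ i, Subgroup.pow_mem _ (Subgroup.mem_zpowers z) i,
      (z ^ i)⁻¹ * x, ?_, by simp⟩
    rw [hH1, Subgroup.mem_subgroupOf, mem_nr, LV_spec hq hζ]
    have : ((((z ^ i)⁻¹ * x : UV v) : Kˣ) : K) - 1 = (ζ ^ i)⁻¹ * ((x : Kˣ) - ζ ^ i) := by
      simp [hzz]
      field_simp
    rw [this, map_mul, map_inv₀, val_root _ hq.ne_zero hμ, inv_one, one_mul]
    exact hμ'
  have h7 : H ≤ H1 := Subgroup.comap_mono (nr_anti v (by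
    rw [NV_eq]; exact Nat.le_mul_of_pos_left _ hq.pos))
  have h8 : H.relIndex (Subgroup.zpowers z ⊔ H1) ≠ 0 := fun h => hHi (by
    have := Subgroup.relIndex_mul_index (H := H) (K := Subgroup.zpowers z ⊔ H1)
      (h7.trans le_sup_right)
    rw [← this, h, zero_mul])
  refine (Subgroup.relIndex_le_of_le_right h6 h8).trans ?_
  rw [← Subgroup.relIndex_mul_relIndex H H1 _ h7 le_sup_right, Subgroup.relIndex_sup_right, mul_comm]
  refine Nat.mul_le_mul ?_ ?_
  · have hfin : IsOfFinOrder z := isOfFinOrder_iff_pow_eq_one.2 ⟨q, hq.pos, hzq⟩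
    have h9 := Subgroup.relIndex_dvd_card H1 (Subgroup.zpowers z)
    rw [Nat.card_zpowers] at h9
    exact Nat.le_of_dvd hq.pos (h9.trans (orderOf_dvd_of_pow_eq_one hzq))
  · rw [hH, hH1, Subgroup.relIndex_subgroupOf (nr_le_UV v _)]
    have : NV ζ q v = LV ζ v + (q - 1) * LV ζ v := by
      rw [NV_eq]
      obtain ⟨n, rfl⟩ : ∃ n, q = n + 1 := ⟨q - 1, (Nat.succ_pred_prime hq).symm⟩
      simp; ring
    rw [this]
    exact (nr_add_index v _ _).2

lemma UV_PV_index (hq : q.Prime) (v : HeightOneSpectrum (𝓞 K)) :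
    (PV ζ q v ⊔ UV v).index ≠ 0 ∧ (PV ζ q v ⊔ UV v).index ≤ q := by
  have : NeZero q := ⟨hq.ne_zero⟩
  rw [← Subgroup.relIndex_top_right]
  have := relIndex_le_map (⊤ : Subgroup Kˣ) (PV ζ q v ⊔ UV v) (α := ZMod q)
    (fun x => ((od v x.1 : ℤ) : ZMod q)) (by
      intro x y h
      rw [eq_comm, ← sub_eq_zero, ← Int.cast_sub, ZMod.intCast_zmod_eq_zero_iff_dvd] at h
      obtain ⟨c, hc⟩ := h
      obtain ⟨π, hπ⟩ := exists_unif v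
      have h1 : (π ^ c) ^ q * ((π ^ c) ^ q)⁻¹ * ((x : Kˣ)⁻¹ * y) = (x : Kˣ)⁻¹ * y := by simp
      rw [← h1, mul_assoc]
      refine Subgroup.mem_sup.2 ⟨_, pow_mem_PV v _, _, ?_, rfl⟩
      rw [mem_UV]
      simp [hπ]
      linarith)
  simpa using this

lemma PV_index (hq : q.Prime) (hζ : IsPrimitiveRoot ζ q) (v : HeightOneSpectrum (𝓞 K)) :
    (PV ζ q v).index ≠ 0 ∧
    (PV ζ q v).index ≤ q ^ 2 * kn v ^ ((q - 1) * LV ζ v) := by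
  rw [← Subgroup.relIndex_mul_index (H := PV ζ q v) (K := PV ζ q v ⊔ UV v) le_sup_left,
    Subgroup.relIndex_sup_left]
  obtain ⟨h1, h2⟩ := PV_UV hq hζ v
  obtain ⟨h3, h4⟩ := UV_PV_index (ζ := ζ) hq v
  refine ⟨mul_ne_zero h1 h3, ?_⟩
  calc _ ≤ (q * kn v ^ ((q - 1) * LV ζ v)) * q := Nat.mul_le_mul h2 h4
    _ = _ := by ring

/-- cyclicity of units modulo `PV` at good places -/
lemma good_cyclic (hq : q.Prime) (hζ : IsPrimitiveRoot ζ q) {v : HeightOneSpectrum (𝓞 K)}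
    (hv : v.valuation K (q : K) = 1) {z z' : Kˣ} (hz : od v z = 0) (hz' : od v z' = 0)
    (hzP : z ∉ PV ζ q v) : ∃ c : ℤ, z' * z ^ c ∈ PV ζ q v := by
  obtain ⟨h1, h2⟩ := PV_UV hq hζ v
  rw [LV_good hq hζ hv, mul_zero, pow_zero, mul_one] at h2
  set N := (PV ζ q v).subgroupOf (UV v) with hN
  have : Fact q.Prime := ⟨hq⟩
  have : Finite (UV v ⧸ N) := Nat.finite_of_card_ne_zero h1
  have ho : orderOf (QuotientGroup.mk ⟨z, hz⟩ : UV v ⧸ N) = q := by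
    refine orderOf_eq_prime ?_ ?_
    · rw [← QuotientGroup.mk_pow, QuotientGroup.eq_one_iff, hN, Subgroup.mem_subgroupOf]
      exact pow_mem_PV v z
    · rw [Ne, QuotientGroup.eq_one_iff, hN, Subgroup.mem_subgroupOf]
      exact hzP
  have hc : Nat.card (UV v ⧸ N) = q := by
    refine le_antisymm h2 ?_
    rw [← ho]
    exact Nat.le_of_dvd Nat.card_pos (orderOf_dvd_natCard _)
  have hm : (QuotientGroup.mk ⟨z', hz'⟩ : UV v ⧸ N) ∈
      Subgroup.zpowers (QuotientGroup.mk ⟨z, hz⟩ : UV v ⧸ N) := by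
    refine mem_zpowers_of_prime_card hc ?_
    intro h; rw [h, orderOf_one] at ho; exact hq.one_lt.ne ho
  obtain ⟨c, hc⟩ := Subgroup.mem_zpowers_iff.1 hm
  refine ⟨-c, ?_⟩
  rw [← QuotientGroup.mk_zpow, QuotientGroup.eq, hN, Subgroup.mem_subgroupOf] at hc
  rw [zpow_neg, mul_comm]
  simpa using hc

lemma od_q (hq : q.Prime) (hζ : IsPrimitiveRoot ζ q) (v : HeightOneSpectrum (𝓞 K)) :
    v.valuation K (q : K) = WithZero.exp (-(((q - 1) * LV ζ v : ℕ) : ℤ)) := by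
  rw [val_q _ hq hζ, ← LV_spec hq hζ, ← WithZero.exp_nsmul]
  push_cast; simp

lemma prod_kn (hq : q.Prime) (hζ : IsPrimitiveRoot ζ q) (S : Finset (HeightOneSpectrum (𝓞 K)))
    (hS : ∀ v, v.valuation K (q : K) ≠ 1 → v ∈ S) :
    ∏ v ∈ S, kn v ^ ((q - 1) * LV ζ v) = q ^ Module.finrank ℚ K := by
  have hI : Ideal.span {(q : 𝓞 K)} ≠ 0 := by
    rw [Ne, Ideal.zero_eq_bot, Ideal.span_singleton_eq_bot]; exact_mod_cast hq.ne_zero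
  have h1 := Ideal.finprod_heightOneSpectrum_factorization hI
  have hcount : ∀ v : HeightOneSpectrum (𝓞 K), v.maxPowDividing (Ideal.span {(q : 𝓞 K)}) =
      v.asIdeal ^ ((q - 1) * LV ζ v) := by
    intro v
    have h2 : v.intValuation (q : 𝓞 K) = WithZero.exp (-(((q - 1) * LV ζ v : ℕ) : ℤ)) := by
      rw [← od_q hq hζ v, ← v.valuation_of_algebraMap (K := K)]; norm_cast
    rw [v.intValuation_if_neg (by exact_mod_cast hq.ne_zero), WithZero.exp_inj] at h2
    rw [HeightOneSpectrum.maxPowDividing]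
    congr 1
    omega
  simp_rw [hcount] at h1
  rw [finprod_eq_prod_of_mulSupport_subset (s := S)] at h1
  · have h3 := congrArg Ideal.absNorm h1
    rw [Ideal.absNorm_span_natCast, map_prod, RingOfIntegers.rank] at h3
    rw [← h3]
    refine Finset.prod_congr rfl fun v _ => ?_
    rw [map_pow]; rfl
  · intro v hv
    refine hS v fun h => hv ?_
    simp only
    rw [LV_good hq hζ h, mul_zero, pow_zero]

end
end Prf
set_option linter.all false
set_option linter.unusedVariables false
set_option linter.unusedSimpArgs false
namespace Prf
open Polynomial NumberField IsDedekindDomain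

section
variable {K : Type} [Field K] [NumberField K] {q : ℕ} {ζ : K}

lemma PV_of_near (hq : q.Prime) (hζ : IsPrimitiveRoot ζ q) {v : HeightOneSpectrum (𝓞 K)}
    (hv : v.valuation K (q : K) = 1) {u : Kˣ} (hu : od v u = 0) {c : K}
    (h : v.valuation K (u - c ^ q) < 1) : u ∈ PV ζ q v := by
  have hu1 : v.valuation K (u : K) = 1 := (od_zero_iff v u).1 hu
  have hc1 : v.valuation K (c ^ q) = 1 := by
    have := Valuation.map_sub_eq_of_lt_left (v.valuation K) (x := (u : K) - (u - c ^ q)) (y := 0)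
    have h2 : v.valuation K ((u : K) - (u - c ^ q)) = v.valuation K (u : K) :=
      Valuation.map_sub_eq_of_lt_left _ (by rw [hu1]; exact h)
    rw [sub_sub_cancel, hu1] at h2
    exact h2
  have hc0 : c ≠ 0 := by
    rintro rfl
    rw [zero_pow hq.ne_zero, map_zero] at hc1
    exact zero_ne_one hc1
  rw [mem_PV_good hq hζ hv]
  refine ⟨u * (Units.mk0 c hc0 ^ q)⁻¹, Units.mk0 c hc0, ?_, by simp⟩
  have : ((u * (Units.mk0 c hc0 ^ q)⁻¹ : Kˣ) : K) - 1 = (u - c ^ q) * (c ^ q)⁻¹ := by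
    push_cast
    simp only [Units.val_mk0]
    field_simp
  rw [this, map_mul, map_inv₀, hc1, inv_one, mul_one]
  exact h

lemma exists_nonPV (hq : q.Prime) (hζ : IsPrimitiveRoot ζ q) {v : HeightOneSpectrum (𝓞 K)}
    (hv : v.valuation K (q : K) = 1) : ∃ z : Kˣ, od v z = 0 ∧ z ∉ PV ζ q v := by
  by_contra! hc
  set N := (nr v 0).subgroupOf (UV v) with hN
  have : Finite (UV v ⧸ N) := Nat.finite_of_card_ne_zero (nr_zero_index v)
  have hs : Function.Surjective (fun x : UV v ⧸ N => x ^ q) := by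
    intro x
    obtain ⟨x, rfl⟩ := QuotientGroup.mk_surjective x
    obtain ⟨b, y, hb, hxy⟩ := (mem_PV_good hq hζ hv x.1).1 (hc x.1 x.2)
    have hbn : b ∈ nr v 0 := by
      rw [mem_nr]; simpa using hb
    have hy : y ∈ UV v := by
      have h1 := x.2
      rw [hxy, mem_UV, od_mul, mem_UV.1 (nr_le_UV v 0 hbn), od_pow, zero_add] at h1
      rw [mem_UV]
      have : (q : ℤ) ≠ 0 := by exact_mod_cast hq.ne_zero
      exact (mul_eq_zero.1 h1).resolve_left this
    refine ⟨QuotientGroup.mk ⟨y, hy⟩, ?_⟩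
    show (QuotientGroup.mk ⟨y, hy⟩ : UV v ⧸ N) ^ q = _
    rw [← QuotientGroup.mk_pow, QuotientGroup.eq, hN, Subgroup.mem_subgroupOf]
    have : (((⟨y, hy⟩ ^ q)⁻¹ * x : UV v) : Kˣ) = b := by
      push_cast
      rw [hxy, mul_comm]; simp
    rw [this]; exact hbn
  have hi := Finite.injective_iff_surjective.2 hs
  have hζ0 : ζ ≠ 0 := hζ.ne_zero hq.ne_zero
  have hz : Units.mk0 ζ hζ0 ∈ UV v := by
    rw [mem_UV, od_zero_iff]; exact val_root _ hq.ne_zero hζ.pow_eq_one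
  have h1 : (QuotientGroup.mk ⟨Units.mk0 ζ hζ0, hz⟩ : UV v ⧸ N) = 1 := by
    apply hi
    show (QuotientGroup.mk ⟨Units.mk0 ζ hζ0, hz⟩ : UV v ⧸ N) ^ q = 1 ^ q
    rw [one_pow, ← QuotientGroup.mk_pow, QuotientGroup.eq_one_iff]
    convert N.one_mem
    ext
    simp [hζ.pow_eq_one]
  rw [QuotientGroup.eq_one_iff, hN, Subgroup.mem_subgroupOf, mem_nr] at h1
  simp only [Units.val_mk0] at h1
  rw [val_q_one _ hq hζ hv] at h1
  simp at h1

variable {L : Type} [Field L] [NumberField L] [Algebra K L] [IsGalois K L]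

lemma res_deg_one (w : HeightOneSpectrum (𝓞 L)) (hf : w.asIdeal.inertiaDeg (𝓞 K) = 1)
    {θ : L} (hθ : w.valuation L θ ≤ 1) : ∃ d : K, w.valuation L (θ - algebraMap K L d) < 1 := by
  obtain ⟨a, ha⟩ := w.exists_valuation_sub_lt_of_integer (K := L) (x := θ) hθ 1
  have : (below K w).asIdeal.IsMaximal := (below K w).isMaximal
  rw [Ideal.inertiaDeg_eq_of_isMaximal (below K w).asIdeal w.asIdeal] at hf
  obtain ⟨c, hc⟩ : ∃ c : 𝓞 K, a - algebraMap (𝓞 K) (𝓞 L) c ∈ w.asIdeal := by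
    letI : Field (𝓞 K ⧸ (below K w).asIdeal) := Ideal.Quotient.field _
    have hb := finrank_eq_one_iff_of_nonzero' (K := 𝓞 K ⧸ (below K w).asIdeal)
      (1 : 𝓞 L ⧸ w.asIdeal) (by
        have : Nontrivial (𝓞 L ⧸ w.asIdeal) := Ideal.Quotient.nontrivial_iff.2 w.isPrime.ne_top
        exact one_ne_zero)
    obtain ⟨c, hc⟩ := hb.1 hf (Ideal.Quotient.mk _ a)
    obtain ⟨c, rfl⟩ := Ideal.Quotient.mk_surjective c
    refine ⟨c, ?_⟩
    rw [← Ideal.Quotient.eq, ← hc, Algebra.smul_def, mul_one]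
    rfl
  have hd : w.valuation L (algebraMap (𝓞 L) L (a - algebraMap (𝓞 K) (𝓞 L) c)) < 1 := by
    rwa [w.valuation_lt_one_iff_mem]
  set d : K := algebraMap (𝓞 K) K c with hdd
  have hd' : algebraMap (𝓞 L) L (algebraMap (𝓞 K) (𝓞 L) c) = algebraMap K L d := by
    rw [hdd, ← IsScalarTower.algebraMap_apply, ← IsScalarTower.algebraMap_apply]
  rw [map_sub, hd'] at hd
  refine ⟨d, ?_⟩
  have := Valuation.map_sub_lt _ hd ha
  convert this using 2
  ring

end

section
variable {K : Type} [Field K] [NumberField K] {q : ℕ} {ζ : K}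

lemma not_pow_of_notMem_PV {v : HeightOneSpectrum (𝓞 K)} (hq : q.Prime) {u : Kˣ} (h : u ∉ PV ζ q v)
    (c : K) : c ^ q ≠ u := by
  intro hc
  have hc0 : c ≠ 0 := by
    rintro rfl
    rw [zero_pow hq.ne_zero] at hc
    exact u.ne_zero hc.symm
  apply h
  have : u = (Units.mk0 c hc0) ^ q := by ext; simp [hc]
  rw [this]; exact pow_mem_PV v _

lemma T1 (hq : q.Prime) (hζ : IsPrimitiveRoot ζ q) {v : HeightOneSpectrum (𝓞 K)}
    (hv : v.valuation K (q : K) = 1) {u N : Kˣ} (hu : od v u = 0) (huP : u ∉ PV ζ q v)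
    (h : NF ζ q (u : K) N) : (q : ℤ) ∣ od v N := by
  obtain ⟨L, _, _, _, _, ⟨M⟩⟩ := exists_kum hq hζ u (not_pow_of_notMem_PV hq huP)
  obtain ⟨y, hy⟩ := M.exists_norm hq hζ h
  obtain ⟨w, hw⟩ := exists_above (L := L) v
  subst hw
  have hram := unram hq hζ M.fin M.hθ M.hσ w hv hu
  have he := efg (K := K) w
  rw [hram, one_mul, M.fin] at he
  have hθ1 : w.valuation L (M.θ : L) ≤ 1 := by
    have : w.valuation L (M.θ : L) ^ q = 1 := by
      rw [← map_pow, M.hθ, val_of_liesOver_one]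
      exact (od_zero_iff _ _).1 hu
    exact ((pow_eq_one_iff_of_nonneg zero_le' hq.ne_zero).1 this).le
  have hg : ((below K w).asIdeal.primesOver (𝓞 L)).ncard = 1 := by
    rcases (Nat.dvd_prime hq).1 (Dvd.intro _ he) with h1 | h1
    · exact h1
    exfalso
    rw [h1] at he
    have hf : w.asIdeal.inertiaDeg (𝓞 K) = 1 :=
      Nat.eq_of_mul_eq_mul_left hq.pos (by rw [he, mul_one])
    obtain ⟨d, hd⟩ := res_deg_one w hf hθ1
    apply huP
    refine PV_of_near hq hζ hv hu (c := d) ?_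
    rw [← val_map_lt_one w, map_sub, map_pow, ← M.hθ]
    have hd1 : w.valuation L (algebraMap K L d) ≤ 1 := by
      have h3 : algebraMap K L d = M.θ - (M.θ - algebraMap K L d) := by ring
      rw [h3]
      exact (Valuation.map_sub _ _ _).trans (max_le hθ1 hd.le)
    obtain ⟨e, he⟩ := sub_dvd_pow_sub_pow (M.θ : L) (algebraMap K L d) q
    rw [← Commute.geom_sum₂_mul (Commute.all _ _), map_mul, mul_comm]
    refine mul_lt_one_of_lt_of_le hd ?_
    refine Valuation.map_sum_le _ fun i _ => ?_
    rw [map_mul, map_pow, map_pow]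
    exact mul_le_one' (pow_le_one' hθ1 _) (pow_le_one' hd1 _)
  have hfix := gw_fix _ hg w rfl
  have hval : ∀ τ : L ≃ₐ[K] L, ∀ y, w.valuation L (τ y) = w.valuation L y := fun τ y => by
    rw [← gw_val, hfix]
  have hn := M.norm_eq hq hζ y
  rw [hy] at hn
  have hn2 := congrArg (w.valuation L) hn
  rw [map_prod, val_map, hram, pow_one] at hn2
  simp only [hval, Finset.prod_const, Finset.card_range] at hn2
  have hy0 : y ≠ 0 := by
    rintro rfl
    rw [map_zero, zero_pow hq.ne_zero, map_eq_zero] at hn2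
    exact N.ne_zero hn2
  have h3 : w.valuation L y = WithZero.exp (-(od w (Units.mk0 y hy0))) := od_spec w (Units.mk0 y hy0)
  rw [od_spec, h3, ← WithZero.exp_nsmul, WithZero.exp_inj] at hn2
  refine ⟨od w (Units.mk0 y hy0), ?_⟩
  simp at hn2
  exact hn2

lemma T2 (hq : q.Prime) (hζ : IsPrimitiveRoot ζ q) {v : HeightOneSpectrum (𝓞 K)}
    (hv : v.valuation K (q : K) = 1) {u N : Kˣ} (hu : ¬ (q : ℤ) ∣ od v u)
    (hN : od v N = 0) (h : NF ζ q (u : K) N) : N ∈ PV ζ q v := by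
  have huP : u ∉ PV ζ q v := fun h => hu (PV_od hq hζ h)
  obtain ⟨L, _, _, _, _, ⟨M⟩⟩ := exists_kum hq hζ u (not_pow_of_notMem_PV hq huP)
  obtain ⟨y, hy⟩ := M.exists_norm hq hζ h
  obtain ⟨w, hw⟩ := exists_above (L := L) v
  subst hw
  have he := efg (K := K) w
  rw [M.fin] at he
  have hr : ram K w = q := by
    have h1 : ram K w ∣ q := ⟨((below K w).asIdeal.primesOver (𝓞 L)).ncard *
      w.asIdeal.inertiaDeg (𝓞 K), by conv_lhs => rw [← he]
                                     ring⟩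
    refine ((Nat.dvd_prime hq).1 h1).resolve_left fun h2 => hu ?_
    have h3 : M.θ ^ q = um L u := by ext; simp [M.hθ]
    have h4 := congrArg (od w) h3
    rw [od_um, h2, od_pow] at h4
    exact ⟨_, by simpa using h4.symm⟩
  have h1 : ((below K w).asIdeal.primesOver (𝓞 L)).ncard * w.asIdeal.inertiaDeg (𝓞 K) = 1 := by
    have := hq.pos
    rw [hr] at he
    have h2 : q * (((below K w).asIdeal.primesOver (𝓞 L)).ncard * w.asIdeal.inertiaDeg (𝓞 K))
      = q * 1 := by linarith
    exact Nat.eq_of_mul_eq_mul_left this h2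
  obtain ⟨hg, hf⟩ := Nat.eq_one_of_mul_eq_one_right h1, Nat.eq_one_of_mul_eq_one_left h1
  have hfix := gw_fix _ hg w rfl
  have hval : ∀ τ : L ≃ₐ[K] L, ∀ y, w.valuation L (τ y) = w.valuation L y := fun τ y => by
    rw [← gw_val, hfix]
  have hn := M.norm_eq hq hζ y
  rw [hy] at hn
  have hy1 : w.valuation L y ≤ 1 := by
    have hn2 := congrArg (w.valuation L) hn
    rw [map_prod, val_map, (od_zero_iff _ _).1 hN, one_pow] at hn2
    simp only [hval, Finset.prod_const, Finset.card_range] at hn2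
    exact ((pow_eq_one_iff_of_nonneg zero_le' hq.ne_zero).1 hn2.symm).le
  obtain ⟨d, hd⟩ := res_deg_one w hf hy1
  have hd1 : w.valuation L (algebraMap K L d) ≤ 1 := by
    have h3 : algebraMap K L d = y - (y - algebraMap K L d) := by ring
    rw [h3]
    exact (Valuation.map_sub _ _ _).trans (max_le hy1 hd.le)
  refine PV_of_near hq hζ hv hN (c := d) ?_
  rw [← val_map_lt_one w, map_sub, map_pow, hn]
  have key : ∀ n, w.valuation L (∏ i ∈ Finset.range n, (M.σ ^ i) y) ≤ 1 ∧
      w.valuation L (∏ i ∈ Finset.range n, (M.σ ^ i) y - algebraMap K L d ^ n) < 1 := by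
    intro n
    induction n with
    | zero => simp
    | succ n ih =>
      rw [Finset.prod_range_succ]
      constructor
      · rw [map_mul, hval]; exact mul_le_one' ih.1 hy1
      · have h5 : (∏ i ∈ Finset.range n, (M.σ ^ i) y) * (M.σ ^ n) y - algebraMap K L d ^ (n + 1) =
          (∏ i ∈ Finset.range n, (M.σ ^ i) y - algebraMap K L d ^ n) * algebraMap K L d +
          (M.σ ^ n) (y - algebraMap K L d) * (∏ i ∈ Finset.range n, (M.σ ^ i) y) := by
          rw [map_sub, AlgEquiv.commutes]; ring
        rw [h5]
        refine Valuation.map_add_lt _ ?_ ?_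
        · rw [map_mul]; exact mul_lt_one_of_lt_of_le ih.2 hd1
        · rw [map_mul, hval]; exact mul_lt_one_of_lt_of_le hd ih.1
  exact (key q).2

/-- norm subgroup -/
noncomputable def NS (hq : q.Prime) (ζ : K) (a : Kˣ) : Subgroup Kˣ where
  carrier := {z | NF ζ q (a : K) z}
  mul_mem' := by
    intro x y hx hy
    simp only [Set.mem_ofPred_eq] at *
    push_cast
    exact NF.mul hx hy
  one_mem' := by
    have := NF_pow (ζ := ζ) (q := q) (a := (a : K)) 1
    simpa using this
  inv_mem' := by
    intro x hx
    simp only [Set.mem_ofPred_eq] at *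
    push_cast
    exact NF.inv hq.ne_zero x.ne_zero hx

lemma mem_NS {hq : q.Prime} {a z : Kˣ} : z ∈ NS hq ζ a ↔ NF ζ q (a : K) z := Iff.rfl

/-- local norm groups -/
noncomputable def HV (hq : q.Prime) (ζ : K) (a : Kˣ) (v : HeightOneSpectrum (𝓞 K)) : Subgroup Kˣ :=
  NS hq ζ a ⊔ PV ζ q v

lemma pow_mem_NS (hq : q.Prime) (a z : Kˣ) : z ^ q ∈ NS hq ζ a := by
  rw [mem_NS]; push_cast; exact NF_pow _

lemma HV_ne_top (hq : q.Prime) (hζ : IsPrimitiveRoot ζ q) {v : HeightOneSpectrum (𝓞 K)}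
    (hv : v.valuation K (q : K) = 1) {u : Kˣ} (hu : u ∉ PV ζ q v) : ∃ z, z ∉ HV hq ζ u v := by
  by_cases hd : (q : ℤ) ∣ od v u
  · obtain ⟨π, hπ⟩ := exists_unif v
    refine ⟨π, fun h => ?_⟩
    obtain ⟨c, hc⟩ := hd
    obtain ⟨N, hN, p, hp, hNp⟩ := Subgroup.mem_sup.1 h
    have h1 : od v (u * (π ^ (-c)) ^ q) = 0 := by simp [hc, hπ]
    have h2 : u * (π ^ (-c)) ^ q ∉ PV ζ q v := fun h =>
      hu ((Subgroup.mul_mem_cancel_right _ (pow_mem_PV v _)).1 h)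
    have h3 : NF ζ q ((u * (π ^ (-c)) ^ q : Kˣ) : K) N := by
      have := NF.of_mul_pow (c := ((π ^ (-c) : Kˣ) : K)) (Units.ne_zero _) hN
      rw [Units.val_mul, Units.val_pow_eq_pow_val]
      exact this
    have h4 := T1 hq hζ hv h1 h2 h3
    have h5 := PV_od hq hζ hp
    have h6 : od v (N * p) = 1 := by rw [hNp, hπ]
    rw [od_mul] at h6
    have h7 : (q : ℤ) ∣ 1 := by rw [← h6]; exact dvd_add h4 h5
    have h8 : q ∣ 1 := by exact_mod_cast h7
    exact hq.one_lt.ne' (Nat.dvd_one.1 h8)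
  · obtain ⟨z, hz, hzP⟩ := exists_nonPV hq hζ hv
    refine ⟨z, fun h => hzP ?_⟩
    obtain ⟨N, hN, p, hp, rfl⟩ := Subgroup.mem_sup.1 h
    obtain ⟨b, y, hb, rfl⟩ := (mem_PV hq hζ v p).1 hp
    have hb0 : od v b = 0 := by
      rw [od_zero_iff]
      rw [← NV_spec hq hζ] at hb
      exact val_one_of_near v hb
    have h1 : od v (N * y ^ q) = 0 := by
      rw [od_mul, od_mul, hb0] at hz; rw [od_mul]; linarith
    have h2 : N * y ^ q ∈ PV ζ q v := by
      refine T2 hq hζ hv hd h1 ?_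
      exact (NS hq ζ u).mul_mem hN (pow_mem_NS hq u y)
    have h3 : N * (b * y ^ q) = b * (N * y ^ q) := by
      rw [mul_left_comm]
    rw [h3]
    exact (PV ζ q v).mul_mem (near_mem_PV hq hζ v b hb) h2
end
end Prf
set_option linter.all false
set_option linter.unusedVariables false
set_option linter.unusedSimpArgs false
namespace Prf
open Polynomial NumberField IsDedekindDomain

theorem ambig {A B : Type*} [CommGroup A] [CommGroup B] [Module.Finite ℤ (Additive A)]
    (q : ℕ) (hq : q.Prime) (j : B →* A) (hj : Function.Injective j) (s : A →* A) (n : A →* B)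
    (hsj : ∀ b, s (j b) = j b) (hnj : ∀ b, n (j b) = b ^ q)
    (hjn : ∀ a, j (n a) = ∏ i ∈ Finset.range q, (s : A → A)^[i] a) (hns : ∀ a, n (s a) = n a)
    (h90 : ∀ a, n a = 1 → ∃ z, a = z / s z) (t : A) (ht : ∃ b, s t = j b * t)
    (htq : t ^ q ∈ j.range) (ht0 : t ∉ j.range) (m k : ℕ)
    (hm : (q - 1) * m + Module.finrank ℤ (Additive B) ≤ Module.finrank ℤ (Additive A))
    (hk : (powMonoidHom q : B →* B).range.index = q ^ k) :
    n.range.index ≠ 0 ∧ n.range.index * q ^ (m + 1) ≤ q ^ k := by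
  let jl : Additive B →ₗ[ℤ] Additive A := (MonoidHom.toAdditive j).toIntLinearMap
  let sl : Module.End ℤ (Additive A) := (MonoidHom.toAdditive s).toIntLinearMap
  have hjl : Function.Injective jl := hj
  let P : Submodule ℤ (Additive A) := LinearMap.range jl
  have hmemP : ∀ a : A, (Additive.ofMul a ∈ P ↔ a ∈ j.range) := fun a => Iff.rfl
  have hP : P ≤ P.comap sl := by
    rintro _ ⟨b, rfl⟩
    exact ⟨b, (hsj (Additive.toMul b)).symm⟩
  let sb : Module.End ℤ (Additive A ⧸ P) := P.mapQ P sl hP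
  have hsb : ∀ a : A, sb (P.mkQ (Additive.ofMul a)) = P.mkQ (Additive.ofMul (s a)) := fun a => rfl
  have hsbi : ∀ (i : ℕ) (a : A), (sb ^ i) (P.mkQ (Additive.ofMul a)) =
      P.mkQ (Additive.ofMul ((s : A → A)^[i] a)) := by
    intro i
    induction i with
    | zero => intro a; rfl
    | succ i ih =>
      intro a
      rw [pow_succ, Module.End.mul_apply, hsb, ih]; rfl
  have hsum : ∑ i ∈ Finset.range q, sb ^ i = 0 := by
    refine LinearMap.ext fun w => ?_
    obtain ⟨a, rfl⟩ := P.mkQ_surjective w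
    rw [LinearMap.sum_apply, LinearMap.zero_apply]
    have : ∀ i, (sb ^ i) (P.mkQ a) = P.mkQ (Additive.ofMul ((s : A → A)^[i] a.toMul)) :=
      fun i => hsbi i a.toMul
    simp only [this]
    rw [← map_sum, ← ofMul_prod, ← hjn]
    rw [Submodule.mkQ_apply, Submodule.Quotient.mk_eq_zero, hmemP]
    exact ⟨_, rfl⟩
  obtain ⟨hh1, hh2⟩ := herbrand q hq sb hsum
  have hrank : Module.finrank ℤ (Additive A ⧸ P) + Module.finrank ℤ (Additive B) =
      Module.finrank ℤ (Additive A) := by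
    rw [← Submodule.finrank_quotient_add_finrank P,
      (LinearEquiv.ofInjective jl hjl).finrank_eq]
  have hkc : q ≤ kc (1 - sb) := by
    have htk : P.mkQ (Additive.ofMul t) ∈ LinearMap.ker (1 - sb) := by
      obtain ⟨b, hb⟩ := ht
      rw [LinearMap.mem_ker, LinearMap.sub_apply, Module.End.one_apply, hsb, hb, ofMul_mul, map_add,
        sub_add_eq_sub_sub, sub_right_comm, sub_self, zero_sub, neg_eq_zero]
      rw [Submodule.mkQ_apply, Submodule.Quotient.mk_eq_zero, hmemP]
      exact ⟨_, rfl⟩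
    have : Fact q.Prime := ⟨hq⟩
    have ho : addOrderOf (⟨_, htk⟩ : LinearMap.ker (1 - sb)) = q := by
      refine addOrderOf_eq_prime ?_ ?_
      · ext
        show q • P.mkQ (Additive.ofMul t) = 0
        rw [← map_nsmul, ← ofMul_pow, Submodule.mkQ_apply, Submodule.Quotient.mk_eq_zero, hmemP]
        exact htq
      · intro h
        have h' : P.mkQ (Additive.ofMul t) = 0 := congrArg Subtype.val h
        rw [Submodule.mkQ_apply, Submodule.Quotient.mk_eq_zero, hmemP] at h'
        exact ht0 h'
    rw [← ho]
    exact Nat.le_of_dvd (Nat.pos_of_ne_zero hh2) (addOrderOf_dvd_natCard _)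
  have hix : q ^ (m + 1) ≤ ix (1 - sb) := by
    have hq1 : q - 1 ≠ 0 := by have := hq.two_le; omega
    rw [← Nat.pow_le_pow_iff_left hq1, hh1]
    calc (q ^ (m + 1)) ^ (q - 1) = q ^ ((q - 1) * m) * q ^ (q - 1) := by ring
      _ ≤ _ := Nat.mul_le_mul (Nat.pow_le_pow_right hq.pos (by omega))
        (Nat.pow_le_pow_left hkc _)
  have hle : (powMonoidHom q : B →* B).range ≤ n.range := by
    rintro _ ⟨b, rfl⟩
    exact ⟨j b, hnj b⟩
  have h1 := Subgroup.relIndex_mul_index hle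
  rw [← Subgroup.index_comap, hk] at h1
  have hqk : q ^ k ≠ 0 := pow_ne_zero _ hq.ne_zero
  let f : A →* Multiplicative ((Additive A ⧸ P) ⧸ LinearMap.range (1 - sb)) :=
    AddMonoidHom.toMultiplicativeRight
      (((LinearMap.range (1 - sb)).mkQ.comp P.mkQ).toAddMonoidHom)
  have hf : ∀ a, f a = Multiplicative.ofAdd ((LinearMap.range (1 - sb)).mkQ (P.mkQ (Additive.ofMul a))) :=
    fun a => rfl
  have hfs : Function.Surjective f := by
    intro y
    obtain ⟨w, hw⟩ := (LinearMap.range (1 - sb)).mkQ_surjective y.toAdd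
    obtain ⟨a, ha⟩ := P.mkQ_surjective w
    exact ⟨a.toMul, by rw [hf, ofMul_toMul, ha, hw]; rfl⟩
  have hker : f.ker = (powMonoidHom q : B →* B).range.comap n := by
    ext a
    rw [MonoidHom.mem_ker, hf, Subgroup.mem_comap]
    have e1 : (Multiplicative.ofAdd ((LinearMap.range (1 - sb)).mkQ (P.mkQ (Additive.ofMul a))) = 1) ↔
      (LinearMap.range (1 - sb)).mkQ (P.mkQ (Additive.ofMul a)) = 0 := Iff.rfl
    rw [e1, Submodule.mkQ_apply, Submodule.Quotient.mk_eq_zero]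
    constructor
    · rintro ⟨w, hw⟩
      obtain ⟨z, rfl⟩ := P.mkQ_surjective w
      have hw' : P.mkQ (z - Additive.ofMul (s z.toMul)) = P.mkQ (Additive.ofMul a) := by
        rw [← hw, LinearMap.sub_apply, map_sub, ← hsb]; rfl
      rw [Submodule.mkQ_apply, Submodule.mkQ_apply, Submodule.Quotient.eq] at hw'
      have h5 : (z.toMul / s z.toMul) / a ∈ j.range := hw'
      obtain ⟨b, hb⟩ := h5
      have h6 : a = (z.toMul / s z.toMul) / j b := by rw [hb]; simp
      refine ⟨b⁻¹, ?_⟩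
      rw [h6, _root_.map_div, _root_.map_div, hns, hnj]; simp
    · rintro ⟨b, hb⟩
      have h5 : n (a / j b) = 1 := by
        rw [_root_.map_div, hnj, ← hb]; simp
      obtain ⟨z, hz⟩ := h90 _ h5
      refine ⟨P.mkQ (Additive.ofMul z), ?_⟩
      rw [LinearMap.sub_apply, Module.End.one_apply, hsb, ← map_sub, Submodule.mkQ_apply,
        Submodule.mkQ_apply, Submodule.Quotient.eq, ← ofMul_div, ← hz, ← ofMul_div, hmemP]
      refine ⟨b⁻¹, ?_⟩
      simp [div_eq_mul_inv]
  have hcard : ((powMonoidHom q : B →* B).range.comap n).index = ix (1 - sb) := by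
    rw [← hker, Subgroup.index_ker, MonoidHom.range_eq_top.2 hfs]
    rw [Subgroup.card_top]; rfl
  rw [hcard] at h1
  constructor
  · intro h; rw [h, mul_zero] at h1; exact hqk h1.symm
  · rw [← h1, mul_comm]
    exact Nat.mul_le_mul_right _ hix

section
variable {K : Type} [Field K] [NumberField K]

/-- class group is generated by primes in `S` -/
def ClTriv (S : Finset (HeightOneSpectrum (𝓞 K))) : Prop :=
  ∀ v ∉ S, ∃ c : Kˣ, od v c = 1 ∧ ∀ v' ∉ S, v' ≠ v → od v' c = 0

lemma ClTriv.mono {S T : Finset (HeightOneSpectrum (𝓞 K))} (h : ClTriv S) (hST : S ⊆ T) :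
    ClTriv T := by
  intro v hv
  obtain ⟨c, h1, h2⟩ := h v (fun hh => hv (hST hh))
  exact ⟨c, h1, fun v' hv' => h2 v' (fun hh => hv' (hST hh))⟩

lemma ClTriv.real {S : Finset (HeightOneSpectrum (𝓞 K))} (h : ClTriv S)
    (f : HeightOneSpectrum (𝓞 K) → ℤ) (hf : {v | v ∉ S ∧ f v ≠ 0}.Finite) :
    ∃ c : Kˣ, ∀ v ∉ S, od v c = f v := by
  classical
  choose! g hg1 hg2 using h
  refine ⟨∏ v ∈ hf.toFinset, g v ^ f v, fun v hv => ?_⟩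
  rw [od_prod]
  simp only [od_zpow]
  rw [Finset.sum_eq_single v]
  · rw [hg1 v hv, mul_one]
  · intro x hx hxv
    have hx' : x ∉ S ∧ f x ≠ 0 := by simpa using hx
    rw [hg2 x hx'.1 v hv (Ne.symm hxv), mul_zero]
  · intro hx
    have : f v = 0 := by
      by_contra h0
      exact hx (hf.mem_toFinset.2 ⟨hv, h0⟩)
    rw [this, zero_mul]

lemma exists_ClTriv : ∃ S : Finset (HeightOneSpectrum (𝓞 K)), ClTriv S := by
  classical
  have hs : ∀ C : ClassGroup (𝓞 K), ∃ I : nonZeroDivisors (Ideal (𝓞 K)), ClassGroup.mk0 I = C :=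
    ClassGroup.mk0_surjective
  choose I hI using hs
  have hfin : ∀ C : ClassGroup (𝓞 K),
      {v : HeightOneSpectrum (𝓞 K) | v.asIdeal ∣ (I C : Ideal (𝓞 K))}.Finite := fun C =>
    Ideal.finite_factors (nonZeroDivisors.coe_ne_zero (I C))
  refine ⟨Finset.univ.biUnion fun C => (hfin C).toFinset, ?_⟩
  intro v hv
  have hv0 : v.asIdeal ∈ nonZeroDivisors (Ideal (𝓞 K)) :=
    mem_nonZeroDivisors_of_ne_zero v.ne_bot
  set C : ClassGroup (𝓞 K) := (ClassGroup.mk0 ⟨v.asIdeal, hv0⟩)⁻¹ with hC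
  have h1 : ClassGroup.mk0 (⟨v.asIdeal, hv0⟩ * I C) = 1 := by
    rw [map_mul, hI, hC, mul_inv_cancel]
  rw [ClassGroup.mk0_eq_one_iff] at h1
  obtain ⟨c, hc⟩ := h1.principal
  have hc' : v.asIdeal * (I C : Ideal (𝓞 K)) = Ideal.span {c} := hc
  have hc0 : c ≠ 0 := by
    rintro rfl
    rw [Ideal.span_singleton_eq_bot.2 rfl] at hc'
    exact mul_ne_zero v.ne_bot (nonZeroDivisors.coe_ne_zero (I C)) hc'
  have hnd : ∀ v' ∉ (Finset.univ.biUnion fun C => (hfin C).toFinset),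
      ¬ v'.asIdeal ∣ (I C : Ideal (𝓞 K)) := by
    intro v' hv' hd
    apply hv'
    rw [Finset.mem_biUnion]
    exact ⟨C, Finset.mem_univ _, by simpa using hd⟩
  have hcK : algebraMap (𝓞 K) K c ≠ 0 := by simpa using hc0
  refine ⟨Units.mk0 _ hcK, ?_, ?_⟩
  · rw [od_eq_iff, Units.val_mk0, v.valuation_of_algebraMap]
    apply le_antisymm
    · have := (v.intValuation_le_pow_iff_mem c 1).2 (by
        rw [pow_one, ← Ideal.dvd_span_singleton, ← hc']; exact Dvd.intro _ rfl)
      simpa using this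
    · by_contra! hlt
      have : v.intValuation c ≤ WithZero.exp (-((2 : ℕ) : ℤ)) := by
        rw [exp_lt_iff] at hlt; simpa using hlt
      rw [v.intValuation_le_pow_iff_mem, ← Ideal.dvd_span_singleton, ← hc', pow_two] at this
      exact hnd v hv ((mul_dvd_mul_iff_left v.ne_bot).1 this)
  · intro v' hv' hne
    rw [od_zero_iff, Units.val_mk0, v'.valuation_eq_one_iff_notMem, ← Ideal.dvd_span_singleton, ← hc']
    intro hd
    rcases v'.prime.dvd_or_dvd hd with h2 | h2
    · apply hne
      ext1
      exact (v.isMaximal.eq_of_le v'.isPrime.ne_top (Ideal.dvd_iff_le.1 h2)).symm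
    · exact hnd v' hv' h2

end
end Prf
set_option linter.all false
set_option linter.unusedVariables false
set_option linter.unusedSimpArgs false
namespace Prf
open Polynomial NumberField IsDedekindDomain

section
variable {K : Type} [Field K] [NumberField K] {q : ℕ} {ζ : K}
variable {L : Type} [Field L] [NumberField L] [Algebra K L] [IsGalois K L] {x : Kˣ}

/-- Galois action on units -/
noncomputable def us (σ : L ≃ₐ[K] L) : Lˣ →* Lˣ := Units.map (σ : L →* L)

@[simp] lemma us_coe (σ : L ≃ₐ[K] L) (y : Lˣ) : ((us σ y : Lˣ) : L) = σ y := rfl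

lemma us_iter (σ : L ≃ₐ[K] L) (i : ℕ) (y : Lˣ) : (us σ)^[i] y = us (σ ^ i) y := by
  induction i generalizing y with
  | zero => rfl
  | succ i ih => rw [Function.iterate_succ_apply, ih, pow_succ]; rfl

lemma od_us (σ : L ≃ₐ[K] L) (w : HeightOneSpectrum (𝓞 L)) (y : Lˣ) : od w (us σ y) = od (gw σ w) y :=
  (gw_od σ w y).symm

/-- norm on units -/
noncomputable def un (K : Type) {L : Type} [Field K] [Field L] [Algebra K L] : Lˣ →* Kˣ :=
  Units.map (Algebra.norm K)

@[simp] lemma un_coe (y : Lˣ) : ((un K y : Kˣ) : K) = Algebra.norm K (y : L) := rfl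

lemma um_un (M : Kum K L ζ q x) (hq : q.Prime) (hζ : IsPrimitiveRoot ζ q) (y : Lˣ) :
    um L (un K y) = ∏ i ∈ Finset.range q, (us M.σ)^[i] y := by
  ext
  simp only [us_iter]
  rw [um_coe, un_coe, M.norm_eq hq hζ, Units.coe_prod]
  rfl

lemma us_mem {S : Finset (HeightOneSpectrum (𝓞 K))} (σ : L ≃ₐ[K] L) {y : Lˣ}
    (hy : y ∈ US (above L S)) : us σ y ∈ US (above L S) := by
  rw [mem_US] at hy ⊢
  intro w hw
  rw [od_us]
  refine hy _ ?_
  rw [mem_above] at hw ⊢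
  rwa [below_gw]

lemma um_mem {S : Finset (HeightOneSpectrum (𝓞 K))} {y : Kˣ} :
    um L y ∈ US (above L S) ↔ y ∈ US S := by
  simp only [mem_US]
  constructor
  · intro h v hv
    obtain ⟨w, hw⟩ := exists_above (L := L) v
    have := h w (by rw [mem_above, hw]; exact hv)
    rw [od_um, hw] at this
    rcases mul_eq_zero.1 this with h | h
    · exact absurd h (by exact_mod_cast ram_ne_zero w)
    · exact h
  · intro h w hw
    rw [mem_above] at hw
    rw [od_um, h _ hw, mul_zero]

lemma un_mem (M : Kum K L ζ q x) (hq : q.Prime) (hζ : IsPrimitiveRoot ζ q)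
    {S : Finset (HeightOneSpectrum (𝓞 K))} {y : Lˣ}
    (hy : y ∈ US (above L S)) : un K y ∈ US S := by
  rw [← um_mem (L := L), um_un M hq hζ]
  refine Subgroup.prod_mem _ fun i _ => ?_
  rw [us_iter]
  exact us_mem _ hy

theorem Aii [IsTotallyComplex K] (hq : q.Prime) (hζ : IsPrimitiveRoot ζ q) (x : Kˣ)
    (hx : ∀ c : K, c ^ q ≠ x) (S R : Finset (HeightOneSpectrum (𝓞 K))) (hR : R ⊆ S)
    (hS : ∀ v : HeightOneSpectrum (𝓞 K), v.valuation K (q : K) ≠ 1 → v ∈ S) (hxS : x ∈ US S)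
    (hcl : ClTriv S) (hP : ∀ v ∈ S, v ∉ R → x ∈ PV ζ q v) :
    (NS hq ζ x).relIndex (US S) ≠ 0 ∧ (NS hq ζ x).relIndex (US S) * q ≤ q ^ R.card := by
  classical
  obtain ⟨L, _, _, _, _, ⟨M⟩⟩ := exists_kum hq hζ x hx
  have hLc : IsTotallyComplex L := isTotallyComplex_of_algebra K L
  let j : US S →* US (above L S) :=
    ((um L).comp (US S).subtype).codRestrict _ (fun y => um_mem.2 y.2)
  let s : US (above L S) →* US (above L S) :=
    ((us M.σ).comp (US (above L S)).subtype).codRestrict _ (fun y => us_mem _ y.2)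
  let n : US (above L S) →* US S :=
    ((un K).comp (US (above L S)).subtype).codRestrict _ (fun y => un_mem M hq hζ y.2)
  have hjc : ∀ y, ((j y : US (above L S)) : Lˣ) = um L (y : Kˣ) := fun y => rfl
  have hsc : ∀ y, ((s y : US (above L S)) : Lˣ) = us M.σ (y : Lˣ) := fun y => rfl
  have hnc : ∀ y, ((n y : US S) : Kˣ) = un K (y : Lˣ) := fun y => rfl
  have hsi : ∀ i y, (((s : US (above L S) → US (above L S))^[i] y : US (above L S)) : Lˣ) = (us M.σ)^[i] (y : Lˣ) := by
    intro i
    induction i with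
    | zero => intro y; rfl
    | succ i ih => intro y; rw [Function.iterate_succ_apply, ih, Function.iterate_succ_apply]; rfl
  have hj : Function.Injective j := by
    intro a b h
    have := congrArg (fun z : US (above L S) => (z : Lˣ)) h
    exact Subtype.ext (um_inj this)
  have hθS : M.θ ∈ US (above L S) := by
    rw [mem_US]
    intro w hw
    have h1 : M.θ ^ q = um L x := Units.ext M.hθ
    have h2 : od w (M.θ ^ q) = 0 := by
      rw [h1]
      exact (mem_US.1 (um_mem.2 hxS)) w hw
    rw [od_pow] at h2
    have hq0 : (q : ℤ) ≠ 0 := by exact_mod_cast hq.ne_zero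
    exact (mul_eq_zero.1 h2).resolve_left hq0
  have hz0 : ζ ≠ 0 := hζ.ne_zero hq.ne_zero
  have hzS : Units.mk0 ζ hz0 ∈ US S := by
    rw [mem_US]
    intro v _
    rw [od_zero_iff]
    exact val_root _ hq.ne_zero hζ.pow_eq_one
  have hr2 : InfinitePlace.nrComplexPlaces L = q * InfinitePlace.nrComplexPlaces K := by
    have h1 := IsTotallyComplex.finrank L
    have h2 := IsTotallyComplex.finrank K
    have h3 := Module.finrank_mul_finrank ℚ K L
    rw [h1, h2, M.fin] at h3
    have : 2 * InfinitePlace.nrComplexPlaces L = 2 * (q * InfinitePlace.nrComplexPlaces K) := by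
      rw [← h3]; ring
    omega
  have hcard : (above L S).card ≥ q * (S \ R).card + R.card := by
    rw [card_above, ← Finset.sum_sdiff hR]
    refine add_le_add ?_ ?_
    · rw [mul_comm, ← smul_eq_mul]
      refine Finset.card_nsmul_le_sum _ _ _ fun v hv => ?_
      rw [Finset.mem_sdiff] at hv
      exact (split_of_PV hq hζ M.fin M.hθ M.hσ (hP v hv.1 hv.2)).ge
    · rw [Finset.card_eq_sum_ones]
      exact Finset.sum_le_sum fun v hv => primesOver_ncard_pos v
  have hSR : (S \ R).card + R.card = S.card := Finset.card_sdiff_add_card_eq_card hR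
  obtain ⟨h1, h2⟩ := ambig q hq j hj s n
    (fun b => by
      ext; rw [hsc, us_coe, hjc, um_coe, AlgEquiv.commutes])
    (fun b => by
      ext; rw [hnc, un_coe, hjc, um_coe, Algebra.norm_algebraMap, M.fin]; rfl)
    (fun a => by
      ext
      rw [hjc, hnc, um_un M hq hζ, Subgroup.val_finset_prod]
      simp only [hsi])
    (fun a => by
      ext
      apply (algebraMap K L).injective
      rw [hnc, un_coe, hnc, un_coe, hsc, us_coe, Algebra.norm_eq_of_algEquiv])
    (by
      intro a ha
      have ha' : Algebra.norm K ((a : Lˣ) : L) = 1 := by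
        have := congrArg (fun z : US S => ((z : Kˣ) : K)) ha
        exact this
      obtain ⟨z, hz⟩ := M.hilbert90 hq hζ ha'
      have hz1 : ∀ w ∉ above L S, od w (us M.σ z) = od w z := by
        intro w hw
        have h3 : z / us M.σ z = a := by
          ext; rw [Units.val_div_eq_div_val]; exact hz
        have h4 := mem_US.1 a.2 w hw
        rw [← h3, od_div] at h4
        omega
      have hz2 : ∀ i, ∀ w ∉ above L S, od w (us (M.σ ^ i) z) = od w z := by
        intro i
        induction i with
        | zero => intro w hw; congr 1
        | succ i ih =>
          intro w hw
          have e : us (M.σ ^ (i+1)) z = us M.σ (us (M.σ ^ i) z) := by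
            rw [pow_succ']; rfl
          rw [e, od_us, ih, ← od_us, hz1 w hw]
          rw [mem_above] at hw ⊢
          rwa [below_gw]
      have hz3 : ∀ w w', w ∉ above L S → below K w = below K w' → od w' z = od w z := by
        intro w w' hw hww
        obtain ⟨τ, rfl⟩ := gw_trans w w' hww
        obtain ⟨i, _, rfl⟩ := M.gen_pow hq hζ τ
        rw [← od_us, hz2 i w hw]
      choose ab hab using exists_above (K := K) (L := L)
      obtain ⟨c, hc⟩ := hcl.real (fun v => od (ab v) z) (by
        refine Set.Finite.subset ((od_support z).image (below K)) ?_
        rintro v ⟨_, hv⟩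
        exact ⟨ab v, hv, hab v⟩)
      have hm : z / um L c ∈ US (above L S) := by
        rw [mem_US]
        intro w hw
        have hw' := hw
        rw [mem_above] at hw'
        have hram := unram hq hζ M.fin M.hθ M.hσ w (by
          by_contra h; exact hw' (hS _ h)) (mem_US.1 hxS _ hw')
        rw [od_div, od_um, hram, hc _ hw', hz3 w (ab (below K w)) hw (hab _).symm]
        simp
      refine ⟨⟨_, hm⟩, ?_⟩
      ext
      rw [← hz, Subgroup.coe_div, hsc, _root_.map_div]
      have e : us M.σ (um L c) = um L c := by
        ext; rw [us_coe, um_coe, AlgEquiv.commutes]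
      rw [e, div_div_div_cancel_right, Units.val_div_eq_div_val]; rfl)
    ⟨M.θ, hθS⟩
    ⟨⟨_, hzS⟩, by
      ext; rw [hsc, us_coe, M.hσ]; rfl⟩
    ⟨⟨x, hxS⟩, by
      ext; exact M.hθ.symm⟩
    (by
      rintro ⟨y, hy⟩
      have h3 := congrArg (fun z : US (above L S) => ((z : Lˣ) : L)) hy
      have h4 : algebraMap K L ((y : Kˣ) : K) = M.θ := h3
      apply hx ((y : Kˣ) : K)
      apply (algebraMap K L).injective
      rw [map_pow, h4, M.hθ])
    ((S \ R).card + InfinitePlace.nrComplexPlaces K) (S.card + InfinitePlace.nrComplexPlaces K)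
    (by
      have h3 := US_rank S
      have h4 := US_rank (above L S)
      rw [hr2] at h4
      obtain ⟨q', rfl⟩ : ∃ q', q = q' + 1 := ⟨q - 1, by have := hq.pos; omega⟩
      simp only [Nat.add_sub_cancel]
      nlinarith)
    (US_pow_index hq hζ S)
  have hle : n.range ≤ (NS hq ζ x).subgroupOf (US S) := by
    rintro _ ⟨y, rfl⟩
    rw [Subgroup.mem_subgroupOf, mem_NS]
    exact M.NF_norm hq hζ hx _
  have hd : (NS hq ζ x).relIndex (US S) ∣ n.range.index := Subgroup.index_dvd_of_le hle
  have hne : (NS hq ζ x).relIndex (US S) ≠ 0 := fun h => h1 (by rw [h] at hd; exact zero_dvd_iff.1 hd)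
  refine ⟨hne, ?_⟩
  have h5 := Nat.le_of_dvd (Nat.pos_of_ne_zero h1) hd
  have h6 : (NS hq ζ x).relIndex (US S) * q * q ^ ((S \ R).card + InfinitePlace.nrComplexPlaces K) ≤
      q ^ R.card * q ^ ((S \ R).card + InfinitePlace.nrComplexPlaces K) := by
    calc _ = (NS hq ζ x).relIndex (US S) * q ^ ((S \ R).card + InfinitePlace.nrComplexPlaces K + 1) := by ring
      _ ≤ n.range.index * q ^ ((S \ R).card + InfinitePlace.nrComplexPlaces K + 1) := Nat.mul_le_mul_right _ h5
      _ ≤ _ := h2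
      _ = _ := by rw [← pow_add]; congr 1; omega
  exact Nat.le_of_mul_le_mul_right h6 (Nat.pos_of_ne_zero (pow_ne_zero _ hq.ne_zero))

end
end Prf
set_option linter.all false
set_option linter.unusedVariables false
set_option linter.unusedSimpArgs false
namespace Prf
open Polynomial NumberField IsDedekindDomain

section
variable {K : Type} [Field K] [NumberField K] {q : ℕ} {ζ : K}

lemma approxK (S : Finset (HeightOneSpectrum (𝓞 K))) (f : HeightOneSpectrum (𝓞 K) → K)
    (n : HeightOneSpectrum (𝓞 K) → ℕ) :
    ∃ z : K, ∀ v ∈ S, v.valuation K (z - f v) < WithZero.exp (-(n v : ℤ)) := by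
  classical
  obtain ⟨d, hd⟩ := IsLocalization.exist_integer_multiples_of_finset (nonZeroDivisors (𝓞 K)) (S.image f)
  have hd0 : algebraMap (𝓞 K) K d ≠ 0 := by
    have := nonZeroDivisors.coe_ne_zero d
    simpa using this
  have hr : ∀ v : S, ∃ r : 𝓞 K, algebraMap (𝓞 K) K r = algebraMap (𝓞 K) K d * f v := by
    intro v
    obtain ⟨r, hr⟩ := hd (f v) (Finset.mem_image_of_mem f v.2)
    exact ⟨r, by rw [hr, Algebra.smul_def]⟩
  choose r hr using hr
  obtain ⟨y, hy⟩ := IsDedekindDomain.exists_forall_sub_mem_ideal (s := S)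
    (fun v : HeightOneSpectrum (𝓞 K) => v.asIdeal)
    (fun v => n v + 1 + (od v (Units.mk0 _ hd0)).toNat) (fun v _ => v.prime)
    (fun v _ w _ h h' => h (HeightOneSpectrum.ext h')) r
  refine ⟨algebraMap (𝓞 K) K y / algebraMap (𝓞 K) K d, fun v hv => ?_⟩
  have h1 := (v.intValuation_le_pow_iff_mem _ _).2 (hy v hv)
  have h2 : algebraMap (𝓞 K) K y / algebraMap (𝓞 K) K d - f v =
      algebraMap (𝓞 K) K (y - r ⟨v, hv⟩) / algebraMap (𝓞 K) K d := by
    rw [map_sub, hr]; field_simp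
  have h3 := od_spec v (Units.mk0 _ hd0)
  rw [Units.val_mk0] at h3
  rw [h2, map_div₀, h3, v.valuation_of_algebraMap, div_eq_mul_inv, ← WithZero.exp_neg]
  refine lt_of_le_of_lt (mul_le_mul_left h1 _) ?_
  rw [← WithZero.exp_add, WithZero.exp_lt_exp]
  push_cast
  have := Int.self_le_toNat (od v (Units.mk0 _ hd0))
  omega

lemma approxU (S : Finset (HeightOneSpectrum (𝓞 K))) (t : HeightOneSpectrum (𝓞 K) → Kˣ)
    (n : HeightOneSpectrum (𝓞 K) → ℕ) :
    ∃ z : Kˣ, ∀ v ∈ S, v.valuation K (((z / t v : Kˣ) : K) - 1) < WithZero.exp (-(n v : ℤ)) := by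
  classical
  rcases S.eq_empty_or_nonempty with rfl | ⟨v0, hv0⟩
  · exact ⟨1, by simp⟩
  obtain ⟨z, hz⟩ := approxK S (fun v => (t v : K)) (fun v => n v + (od v (t v)).toNat)
  have key : ∀ v ∈ S, v.valuation K (z / (t v : K) - 1) < WithZero.exp (-(n v : ℤ)) := by
    intro v hv
    have h2 : z / (t v : K) - 1 = (z - t v) / t v := by
      have := (t v).ne_zero
      field_simp
    rw [h2, map_div₀, od_spec, div_eq_mul_inv, ← WithZero.exp_neg]
    have h1 := hz v hv
    calc _ < WithZero.exp (-((n v + (od v (t v)).toNat : ℕ) : ℤ)) * WithZero.exp (- -(od v (t v))) :=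
          mul_lt_mul_of_pos_right h1 (WithZero.exp_pos)
      _ ≤ _ := by
        rw [← WithZero.exp_add, WithZero.exp_le_exp]
        push_cast
        have := Int.self_le_toNat (od v (t v))
        omega
  have hz0 : z ≠ 0 := by
    rintro rfl
    have := key v0 hv0
    rw [zero_div, zero_sub, Valuation.map_neg, map_one, ← WithZero.exp_zero, WithZero.exp_lt_exp] at this
    omega
  refine ⟨Units.mk0 z hz0, fun v hv => ?_⟩
  rw [Units.val_div_eq_div_val]
  exact key v hv

lemma approxPV (hq : q.Prime) (hζ : IsPrimitiveRoot ζ q) (S : Finset (HeightOneSpectrum (𝓞 K)))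
    (t : HeightOneSpectrum (𝓞 K) → Kˣ) :
    ∃ z : Kˣ, ∀ v ∈ S, z / t v ∈ PV ζ q v := by
  obtain ⟨z, hz⟩ := approxU S t (NV ζ q)
  exact ⟨z, fun v hv => near_mem_PV hq hζ v _ (by rw [← NV_spec hq hζ]; exact hz v hv)⟩

lemma mem_of_zpow {G : Type*} [Group G] (hq : q.Prime) (H : Subgroup G) {x : G} (hx : x ^ q ∈ H)
    {c : ℤ} (hc : ¬ (q : ℤ) ∣ c) (h : x ^ c ∈ H) : x ∈ H := by
  have h1 : IsCoprime (q : ℤ) c := (Int.prime_iff_natAbs_prime.2 (by simpa using hq)).coprime_iff_not_dvd.2 hc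
  obtain ⟨a, b, hab⟩ := h1
  have : x = (x ^ q) ^ a * (x ^ c) ^ b := by
    rw [← zpow_natCast, ← zpow_mul, ← zpow_mul, ← zpow_add, mul_comm, mul_comm c, hab, zpow_one]
  rw [this]
  exact H.mul_mem (H.zpow_mem hx _) (H.zpow_mem h _)

lemma pow_mem_HV (hq : q.Prime) (a z : Kˣ) (v) : z ^ q ∈ HV hq ζ a v :=
  Subgroup.mem_sup_left (pow_mem_NS hq a z)

theorem NSl [IsTotallyComplex K] (hq : q.Prime) (hζ : IsPrimitiveRoot ζ q) (a : Kˣ)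
    (ha : ∀ c : K, c ^ q ≠ a) (S R : Finset (HeightOneSpectrum (𝓞 K))) (hR : R ⊆ S)
    (hS : ∀ v : HeightOneSpectrum (𝓞 K), v.valuation K (q : K) ≠ 1 → v ∈ S) (haS : a ∈ US S)
    (hcl : ClTriv S) (hP : ∀ v ∈ S, v ∉ R → a ∈ PV ζ q v)
    (z : HeightOneSpectrum (𝓞 K) → Kˣ) (hzS : ∀ v ∈ R, z v ∈ US S) (hz1 : ∀ v ∈ R, z v ∉ HV hq ζ a v)
    (hz2 : ∀ v ∈ R, ∀ v' ∈ R, v' ≠ v → z v ∈ HV hq ζ a v') : False := by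
  classical
  obtain ⟨h1, h2⟩ := Aii hq hζ a ha S R hR hS haS hcl hP
  have h3 := lin_lower q hq ((NS hq ζ a).subgroupOf (US S)) h1
    (fun v : R => (⟨z v, hzS v v.2⟩ : US S)) (by
      intro c hc v
      by_contra hd
      apply hz1 v v.2
      apply mem_of_zpow hq _ (pow_mem_HV hq a _ v) hd
      rw [Subgroup.mem_subgroupOf, Subgroup.val_finset_prod] at hc
      have h4 : ∏ i : R, z i ^ c i ∈ HV hq ζ a v := Subgroup.mem_sup_left hc
      rw [← Finset.mul_prod_erase _ _ (Finset.mem_univ v)] at h4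
      refine (Subgroup.mul_mem_cancel_right _ ?_).1 h4
      refine Subgroup.prod_mem _ fun i hi => Subgroup.zpow_mem _ (hz2 i i.2 v v.2 ?_) _
      intro h
      exact (Finset.mem_erase.1 hi).1 (Subtype.ext h.symm))
  rw [Fintype.card_coe] at h3
  have h4 : (NS hq ζ a).relIndex (US S) * q ≤ (NS hq ζ a).relIndex (US S) := h2.trans h3
  have := hq.two_le
  have := Nat.pos_of_ne_zero h1
  nlinarith

lemma qplaces_finite (hq : q.Prime) :
    {v : HeightOneSpectrum (𝓞 K) | v.valuation K (q : K) ≠ 1}.Finite := by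
  have h : (q : K) ≠ 0 := by exact_mod_cast hq.ne_zero
  refine (od_support (Units.mk0 (q : K) h)).subset ?_
  intro v hv h0
  rw [od_zero_iff] at h0
  exact hv h0

/-- places above q -/
noncomputable def QS (K : Type) [Field K] [NumberField K] (hq : q.Prime) : Finset (HeightOneSpectrum (𝓞 K)) :=
  (qplaces_finite hq).toFinset

lemma mem_QS {hq : q.Prime} {v : HeightOneSpectrum (𝓞 K)} :
    v ∈ QS K hq ↔ v.valuation K (q : K) ≠ 1 := by
  rw [QS, Set.Finite.mem_toFinset]; rfl

/-- support of a unit -/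
noncomputable def sup0 (x : Kˣ) : Finset (HeightOneSpectrum (𝓞 K)) := (od_support x).toFinset

lemma mem_sup0 {x : Kˣ} {v : HeightOneSpectrum (𝓞 K)} : v ∈ sup0 x ↔ od v x ≠ 0 := by
  rw [sup0, Set.Finite.mem_toFinset]; rfl

lemma US_of_sup0 {x : Kˣ} {S : Finset (HeightOneSpectrum (𝓞 K))} (h : sup0 x ⊆ S) : x ∈ US S := by
  rw [mem_US]
  intro v hv
  by_contra h0
  exact hv (h (mem_sup0.2 h0))

theorem Dp [IsTotallyComplex K] (hq : q.Prime) (hζ : IsPrimitiveRoot ζ q) (u : Kˣ)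
    (hu : ∀ c : K, c ^ q ≠ u) (huq : ∀ v : HeightOneSpectrum (𝓞 K), v.valuation K (q : K) ≠ 1 → u ∈ PV ζ q v)
    (Z : Finset (HeightOneSpectrum (𝓞 K))) : ∃ v ∉ Z, u ∉ PV ζ q v := by
  classical
  by_contra! hcon
  obtain ⟨S0, hS0⟩ := exists_ClTriv (K := K)
  set S1 := S0 ∪ (QS K hq) ∪ sup0 u ∪ Z with hS1
  set R := S1.filter (fun v => u ∉ PV ζ q v) with hR
  have hRq : ∀ v ∈ R, v.valuation K (q : K) = 1 := by
    intro v hv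
    by_contra h
    exact (Finset.mem_filter.1 hv).2 (huq v h)
  have hz' : ∀ v, ∃ z, v ∈ R → z ∉ HV hq ζ u v := by
    intro v
    by_cases hv : v ∈ R
    · obtain ⟨z, hz⟩ := HV_ne_top hq hζ (hRq v hv) (Finset.mem_filter.1 hv).2
      exact ⟨z, fun _ => hz⟩
    · exact ⟨1, fun h => absurd h hv⟩
  choose z' hz' using hz'
  have hz : ∀ v, ∃ z : Kˣ, ∀ v' ∈ R, z / (if v' = v then z' v else 1) ∈ PV ζ q v' := fun v =>
    approxPV hq hζ R _
  choose z hz using hz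
  refine NSl hq hζ u hu (S1 ∪ R.biUnion (fun v => sup0 (z v))) R
    ((Finset.filter_subset _ _).trans Finset.subset_union_left) ?_ ?_ ?_ ?_ z ?_ ?_ ?_
  · intro v hv
    simp [hS1, mem_QS, hv]
  · refine US_of_sup0 ?_
    intro v hv
    simp [hS1, hv]
  · refine hS0.mono ?_
    intro v hv
    simp [hS1, hv]
  · intro v hv hvR
    by_contra h
    rw [Finset.mem_union] at hv
    by_cases hv1 : v ∈ S1
    · exact hvR (Finset.mem_filter.2 ⟨hv1, h⟩)
    · apply h
      apply hcon
      intro hvZ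
      exact hv1 (by simp [hS1, hvZ])
  · intro v hv
    refine US_of_sup0 ?_
    refine Finset.Subset.trans ?_ Finset.subset_union_right
    exact Finset.subset_biUnion_of_mem (fun v => sup0 (z v)) hv
  · intro v hv h
    have h1 := hz v v hv
    rw [if_pos rfl] at h1
    apply hz' v hv
    have h2 : z' v = z v / (z v / z' v) := by rw [div_div_cancel]
    rw [h2]
    exact Subgroup.div_mem _ h (Subgroup.mem_sup_right h1)
  · intro v hv v' hv' hne
    have h1 := hz v v' hv'
    rw [if_neg hne, div_one] at h1
    exact Subgroup.mem_sup_right h1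

lemma exists_place (Z : Finset (HeightOneSpectrum (𝓞 K))) : ∃ v : HeightOneSpectrum (𝓞 K), v ∉ Z := by
  classical
  by_contra! h
  -- product of the residue cardinalities plus primes
  have hc : ∀ v : HeightOneSpectrum (𝓞 K), ∃ l : ℕ, v ∈ Z → ∀ p : ℕ, p.Prime → ((p : ℕ) : 𝓞 K) ∈ v.asIdeal → p ≤ l := by
    intro v
    by_cases hex : ∃ p : ℕ, p.Prime ∧ ((p : ℕ) : 𝓞 K) ∈ v.asIdeal
    · obtain ⟨p, hp, hpv⟩ := hex
      refine ⟨p, fun _ p' hp' hpv' => ?_⟩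
      by_contra! hlt
      have hcop : IsCoprime (p : ℤ) (p' : ℤ) :=
        Nat.isCoprime_iff_coprime.2 ((Nat.coprime_primes hp hp').2 hlt.ne)
      obtain ⟨a, b, hab⟩ := hcop
      apply v.isPrime.ne_top
      rw [Ideal.eq_top_iff_one]
      have : (1 : 𝓞 K) = (a : 𝓞 K) * (p : 𝓞 K) + (b : 𝓞 K) * (p' : 𝓞 K) := by
        have := congrArg (fun z : ℤ => (z : 𝓞 K)) hab
        push_cast at this
        exact this.symm
      rw [this]
      exact Ideal.add_mem _ (Ideal.mul_mem_left _ _ hpv) (Ideal.mul_mem_left _ _ hpv')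
    · exact ⟨0, fun _ p hp hpv => absurd ⟨p, hp, hpv⟩ hex⟩
  choose l hl using hc
  obtain ⟨p, hpl, hp⟩ := Nat.exists_infinite_primes (∑ v ∈ Z, l v + 1)
  have hnu : ¬ IsUnit ((p : ℕ) : 𝓞 K) := by
    intro hu
    have h1 := hu.map (Algebra.norm ℤ)
    have h2 : Algebra.norm ℤ ((p : ℕ) : 𝓞 K) = (p : ℤ) ^ Module.finrank ℤ (𝓞 K) := by
      have := Algebra.norm_algebraMap (R := ℤ) (S := 𝓞 K) (p : ℤ)
      simpa using this
    rw [h2] at h1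
    have h3 := isUnit_pow_iff (Module.finrank_pos (R := ℤ) (M := 𝓞 K)).ne' |>.1 h1
    rw [Int.isUnit_iff] at h3
    have := hp.two_le
    omega
  obtain ⟨I, hI, hpI⟩ := exists_max_ideal_of_mem_nonunits hnu
  have hI0 : I ≠ ⊥ := by
    rintro rfl
    rw [Ideal.mem_bot] at hpI
    exact hp.ne_zero (by exact_mod_cast hpI)
  have := hl ⟨I, hI.isPrime, hI0⟩ (h _) p hp hpI
  have h5 := Finset.single_le_sum (f := l) (fun v _ => Nat.zero_le _) (h ⟨I, hI.isPrime, hI0⟩)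
  omega

/-- Kummer theory -/
lemma Kum.pow_eq {L : Type} [Field L] [NumberField L] [Algebra K L] [IsGalois K L] {x : Kˣ}
    (M : Kum K L ζ q x) (hq : q.Prime) (hζ : IsPrimitiveRoot ζ q) {u : Kˣ} {m : L}
    (hm : m ^ q = algebraMap K L u) : ∃ (c : Kˣ) (i : ℕ), i < q ∧ u = c ^ q * x ^ i := by
  have hm0 : m ≠ 0 := by
    rintro rfl
    rw [zero_pow hq.ne_zero] at hm
    exact u.ne_zero ((algebraMap K L).injective (by rw [← hm, map_zero]))
  have h1 : (M.σ m / m) ^ q = 1 := by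
    rw [div_pow, ← map_pow, hm, M.σ.commutes, div_self]
    rw [← hm]; exact pow_ne_zero _ hm0
  have hζL := hζ.map_of_injective (algebraMap K L).injective
  have : NeZero q := ⟨hq.ne_zero⟩
  obtain ⟨i, hi, h2⟩ := hζL.eq_pow_of_pow_eq_one h1
  have h3 : M.σ (m / (M.θ : L) ^ i) = m / (M.θ : L) ^ i := by
    have h4 : M.σ m = (algebraMap K L ζ) ^ i * m := by rw [h2]; field_simp
    rw [map_div₀, map_pow, M.hσ, mul_pow, h4]
    exact mul_div_mul_left _ _ (pow_ne_zero _ (hζL.ne_zero hq.ne_zero))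
  obtain ⟨c, hc⟩ := M.fixed hq hζ h3
  have hc0 : c ≠ 0 := by
    rintro rfl
    rw [map_zero] at hc
    exact div_ne_zero hm0 (pow_ne_zero _ M.θ.ne_zero) hc.symm
  refine ⟨Units.mk0 c hc0, i, hi, ?_⟩
  ext
  apply (algebraMap K L).injective
  rw [Units.val_mul, Units.val_pow_eq_pow_val, Units.val_pow_eq_pow_val, Units.val_mk0, map_mul, map_pow, map_pow, hc, ← M.hθ, ← hm, ← pow_mul, mul_comm q i, pow_mul,
    ← mul_pow, div_mul_cancel₀ _ (pow_ne_zero _ M.θ.ne_zero)]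

end
end Prf
set_option linter.all false
set_option linter.unusedVariables false
set_option linter.unusedSimpArgs false
namespace Prf
open Polynomial NumberField IsDedekindDomain

section
variable {K : Type} [Field K] [NumberField K] {q : ℕ} {ζ : K}

/-- D over a field where we adjoin nothing -/
lemma D0 [IsTotallyComplex K] (hq : q.Prime) (hζ : IsPrimitiveRoot ζ q) (u : Kˣ)
    (hu : ∀ c : K, c ^ q ≠ u) (Z : Finset (HeightOneSpectrum (𝓞 K))) :
    ∃ v ∉ Z, u ∉ PV ζ q v := by
  classical
  obtain ⟨l, hl⟩ := exists_place (QS K hq ∪ sup0 u)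
  rw [Finset.mem_union, not_or] at hl
  obtain ⟨π, hπ⟩ := exists_unif l
  obtain ⟨t, ht⟩ := approxU (insert l (QS K hq)) (fun v => if v = l then π else 1) (NV ζ q)
  have htl : od l t = 1 := by
    have h1 := ht l (Finset.mem_insert_self _ _)
    rw [if_pos rfl] at h1
    have h2 := (od_zero_iff l (t / π)).2 (val_one_of_near l h1)
    rw [od_div, hπ] at h2
    omega
  have htq : ∀ v : HeightOneSpectrum (𝓞 K), v.valuation K (q : K) ≠ 1 →
      v.valuation K ((t : K) - 1) < v.valuation K (ζ - 1) ^ q := by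
    intro v hv
    have h1 := ht v (Finset.mem_insert_of_mem (mem_QS.2 hv))
    rw [if_neg (by rintro rfl; exact hl.1 (mem_QS.2 hv)), div_one] at h1
    rwa [← NV_spec hq hζ]
  have hul : od l u = 0 := by
    by_contra h; exact hl.2 (mem_sup0.2 h)
  have hut : ∀ c : K, c ^ q ≠ ((u * t : Kˣ) : K) := by
    intro c hc
    have hc0 : c ≠ 0 := by
      rintro rfl
      rw [zero_pow hq.ne_zero] at hc
      exact (u * t).ne_zero hc.symm
    have h1 : (Units.mk0 c hc0) ^ q = u * t := Units.ext hc
    have h2 := congrArg (od l) h1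
    rw [od_pow, od_mul, hul, htl] at h2
    have h3 : (q : ℤ) ∣ 1 := ⟨_, by rw [h2]; rfl⟩
    exact hq.one_lt.ne' (by exact_mod_cast Int.eq_one_of_dvd_one (by positivity) h3)
  obtain ⟨L, _, _, _, _, ⟨M⟩⟩ := exists_kum hq hζ (u * t) hut
  have : IsTotallyComplex L := isTotallyComplex_of_algebra K L
  have hζL := hζ.map_of_injective (algebraMap K L).injective
  have huL : ∀ c : L, c ^ q ≠ (um L u : Lˣ) := by
    intro m hm
    rw [um_coe] at hm
    obtain ⟨c, i, hi, hc⟩ := M.pow_eq hq hζ hm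
    have h1 := congrArg (od l) hc
    rw [hul, od_mul, od_pow, od_pow, od_mul, hul, htl] at h1
    have h2 : (q : ℤ) ∣ i := ⟨-od l c, by linarith⟩
    have h3 := Nat.eq_zero_of_dvd_of_lt (Int.natCast_dvd_natCast.1 h2) hi
    rw [h3, pow_zero, mul_one] at hc
    exact hu c (by rw [hc]; rfl)
  obtain ⟨w, hwZ, hw⟩ := Dp hq hζL (um L u) huL (by
    intro w hw
    have hv : (below K w).valuation K (q : K) ≠ 1 := by
      intro h
      apply hw
      have := val_map w (q : K)
      rw [h, one_pow, map_natCast] at this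
      exact this
    have h1 : um L t ∈ PV (algebraMap K L ζ) q w := PV_um hq hζ w (near_mem_PV hq hζ _ t (htq _ hv))
    have h2 : um L (u * t) ∈ PV (algebraMap K L ζ) q w := by
      have : um L (u * t) = M.θ ^ q := by ext; exact M.hθ.symm
      rw [this]; exact pow_mem_PV _ _
    rw [map_mul] at h2
    exact (Subgroup.mul_mem_cancel_right _ h1).1 h2) (above L Z)
  exact ⟨below K w, fun h => hwZ (mem_above.2 h), fun h => hw (PV_um hq hζ w h)⟩

theorem Dth [IsTotallyComplex K] (hq : q.Prime) (hζ : IsPrimitiveRoot ζ q) (a u : Kˣ)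
    (ha : ∀ c : K, c ^ q ≠ a) (hu : ∀ (c : Kˣ) (i : ℕ), u ≠ c ^ q * a ^ i)
    (Z : Finset (HeightOneSpectrum (𝓞 K))) :
    ∃ v ∉ Z, v.valuation K (q : K) = 1 ∧ od v a = 0 ∧ od v u = 0 ∧ a ∈ PV ζ q v ∧ u ∉ PV ζ q v := by
  classical
  obtain ⟨L, _, _, _, _, ⟨M⟩⟩ := exists_kum hq hζ a ha
  have : IsTotallyComplex L := isTotallyComplex_of_algebra K L
  have hζL := hζ.map_of_injective (algebraMap K L).injective
  obtain ⟨w, hwZ, hw⟩ := D0 hq hζL (um L u) (by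
    intro m hm
    obtain ⟨c, i, hi, hc⟩ := M.pow_eq hq hζ hm
    exact hu c i hc) (above L (Z ∪ QS K hq ∪ sup0 a ∪ sup0 u))
  simp only [mem_above, Finset.mem_union, not_or, mem_QS, mem_sup0, not_not] at hwZ
  obtain ⟨⟨⟨h1, h2⟩, h3⟩, h4⟩ := hwZ
  have h5 : u ∉ PV ζ q (below K w) := fun h => hw (PV_um hq hζ w h)
  refine ⟨below K w, h1, h2, h3, h4, ?_, h5⟩
  by_contra h6
  obtain ⟨c, hc⟩ := good_cyclic hq hζ h2 h3 h4 h6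
  have h7 := PV_um hq hζ w hc
  rw [map_mul, map_zpow] at h7
  have h8 : um L a ∈ PV (algebraMap K L ζ) q w := by
    have : um L a = M.θ ^ q := by ext; exact M.hθ.symm
    rw [this]; exact pow_mem_PV _ _
  exact hw ((Subgroup.mul_mem_cancel_right _ (Subgroup.zpow_mem _ h8 c)).1 h7)

end
end Prf
set_option linter.all false
set_option linter.unusedVariables false
set_option linter.unusedSimpArgs false
namespace Prf
open Polynomial NumberField IsDedekindDomain

section
variable {K : Type} [Field K] [NumberField K] {q : ℕ} {ζ : K}

lemma notMem_HV (hq : q.Prime) (hζ : IsPrimitiveRoot ζ q) {v : HeightOneSpectrum (𝓞 K)}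
    (hv : v.valuation K (q : K) = 1) {u z : Kˣ} (hd : ¬ (q : ℤ) ∣ od v u) (hz : od v z = 0)
    (hzP : z ∉ PV ζ q v) : z ∉ HV hq ζ u v := by
  intro h
  apply hzP
  obtain ⟨N, hN, p, hp, rfl⟩ := Subgroup.mem_sup.1 h
  obtain ⟨b, y, hb, rfl⟩ := (mem_PV hq hζ v p).1 hp
  have hb0 : od v b = 0 := by
    rw [od_zero_iff]
    rw [← NV_spec hq hζ] at hb
    exact val_one_of_near v hb
  have h1 : od v (N * y ^ q) = 0 := by
    rw [od_mul, od_mul, hb0] at hz; rw [od_mul]; linarith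
  have h2 : N * y ^ q ∈ PV ζ q v := by
    refine T2 hq hζ hv hd h1 ?_
    exact (NS hq ζ u).mul_mem hN (pow_mem_NS hq u y)
  have h3 : N * (b * y ^ q) = b * (N * y ^ q) := by
    rw [mul_left_comm]
  rw [h3]
  exact (PV ζ q v).mul_mem (near_mem_PV hq hζ v b hb) h2

lemma US_root (hq : q.Prime) {S : Finset (HeightOneSpectrum (𝓞 K))} {c : Kˣ} (h : c ^ q ∈ US S) :
    c ∈ US S := by
  rw [mem_US] at h ⊢
  intro v hv
  have h2 := h v hv
  rw [od_pow] at h2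
  have hq0 : (q : ℤ) ≠ 0 := by exact_mod_cast hq.ne_zero
  exact (mul_eq_zero.1 h2).resolve_left hq0

/-- standing data -/
structure Dat (hq : q.Prime) (ζ : K) (a : Kˣ) (S : Finset (HeightOneSpectrum (𝓞 K))) : Prop where
  hζ : IsPrimitiveRoot ζ q
  ha : ∀ c : K, c ^ q ≠ a
  haq : ∀ v : HeightOneSpectrum (𝓞 K), v.valuation K (q : K) ≠ 1 → a ∈ PV ζ q v
  hS : ∀ v : HeightOneSpectrum (𝓞 K), v.valuation K (q : K) ≠ 1 → v ∈ S
  haS : a ∈ US S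
  hcl : ClTriv S

/-- auxiliary set of primes -/
structure Aux (ζ : K) (q : ℕ) (a : Kˣ) (S B : Finset (HeightOneSpectrum (𝓞 K)))
    (z : HeightOneSpectrum (𝓞 K) → Kˣ) : Prop where
  disj : ∀ v ∈ B, v ∉ S
  hP : ∀ v ∈ B, a ∈ PV ζ q v
  zU : ∀ v ∈ B, z v ∈ US S
  z1 : ∀ v ∈ B, z v ∉ PV ζ q v
  z2 : ∀ v ∈ B, ∀ v' ∈ B, v' ≠ v → z v ∈ PV ζ q v'

variable {hq : q.Prime} {a : Kˣ} {S : Finset (HeightOneSpectrum (𝓞 K))}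

lemma Dat.good (D : Dat hq ζ a S) {v : HeightOneSpectrum (𝓞 K)} (hv : v ∉ S) : v.valuation K (q : K) = 1 := by
  by_contra h
  exact hv (D.hS v h)

lemma Dat.step [IsTotallyComplex K] (D : Dat hq ζ a S) {B : Finset (HeightOneSpectrum (𝓞 K))}
    {z : HeightOneSpectrum (𝓞 K) → Kˣ} (A : Aux ζ q a S B z)
    (hn : B.card + 1 < S.card + InfinitePlace.nrComplexPlaces K) :
    ∃ u ∈ US S, (∀ v ∈ B, u ∈ PV ζ q v) ∧ ∀ (c : Kˣ) (i : ℕ), u ≠ c ^ q * a ^ i := by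
  classical
  by_contra! hcon
  have hζ := D.hζ
  have key := lin_upper q hq (powMonoidHom q : US S →* US S).range (fun x => ⟨x, rfl⟩)
    (fun o : Option B => o.elim (⟨a, D.haS⟩ : US S) (fun v => ⟨z v, A.zU v v.2⟩)) (by
      intro x
      have hc : ∀ v : B, ∃ c : ℤ, (x : Kˣ) * z v ^ c ∈ PV ζ q (v : HeightOneSpectrum (𝓞 K)) := fun v =>
        good_cyclic hq hζ (D.good (A.disj v v.2)) (mem_US.1 (A.zU v v.2) _ (A.disj v v.2))
          (mem_US.1 x.2 _ (A.disj v v.2)) (A.z1 v v.2)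
      choose c hc using hc
      obtain ⟨d, i, hd⟩ := hcon ((x : Kˣ) * ∏ v : B, z v ^ c v)
        ((US S).mul_mem x.2 ((US S).prod_mem fun v _ => (US S).zpow_mem (A.zU v v.2) _)) (by
          intro v hv
          rw [← Finset.mul_prod_erase _ _ (Finset.mem_univ (⟨v, hv⟩ : B)), ← mul_assoc]
          refine Subgroup.mul_mem _ (hc ⟨v, hv⟩) (Subgroup.prod_mem _ fun w hw => ?_)
          refine Subgroup.zpow_mem _ (A.z2 w w.2 v hv ?_) _
          intro h
          exact (Finset.mem_erase.1 hw).1 (Subtype.ext h.symm))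
      refine ⟨fun o => o.elim (-(i : ℤ)) c, ?_⟩
      have h1 : (x : Kˣ) * (a ^ (-(i : ℤ)) * ∏ v : B, z v ^ c v) = d ^ q := by
        rw [mul_left_comm, hd]; simp
      have h2 : d ∈ US S := by
        apply US_root hq
        rw [← h1]
        exact (US S).mul_mem x.2 ((US S).mul_mem ((US S).zpow_mem D.haS _)
          ((US S).prod_mem fun v _ => (US S).zpow_mem (A.zU v v.2) _))
      refine ⟨⟨d, h2⟩, ?_⟩
      ext1
      rw [Fintype.prod_option]
      simp only [Option.elim, Subgroup.coe_mul, Subgroup.coe_zpow, Subgroup.val_finset_prod]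
      exact h1.symm)
  rw [US_pow_index hq hζ, Fintype.card_option, Fintype.card_coe] at key
  have := (Nat.pow_le_pow_iff_right hq.one_lt).1 key.1
  omega

lemma Dat.exists_aux [IsTotallyComplex K] (D : Dat hq ζ a S) (n : ℕ)
    (hn : n < S.card + InfinitePlace.nrComplexPlaces K) :
    ∃ B z, Aux ζ q a S B z ∧ B.card = n := by
  classical
  have hζ := D.hζ
  induction n with
  | zero => exact ⟨∅, 1, ⟨by simp, by simp, by simp, by simp, by simp⟩, rfl⟩
  | succ n ih =>
    obtain ⟨B, z, A, hB⟩ := ih (by omega)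
    obtain ⟨u, huS, huB, hu⟩ := D.step A (by omega)
    obtain ⟨v, hvZ, hvq, hva, hvu, haP, huP⟩ := Dth hq hζ a u D.ha hu (S ∪ B)
    rw [Finset.mem_union, not_or] at hvZ
    have hc : ∀ w, ∃ c : ℤ, w ∈ B → z w * u ^ c ∈ PV ζ q v := by
      intro w
      by_cases hw : w ∈ B
      · obtain ⟨c, hc⟩ := good_cyclic hq hζ hvq hvu (mem_US.1 (A.zU w hw) _ hvZ.1) huP
        exact ⟨c, fun _ => hc⟩
      · exact ⟨0, fun h => absurd h hw⟩
    choose c hc using hc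
    have hne : ∀ w ∈ B, w ≠ v := by rintro w hw rfl; exact hvZ.2 hw
    refine ⟨insert v B, fun w => if w = v then u else z w * u ^ c w, ⟨?_, ?_, ?_, ?_, ?_⟩, ?_⟩
    · intro w hw
      rcases Finset.mem_insert.1 hw with rfl | hw
      · exact hvZ.1
      · exact A.disj w hw
    · intro w hw
      rcases Finset.mem_insert.1 hw with rfl | hw
      · exact haP
      · exact A.hP w hw
    · intro w hw
      rcases Finset.mem_insert.1 hw with rfl | hw
      · simpa using huS
      · rw [if_neg (hne w hw)]
        exact (US S).mul_mem (A.zU w hw) ((US S).zpow_mem huS _)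
    · intro w hw
      rcases Finset.mem_insert.1 hw with rfl | hw
      · simpa using huP
      · rw [if_neg (hne w hw)]
        intro h
        exact A.z1 w hw ((Subgroup.mul_mem_cancel_right _ (Subgroup.zpow_mem _ (huB w hw) _)).1 h)
    · intro w hw w' hw' hww
      rcases Finset.mem_insert.1 hw with rfl | hw
      · rw [if_pos rfl]
        rcases Finset.mem_insert.1 hw' with rfl | hw'
        · exact absurd rfl hww
        · exact huB w' hw'
      · rw [if_neg (hne w hw)]
        rcases Finset.mem_insert.1 hw' with hw' | hw'
        · rw [hw']; exact hc w hw
        · exact Subgroup.mul_mem _ (A.z2 w hw w' hw' hww) (Subgroup.zpow_mem _ (huB w' hw') _)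
    · rw [Finset.card_insert_of_notMem hvZ.2, hB]

open Classical in
lemma reduce (hcl : ClTriv S) (B : Finset (HeightOneSpectrum (𝓞 K))) (x : Kˣ)
    (hx : ∀ v ∉ S, v ∉ B → (q : ℤ) ∣ od v x) :
    ∃ c : Kˣ, x / c ^ q ∈ US (S ∪ B.filter (fun v => ¬ (q : ℤ) ∣ od v x)) := by
  obtain ⟨c, hc⟩ := hcl.real (fun v => if (q : ℤ) ∣ od v x then od v x / q else 0) (by
    refine (od_support x).subset ?_
    rintro v ⟨_, hv⟩ h0
    apply hv
    simp [h0])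
  refine ⟨c, ?_⟩
  rw [mem_US]
  intro v hv
  rw [Finset.mem_union, not_or, Finset.mem_filter] at hv
  have h1 : (q : ℤ) ∣ od v x := by
    by_contra h
    by_cases hB : v ∈ B
    · exact hv.2 ⟨hB, h⟩
    · exact h (hx v hv.1 hB)
  rw [od_div, od_pow, hc v hv.1, if_pos h1, Int.mul_ediv_cancel' h1, sub_self]

lemma od_dvd_div_pow (x c : Kˣ) (v : HeightOneSpectrum (𝓞 K)) :
    (q : ℤ) ∣ od v (x / c ^ q) ↔ (q : ℤ) ∣ od v x := by
  rw [od_div, od_pow]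
  exact dvd_sub_left (dvd_mul_right _ _)

theorem Dat.claimF [IsTotallyComplex K] (D : Dat hq ζ a S) {B : Finset (HeightOneSpectrum (𝓞 K))}
    {z : HeightOneSpectrum (𝓞 K) → Kˣ} (A : Aux ζ q a S B z) (x : Kˣ) (hxS : ∀ v ∈ S, x ∈ PV ζ q v)
    (hx : ∀ v ∉ S, v ∉ B → (q : ℤ) ∣ od v x) : ∃ c : Kˣ, c ^ q = x := by
  classical
  by_contra! hcon
  have hζ := D.hζ
  obtain ⟨d, hd⟩ := reduce D.hcl B x hx
  set R := B.filter (fun v => ¬ (q : ℤ) ∣ od v x) with hR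
  have hRB : ∀ v ∈ R, v ∈ B := fun v hv => (Finset.mem_filter.1 hv).1
  have hxd : ∀ c : K, c ^ q ≠ ((x / d ^ q : Kˣ) : K) := by
    intro c hc
    have hc0 : c ≠ 0 := by
      rintro rfl
      rw [zero_pow hq.ne_zero] at hc
      exact (x / d ^ q).ne_zero hc.symm
    have h1 : (Units.mk0 c hc0) ^ q = x / d ^ q := Units.ext hc
    apply hcon (Units.mk0 c hc0 * d)
    rw [mul_pow, h1, div_mul_cancel]
  refine NSl hq hζ (x / d ^ q) hxd (S ∪ R) R Finset.subset_union_right ?_ hd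
    (D.hcl.mono Finset.subset_union_left) ?_ z ?_ ?_ ?_
  · intro v hv
    exact Finset.mem_union_left _ (D.hS v hv)
  · intro v hv hvR
    rcases Finset.mem_union.1 hv with hv | hv
    · exact Subgroup.div_mem _ (hxS v hv) (pow_mem_PV _ _)
    · exact absurd hv hvR
  · intro v hv
    exact US_mono Finset.subset_union_left (A.zU v (hRB v hv))
  · intro v hv
    refine notMem_HV hq hζ (D.good (A.disj v (hRB v hv))) ?_
      (mem_US.1 (A.zU v (hRB v hv)) v (A.disj v (hRB v hv))) (A.z1 v (hRB v hv))
    rw [od_dvd_div_pow]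
    exact (Finset.mem_filter.1 hv).2
  · intro v hv v' hv' hne
    exact Subgroup.mem_sup_right (A.z2 v (hRB v hv) v' (hRB v' hv') hne)

theorem Dat.exists_x [IsTotallyComplex K] (D : Dat hq ζ a S) {B : Finset (HeightOneSpectrum (𝓞 K))}
    {z : HeightOneSpectrum (𝓞 K) → Kˣ} (A : Aux ζ q a S B z)
    (hB : B.card + 1 = S.card + InfinitePlace.nrComplexPlaces K)
    (w : HeightOneSpectrum (𝓞 K)) (hwS : w ∉ S) (hwB : w ∉ B) (haw : a ∈ PV ζ q w) :
    ∃ x : Kˣ, (∀ v ∈ S, x ∈ PV ζ q v) ∧ (∀ v ∉ S, v ∉ B → v ≠ w → od v x = 0) ∧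
      ∀ c : Kˣ, c ^ q ≠ x := by
  classical
  by_contra! hcon
  have hζ := D.hζ
  set T := S ∪ insert w B with hT
  have hTc : T.card = 2 * S.card + InfinitePlace.nrComplexPlaces K := by
    rw [hT, Finset.card_union_of_disjoint, Finset.card_insert_of_notMem hwB, hB]
    · ring
    · rw [Finset.disjoint_right]
      intro v hv
      rcases Finset.mem_insert.1 hv with rfl | hv
      · exact hwS
      · exact A.disj v hv
  have hTm : ∀ v, v ∉ T ↔ v ∉ S ∧ v ≠ w ∧ v ∉ B := by
    intro v; simp only [hT, Finset.mem_union, Finset.mem_insert]; tauto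
  let I : Subgroup Kˣ := ⨅ v : S, PV ζ q (v : HeightOneSpectrum (𝓞 K))
  have hI : ∀ y, y ∈ I ↔ ∀ v ∈ S, y ∈ PV ζ q v := by
    intro y; simp [I, Subgroup.mem_iInf]
  have hIle : I.index ≠ 0 ∧ I.index ≤ q ^ (2 * (S.card + InfinitePlace.nrComplexPlaces K)) := by
    constructor
    · exact Subgroup.index_iInf_ne_zero fun v => (PV_index hq hζ _).1
    · calc I.index ≤ ∏ v : S, (PV ζ q (v : HeightOneSpectrum (𝓞 K))).index := Subgroup.index_iInf_le _
        _ ≤ ∏ v : S, (q ^ 2 * kn (v : HeightOneSpectrum (𝓞 K)) ^ ((q - 1) * LV ζ (v : HeightOneSpectrum (𝓞 K)))) :=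
          Finset.prod_le_prod' fun v _ => (PV_index hq hζ _).2
        _ = ∏ v ∈ S, (q ^ 2 * kn v ^ ((q - 1) * LV ζ v)) :=
          Finset.prod_coe_sort S (fun v => q ^ 2 * kn v ^ ((q - 1) * LV ζ v))
        _ = _ := by
          rw [Finset.prod_mul_distrib, prod_kn hq hζ S D.hS, IsTotallyComplex.finrank, Finset.prod_const]
          ring
  have hrel : I.relIndex (US T) = q ^ (2 * (S.card + InfinitePlace.nrComplexPlaces K)) := by
    have h1 : I.subgroupOf (US T) = (powMonoidHom q : US T →* US T).range := by
      ext y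
      rw [Subgroup.mem_subgroupOf, hI]
      constructor
      · intro hy
        obtain ⟨c, hc⟩ := hcon y hy (by
          intro v h1 h2 h3
          exact mem_US.1 y.2 v ((hTm v).2 ⟨h1, h3, h2⟩))
        refine ⟨⟨c, US_root hq (by rw [hc]; exact y.2)⟩, ?_⟩
        ext1; exact hc
      · rintro ⟨c, rfl⟩ v _
        exact pow_mem_PV _ _
    rw [Subgroup.relIndex, h1, US_pow_index hq hζ, hTc]
    congr 1; ring
  have htop : I ⊔ US T = ⊤ := by
    have h1 := Subgroup.relIndex_mul_index (H := I) (K := I ⊔ US T) le_sup_left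
    rw [Subgroup.relIndex_sup_left, hrel] at h1
    rw [← Subgroup.index_eq_one]
    have h2 : q ^ (2 * (S.card + InfinitePlace.nrComplexPlaces K)) * (I ⊔ US T).index ≤
      q ^ (2 * (S.card + InfinitePlace.nrComplexPlaces K)) * 1 := by rw [h1, mul_one]; exact hIle.2
    have h3 := Nat.le_of_mul_le_mul_left h2 (pow_pos hq.pos _)
    have h4 : (I ⊔ US T).index ≠ 0 := by
      intro h; rw [h, mul_zero] at h1; exact hIle.1 h1.symm
    omega
  set R := S.filter (fun v => a ∉ PV ζ q v) with hR
  have hRq : ∀ v ∈ R, v.valuation K (q : K) = 1 := by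
    intro v hv
    by_contra h
    exact (Finset.mem_filter.1 hv).2 (D.haq v h)
  have hz' : ∀ v, ∃ z, v ∈ R → z ∉ HV hq ζ a v := by
    intro v
    by_cases hv : v ∈ R
    · obtain ⟨z, hz⟩ := HV_ne_top hq hζ (hRq v hv) (Finset.mem_filter.1 hv).2
      exact ⟨z, fun _ => hz⟩
    · exact ⟨1, fun h => absurd h hv⟩
  choose z' hz' using hz'
  have hz : ∀ v, ∃ z ∈ US T, ∀ v' ∈ S, z / (if v' = v then z' v else 1) ∈ PV ζ q v' := by
    intro v
    obtain ⟨y, hy⟩ := approxPV hq hζ S (fun v' => if v' = v then z' v else 1)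
    have : y ∈ I ⊔ US T := by rw [htop]; trivial
    obtain ⟨i, hi, z, hz, rfl⟩ := Subgroup.mem_sup.1 this
    refine ⟨z, hz, fun v' hv' => ?_⟩
    have h1 := hy v' hv'
    rw [mul_div_assoc] at h1
    exact (Subgroup.mul_mem_cancel_left _ ((hI i).1 hi v' hv')).1 h1
  choose z hzT hz using hz
  have hRS : R ⊆ S := Finset.filter_subset _ _
  refine NSl hq hζ a D.ha T R (hRS.trans Finset.subset_union_left) ?_
    (US_mono Finset.subset_union_left D.haS) (D.hcl.mono Finset.subset_union_left) ?_ z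
    (fun v _ => hzT v) ?_ ?_
  · intro v hv
    exact Finset.mem_union_left _ (D.hS v hv)
  · intro v hv hvR
    rcases Finset.mem_union.1 hv with hv | hv
    · by_contra h; exact hvR (Finset.mem_filter.2 ⟨hv, h⟩)
    · rcases Finset.mem_insert.1 hv with rfl | hv
      · exact haw
      · exact A.hP v hv
  · intro v hv h
    have h1 := hz v v (hRS hv)
    rw [if_pos rfl] at h1
    apply hz' v hv
    have h2 : z' v = z v / (z v / z' v) := by rw [div_div_cancel]
    rw [h2]
    exact Subgroup.div_mem _ h (Subgroup.mem_sup_right h1)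
  · intro v hv v' hv' hne
    have h1 := hz v v' (hRS hv')
    rw [if_neg hne, div_one] at h1
    exact Subgroup.mem_sup_right h1

theorem Dat.exists_x' [IsTotallyComplex K] (D : Dat hq ζ a S) {B : Finset (HeightOneSpectrum (𝓞 K))}
    {z : HeightOneSpectrum (𝓞 K) → Kˣ} (A : Aux ζ q a S B z)
    (hB : B.card + 1 = S.card + InfinitePlace.nrComplexPlaces K)
    (w : HeightOneSpectrum (𝓞 K)) (hwS : w ∉ S) (hwB : w ∉ B) (haw : a ∈ PV ζ q w) :
    ∃ x : Kˣ, (∀ v ∈ S, x ∈ PV ζ q v) ∧ (∀ v ∉ S, v ∉ B → v ≠ w → od v x = 0) ∧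
      ¬ (q : ℤ) ∣ od w x ∧ x ∈ NS hq ζ a := by
  classical
  have hζ := D.hζ
  obtain ⟨x, hxS, hx0, hxc⟩ := D.exists_x A hB w hwS hwB haw
  have hw : ¬ (q : ℤ) ∣ od w x := by
    intro hd
    obtain ⟨c, hc⟩ := D.claimF A x hxS (by
      intro v hv hvB
      by_cases hvw : v = w
      · rw [hvw]; exact hd
      · rw [hx0 v hv hvB hvw]; exact dvd_zero _)
    exact hxc c hc
  refine ⟨x, hxS, hx0, hw, ?_⟩
  obtain ⟨d, hd⟩ := reduce (q := q) D.hcl (insert w B) x (by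
    intro v hv hvB
    rw [Finset.mem_insert, not_or] at hvB
    rw [hx0 v hv hvB.2 hvB.1]; exact dvd_zero _)
  set R := (insert w B).filter (fun v => ¬ (q : ℤ) ∣ od v x) with hR
  set y := x / d ^ q with hy
  have hxd : ∀ c : K, c ^ q ≠ (y : K) := by
    intro c hc
    have hc0 : c ≠ 0 := by
      rintro rfl
      rw [zero_pow hq.ne_zero] at hc
      exact y.ne_zero hc.symm
    have h1 : (Units.mk0 c hc0) ^ q = x / d ^ q := Units.ext hc
    apply hxc (Units.mk0 c hc0 * d)
    rw [mul_pow, h1, div_mul_cancel]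
  have hwR : w ∈ R := Finset.mem_filter.2 ⟨Finset.mem_insert_self _ _, hw⟩
  have hRw : ∀ v ∈ R.erase w, v ∈ B ∧ ¬ (q : ℤ) ∣ od v y := by
    intro v hv
    obtain ⟨h1, h2⟩ := Finset.mem_erase.1 hv
    obtain ⟨h3, h4⟩ := Finset.mem_filter.1 h2
    exact ⟨(Finset.mem_insert.1 h3).resolve_left h1, by rwa [hy, od_dvd_div_pow]⟩
  have hya : a ∈ NS hq ζ y := by
    by_contra hna
    obtain ⟨h1, h2⟩ := Aii hq hζ y hxd (S ∪ R) R Finset.subset_union_right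
      (fun v hv => Finset.mem_union_left _ (D.hS v hv)) hd (D.hcl.mono Finset.subset_union_left) (by
        intro v hv hvR
        rcases Finset.mem_union.1 hv with hv | hv
        · exact Subgroup.div_mem _ (hxS v hv) (pow_mem_PV _ _)
        · exact absurd hv hvR)
    have haS : a ∈ US (S ∪ R) := US_mono Finset.subset_union_left D.haS
    have hzS : ∀ v : R.erase w, z v ∈ US (S ∪ R) := fun v =>
      US_mono Finset.subset_union_left (A.zU v (hRw v v.2).1)
    have h3 := lin_lower q hq ((NS hq ζ y).subgroupOf (US (S ∪ R))) h1
      (fun o : Option (R.erase w) => o.elim (⟨a, haS⟩ : US (S ∪ R)) (fun v => ⟨z v, hzS v⟩)) (by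
      intro c hc
      rw [Subgroup.mem_subgroupOf, Fintype.prod_option] at hc
      simp only [Option.elim, Subgroup.coe_mul, Subgroup.coe_zpow, Subgroup.val_finset_prod] at hc
      have hcv : ∀ v : R.erase w, (q : ℤ) ∣ c (some v) := by
        intro v
        by_contra hdv
        have hvB := (hRw v v.2).1
        have hvS := A.disj v hvB
        refine notMem_HV hq hζ (D.good hvS) (hRw v v.2).2 (mem_US.1 (A.zU v hvB) v hvS) (A.z1 v hvB) ?_
        apply mem_of_zpow hq _ (pow_mem_HV hq y _ _) hdv
        have h4 : a ^ c none * ∏ i : R.erase w, z i ^ c (some i) ∈ HV hq ζ y v := Subgroup.mem_sup_left hc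
        rw [← Finset.mul_prod_erase _ _ (Finset.mem_univ v), mul_left_comm] at h4
        refine (Subgroup.mul_mem_cancel_right _ ?_).1 h4
        refine Subgroup.mul_mem _ (Subgroup.zpow_mem _ (Subgroup.mem_sup_right (A.hP v hvB)) _)
          (Subgroup.prod_mem _ fun i hi => Subgroup.zpow_mem _ (Subgroup.mem_sup_right
            (A.z2 i (hRw i i.2).1 v hvB ?_)) _)
        intro h
        exact (Finset.mem_erase.1 hi).1 (Subtype.ext h.symm)
      intro o
      cases o with
      | some v => exact hcv v
      | none =>
        by_contra hdv
        apply hna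
        apply mem_of_zpow hq _ (pow_mem_NS hq y _) hdv
        refine (Subgroup.mul_mem_cancel_right _ ?_).1 hc
        refine Subgroup.prod_mem _ fun i hi => ?_
        obtain ⟨e, he⟩ := hcv i
        rw [he, zpow_mul, zpow_natCast]
        exact Subgroup.zpow_mem _ (pow_mem_NS hq y _) _)
    rw [Fintype.card_option, Fintype.card_coe, Finset.card_erase_add_one hwR] at h3
    have h4 : (NS hq ζ y).relIndex (US (S ∪ R)) * q ≤ (NS hq ζ y).relIndex (US (S ∪ R)) := h2.trans h3
    have := hq.two_le
    have := Nat.pos_of_ne_zero h1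
    nlinarith
  have h5 : y ∈ NS hq ζ a := NF.symm hζ hq y.ne_zero a.ne_zero hya
  have h6 : x = y * d ^ q := by rw [hy, div_mul_cancel]
  rw [h6]
  exact Subgroup.mul_mem _ h5 (pow_mem_NS hq a d)

theorem Dat.main [IsTotallyComplex K] (D : Dat hq ζ a S) (b : Kˣ) (hbS : ∀ v ∈ S, b ∈ PV ζ q v)
    (hb : ∀ v ∉ S, ¬ (q : ℤ) ∣ od v b → a ∈ PV ζ q v) : NF ζ q (a : K) b := by
  classical
  have hζ := D.hζ
  have hr : 0 < InfinitePlace.nrComplexPlaces K := by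
    have h1 := IsTotallyComplex.finrank K
    have h2 := Module.finrank_pos (R := ℚ) (M := K)
    omega
  obtain ⟨B, z, A, hB⟩ := D.exists_aux (S.card + InfinitePlace.nrComplexPlaces K - 1) (by omega)
  have hB' : B.card + 1 = S.card + InfinitePlace.nrComplexPlaces K := by omega
  set T := (sup0 b).filter (fun v => v ∉ S ∧ v ∉ B ∧ ¬ (q : ℤ) ∣ od v b) with hT
  have hx : ∀ w, ∃ x : Kˣ, w ∈ T → (∀ v ∈ S, x ∈ PV ζ q v) ∧ (∀ v ∉ S, v ∉ B → v ≠ w → od v x = 0) ∧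
      ¬ (q : ℤ) ∣ od w x ∧ x ∈ NS hq ζ a := by
    intro w
    by_cases hw : w ∈ T
    · obtain ⟨-, h1, h2, h3⟩ := Finset.mem_filter.1 hw
      obtain ⟨x, hx⟩ := D.exists_x' A hB' w h1 h2 (hb w h1 h3)
      exact ⟨x, fun _ => hx⟩
    · exact ⟨1, fun h => absurd h hw⟩
  choose x hx using hx
  have hc : ∀ w, ∃ c : ℤ, w ∈ T → (q : ℤ) ∣ od w b + c * od w (x w) := by
    intro w
    by_cases hw : w ∈ T
    · have h1 : IsCoprime (q : ℤ) (od w (x w)) :=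
        (Int.prime_iff_natAbs_prime.2 (by simpa using hq)).coprime_iff_not_dvd.2 (hx w hw).2.2.1
      obtain ⟨e, f, hef⟩ := h1
      refine ⟨-f * od w b, fun _ => ⟨e * od w b, ?_⟩⟩
      linear_combination (- od w b) * hef
    · exact ⟨0, fun h => absurd h hw⟩
  choose c hc using hc
  obtain ⟨d, hd⟩ := D.claimF A (b * ∏ w ∈ T, x w ^ c w) (by
    intro v hv
    exact Subgroup.mul_mem _ (hbS v hv) (Subgroup.prod_mem _ fun w hw =>
      Subgroup.zpow_mem _ ((hx w hw).1 v hv) _)) (by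
    intro v hv hvB
    rw [od_mul, od_prod]
    simp only [od_zpow]
    by_cases hvT : v ∈ T
    · rw [Finset.sum_eq_single_of_mem v hvT]
      · exact hc v hvT
      · intro w hw hwv
        rw [(hx w hw).2.1 v hv hvB (Ne.symm hwv), mul_zero]
    · rw [Finset.sum_eq_zero]
      · rw [add_zero]
        by_contra h
        exact hvT (Finset.mem_filter.2 ⟨mem_sup0.2 (fun h0 => h (by rw [h0]; exact dvd_zero _)), hv, hvB, h⟩)
      · intro w hw
        rw [(hx w hw).2.1 v hv hvB (by rintro rfl; exact hvT hw), mul_zero])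
  have h1 : b * ∏ w ∈ T, x w ^ c w ∈ NS hq ζ a := by rw [← hd]; exact pow_mem_NS hq a d
  exact (Subgroup.mul_mem_cancel_right _ (Subgroup.prod_mem _ fun w hw =>
    Subgroup.zpow_mem _ (hx w hw).2.2.2 _)).1 h1

end
end Prf
set_option linter.all false
set_option linter.unusedVariables false
set_option linter.unusedSimpArgs false
namespace Prf
open Polynomial NumberField IsDedekindDomain
open scoped Topology

section
variable {K : Type} [Field K] [NumberField K] {q : ℕ} {ζ : K}

lemma nhds_adic (v : HeightOneSpectrum (𝓞 K)) (x : v.adicCompletion K) (s : Set (v.adicCompletion K)) :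
    s ∈ 𝓝 x ↔ ∃ n : ℕ, {y | Valued.v (y - x) < WithZero.exp (-(n : ℤ))} ⊆ s := by
  rw [Valued.mem_nhds]
  constructor
  · rintro ⟨γ, hγ⟩
    have h0 : MonoidWithZeroHom.ValueGroup₀.embedding (γ.1) ≠ 0 := by
      simp
    obtain ⟨k, hk⟩ := WithZero.ne_zero_iff_exists.1 h0
    refine ⟨(-(Multiplicative.toAdd k)).toNat, fun y hy => hγ ?_⟩
    simp only [Set.mem_ofPred_eq] at hy ⊢
    rw [Valuation.restrict_lt_iff_lt_embedding, ← hk]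
    refine lt_of_lt_of_le hy ?_
    change WithZero.exp _ ≤ WithZero.exp (Multiplicative.toAdd k)
    rw [WithZero.exp_le_exp]
    omega
  · rintro ⟨n, hn⟩
    obtain ⟨c, hc⟩ := v.valuedAdicCompletion_surjective K (WithZero.exp (-(n:ℤ)))
    have hc0 : Valued.v.restrict c ≠ 0 := by
      simp only [ne_eq, Valuation.restrict_eq_zero_iff] 
      rw [hc]; simp
    refine ⟨Units.mk0 _ hc0, fun y hy => hn ?_⟩
    simp only [Set.mem_ofPred_eq, Units.val_mk0] at hy ⊢
    rw [← hc]
    exact (Valuation.restrict_lt_iff _).1 hy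

lemma v_alg (v : HeightOneSpectrum (𝓞 K)) (x : K) :
    Valued.v (algebraMap K (v.adicCompletion K) x) = v.valuation K x := by
  rw [HeightOneSpectrum.algebraMap_adicCompletion]
  exact v.valuedAdicCompletion_eq_valuation' x

lemma dense_adic (v : HeightOneSpectrum (𝓞 K)) (x : v.adicCompletion K) (n : ℕ) :
    ∃ y : K, Valued.v (algebraMap K (v.adicCompletion K) y - x) < WithZero.exp (-(n:ℤ)) := by
  have := (HeightOneSpectrum.denseRange_algebraMap K v) x
  rw [mem_closure_iff_nhds] at this
  obtain ⟨_, h, y, rfl⟩ := this _ ((nhds_adic v x _).2 ⟨n, subset_rfl⟩)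
  exact ⟨y, h⟩

lemma nform_near (hq : q.Prime) (hζ : IsPrimitiveRoot ζ q) (a : K) (b : Kˣ) (v : HeightOneSpectrum (𝓞 K))
    (h : NF (algebraMap K (v.adicCompletion K) ζ) q (algebraMap K (v.adicCompletion K) a)
      (algebraMap K (v.adicCompletion K) b)) (n : ℕ) :
    ∃ (f : Fin q → K) (m : ℕ), ∀ z : Fin q → K, (∀ i, v.valuation K (z i - f i) < WithZero.exp (-(m:ℤ))) →
      v.valuation K (nform ζ q a z - b) < WithZero.exp (-(n:ℤ)) := by
  classical
  have hζ' := hζ.map_of_injective (algebraMap K (v.adicCompletion K)).injective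
  obtain ⟨y, hy⟩ := h.exists_nform hζ' hq.ne_zero
  have hc := (nform_continuous (ζ := algebraMap K (v.adicCompletion K) ζ) (q := q)
    (a := algebraMap K (v.adicCompletion K) a)).tendsto y
  have h1 := hc ((nhds_adic v _ _).2 ⟨n, subset_rfl⟩)
  rw [Filter.mem_map, nhds_pi, Filter.mem_pi'] at h1
  obtain ⟨I, t, ht, hI⟩ := h1
  choose m hm using fun i => (nhds_adic v _ _).1 (ht i)
  choose f hf using fun i => dense_adic v (y i) (∑ i, m i)
  refine ⟨f, ∑ i, m i, fun z hz => ?_⟩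
  have : (fun i => algebraMap K (v.adicCompletion K) (z i)) ∈ (I : Set (Fin q)).pi t := by
    intro i _
    apply hm
    simp only [Set.mem_ofPred_eq]
    have h2 : algebraMap K (v.adicCompletion K) (z i) - y i = algebraMap K (v.adicCompletion K) (z i - f i) +
      (algebraMap K (v.adicCompletion K) (f i) - y i) := by simp
    rw [h2]
    refine lt_of_lt_of_le (Valuation.map_add_lt _ ((v_alg v _).trans_lt (hz i)) (hf i)) ?_
    rw [WithZero.exp_le_exp]
    have : m i ≤ ∑ i, m i := Finset.single_le_sum (fun _ _ => Nat.zero_le _) (Finset.mem_univ i)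
    omega
  have h3 := hI this
  simp only [Set.mem_preimage, Set.mem_ofPred_eq, nform_map] at h3
  rwa [hy, ← map_sub, v_alg] at h3

lemma approxNF (hq : q.Prime) (hζ : IsPrimitiveRoot ζ q) (a : K) (b : Kˣ) (S : Finset (HeightOneSpectrum (𝓞 K)))
    (h : ∀ v ∈ S, NF (algebraMap K (v.adicCompletion K) ζ) q (algebraMap K (v.adicCompletion K) a)
      (algebraMap K (v.adicCompletion K) b)) (n : HeightOneSpectrum (𝓞 K) → ℕ) :
    ∃ z : Kˣ, NF ζ q a (z:K) ∧ ∀ v ∈ S, v.valuation K (((z / b : Kˣ) : K) - 1) < WithZero.exp (-(n v : ℤ)) := by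
  classical
  rcases S.eq_empty_or_nonempty with rfl | hS
  · refine ⟨1, ?_, by simp⟩
    have := NF_pow (ζ := ζ) (q := q) (a := a) 1
    simpa using this
  have h' : ∀ v, ∃ (f : Fin q → K) (m : ℕ), v ∈ S → ∀ z : Fin q → K, (∀ i, v.valuation K (z i - f i) < WithZero.exp (-(m:ℤ))) →
      v.valuation K (nform ζ q a z - b) < WithZero.exp (-((n v + (od v b).toNat:ℕ):ℤ)) := by
    intro v
    by_cases hv : v ∈ S
    · obtain ⟨f, m, hfm⟩ := nform_near hq hζ a b v (h v hv) (n v + (od v b).toNat)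
      exact ⟨f, m, fun _ => hfm⟩
    · exact ⟨0, 0, fun h => absurd h hv⟩
  choose f m hfm using h'
  choose z hz using fun i => approxK S (fun v => f v i) m
  have key : ∀ v ∈ S, v.valuation K (nform ζ q a z / (b : K) - 1) < WithZero.exp (-(n v : ℤ)) := by
    intro v hv
    have h2 : nform ζ q a z / (b : K) - 1 = (nform ζ q a z - b) / b := by
      have := b.ne_zero
      field_simp
    rw [h2, map_div₀, od_spec, div_eq_mul_inv, ← WithZero.exp_neg]
    have h3 := hfm v hv z (fun i => hz i v hv)
    calc _ < WithZero.exp (-((n v + (od v b).toNat:ℕ):ℤ)) * WithZero.exp (- -(od v b)) := by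
          apply mul_lt_mul_of_pos_right h3 
          simp
      _ ≤ _ := by
          rw [← WithZero.exp_add, WithZero.exp_le_exp]
          push_cast
          omega
  have hne : nform ζ q a z ≠ 0 := by
    obtain ⟨v, hv⟩ := hS
    intro h0
    have := key v hv
    rw [h0] at this
    simp at this
    have h4 : WithZero.exp (-(n v:ℤ)) ≤ WithZero.exp 0 := by
      rw [WithZero.exp_le_exp]; omega
    rw [← WithZero.exp_zero] at this
    exact absurd this (not_lt.2 h4)
  refine ⟨Units.mk0 _ hne, NF_nform hζ hq.ne_zero a z, fun v hv => ?_⟩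
  simpa using key v hv

lemma approxNF_PV (hq : q.Prime) (hζ : IsPrimitiveRoot ζ q) (a : K) (b : Kˣ) (S : Finset (HeightOneSpectrum (𝓞 K)))
    (h : ∀ v ∈ S, NF (algebraMap K (v.adicCompletion K) ζ) q (algebraMap K (v.adicCompletion K) a)
      (algebraMap K (v.adicCompletion K) b)) :
    ∃ z : Kˣ, NF ζ q a (z:K) ∧ ∀ v ∈ S, z / b ∈ PV ζ q v ∧ od v z = od v b := by
  obtain ⟨z, hz, h2⟩ := approxNF hq hζ a b S h (fun v => NV ζ q v)
  refine ⟨z, hz, fun v hv => ⟨?_, ?_⟩⟩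
  · apply near_mem_PV hq hζ
    have := h2 v hv
    rwa [NV_spec hq hζ] at this
  · have h4 := val_one_of_near v (h2 v hv)
    have := (od_zero_iff v _).2 h4
    rw [od_div] at this
    omega

abbrev NFl (ζ : K) (q : ℕ) (a b : K) (v : HeightOneSpectrum (𝓞 K)) : Prop :=
  NF (algebraMap K (v.adicCompletion K) ζ) q (algebraMap K (v.adicCompletion K) a)
      (algebraMap K (v.adicCompletion K) b)

lemma NF.divr {E : Type*} [Field E] {ζ a b c : E} {q : ℕ} (hq : q ≠ 0) (hc : c ≠ 0) (h : NF ζ q a b) (h' : NF ζ q a c) :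
    NF ζ q a (b / c) := by
  rw [div_eq_mul_inv]
  exact h.mul (h'.inv hq hc)

lemma thmH2 [IsTotallyComplex K] (hq : q.Prime) (hζ : IsPrimitiveRoot ζ q) (a b : Kˣ)
    (hloc : ∀ v, NFl ζ q (a:K) b v)
    (haq : ∀ v, v.valuation K (q:K) ≠ 1 → a ∈ PV ζ q v) : NF ζ q (a:K) b := by
  classical
  by_cases ha : ∃ c : K, c^q = a
  · obtain ⟨c, hc⟩ := ha
    have hc0 : c ≠ 0 := by
      rintro rfl
      rw [zero_pow hq.ne_zero] at hc
      exact a.ne_zero hc.symm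
    rw [← hc]
    exact NF_of_isPow hζ hq.ne_zero hc0 _
  push Not at ha
  obtain ⟨S1, hS1⟩ := exists_ClTriv (K := K)
  set S := QS K hq ∪ sup0 a ∪ S1 with hS
  have D : Dat hq ζ a S := by
    refine ⟨hζ, ha, haq, ?_, US_of_sup0 ?_, hS1.mono ?_⟩
    · intro v hv
      simp [hS, mem_QS, hv]
    · intro v hv; simp [hS, hv]
    · intro v hv; simp [hS, hv]
  obtain ⟨z, hz, hz2⟩ := approxNF_PV hq hζ a b S (fun v _ => hloc v)
  have hbz : NF ζ q (a:K) ((b / z : Kˣ) : K) := by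
    apply D.main
    · intro v hv
      have := inv_mem (hz2 v hv).1
      simpa using this
    · intro v hv hnd
      by_contra hP
      apply hnd
      obtain ⟨y, hy, hy2⟩ := approxNF_PV hq hζ a b {v} (fun v _ => hloc v)
      have hvq : v.valuation K (q:K) = 1 := by
        by_contra h; exact hv (D.hS v h)
      have hua : od v a = 0 := by
        by_contra h
        apply hv
        simp [hS, mem_sup0, h]
      have e1 := T1 hq hζ hvq hua hP hy
      have e2 := T1 hq hζ hvq hua hP hz
      rw [(hy2 v (by simp)).2] at e1
      rw [od_div]
      exact dvd_sub e1 e2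
  have := hbz.mul hz
  simpa using this

theorem thmH [IsTotallyComplex K] (hq : q.Prime) (hζ : IsPrimitiveRoot ζ q) (a b : Kˣ)
    (hloc : ∀ v, NFl ζ q (a:K) b v) : NF ζ q (a:K) b := by
  classical
  have hsy : ∀ v, NFl ζ q (b:K) a v := fun v => by
    apply (hloc v).symm (hζ.map_of_injective (algebraMap K (v.adicCompletion K)).injective) hq
    · simp
    · simp
  obtain ⟨z, hz, hz2⟩ := approxNF_PV hq hζ b a (QS K hq) (fun v _ => hsy v)
  have h1 : NF ζ q ((a / z : Kˣ) : K) b := by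
    apply thmH2 hq hζ
    · intro v
      have hz' := NF.map (algebraMap K (v.adicCompletion K)) hz
      have h3 := (hsy v).divr hq.ne_zero (by simp) hz'
      have h4 := h3.symm (hζ.map_of_injective (algebraMap K (v.adicCompletion K)).injective) hq (by simp) (by simp)
      unfold NFl
      simpa using h4
    · intro v hv
      have := inv_mem (hz2 v (mem_QS.2 hv)).1
      simpa using this
  have h2 := h1.symm hζ hq (by simp) (by simp)
  have h3 := (h2.mul hz).symm hζ hq (by simp) (by simp)
  simpa using h3
end
end Prf
set_option linter.all false
set_option linter.unusedVariables false
set_option linter.unusedSimpArgs false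
namespace Prf
open scoped TensorProduct
open Module

section burnside
variable {K V R : Type*} [Field K] [AddCommGroup V] [Module K V] [Ring R] [Algebra K R]

lemma density_aux (ρ : R →ₐ[K] Module.End K V) (h1 : ∀ v : V, v ≠ 0 → ∀ w, ∃ r, ρ r v = w)
    (h2 : ∀ φ : Module.End K V, (∀ r, φ * ρ r = ρ r * φ) → ∃ c : K, ∀ v, φ v = c • v)
    (S : Submodule K V) (hS : S.FG) : ∀ x, x ∉ S → ∃ r, (∀ y ∈ S, ρ r y = 0) ∧ ρ r x ≠ 0 := by
  classical
  obtain ⟨s, rfl⟩ := hS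
  induction s using Finset.induction_on with
  | empty =>
    intro x hx
    refine ⟨1, ?_, ?_⟩
    · intro y hy; simpa using hy
    · simpa using hx
  | insert u s hu ih =>
    set S' := Submodule.span K (s : Set V) with hS'
    intro x hx
    rw [Finset.coe_insert, Submodule.span_insert] at hx ⊢
    by_cases huS : u ∈ S'
    · have : K ∙ u ⊔ S' = S' := by
        rw [sup_eq_right, Submodule.span_singleton_le_iff_mem]; exact huS
      rw [this] at hx ⊢
      exact ih x hx
    obtain ⟨r0, hr0, hr0u⟩ := ih u huS
    have hI : ∀ w, ∃ r, (∀ y ∈ S', ρ r y = 0) ∧ ρ r u = w := by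
      intro w
      obtain ⟨r, hr⟩ := h1 _ hr0u w
      refine ⟨r * r0, fun y hy => ?_, ?_⟩
      · rw [map_mul, Module.End.mul_apply, hr0 y hy, map_zero]
      · rw [map_mul, Module.End.mul_apply, hr]
    by_contra hcon
    push Not at hcon
    have hcon' : ∀ r, (∀ y ∈ S', ρ r y = 0) → ρ r u = 0 → ρ r x = 0 := by
      intro r h h'
      apply hcon
      intro y hy
      obtain ⟨y1, hy1, y2, hy2, rfl⟩ := Submodule.mem_sup.1 hy
      obtain ⟨c, rfl⟩ := Submodule.mem_span_singleton.1 hy1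
      rw [map_add, map_smul, h', h _ hy2]; simp
    have huniq : ∀ r r', (∀ y ∈ S', ρ r y = 0) → (∀ y ∈ S', ρ r' y = 0) → ρ r u = ρ r' u → ρ r x = ρ r' x := by
      intro r r' h h' h''
      have := hcon' (r - r') (fun y hy => by rw [map_sub, LinearMap.sub_apply, h y hy, h' y hy, sub_zero])
        (by rw [map_sub, LinearMap.sub_apply, h'', sub_self])
      rw [map_sub, LinearMap.sub_apply] at this
      exact sub_eq_zero.1 this
    choose f hf1 hf2 using hI
    let φ : Module.End K V :=
      { toFun := fun w => ρ (f w) x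
        map_add' := fun w w' => by
          have := huniq (f (w+w')) (f w + f w') (hf1 _)
            (fun y hy => by rw [map_add, LinearMap.add_apply, hf1 _ y hy, hf1 _ y hy, add_zero])
            (by rw [map_add, LinearMap.add_apply, hf2, hf2, hf2])
          rw [this, map_add, LinearMap.add_apply]
        map_smul' := fun c w => by
          have := huniq (f (c•w)) (c • f w) (hf1 _)
            (fun y hy => by rw [map_smul, LinearMap.smul_apply, hf1 _ y hy, smul_zero])
            (by rw [map_smul, LinearMap.smul_apply, hf2, hf2])
          rw [this, map_smul, LinearMap.smul_apply, RingHom.id_apply] }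
    obtain ⟨c, hc⟩ := h2 φ (fun r => by
      ext w
      have := huniq (f (ρ r w)) (r * f w) (hf1 _)
            (fun y hy => by rw [map_mul, Module.End.mul_apply, hf1 _ y hy, map_zero])
            (by rw [map_mul, Module.End.mul_apply, hf2, hf2])
      change ρ (f (ρ r w)) x = ρ r (ρ (f w) x)
      rw [this, map_mul, Module.End.mul_apply])
    have h3 : ∀ r, (∀ y ∈ S', ρ r y = 0) → ρ r (x - c • u) = 0 := by
      intro r hr
      have h4 := huniq r (f (ρ r u)) hr (hf1 _) (hf2 _).symm
      have h5 : ρ (f (ρ r u)) x = c • ρ r u := hc (ρ r u)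
      rw [map_sub, map_smul, h4, h5, sub_self]
    have h6 : x - c • u ∈ S' := by
      by_contra h
      obtain ⟨r, hr, hr'⟩ := ih _ h
      exact hr' (h3 r hr)
    apply hx
    rw [Submodule.mem_sup]
    exact ⟨c • u, Submodule.smul_mem _ _ (Submodule.mem_span_singleton_self u), _, h6, by abel⟩

lemma burnside [FiniteDimensional K V] (ρ : R →ₐ[K] Module.End K V) (h1 : ∀ v : V, v ≠ 0 → ∀ w, ∃ r, ρ r v = w)
    (h2 : ∀ φ : Module.End K V, (∀ r, φ * ρ r = ρ r * φ) → ∃ c : K, ∀ v, φ v = c • v) :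
    Function.Surjective ρ := by
  classical
  intro φ
  let b := Module.finBasis K V
  have : ∀ j, ∃ r, ∀ i, ρ r (b i) = if i = j then φ (b j) else 0 := by
    intro j
    have hj : b j ∉ Submodule.span K (b '' {i | i ≠ j}) := by
      have := b.linearIndependent.notMem_span_image (s := {i | i ≠ j}) (x := j) (by simp)
      exact this
    obtain ⟨r, hr, hr2⟩ := density_aux ρ h1 h2 _ (IsNoetherian.noetherian _) _ hj
    obtain ⟨r', hr'⟩ := h1 _ hr2 (φ (b j))
    refine ⟨r' * r, fun i => ?_⟩
    rw [map_mul, Module.End.mul_apply]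
    split_ifs with h
    · rw [h, hr']
    · rw [hr (b i) (Submodule.subset_span ⟨i, h, rfl⟩), map_zero]
  choose r hr using this
  refine ⟨∑ j, r j, b.ext fun i => ?_⟩
  rw [map_sum, LinearMap.sum_apply]
  simp [hr]
end burnside

section
variable (K C : Type) [Field K] [Ring C] [Algebra K C] [IsSimpleRing C] [Algebra.IsCentral K C]
  [FiniteDimensional K C]

lemma simple_span {v : C} (hv : v ≠ 0) (w : C) : ∃ r : C ⊗[K] Cᵐᵒᵖ, AlgHom.mulLeftRight K C r v = w := by
  let I : TwoSidedIdeal C := TwoSidedIdeal.mk' {w | ∃ r : C ⊗[K] Cᵐᵒᵖ, AlgHom.mulLeftRight K C r v = w}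
    ⟨0, by simp⟩
    (by rintro x y ⟨r, rfl⟩ ⟨s, rfl⟩; exact ⟨r + s, by simp⟩)
    (by rintro x ⟨r, rfl⟩; exact ⟨-r, by simp⟩)
    (by rintro x _ ⟨r, rfl⟩
        exact ⟨(x ⊗ₜ 1) * r, by rw [map_mul, Module.End.mul_apply, AlgHom.mulLeftRight_apply]; simp⟩)
    (by rintro _ x ⟨r, rfl⟩
        exact ⟨(1 ⊗ₜ (MulOpposite.op x)) * r, by rw [map_mul, Module.End.mul_apply, AlgHom.mulLeftRight_apply]; simp⟩)
  have hI : ∀ x, x ∈ I ↔ ∃ r : C ⊗[K] Cᵐᵒᵖ, AlgHom.mulLeftRight K C r v = x := by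
    intro x
    simp only [I, TwoSidedIdeal.mem_mk']; rfl
  rw [← hI]
  have : I = ⊤ := by
    rcases eq_bot_or_eq_top I with h | h
    · exfalso
      apply hv
      have : v ∈ I := (hI v).2 ⟨1, by simp⟩
      rw [h] at this
      simpa using this
    · exact h
  rw [this]; trivial

lemma mulLR_surj : Function.Surjective (AlgHom.mulLeftRight K C) := by
  apply burnside
  · intro v hv w
    exact simple_span K C hv w
  · intro φ hφ
    have hl : ∀ x y, φ (x * y) = x * φ y := by
      intro x y
      have := LinearMap.congr_fun (hφ (x ⊗ₜ 1)) y
      simpa using this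
    have hr : ∀ x y, φ (y * x) = φ y * x := by
      intro x y
      have := LinearMap.congr_fun (hφ (1 ⊗ₜ (MulOpposite.op x))) y
      simpa using this
    have hc : φ 1 ∈ Subalgebra.center K C := by
      rw [Subalgebra.mem_center_iff]
      intro b
      rw [← hl, ← hr]; simp
    rw [Algebra.IsCentral.center_eq_bot] at hc
    obtain ⟨c, hc⟩ := Algebra.mem_bot.1 hc
    refine ⟨c, fun v => ?_⟩
    have := hr v 1
    rw [one_mul] at this
    rw [this, ← hc, Algebra.smul_def]

def AS (K C : Type) [Field K] [Ring C] [Algebra K C] : Prop :=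
  ∀ (M : Type) [Field M] [Algebra K M], IsSimpleRing (M ⊗[K] C)

lemma lT_mem {M : Type} [Field M] [Algebra K M] (I : TwoSidedIdeal (M ⊗[K] C)) (t : C ⊗[K] Cᵐᵒᵖ)
    {x : M ⊗[K] C} (hx : x ∈ I) : LinearMap.lTensor M (AlgHom.mulLeftRight K C t) x ∈ I := by
  induction t with
  | zero => simp [I.zero_mem]
  | add s t hs ht =>
    rw [map_add, LinearMap.lTensor_add, LinearMap.add_apply]
    exact I.add_mem hs ht
  | tmul a b =>
    have : LinearMap.lTensor M (AlgHom.mulLeftRight K C (a ⊗ₜ b)) x = (1 ⊗ₜ a) * x * (1 ⊗ₜ b.unop) := by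
      clear hx
      induction x with
      | zero => simp
      | add x y hx hy => rw [map_add, hx, hy, mul_add, add_mul]
      | tmul m c => simp [Algebra.TensorProduct.tmul_mul_tmul]
    rw [this]
    exact I.mul_mem_right _ _ (I.mul_mem_left _ _ hx)

lemma CSA_AS : AS K C := by
  classical
  intro M _ _
  let b := Module.finBasis K C
  let B := b.baseChange M
  haveI : Nontrivial (M ⊗[K] C) := inferInstance
  refine ⟨⟨fun I => ?_⟩⟩
  by_cases h : ∃ x ∈ I, x ≠ 0
  · right
    obtain ⟨x, hx, hx0⟩ := h
    obtain ⟨j, hj⟩ : ∃ j, B.repr x j ≠ 0 := by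
      by_contra hcon
      push Not at hcon
      apply hx0
      apply B.repr.injective
      ext j; simp [hcon j]
    obtain ⟨t, ht⟩ := mulLR_surj K C (b.constr K (fun i => if i = j then (1:C) else 0))
    have h1 := lT_mem K C I t hx
    have h2 : LinearMap.lTensor M (AlgHom.mulLeftRight K C t) x = (B.repr x j) ⊗ₜ 1 := by
      conv_lhs => rw [← B.sum_repr x]
      rw [map_sum]
      have h3 : ∀ i, LinearMap.lTensor M (AlgHom.mulLeftRight K C t) (B.repr x i • B i) =
          if i = j then (B.repr x j) ⊗ₜ 1 else 0 := by
        intro i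
        have : B.repr x i • B i = B.repr x i ⊗ₜ (b i) := by
          simp [B, TensorProduct.smul_tmul']
        rw [this, LinearMap.lTensor_tmul, ht, Basis.constr_basis]
        split_ifs with h
        · rw [h]
        · simp
      rw [Finset.sum_congr rfl (fun i _ => h3 i)]
      simp
    rw [h2] at h1
    have h4 : (1 : M ⊗[K] C) ∈ I := by
      have := I.mul_mem_left ((B.repr x j)⁻¹ ⊗ₜ 1) _ h1
      rwa [Algebra.TensorProduct.tmul_mul_tmul, inv_mul_cancel₀ hj, one_mul] at this
    rw [eq_top_iff]
    intro y _
    simpa using I.mul_mem_left y _ h4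
  · left
    push Not at h
    rw [eq_bot_iff]
    intro y hy
    simpa using h y hy
end

lemma AS.baseChange {K C : Type} [Field K] [Ring C] [Algebra K C] (h : AS K C) (F : Type) [Field F] [Algebra K F] :
    AS F (F ⊗[K] C) := by
  intro M _ _
  letI : Algebra K M := ((algebraMap F M).comp (algebraMap K F)).toAlgebra
  haveI : IsScalarTower K F M := IsScalarTower.of_algebraMap_eq (fun _ => rfl)
  haveI := h M
  haveI : Nontrivial (F ⊗[K] C) := (h F).simple.toNontrivial.rec (fun _ => by haveI := h F; infer_instance)
  let f : M ⊗[K] C →ₐ[K] M ⊗[F] (F ⊗[K] C) := Algebra.TensorProduct.lift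
    ((Algebra.TensorProduct.includeLeft (R := F) (S := K) (A := M) (B := F ⊗[K] C)))
    (((Algebra.TensorProduct.includeRight (R := F) (A := M) (B := F ⊗[K] C)).restrictScalars K).comp
      (Algebra.TensorProduct.includeRight (R := K) (A := F) (B := C)))
    (fun x y => by
      simp [Commute, SemiconjBy, Algebra.TensorProduct.tmul_mul_tmul])
  have hf : ∀ m c, f (m ⊗ₜ c) = m ⊗ₜ (1 ⊗ₜ c) := by
    intro m c
    refine (Algebra.TensorProduct.lift_tmul _ _ _ m c).trans ?_
    simp [Algebra.TensorProduct.tmul_mul_tmul]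
  have hs : Function.Surjective f := by
    intro x
    induction x with
    | zero => exact ⟨0, map_zero _⟩
    | add x y hx hy =>
      obtain ⟨x, rfl⟩ := hx
      obtain ⟨y, rfl⟩ := hy
      exact ⟨x + y, map_add _ _ _⟩
    | tmul m y =>
      induction y with
      | zero => exact ⟨0, by simp⟩
      | add x y hx hy =>
        obtain ⟨x, hx⟩ := hx
        obtain ⟨y, hy⟩ := hy
        exact ⟨x + y, by rw [map_add, hx, hy, TensorProduct.tmul_add]⟩
      | tmul a c =>
        refine ⟨(a • m) ⊗ₜ c, ?_⟩
        rw [hf, TensorProduct.smul_tmul, TensorProduct.smul_tmul', smul_eq_mul, mul_one]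
  have hi : Function.Injective f := RingHom.injective f.toRingHom
  exact IsSimpleRing.of_ringEquiv (RingEquiv.ofBijective f ⟨hi, hs⟩) inferInstance

end Prf
set_option linter.all false
set_option linter.unusedVariables false
set_option linter.unusedSimpArgs false
namespace Prf
open scoped TensorProduct
open Module

section
variable (F A : Type) [Field F] [Ring A] [Algebra F A] [IsSimpleRing A] [FiniteDimensional F A]

lemma simple_module_str : ∃ S : Ideal A, 0 < finrank F S ∧
    ∀ (W : Type) [AddCommGroup W] [Module F W] [Module A W] [IsScalarTower F A W] [FiniteDimensional F W],
      ∃ n : ℕ, Nonempty (W ≃ₗ[A] (Fin n → S)) := by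
  haveI : IsArtinianRing A := IsArtinianRing.of_finite F A
  obtain ⟨S, hS⟩ := IsSemisimpleModule.exists_simple_submodule A A
  refine ⟨S, ?_, ?_⟩
  · haveI := IsSimpleModule.nontrivial A S
    exact finrank_pos
  · intro W _ _ _ _ _
    haveI : Module.Finite A W := Module.Finite.of_restrictScalars_finite F A W
    have : IsIsotypicOfType A W S := by
      intro m hm
      obtain ⟨J, ⟨e⟩⟩ := IsSemisimpleRing.exists_linearEquiv_ideal_of_isSimpleModule A m
      haveI : IsSimpleModule A J := IsSimpleModule.congr e.symm
      obtain ⟨e'⟩ := IsSimpleRing.isIsotypic A A S J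
      exact ⟨e.trans e'⟩
    exact this.linearEquiv_fun

lemma finrank_fun_ideal {S : Ideal A} {W : Type} [AddCommGroup W] [Module F W] [Module A W] [IsScalarTower F A W]
    {n : ℕ} (e : W ≃ₗ[A] (Fin n → S)) : finrank F W = n * finrank F S := by
  rw [(e.restrictScalars F).finrank_eq, finrank_pi_fintype]
  simp

variable {F A}
lemma rep_iso {W₁ W₂ : Type} [AddCommGroup W₁] [Module F W₁] [AddCommGroup W₂] [Module F W₂]
    [FiniteDimensional F W₁] [FiniteDimensional F W₂]
    (ρ₁ : A →ₐ[F] Module.End F W₁) (ρ₂ : A →ₐ[F] Module.End F W₂) (h : finrank F W₁ = finrank F W₂) :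
    ∃ e : W₁ ≃ₗ[F] W₂, ∀ a w, e (ρ₁ a w) = ρ₂ a (e w) := by
  letI : Module A W₁ := Module.compHom W₁ ρ₁.toRingHom
  letI : Module A W₂ := Module.compHom W₂ ρ₂.toRingHom
  haveI : IsScalarTower F A W₁ := ⟨fun x a w => by
    change ρ₁ (x • a) w = x • ρ₁ a w
    simp⟩
  haveI : IsScalarTower F A W₂ := ⟨fun x a w => by
    change ρ₂ (x • a) w = x • ρ₂ a w
    simp⟩
  obtain ⟨S, hS0, hS⟩ := simple_module_str F A
  obtain ⟨n₁, ⟨e₁⟩⟩ := hS W₁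
  obtain ⟨n₂, ⟨e₂⟩⟩ := hS W₂
  have h1 := finrank_fun_ideal F A e₁
  have h2 := finrank_fun_ideal F A e₂
  have h3 : n₁ = n₂ := by
    apply Nat.eq_of_mul_eq_mul_right hS0
    rw [← h1, ← h2, h]
  subst h3
  exact ⟨(e₁.trans e₂.symm).restrictScalars F, fun a w => (e₁.trans e₂.symm).map_smul a w⟩

/-- representation of dimension `d` -/
def HasRep (F A : Type) [Field F] [Ring A] [Algebra F A] (d : ℕ) : Prop :=
  Nonempty (A →ₐ[F] Matrix (Fin d) (Fin d) F)

lemma HasRep.of_end {F A : Type} [Field F] [Ring A] [Algebra F A] {W : Type} [AddCommGroup W] [Module F W] [FiniteDimensional F W]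
    (ρ : A →ₐ[F] Module.End F W) : HasRep F A (finrank F W) :=
  ⟨(LinearMap.toMatrixAlgEquiv (finBasis F W)).toAlgHom.comp ρ⟩

lemma HasRep.end {F A : Type} [Field F] [Ring A] [Algebra F A] {d : ℕ} (h : HasRep F A d) :
    Nonempty (A →ₐ[F] Module.End F (Fin d → F)) := by
  obtain ⟨f⟩ := h
  exact ⟨(Matrix.toLinAlgEquiv (Pi.basisFun F (Fin d))).toAlgHom.comp f⟩

lemma hasRep_iff (F A : Type) [Field F] [Ring A] [Algebra F A] [IsSimpleRing A] [FiniteDimensional F A] :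
    ∃ δ : ℕ, ∀ d, HasRep F A d ↔ δ ∣ d := by
  obtain ⟨S, hS0, hS⟩ := simple_module_str F A
  refine ⟨finrank F S, fun d => ⟨fun h => ?_, ?_⟩⟩
  · obtain ⟨ρ⟩ := h.end
    letI : Module A (Fin d → F) := Module.compHom (Fin d → F) ρ.toRingHom
    haveI : IsScalarTower F A (Fin d → F) := ⟨fun x a w => by
      change ρ (x • a) w = x • ρ a w
      simp⟩
    obtain ⟨n, ⟨e⟩⟩ := hS (Fin d → F)
    have := finrank_fun_ideal F A e
    rw [finrank_fin_fun] at this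
    exact ⟨n, by rw [this, mul_comm]⟩
  · rintro ⟨n, rfl⟩
    have h := HasRep.of_end (Algebra.lsmul F (A := A) F (Fin n → S))
    have h2 : finrank F (Fin n → S) = finrank F S * n := by
      rw [finrank_pi_fintype]; simp [mul_comm]
    rwa [h2] at h

lemma HasRep.le {F A : Type} [Field F] [Ring A] [Algebra F A] [IsSimpleRing A] [FiniteDimensional F A]
    {d n : ℕ} (hd : 0 < d) (h : HasRep F A d) (hn : finrank F A = n^2) : n ≤ d := by
  obtain ⟨f⟩ := h
  haveI : NeZero d := ⟨hd.ne'⟩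
  have hi : Function.Injective f := RingHom.injective f.toRingHom
  have := LinearMap.finrank_le_finrank_of_injective (f := f.toLinearMap) hi
  rw [finrank_matrix] at this
  simp [hn] at this
  nlinarith

lemma HasRep.surj {F A : Type} [Field F] [Ring A] [Algebra F A] [IsSimpleRing A] [FiniteDimensional F A]
    {n : ℕ} (hn0 : 0 < n) (f : A →ₐ[F] Matrix (Fin n) (Fin n) F) (hn : finrank F A = n^2) : Function.Bijective f := by
  haveI : NeZero n := ⟨hn0.ne'⟩
  have hi : Function.Injective f := RingHom.injective f.toRingHom
  refine ⟨hi, ?_⟩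
  have := (LinearMap.injective_iff_surjective_of_finrank_eq_finrank (f := f.toLinearMap) ?_).1 hi
  · exact this
  · rw [hn, finrank_matrix]; simp [sq]
end

/-- splitting -/
def Spl (K C E : Type) [Field K] [Ring C] [Algebra K C] [Field E] [Algebra K E] (d : ℕ) : Prop :=
  Nonempty (C →ₐ[K] Matrix (Fin d) (Fin d) E)

section
variable {K C E : Type} [Field K] [Ring C] [Algebra K C] [Field E] [Algebra K E] {d : ℕ}

/-- extension of a homomorphism -/
noncomputable def ext (f : C →ₐ[K] Matrix (Fin d) (Fin d) E) : E ⊗[K] C →ₐ[E] Matrix (Fin d) (Fin d) E :=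
  Algebra.TensorProduct.lift (Algebra.ofId E _) f (fun x y => Algebra.commutes _ _)

@[simp] lemma ext_tmul (f : C →ₐ[K] Matrix (Fin d) (Fin d) E) (x : E) (y : C) : ext f (x ⊗ₜ y) = x • f y := by
  refine (Algebra.TensorProduct.lift_tmul _ _ _ x y).trans ?_
  rw [Algebra.smul_def]; rfl

lemma Spl_iff : Spl K C E d ↔ HasRep E (E ⊗[K] C) d := by
  constructor
  · rintro ⟨f⟩; exact ⟨ext f⟩
  · rintro ⟨f⟩
    exact ⟨(f.restrictScalars K).comp Algebra.TensorProduct.includeRight⟩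

lemma Spl_self : Spl K C K d ↔ HasRep K C d := Iff.rfl

lemma Spl_tower {F : Type} [Field F] [Algebra K F] [Algebra F E] [IsScalarTower K F E] :
    Spl F (F ⊗[K] C) E d ↔ Spl K C E d := by
  constructor
  · rintro ⟨f⟩
    exact ⟨(f.restrictScalars K).comp Algebra.TensorProduct.includeRight⟩
  · rintro ⟨f⟩
    exact ⟨Algebra.TensorProduct.lift (Algebra.ofId F _) f (fun x y => Algebra.commutes _ _)⟩

lemma Spl.map {E' : Type} [Field E'] [Algebra K E'] (h : Spl K C E d) (g : E →ₐ[K] E') : Spl K C E' d := by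
  obtain ⟨f⟩ := h
  exact ⟨g.mapMatrix.comp f⟩

/-- restricted representation -/
noncomputable def rrep (f : C →ₐ[K] Matrix (Fin d) (Fin d) E) : C →ₐ[K] Module.End K (Fin d → E) :=
    { toFun := fun c => ((Matrix.toLin' (f c)).restrictScalars K)
      map_one' := by rw [map_one, Matrix.toLin'_one]; rfl
      map_zero' := by rw [map_zero, map_zero]; rfl
      map_mul' := fun x y => by rw [map_mul, Matrix.toLin'_mul]; rfl
      map_add' := fun x y => by rw [map_add, map_add]; rfl
      commutes' := fun r => by
        refine LinearMap.ext fun w => ?_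
        simp only [AlgHom.commutes, LinearMap.coe_restrictScalars, Matrix.toLin'_apply,
          Module.algebraMap_end_apply]
        rw [Algebra.algebraMap_eq_smul_one, Matrix.smul_mulVec, Matrix.one_mulVec] }

/-- restriction of scalars -/
lemma Spl.restrict [FiniteDimensional K E] (h : Spl K C E d) : HasRep K C (d * finrank K E) := by
  obtain ⟨f⟩ := h
  let g := rrep f
  have := HasRep.of_end g
  rwa [show finrank K (Fin d → E) = d * finrank K E by rw [finrank_pi_fintype]; simp] at this
end

/-- dimension is a square -/
lemma AS.sq {K C : Type} [Field K] [Ring C] [Algebra K C] [FiniteDimensional K C] (h : AS K C) :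
    ∃ n, 0 < n ∧ finrank K C = n^2 ∧ Spl K C (AlgebraicClosure K) n := by
  haveI := h (AlgebraicClosure K)
  obtain ⟨n, hn, ⟨e⟩⟩ := IsSimpleRing.exists_algEquiv_matrix_of_isAlgClosed (AlgebraicClosure K) (AlgebraicClosure K ⊗[K] C)
  refine ⟨n, Nat.pos_of_ne_zero hn.1, ?_, Spl_iff.2 ⟨e.toAlgHom⟩⟩
  have := e.toLinearEquiv.finrank_eq
  rw [finrank_baseChange, finrank_matrix] at this
  simpa [_root_.sq] using this

/-- S1 -/
lemma embed_of_Spl {K C F : Type} [Field K] [Ring C] [Algebra K C] [IsSimpleRing C] [FiniteDimensional K C]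
    [Field F] [Algebra K F] [FiniteDimensional K F] {n : ℕ} (hn : finrank K C = n^2) (hF : finrank K F = n)
    (h : Spl K C F n) : ∃ f : F →ₐ[K] C, Function.Injective f := by
  obtain ⟨f⟩ := h
  let g := rrep f
  obtain ⟨e, he⟩ := rep_iso g (Algebra.lmul K C) (by
    rw [hn, finrank_pi_fintype]; simp [hF, sq])
  have hg : ∀ c (x : F) w, g c (x • w) = x • g c w := fun c x w => (Matrix.toLin' (f c)).map_smul x w
  have key : ∀ (x : F) (c : C), e (x • e.symm c) = c * e (x • e.symm 1) := by
    intro x c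
    have h1 : e.symm c = g c (e.symm 1) := by
      apply e.injective
      rw [he]; simp
    rw [h1, ← hg, he]; rfl
  refine ⟨{ toFun := fun x => e (x • e.symm 1)
            map_one' := by simp
            map_zero' := by simp
            map_mul' := fun x y => by
              rw [← key, LinearEquiv.symm_apply_apply, mul_comm, mul_smul, smul_comm]
            map_add' := fun x y => by rw [add_smul, map_add]
            commutes' := fun r => by
              rw [algebraMap_smul, map_smul, LinearEquiv.apply_symm_apply, Algebra.algebraMap_eq_smul_one] }, ?_⟩
  haveI : Nontrivial C := inferInstance
  exact RingHom.injective _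
end Prf
set_option linter.all false
set_option linter.unusedVariables false
set_option linter.unusedSimpArgs false
namespace Prf
open scoped TensorProduct
open Module Polynomial

section conv
variable {F C V : Type} [Field F] [CharZero F] [Ring C] [Algebra F C] [AddCommGroup V] [Module F V]
  [FiniteDimensional F V] {ζ a b : F} {q n : ℕ}

lemma op_comm_aeval {X : Module.End F V} {T : Module.End F V} (h : T * X = X * T) (y : F[X]) :
    T * aeval X y = aeval X y * T := by
  induction y using Polynomial.induction_on' with
  | add p r hp hr => rw [map_add, mul_add, add_mul, hp, hr]
  | monomial k c =>
    have h1 : Commute T (X^k) := (show Commute T X from h).pow_right k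
    rw [aeval_monomial, ← mul_assoc, ← (Algebra.commutes c T), mul_assoc, mul_assoc, h1.eq]

lemma op_twist {X Y : Module.End F V} (h : Y * X = ζ • (X * Y)) (k : ℕ) (y : F[X]) :
    Y^k * aeval X y = aeval X (y.comp (Polynomial.C (ζ^k) * Polynomial.X)) * Y^k := by
  have h0 : Y^k * X = ζ^k • (X * Y^k) := by
    induction k with
    | zero => simp
    | succ k ih =>
      rw [pow_succ, mul_assoc, h, mul_smul_comm, ← mul_assoc, ih, pow_succ, smul_mul_assoc, smul_smul, mul_comm, mul_assoc]
  have h1 : ∀ m, Y^k * X^m = (ζ^k)^m • (X^m * Y^k) := by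
    intro m
    induction m with
    | zero => simp
    | succ m ih =>
      rw [pow_succ, ← mul_assoc, ih, smul_mul_assoc, mul_assoc, h0, mul_smul_comm, smul_smul, ← mul_assoc, pow_succ]
  induction y using Polynomial.induction_on' with
  | add p r hp hr => rw [map_add, mul_add, add_comp, map_add, add_mul, hp, hr]
  | monomial m c =>
    rw [monomial_comp, mul_pow, ← C_pow, map_mul, map_mul, aeval_C, aeval_C, aeval_X_pow, map_pow, aeval_monomial,
      ← mul_assoc, ← (Algebra.commutes c (Y^k)), mul_assoc, h1]
    simp only [Algebra.algebraMap_eq_smul_one, smul_mul_assoc, one_mul, mul_assoc, _root_.smul_pow, one_pow]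

lemma split_of_NF (hq : q.Prime) (hζ : IsPrimitiveRoot ζ q) (ha : a ≠ 0) (hb : b ≠ 0) (hV : finrank F V = n * q)
    (ρ : C →ₐ[F] Module.End F V) (X Y : Module.End F V) (hX : ∀ c, X * ρ c = ρ c * X) (hY : ∀ c, Y * ρ c = ρ c * Y)
    (hXq : X^q = a • 1) (hYq : Y^q = b • 1) (hYX : Y * X = ζ • (X * Y)) (h : NF ζ q a b) : HasRep F C n := by
  obtain ⟨y, hy⟩ := h.inv hq.ne_zero hb
  set u := aeval X y with hu
  set Z := u * Y with hZ
  have hZk : ∀ k, Z^k = aeval X (∏ i ∈ Finset.range k, y.comp (Polynomial.C (ζ ^ i) * Polynomial.X)) * Y^k := by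
    intro k
    induction k with
    | zero => simp
    | succ k ih =>
      rw [pow_succ, ih, Finset.prod_range_succ, map_mul, hZ, mul_assoc, ← mul_assoc (Y^k), hu, op_twist hYX, pow_succ]
      simp only [mul_assoc]
  have hZq : Z^q = 1 := by
    rw [hZk]
    obtain ⟨r, hr⟩ := hy
    have h1 : npol ζ q y = (Polynomial.X^q - Polynomial.C a) * r + Polynomial.C b⁻¹ := by rw [← hr]; ring
    change aeval X (npol ζ q y) * Y^q = 1
    rw [h1, map_add, map_mul, map_sub, map_pow, aeval_X, aeval_C, aeval_C, hXq, hYq]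
    simp [Algebra.algebraMap_eq_smul_one, smul_smul, hb]
  have hZρ : ∀ c, Z * ρ c = ρ c * Z := by
    intro c
    rw [hZ, mul_assoc, hY, ← mul_assoc, hu, ← op_comm_aeval (hX c).symm, mul_assoc]
  have hZX : Z * X = ζ • (X * Z) := by
    rw [hZ, mul_assoc, hYX, mul_smul_comm, ← mul_assoc, hu, ← op_comm_aeval rfl, mul_assoc]
  have hZX' : ∀ k, Z^k * X = ζ^k • (X * Z^k) := by
    intro k
    induction k with
    | zero => simp
    | succ k ih =>
      rw [pow_succ, mul_assoc, hZX, mul_smul_comm, ← mul_assoc, ih, pow_succ, smul_mul_assoc, smul_smul, mul_comm, mul_assoc]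
  have hXinv : X * (a⁻¹ • X^(q-1)) = 1 := by
    rw [mul_smul_comm, ← pow_succ', Nat.sub_add_cancel hq.one_le, hXq, smul_smul, inv_mul_cancel₀ ha, one_smul]
  have hXinv' : (a⁻¹ • X^(q-1)) * X = 1 := by
    rw [smul_mul_assoc, ← pow_succ, Nat.sub_add_cancel hq.one_le, hXq, smul_smul, inv_mul_cancel₀ ha, one_smul]
  have htr : ∀ i, 0 < i → i < q → LinearMap.trace F V (Z^i) = 0 := by
    intro i hi hiq
    have h1 : LinearMap.trace F V (Z^i) = ζ^i * LinearMap.trace F V (Z^i) := by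
      conv_lhs => rw [← mul_one (Z^i), ← hXinv, ← mul_assoc, hZX', smul_mul_assoc, map_smul, LinearMap.trace_mul_comm,
        ← mul_assoc, hXinv', one_mul]
      rfl
    have h2 : ζ^i ≠ 1 := hζ.pow_ne_one_of_pos_of_lt hi.ne' hiq
    have h3 : (1 - ζ^i) * LinearMap.trace F V (Z^i) = 0 := by rw [sub_mul, one_mul, ← h1, sub_self]
    rcases mul_eq_zero.1 h3 with h | h
    · exact absurd (sub_eq_zero.1 h).symm h2
    · exact h
  have hq0 : (q : F) ≠ 0 := by exact_mod_cast hq.ne_zero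
  set e : Module.End F V := (q : F)⁻¹ • ∑ i ∈ Finset.range q, Z^i with he
  have hZe : Z * e = e := by
    rw [he, mul_smul_comm, Finset.mul_sum]
    congr 1
    have h1 := Finset.sum_range_succ (fun i => Z^i) q
    have h2 := Finset.sum_range_succ' (fun i => Z^i) q
    rw [h1, hZq, pow_zero] at h2
    have h3 := add_right_cancel h2
    rw [h3]
    exact Finset.sum_congr rfl (fun i _ => (pow_succ' Z i).symm)
  have hZie : ∀ i, Z^i * e = e := by
    intro i
    induction i with
    | zero => simp
    | succ i ih => rw [pow_succ, mul_assoc, hZe, ih]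
  have hee : e * e = e := by
    conv_lhs => rw [he]
    rw [smul_mul_assoc, Finset.sum_mul, Finset.sum_congr rfl (fun i _ => hZie i), Finset.sum_const, Finset.card_range,
      ← Nat.cast_smul_eq_nsmul F, smul_smul, inv_mul_cancel₀ hq0, one_smul]
  have heρ : ∀ c, e * ρ c = ρ c * e := by
    intro c
    rw [he, smul_mul_assoc, mul_smul_comm, Finset.sum_mul, Finset.mul_sum]
    congr 1
    exact Finset.sum_congr rfl (fun i _ => ((show Commute Z (ρ c) from hZρ c).pow_left i).eq)
  have htre : LinearMap.trace F V e = n := by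
    rw [he, map_smul, map_sum, Finset.sum_eq_single 0]
    · rw [pow_zero, LinearMap.trace_one, hV]
      push_cast
      rw [smul_eq_mul]; field_simp
    · intro i hi hi0
      exact htr i (Nat.pos_of_ne_zero hi0) (Finset.mem_range.1 hi)
    · intro h; exact absurd (Finset.mem_range.2 hq.pos) h
  set R := LinearMap.range e with hR
  have hproj : LinearMap.IsProj R e := ⟨fun x => ⟨x, rfl⟩, by
    rintro _ ⟨x, rfl⟩
    exact LinearMap.congr_fun hee x⟩
  have hfr : finrank F R = n := by
    have := hproj.trace
    rw [htre] at this
    exact_mod_cast this.symm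
  have hst : ∀ c, ∀ x ∈ R, ρ c x ∈ R := by
    rintro c _ ⟨x, rfl⟩
    exact ⟨ρ c x, LinearMap.congr_fun (heρ c) x⟩
  let g : C →ₐ[F] Module.End F R :=
    { toFun := fun c => (ρ c).restrict (hst c)
      map_one' := by ext x; simp
      map_zero' := by ext x; simp
      map_mul' := fun x y => by ext z; simp
      map_add' := fun x y => by ext z; simp
      commutes' := fun r => by ext z; simp }
  have := HasRep.of_end g
  rwa [hfr] at this
end conv

section loc
variable {E A V : Type} [Field E] [Ring A] [Algebra E A] [IsSimpleRing A] [FiniteDimensional E A]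
  [AddCommGroup V] [Module E V] [FiniteDimensional E V] {ζ a b : E} {q n : ℕ}

lemma NF_of_rep (hq : q.Prime) (hζ : IsPrimitiveRoot ζ q) (ha : a ≠ 0) (hV : finrank E V = n * q)
    (hn0 : 0 < n) (hA : finrank E A = n^2) (f : A →ₐ[E] Matrix (Fin n) (Fin n) E)
    (ρ : A →ₐ[E] Module.End E V) (X Y : Module.End E V) (hX : ∀ c, X * ρ c = ρ c * X) (hY : ∀ c, Y * ρ c = ρ c * Y)
    (hXq : X^q = a • 1) (hYq : Y^q = b • 1) (hYX : Y * X = ζ • (X * Y)) : NF ζ q a b := by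
  haveI : NeZero n := ⟨hn0.ne'⟩
  let ρ₂ : A →ₐ[E] Module.End E (Matrix (Fin n) (Fin q) E) :=
    { toFun := fun c =>
        { toFun := fun M => f c * M
          map_add' := fun x y => Matrix.mul_add _ _ _
          map_smul' := fun r x => Matrix.mul_smul _ _ _ }
      map_one' := by ext1 M; simp
      map_zero' := by ext1 M; simp
      map_mul' := fun x y => by ext1 M; simp [Matrix.mul_assoc]
      map_add' := fun x y => by ext1 M; simp [Matrix.add_mul]
      commutes' := fun r => by ext1 M; simp [Algebra.algebraMap_eq_smul_one] }
  obtain ⟨e, he⟩ := rep_iso ρ ρ₂ (by rw [hV, finrank_matrix]; simp)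
  obtain ⟨c0, hc0⟩ := (HasRep.surj hn0 f hA).2 (Matrix.single 0 0 1)
  let ι : (Fin q → E) →ₗ[E] V := e.symm.toLinearMap ∘ₗ
    { toFun := fun w => Matrix.of (fun i j => if i = 0 then w j else 0)
      map_add' := fun x y => by ext i j; simp; split_ifs <;> simp
      map_smul' := fun r x => by ext i j; simp }
  let π : V →ₗ[E] (Fin q → E) :=
    { toFun := fun M => M 0
      map_add' := fun x y => rfl
      map_smul' := fun r x => rfl } ∘ₗ e.toLinearMap
  have hπι : π ∘ₗ ι = LinearMap.id := by
    refine LinearMap.ext fun w => funext fun j => ?_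
    change e (e.symm _) 0 j = w j
    rw [LinearEquiv.apply_symm_apply]
    change (if (0 : Fin n) = 0 then w j else 0) = w j
    rw [if_pos rfl]
  have hιπ : ι ∘ₗ π = ρ c0 := by
    refine LinearMap.ext fun v => ?_
    apply e.injective
    rw [he]
    change e (e.symm _) = f c0 * e v
    rw [LinearEquiv.apply_symm_apply, hc0]
    ext i j
    rw [Matrix.mul_apply]
    by_cases hi : i = 0
    · subst hi
      simp [Matrix.single_apply]
      rfl
    · simp [Matrix.single_apply, hi, Ne.symm hi]
  let x : Module.End E V → Module.End E (Fin q → E) := fun T => π ∘ₗ T ∘ₗ ι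
  have hmul : ∀ S T, (S * ρ c0 = ρ c0 * S) → x S * x T = x (S * T) := by
    intro S T hS
    refine LinearMap.ext fun w => ?_
    change π (S (ι (π (T (ι w))))) = π (S (T (ι w)))
    have h1 : ι (π (T (ι w))) = ρ c0 (T (ι w)) := LinearMap.congr_fun hιπ _
    have h2 : S (ρ c0 (T (ι w))) = ρ c0 (S (T (ι w))) := LinearMap.congr_fun hS _
    rw [h1, h2, ← hιπ]
    exact LinearMap.congr_fun hπι _
  have hone : x 1 = 1 := hπι
  have hpow : ∀ S, (S * ρ c0 = ρ c0 * S) → ∀ k, x S ^ k = x (S^k) := by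
    intro S hS k
    induction k with
    | zero => simp [hone]
    | succ k ih => rw [pow_succ', pow_succ', ih, hmul _ _ hS]
  have hsm : ∀ (r : E) S, x (r • S) = r • x S := by
    intro r S
    refine LinearMap.ext fun w => ?_
    change π (r • (S (ι w))) = r • π (S (ι w))
    rw [map_smul]
  refine NF_of_op hζ hq ha (W := Fin q → E) (by simp) (x X) (x Y) ?_ ?_ ?_
  · rw [hpow _ (hX c0), hXq, hsm, hone]
  · rw [hpow _ (hY c0), hYq, hsm, hone]
  · rw [hmul _ _ (hY c0), hYX, hsm, hmul _ _ (hX c0)]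

end loc

section bc
variable {F C V : Type} [Field F] [Ring C] [Algebra F C] [AddCommGroup V] [Module F V]
  [FiniteDimensional F V] [FiniteDimensional F C] {ζ a b : F} {q n : ℕ}

lemma NF_of_Spl (hC : AS F C) (hq : q.Prime) (hζ : IsPrimitiveRoot ζ q) (ha : a ≠ 0) (hV : finrank F V = n * q)
    (hn0 : 0 < n) (hA : finrank F C = n^2)
    (ρ : C →ₐ[F] Module.End F V) (X Y : Module.End F V) (hX : ∀ c, X * ρ c = ρ c * X) (hY : ∀ c, Y * ρ c = ρ c * Y)
    (hXq : X^q = a • 1) (hYq : Y^q = b • 1) (hYX : Y * X = ζ • (X * Y))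
    (E : Type) [Field E] [Algebra F E] (h : Spl F C E n) :
    NF (algebraMap F E ζ) q (algebraMap F E a) (algebraMap F E b) := by
  obtain ⟨f⟩ := Spl_iff.1 h
  haveI := hC E
  let β : Module.End F V →ₐ[F] Module.End E (E ⊗[F] V) := Module.End.baseChangeHom F E V
  let ρE : E ⊗[F] C →ₐ[E] Module.End E (E ⊗[F] V) :=
    Algebra.TensorProduct.lift (Algebra.ofId E _) (β.comp ρ) (fun x y => Algebra.commutes _ _)
  have hρE : ∀ x c, ρE (x ⊗ₜ c) = x • β (ρ c) := by
    intro x c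
    refine (Algebra.TensorProduct.lift_tmul _ _ _ x c).trans ?_
    rw [Algebra.smul_def]; rfl
  have hcomm : ∀ T : Module.End F V, (∀ c, T * ρ c = ρ c * T) → ∀ y, β T * ρE y = ρE y * β T := by
    intro T hT y
    induction y with
    | zero => simp
    | add x y hx hy => rw [map_add, mul_add, add_mul, hx, hy]
    | tmul x c => rw [hρE, mul_smul_comm, smul_mul_assoc, ← map_mul, ← map_mul, hT]
  refine NF_of_rep hq (hζ.map_of_injective (algebraMap F E).injective) (by simpa using ha)
    (V := E ⊗[F] V) (A := E ⊗[F] C) (n := n) (by rw [finrank_baseChange, hV]) hn0 (by rw [finrank_baseChange, hA]) f ρE (β X) (β Y)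
    (hcomm X hX) (hcomm Y hY) ?_ ?_ ?_
  · rw [← map_pow, hXq, map_smul, map_one, algebraMap_smul]
  · rw [← map_pow, hYq, map_smul, map_one, algebraMap_smul]
  · rw [← map_mul, hYX, map_smul, map_mul, algebraMap_smul]
end bc
end Prf
set_option linter.all false
set_option linter.unusedVariables false
set_option linter.unusedSimpArgs false
namespace Prf
open scoped TensorProduct
open Module Polynomial

lemma cyc_data {F C M : Type} [Field F] [Ring C] [Algebra F C] [FiniteDimensional F C] [Field M] [Algebra F M]
    {q n : ℕ} (hC : AS F C) (hn0 : 0 < n) (hA : finrank F C = n^2) (σ : M ≃ₐ[F] M) (hσ : σ^q = 1)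
    (hfix : ∀ m, σ m = m → m ∈ Set.range (algebraMap F M)) (f : C →ₐ[F] Matrix (Fin n) (Fin n) M) :
    ∃ (φ : Module.End F (Fin n → M)) (b : F), b ≠ 0 ∧ (∀ c, φ * rrep f c = rrep f c * φ) ∧ φ^q = b • 1 ∧
      ∀ (m : M) v, φ (m • v) = σ m • φ v := by
  haveI := hC M
  haveI : NeZero n := ⟨hn0.ne'⟩
  let f' : C →ₐ[F] Matrix (Fin n) (Fin n) M := (σ.mapMatrix : _ ≃ₐ[F] Matrix (Fin n) (Fin n) M).toAlgHom.comp f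
  obtain ⟨e, he⟩ := rep_iso (F := M) (A := M ⊗[F] C) (Matrix.toLinAlgEquiv'.toAlgHom.comp (ext f))
    (Matrix.toLinAlgEquiv'.toAlgHom.comp (ext f')) rfl
  have he1 : ∀ c v, e ((f c).mulVec v) = ((f c).map σ).mulVec (e v) := by
    intro c v
    have := he (1 ⊗ₜ c) v
    simpa [f'] using this
  let s : (Fin n → M) →ₗ[F] (Fin n → M) :=
    { toFun := fun v i => σ (v i)
      map_add' := fun x y => by ext i; simp
      map_smul' := fun r x => by ext i; simp }
  have hs1 : ∀ (m : M) v, s (m • v) = σ m • s v := fun m v => by ext i; simp [s]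
  have hs2 : ∀ (A : Matrix (Fin n) (Fin n) M) v, s (A.mulVec v) = (A.map σ).mulVec (s v) := fun A v => by
    ext i; simp [s, Matrix.mulVec, dotProduct]
  let φ : Module.End F (Fin n → M) := (e.symm.toLinearMap.restrictScalars F) ∘ₗ s
  have hφ : ∀ v, φ v = e.symm (s v) := fun v => rfl
  have hφ1 : ∀ (m : M) v, φ (m • v) = σ m • φ v := fun m v => by rw [hφ, hs1, map_smul, hφ]
  have hφ2 : ∀ c v, φ ((f c).mulVec v) = (f c).mulVec (φ v) := fun c v => by
    rw [hφ, hs2]; apply e.injective; rw [he1, hφ]; simp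
  have hinj : Function.Injective φ := by
    intro v w h
    rw [hφ, hφ] at h
    have := e.symm.injective h
    funext i
    exact σ.injective (congrFun this i)
  have hk1 : ∀ k (m : M) v, (φ^k) (m • v) = (σ^k) m • (φ^k) v := by
    intro k
    induction k with
    | zero => intro m v; simp
    | succ k ih => intro m v; rw [pow_succ', Module.End.mul_apply, ih, hφ1, pow_succ']; rfl
  have hk2 : ∀ k c v, (φ^k) ((f c).mulVec v) = (f c).mulVec ((φ^k) v) := by
    intro k
    induction k with
    | zero => intro m v; simp
    | succ k ih => intro m v; rw [pow_succ', Module.End.mul_apply, ih, hφ2]; rfl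
  let P : Module.End M (Fin n → M) :=
    { toFun := fun v => (φ^q) v
      map_add' := fun x y => map_add _ _ _
      map_smul' := fun m v => by rw [hk1, hσ]; rfl }
  have hsur := (HasRep.surj hn0 (ext f) (by rw [finrank_baseChange, hA])).2
  have hPc : ∀ y : M ⊗[F] C, ∀ v, P ((ext f y).mulVec v) = (ext f y).mulVec (P v) := by
    intro y
    induction y with
    | zero => intro v; simp
    | add x y hx hy => intro v; rw [map_add, Matrix.add_mulVec, map_add, hx, hy, Matrix.add_mulVec]
    | tmul x c =>
      intro v
      rw [ext_tmul, Matrix.smul_mulVec, Matrix.smul_mulVec, map_smul]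
      congr 1
      exact hk2 q c v
  have hcen : P ∈ Subalgebra.center M (Module.End M (Fin n → M)) := by
    rw [Subalgebra.mem_center_iff]
    intro T
    obtain ⟨y, hy⟩ := hsur (LinearMap.toMatrix' T)
    refine LinearMap.ext fun v => ?_
    have h2 : ∀ v, T v = (ext f y).mulVec v := fun v => by
      rw [hy, ← Matrix.toLin'_apply, Matrix.toLin'_toMatrix']
    rw [Module.End.mul_apply, Module.End.mul_apply, h2, h2, hPc]
  rw [Algebra.IsCentral.center_eq_bot, Algebra.mem_bot] at hcen
  obtain ⟨b, hb⟩ := hcen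
  have hb1 : ∀ v, (φ^q) v = b • v := fun v => by
    have : P v = b • v := by rw [← hb]; rfl
    exact this
  have hex : ∃ v : Fin n → M, v ≠ 0 := ⟨1, one_ne_zero⟩
  obtain ⟨v, hv⟩ := hex
  have hφv : φ v ≠ 0 := fun h => hv (hinj (by rw [h, map_zero]))
  have hbσ : σ b = b := by
    have h1 : φ ((φ^q) v) = (φ^q) (φ v) := by
      rw [← Module.End.mul_apply, ← Module.End.mul_apply, ← pow_succ', ← pow_succ]
    rw [hb1, hb1, hφ1] at h1
    exact smul_left_injective M hφv h1
  obtain ⟨b0, hb0⟩ := hfix b hbσ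
  refine ⟨φ, b0, ?_, ?_, ?_, hφ1⟩
  · rintro rfl
    have hpi : Function.Injective (φ^q) := by
      rw [Module.End.coe_pow]; exact hinj.iterate q
    apply hv
    apply hpi
    rw [hb1, ← hb0, map_zero, zero_smul, map_zero]
  · intro c
    refine LinearMap.ext fun v => ?_
    exact hφ2 c v
  · refine LinearMap.ext fun v => ?_
    rw [hb1, ← hb0, algebraMap_smul]
    rfl

/-- The main cyclic step. -/
lemma cyc_step {F C M : Type} [Field F] [CharZero F] [Ring C] [Algebra F C] [FiniteDimensional F C] [Field M] [Algebra F M]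
    [FiniteDimensional F M]
    {q n : ℕ} (hC : AS F C) (hn0 : 0 < n) (hA : finrank F C = n^2) (σ : M ≃ₐ[F] M) (hσ : σ^q = 1)
    (hfix : ∀ m, σ m = m → m ∈ Set.range (algebraMap F M)) (hq : q.Prime) (hM : finrank F M = q)
    (α : M) (a ζ : F) (hζ : IsPrimitiveRoot ζ q) (ha : a ≠ 0) (hα : α^q = algebraMap F M a) (hσα : σ α = algebraMap F M ζ * α)
    (hs : Spl F C M n) (hns : ¬ Spl F C F n) :
    ∃ b : F, b ≠ 0 ∧ ¬ NF ζ q a b ∧ ∀ (E : Type) [Field E] [Algebra F E], Spl F C E n →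
      NF (algebraMap F E ζ) q (algebraMap F E a) (algebraMap F E b) := by
  obtain ⟨f⟩ := hs
  obtain ⟨φ, b, hb, h1, h2, h3⟩ := cyc_data hC hn0 hA σ hσ hfix f
  have hV : finrank F (Fin n → M) = n * q := by rw [finrank_pi_fintype]; simp [hM]
  have hX : ∀ c, Algebra.lsmul F F (Fin n → M) α * rrep f c = rrep f c * Algebra.lsmul F F (Fin n → M) α := by
    intro c
    refine LinearMap.ext fun v => ?_
    change α • ((Matrix.toLin' (f c)) v) = (Matrix.toLin' (f c)) (α • v)
    rw [map_smul]
  have hXq : (Algebra.lsmul F F (Fin n → M) α)^q = a • 1 := by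
    rw [← map_pow, hα]
    refine LinearMap.ext fun v => ?_
    change algebraMap F M a • v = a • v
    rw [algebraMap_smul]
  have hYX : φ * Algebra.lsmul F F (Fin n → M) α = ζ • (Algebra.lsmul F F (Fin n → M) α * φ) := by
    refine LinearMap.ext fun v => ?_
    change φ (α • v) = ζ • (α • φ v)
    rw [h3, hσα, mul_smul, algebraMap_smul]
  refine ⟨b, hb, fun hN => hns ?_, fun E _ _ hE => ?_⟩
  · have := split_of_NF hq hζ ha hb hV (rrep f) _ φ hX h1 hXq h2 hYX hN
    exact Spl_self.2 this
  · exact NF_of_Spl hC hq hζ ha hV hn0 hA (rrep f) _ φ hX h1 hXq h2 hYX E hE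
end Prf
set_option linter.all false
set_option linter.unusedVariables false
set_option linter.unusedSimpArgs false
namespace Prf
open scoped TensorProduct
open Module Polynomial IntermediateField

lemma qgroup_step {F C E : Type} [Field F] [CharZero F] [Ring C] [Algebra F C] [FiniteDimensional F C] [IsSimpleRing C]
    [Field E] [Algebra F E] [FiniteDimensional F E] [IsGalois F E] {n : ℕ} (hA : finrank F C = n^2)
    (hns : ¬ Spl F C F n) (hmin : ∀ M : IntermediateField F E, M ≠ ⊥ → Spl F C M n) :
    ∃ q, q.Prime ∧ q ∣ n ∧ ∃ k, finrank F E = q^k := by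
  obtain ⟨δ, hδ⟩ := hasRep_iff F C
  have h1 : ¬ δ ∣ n := fun h => hns (Spl_self.2 ((hδ n).2 h))
  have h2 : δ ∣ n^2 := by
    rw [← hδ, ← hA]; exact HasRep.of_end (Algebra.lmul F C)
  rw [Nat.dvd_iff_prime_pow_dvd_dvd] at h1
  push Not at h1
  obtain ⟨q, k, hq, hk1, hk2⟩ := h1
  have hk0 : k ≠ 0 := by rintro rfl; simp at hk2
  haveI : Fact q.Prime := ⟨hq⟩
  refine ⟨q, hq, hq.dvd_of_dvd_pow (((dvd_pow_self q hk0).trans hk1).trans h2), ?_⟩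
  let P : Sylow q (E ≃ₐ[F] E) := default
  have hdeg := finrank_eq_fixingSubgroup_index E (fixedField (P : Subgroup (E ≃ₐ[F] E)))
  rw [fixingSubgroup_fixedField] at hdeg
  have hnd := P.not_dvd_index
  rw [← hdeg] at hnd
  have hbot : fixedField (P : Subgroup (E ≃ₐ[F] E)) = ⊥ := by
    by_contra hne
    have h3 := (hδ _).1 ((hmin _ hne).restrict)
    apply hk2
    exact Nat.Coprime.dvd_of_dvd_mul_right (Nat.Coprime.pow_left k ((Nat.Prime.coprime_iff_not_dvd hq).2 hnd)) (hk1.trans h3)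
  refine ⟨(Nat.card (E ≃ₐ[F] E)).factorization q, ?_⟩
  · have h4 := P.card_eq_multiplicity
    have h5 : (P : Subgroup (E ≃ₐ[F] E)).index = 1 := by rw [← hdeg, hbot]; exact IntermediateField.finrank_bot
    have h6 := (P : Subgroup (E ≃ₐ[F] E)).card_mul_index
    rw [h5, mul_one, IsGalois.card_aut_eq_finrank] at h6
    rw [← h6]; exact h4

lemma zeta_mem {F E : Type} [Field F] [CharZero F] [Field E] [Algebra F E] [FiniteDimensional F E] {q k : ℕ} (hq : q.Prime)
    (hk : finrank F E = q^k) {ζ : E} (hζ : IsPrimitiveRoot ζ q) : ∃ z : F, IsPrimitiveRoot z q := by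
  have hintg : IsIntegral F ζ := Algebra.IsIntegral.isIntegral ζ
  have h1 := adjoin.finrank hintg
  have h2 : minpoly F ζ ∣ cyclotomic q F := by
    apply minpoly.dvd
    haveI : NeZero (q : E) := ⟨by haveI : CharZero E := charZero_of_injective_algebraMap (algebraMap F E).injective
                                  exact_mod_cast hq.ne_zero⟩
    have := hζ.isRoot_cyclotomic hq.pos
    rw [IsRoot.def, ← map_cyclotomic q (algebraMap F E), eval_map_algebraMap] at this
    exact this
  have h3 := natDegree_le_of_dvd h2 (cyclotomic_ne_zero q F)
  rw [natDegree_cyclotomic, Nat.totient_prime hq, ← h1] at h3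
  have h4 : finrank F F⟮ζ⟯ ∣ q^k := by rw [← hk, ← finrank_mul_finrank F F⟮ζ⟯ E]; exact dvd_mul_right _ _
  obtain ⟨j, hj, hj2⟩ := (Nat.dvd_prime_pow hq).1 h4
  have hj0 : j = 0 := by
    by_contra hj0
    have := Nat.le_of_dvd (by rw [hj2]; exact pow_pos hq.pos _) (hj2 ▸ dvd_pow_self q hj0)
    have := hq.pos
    omega
  rw [hj0, pow_zero, IntermediateField.finrank_eq_one_iff] at hj2
  have h5 : ζ ∈ (⊥ : IntermediateField F E) := hj2 ▸ mem_adjoin_simple_self F ζ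
  obtain ⟨z, rfl⟩ := mem_bot.1 h5
  exact ⟨z, hζ.of_map_of_injective (algebraMap F E).injective⟩

lemma cyc_exists {F E : Type} [Field F] [CharZero F] [Field E] [Algebra F E] [FiniteDimensional F E] [IsGalois F E] {q k : ℕ}
    (hq : q.Prime) (hk : finrank F E = q^k) (hk0 : k ≠ 0) {z : F} (hz : IsPrimitiveRoot z q) :
    ∃ (M : IntermediateField F E) (σ : M ≃ₐ[F] M) (α : M) (a ζ : F), finrank F M = q ∧ σ^q = 1 ∧
      (∀ m, σ m = m → m ∈ Set.range (algebraMap F M)) ∧ IsPrimitiveRoot ζ q ∧ a ≠ 0 ∧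
      α^q = algebraMap F M a ∧ σ α = algebraMap F M ζ * α := by
  haveI : Fact q.Prime := ⟨hq⟩
  have hG : Nat.card (E ≃ₐ[F] E) = q^k := by rw [IsGalois.card_aut_eq_finrank, hk]
  obtain ⟨k, rfl⟩ := Nat.exists_eq_succ_of_ne_zero hk0
  obtain ⟨H, hH⟩ := Sylow.exists_subgroup_card_pow_prime q (G := E ≃ₐ[F] E) (n := k) (by rw [hG]; exact pow_dvd_pow q (Nat.le_succ k))
  have hidx : H.index = q := by
    have := H.card_mul_index
    rw [hH, hG, pow_succ] at this
    exact Nat.eq_of_mul_eq_mul_left (pow_pos hq.pos k) this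
  haveI : H.Normal := Subgroup.normal_of_index_eq_minFac_card (by rw [hidx, hG, Nat.Prime.pow_minFac hq (Nat.succ_ne_zero k)])
  haveI := IsGalois.of_fixedField_normal_subgroup H
  set M := fixedField H with hM
  have hdeg : finrank F M = q := by
    rw [finrank_eq_fixingSubgroup_index E M, hM, fixingSubgroup_fixedField, hidx]
  have hcard : Nat.card (M ≃ₐ[F] M) = q := by rw [IsGalois.card_aut_eq_finrank, hdeg]
  haveI : IsCyclic (M ≃ₐ[F] M) := isCyclic_of_prime_card hcard
  obtain ⟨α, ⟨a, ha⟩, hα⟩ := exists_root_adjoin_eq_top_of_isCyclic F M ⟨z, by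
    rw [hdeg, mem_primitiveRoots hq.pos]; exact hz⟩
  rw [hdeg] at ha
  have hαF : α ∉ (⊥ : IntermediateField F M) := by
    intro h
    rw [← adjoin_simple_eq_bot_iff, hα] at h
    have h2 : finrank F (⊤ : IntermediateField F M) = 1 := by rw [h]; exact IntermediateField.finrank_bot
    rw [finrank_top', hdeg] at h2
    exact hq.one_lt.ne' h2
  have hα0 : α ≠ 0 := fun h => hαF (h ▸ zero_mem _)
  rw [IsGalois.mem_bot_iff_fixed] at hαF
  push Not at hαF
  obtain ⟨σ, hσ⟩ := hαF
  have hq1 : (σ α / α)^q = 1 := by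
    rw [div_pow, ← map_pow, ← ha, σ.commutes, div_self]
    rw [ha]; exact pow_ne_zero _ hα0
  have hzM : IsPrimitiveRoot (algebraMap F M z) q := hz.map_of_injective (algebraMap F M).injective
  obtain ⟨i, hi, hi2⟩ := hzM.eq_pow_of_pow_eq_one hq1
  have hz1 : z^i ≠ 1 := by
    intro h
    rw [← map_pow, h, map_one] at hi2
    exact hσ ((div_eq_one_iff_eq hα0).1 hi2.symm)
  have hzq : (z^i)^q = 1 := by rw [← pow_mul, mul_comm, pow_mul, hz.pow_eq_one, one_pow]
  have hσ1 : σ ≠ 1 := by rintro rfl; exact hσ rfl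
  refine ⟨M, σ, α, a, z^i, hdeg, ?_, ?_, ?_, ?_, ha.symm, ?_⟩
  · rw [← hcard]; exact pow_card_eq_one'
  · intro m hm
    rw [← mem_bot, IsGalois.mem_bot_iff_fixed]
    intro τ
    obtain ⟨j, rfl⟩ := mem_powers_of_prime_card hcard hσ1 (g' := τ)
    clear hσ1
    change (σ^j) m = m
    induction j with
    | zero => rfl
    | succ j ih => rw [pow_succ]; change (σ^j) (σ m) = m; rw [hm, ih]
  · rw [← orderOf_eq_prime hzq hz1]; exact IsPrimitiveRoot.orderOf _
  · rintro rfl; rw [map_zero] at ha; exact hα0 (pow_eq_zero_iff hq.ne_zero |>.1 ha.symm)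
  · rw [map_pow, hi2, div_mul_cancel₀ _ hα0]

lemma thmS_aux {F C E : Type} [Field F] [CharZero F] [Ring C] [Algebra F C] [FiniteDimensional F C]
    [Field E] [Algebra F E] [FiniteDimensional F E] [IsGalois F E] {n : ℕ} (hC : AS F C) [IsSimpleRing C] (hn0 : 0 < n) (hA : finrank F C = n^2)
    (hns : ¬ Spl F C F n) (hmin : ∀ M : IntermediateField F E, M ≠ ⊥ → Spl F C M n) {ξ : E} (hξ : IsPrimitiveRoot ξ n)
    (hE : Spl F C E n) :
    ∃ q, q.Prime ∧ q ∣ n ∧ ∃ ζ a b : F, IsPrimitiveRoot ζ q ∧ a ≠ 0 ∧ b ≠ 0 ∧ ¬ NF ζ q a b ∧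
      ∀ (E : Type) [Field E] [Algebra F E], Spl F C E n →
      NF (algebraMap F E ζ) q (algebraMap F E a) (algebraMap F E b) := by
  obtain ⟨q, hq, hqn, k, hk⟩ := qgroup_step hA hns hmin
  have hk0 : k ≠ 0 := by
    rintro rfl
    rw [pow_zero] at hk
    apply hns
    have h2 := hE.restrict
    rw [hk, mul_one] at h2
    exact h2
  have hqn' : IsPrimitiveRoot (ξ^(n/q)) q := hξ.pow hn0 (Nat.div_mul_cancel hqn).symm
  obtain ⟨z, hz⟩ := zeta_mem hq hk hqn'
  obtain ⟨M, σ, α, a, ζ, hM, hσ, hfix, hζ, ha, hα, hσα⟩ := cyc_exists hq hk hk0 hz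
  have hMb : M ≠ ⊥ := by
    intro h
    rw [h, IntermediateField.finrank_bot] at hM
    exact hq.one_lt.ne hM
  obtain ⟨b, hb, h1, h2⟩ := cyc_step hC hn0 hA σ hσ hfix hq hM α a ζ hζ ha hα hσα (hmin M hMb) hns
  exact ⟨q, hq, hqn, ζ, a, b, hζ, ha, hb, h1, h2⟩

lemma Spl_descend {F C Ω : Type} [Field F] [Ring C] [Algebra F C] [Field Ω] [Algebra F Ω] {n : ℕ} (f : C →ₐ[F] Matrix (Fin n) (Fin n) Ω)
    (L : IntermediateField F Ω) (h : ∀ c i j, f c i j ∈ L) : Spl F C L n := by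
  refine ⟨{ toFun := fun c => Matrix.of fun i j => (⟨f c i j, h c i j⟩ : L), map_one' := ?_, map_mul' := ?_, map_zero' := ?_, map_add' := ?_, commutes' := ?_}⟩
  · ext i j
    simp only [map_one, Matrix.of_apply, Matrix.one_apply]
    split_ifs <;> rfl
  · intro x y
    ext i j
    simp [Matrix.mul_apply]
  · ext i j
    simp
  · intro x y
    ext i j
    simp
  · intro r
    ext i j
    simp only [AlgHom.commutes, Matrix.of_apply, Matrix.algebraMap_matrix_apply]
    split_ifs <;> rfl

lemma exists_gal_split {F C : Type} [Field F] [CharZero F] [Ring C] [Algebra F C] [FiniteDimensional F C] (hC : AS F C) {n : ℕ}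
    (hn0 : 0 < n) (hA : finrank F C = n^2) : ∃ (E : Type) (_ : Field E) (_ : Algebra F E), FiniteDimensional F E ∧ IsGalois F E ∧
      Spl F C E n ∧ ∃ ξ : E, IsPrimitiveRoot ξ n := by
  obtain ⟨n', hn', hA', ⟨f⟩⟩ := hC.sq
  have hnn : n' = n := by
    rw [hA] at hA'
    exact (Nat.pow_left_injective (n := 2) (by norm_num) hA').symm
  subst hnn
  let Ω := AlgebraicClosure F
  haveI : NeZero ((n' : ℕ) : Ω) := ⟨by exact_mod_cast hn0.ne'⟩
  obtain ⟨ξ, hξ⟩ := IsAlgClosed.exists_root (cyclotomic n' Ω) (by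
    rw [degree_cyclotomic]; exact_mod_cast (Nat.totient_pos.2 hn0).ne')
  have hξ' : IsPrimitiveRoot ξ n' := isRoot_cyclotomic_iff.1 hξ
  let b := finBasis F C
  let S : Set Ω := insert ξ (Set.range fun x : (Fin (finrank F C)) × Fin n' × Fin n' => f (b x.1) x.2.1 x.2.2)
  haveI : Finite S := ((Set.finite_range _).insert _).to_subtype
  haveI : FiniteDimensional F (adjoin F S) := finiteDimensional_adjoin (fun x _ => Algebra.IsIntegral.isIntegral x)
  have hfS : ∀ c i j, f c i j ∈ adjoin F S := by
    intro c i j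
    rw [← b.sum_repr c, map_sum, Matrix.sum_apply]
    refine sum_mem fun k _ => ?_
    rw [map_smul, Matrix.smul_apply]
    exact IntermediateField.smul_mem _ (subset_adjoin F S (Set.mem_insert_of_mem _ ⟨(k, i, j), rfl⟩))
  let L := IntermediateField.normalClosure F (adjoin F S) Ω
  have hle : adjoin F S ≤ L := le_normalClosure _
  refine ⟨L, inferInstance, inferInstance, inferInstance, ⟨⟩, Spl_descend f L (fun c i j => hle (hfS c i j)),
    ⟨ξ, hle (subset_adjoin F S (Set.mem_insert _ _))⟩, ?_⟩
  exact IsPrimitiveRoot.of_map_of_injective (f := algebraMap L Ω) hξ' (algebraMap L Ω).injective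

/-- Theorem S. -/
theorem thmS {F C : Type} [Field F] [CharZero F] [Ring C] [Algebra F C] [FiniteDimensional F C] (hC : AS F C) {n : ℕ}
    (hn0 : 0 < n) (hA : finrank F C = n^2) (hns : ¬ Spl F C F n) :
    ∃ q, q.Prime ∧ q ∣ n ∧ ∃ (K' : Type) (_ : Field K') (_ : Algebra F K') (_ : FiniteDimensional F K'),
      ∃ ζ a b : K', IsPrimitiveRoot ζ q ∧ a ≠ 0 ∧ b ≠ 0 ∧ ¬ NF ζ q a b ∧
      ∀ (E : Type) [Field E] [Algebra K' E] [Algebra F E] [IsScalarTower F K' E], Spl F C E n →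
      NF (algebraMap K' E ζ) q (algebraMap K' E a) (algebraMap K' E b) := by
  obtain ⟨E, _, _, _, _, hE, ξ, hξ⟩ := exists_gal_split hC hn0 hA
  haveI : Finite (IntermediateField F E) := Field.finite_intermediateField_of_exists_primitive_element F E
    (Field.exists_primitive_element F E)
  obtain ⟨K', hK'⟩ := (Set.toFinite {M : IntermediateField F E | ¬ Spl F C M n}).exists_maximal ⟨⊥, fun h =>
    hns (h.map (botEquiv F E).toAlgHom)⟩
  haveI := hC K'
  obtain ⟨q, hq, hqn, ζ, a, b, h1, h2, h3, h4, h5⟩ := thmS_aux (F := K') (C := K' ⊗[F] C) (E := E) (hC.baseChange K') hn0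
    (by rw [finrank_baseChange, hA]) (by rw [Spl_tower]; exact hK'.1) (by
      intro M hM
      rw [Spl_tower]
      by_contra hns2
      have hle : K' ≤ M.restrictScalars F := by
        intro x hx
        exact M.algebraMap_mem ⟨x, hx⟩
      have := hK'.2 (y := M.restrictScalars F) hns2 hle
      apply hM
      rw [eq_bot_iff]
      intro x hx
      rw [mem_bot]
      exact ⟨⟨x, this hx⟩, rfl⟩) hξ (by rw [Spl_tower]; exact hE)
  refine ⟨q, hq, hqn, K', inferInstance, inferInstance, inferInstance, ζ, a, b, h1, h2, h3, h4, ?_⟩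
  intro E' _ _ _ _ hE'
  exact h5 E' (Spl_tower.2 hE')
end Prf
set_option linter.all false
set_option linter.unusedVariables false
set_option linter.unusedSimpArgs false
namespace Prf
open Module Polynomial TensorProduct

lemma Spl_of_subfield {E D L : Type} [Field E] [Ring D] [Algebra E D] [FiniteDimensional E D] [Field L] [Algebra E L]
    (φ : L →ₐ[E] D) : ∃ d, finrank E L * d = finrank E D ∧ Spl E D L d := by
  letI : Module L D :=
    { smul := fun l y => y * φ l
      one_smul := fun y => by change y * φ 1 = y; simp
      mul_smul := fun a b y => by change y * φ (a * b) = (y * φ b) * φ a; rw [mul_comm a b]; simp [mul_assoc]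
      smul_zero := fun a => by change 0 * φ a = 0; simp
      zero_smul := fun y => by change y * φ 0 = 0; simp
      smul_add := fun a x y => by change (x + y) * φ a = x * φ a + y * φ a; simp [add_mul]
      add_smul := fun a b y => by change y * φ (a + b) = y * φ a + y * φ b; simp [mul_add] }
  have hs : ∀ (l : L) (y : D), l • y = y * φ l := fun _ _ => rfl
  haveI : IsScalarTower E L D := ⟨fun e l y => by simp [hs]⟩
  haveI : FiniteDimensional L D := Module.Finite.of_restrictScalars_finite E L D
  refine ⟨finrank L D, finrank_mul_finrank E L D, ?_⟩
  let ρ : D →ₐ[E] Module.End L D :=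
    AlgHom.ofLinearMap
      { toFun := fun x => { toFun := fun y => x * y, map_add' := mul_add x, map_smul' := fun l y => by simp [hs, mul_assoc] }
        map_add' := fun x y => LinearMap.ext fun z => add_mul x y z
        map_smul' := fun e x => LinearMap.ext fun z => by
          change (e • x) * z = e • (x * z)
          simp }
      (LinearMap.ext fun z => one_mul z)
      (fun x y => LinearMap.ext fun z => mul_assoc x y z)
  let b := Module.finBasis L D
  exact ⟨((LinearMap.toMatrixAlgEquiv b).toAlgHom.restrictScalars E).comp ρ⟩

lemma norm_subfield {E D L : Type} [Field E] [Ring D] [Algebra E D] [FiniteDimensional E D] [Field L] [Algebra E L]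
    (φ : L →ₐ[E] D) : ∃ d, finrank E L * d = finrank E D ∧ ∀ l, Algebra.norm E (φ l) = Algebra.norm E l ^ d := by
  letI : Module L D := Module.compHom D φ.toRingHom
  have hs : ∀ (l : L) (y : D), l • y = φ l * y := fun _ _ => rfl
  haveI : IsScalarTower E L D := ⟨fun e l y => by simp [hs]⟩
  haveI : FiniteDimensional L D := Module.Finite.of_restrictScalars_finite E L D
  refine ⟨finrank L D, finrank_mul_finrank E L D, fun l => ?_⟩
  rw [Algebra.norm_apply]
  have : Algebra.lmul E D (φ l) = ((l • LinearMap.id : D →ₗ[L] D)).restrictScalars E := by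
    refine LinearMap.ext fun z => ?_
    simp [hs]
  rw [this]
  have h2 := LinearMap.det_restrictScalars (R := E) (S := L) (A := D) (f := l • LinearMap.id)
  rw [h2]
  simp

lemma minpoly_data {E D : Type} [Field E] [DivisionRing D] [Algebra E D] [FiniteDimensional E D] (x : D) :
    ∃ r, (minpoly E x).natDegree * r = finrank E D ∧
      Algebra.norm E x = ((-1) ^ (minpoly E x).natDegree * (minpoly E x).coeff 0) ^ r ∧
      ∀ (E' : Type) [Field E'] [Algebra E E'] (y : E'), aeval y (minpoly E x) = 0 → Spl E D E' r := by
  have hi : IsIntegral E x := .of_finite E x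
  have hm := minpoly.monic hi
  haveI : Fact (Irreducible (minpoly E x)) := ⟨minpoly.irreducible hi⟩
  let L := AdjoinRoot (minpoly E x)
  let φ : L →ₐ[E] D := Ideal.Quotient.liftₐ (Ideal.span {minpoly E x}) (aeval x) (by
    intro a ha
    obtain ⟨b, rfl⟩ := Ideal.mem_span_singleton.1 ha
    simp [minpoly.aeval])
  have hφ : φ (AdjoinRoot.root _) = x := by
    change aeval x (X : E[X]) = x
    exact aeval_X x
  let pb := AdjoinRoot.powerBasis (minpoly.ne_zero hi)
  have hfr : finrank E L = (minpoly E x).natDegree := by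
    rw [pb.finrank]; exact AdjoinRoot.powerBasis_dim _
  haveI : FiniteDimensional E L := pb.finite
  have hpos : 0 < finrank E L := Module.finrank_pos
  obtain ⟨d, hd, hS⟩ := Spl_of_subfield φ
  obtain ⟨d', hd', hN⟩ := norm_subfield φ
  obtain rfl : d = d' := Nat.eq_of_mul_eq_mul_left hpos (hd.trans hd'.symm)
  refine ⟨d, by rw [← hfr, hd], ?_, fun E' _ _ y hy => ?_⟩
  · rw [← hφ, hN, hφ]
    congr 1
    have := Algebra.PowerBasis.norm_gen_eq_coeff_zero_minpoly pb
    rw [AdjoinRoot.powerBasis_gen, AdjoinRoot.minpoly_root (minpoly.ne_zero hi)] at this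
    rw [this, hm.leadingCoeff]
    simp [pb]
  · exact hS.map (AdjoinRoot.liftAlgHom _ (Algebra.ofId E E') y hy)

lemma minpoly_data' {E D : Type} [Field E] [DivisionRing D] [Algebra E D] [FiniteDimensional E D] (hD : AS E D) {m : ℕ}
    (hm : finrank E D = m ^ 2) (x : D) :
    ∃ r, (minpoly E x).natDegree * r = m ^ 2 ∧ m ≤ r ∧ (minpoly E x).natDegree ≤ m ∧
      Algebra.norm E x = ((-1) ^ (minpoly E x).natDegree * (minpoly E x).coeff 0) ^ r ∧
      ∀ (E' : Type) [Field E'] [Algebra E E'] (y : E'), aeval y (minpoly E x) = 0 → Spl E D E' r := by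
  obtain ⟨r, h1, h2, h3⟩ := minpoly_data (E := E) x
  have hi : IsIntegral E x := .of_finite E x
  have hpos : 0 < finrank E D := Module.finrank_pos
  have hr : 0 < r := Nat.pos_of_ne_zero (by rintro rfl; simp at h1; omega)
  have hmr : m ≤ r := by
    obtain ⟨y, hy⟩ := IsAlgClosed.exists_aeval_eq_zero (AlgebraicClosure E) (minpoly E x) (minpoly.degree_pos hi).ne'
    have h4 := Spl_iff.1 (h3 (AlgebraicClosure E) y hy)
    haveI := hD (AlgebraicClosure E)
    exact HasRep.le hr h4 (by rw [Module.finrank_baseChange, hm])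
  rw [hm] at h1
  refine ⟨r, h1, hmr, ?_, h2, h3⟩
  by_contra hlt
  push Not at hlt
  have : m * m < (minpoly E x).natDegree * r := Nat.mul_lt_mul_of_lt_of_le hlt hmr hr
  nlinarith
end Prf
set_option linter.all false
set_option linter.unusedVariables false
set_option linter.unusedSimpArgs false
namespace Prf
open Module Polynomial TensorProduct WithZero

/-- the properties of a complete discretely valued field with finite residue field that we need -/
structure LF {E : Type} [Field E] (V : Valuation E ℤᵐ⁰) : Prop where
  unif : ∃ π : E, V π = exp (-1 : ℤ)
  complete : ∀ c : ℕ → E, (∀ k : ℕ, V (c (k + 1) - c k) ≤ exp (-(k : ℤ))) → ∃ l, ∀ k : ℕ, V (l - c k) ≤ exp (-(k : ℤ))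
  hintg : ∀ f : E[X], f.Monic → Irreducible f → V (f.coeff 0) ≤ 1 → ∀ i, V (f.coeff i) ≤ 1
  fin : Finite (IsLocalRing.ResidueField V.valuationSubring)
  hensel : HenselianLocalRing V.valuationSubring

section
variable {E : Type} [Field E] {V : Valuation E ℤᵐ⁰} (hV : LF V) {D : Type} [DivisionRing D] [Algebra E D]
  [FiniteDimensional E D] (hD : AS E D) {m : ℕ} (hm : finrank E D = m ^ 2)

lemma V_coeff_pow {r : ℕ} (hr : r ≠ 0) {d : ℕ} (c : E) : V (((-1) ^ d * c) ^ r) = V c ^ r := by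
  simp

lemma W_le_one (hV : LF V) (hD : AS E D) (hm : finrank E D = m ^ 2) {x : D} (h : V (Algebra.norm E x) ≤ 1) (i : ℕ) : V ((minpoly E x).coeff i) ≤ 1 := by
  obtain ⟨r, h1, h2, h3, h4, h5⟩ := minpoly_data' hD hm x
  have hi : IsIntegral E x := .of_finite E x
  have hpos : 0 < finrank E D := Module.finrank_pos
  have hr : r ≠ 0 := by rintro rfl; simp at h1; rw [hm] at hpos; rw [← h1] at hpos; simp at hpos
  refine hV.hintg _ (minpoly.monic hi) (minpoly.irreducible hi) ?_ i
  rw [h4] at h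
  simp only [map_pow, map_mul, map_neg, Valuation.map_neg, map_one, one_pow, one_mul] at h
  exact (pow_le_one_iff hr).1 h

lemma W_one_add (hV : LF V) (hD : AS E D) (hm : finrank E D = m ^ 2) {x : D} (h : V (Algebra.norm E x) ≤ 1) : V (Algebra.norm E (1 + x)) ≤ 1 := by
  have hc := W_le_one hV hD hm h
  obtain ⟨r, h1, h2, h3, h4, h5⟩ := minpoly_data' hD hm (1 + x)
  rw [h4]
  simp only [map_pow, map_mul, map_neg, Valuation.map_neg, map_one, one_pow, one_mul]
  refine pow_le_one₀ (zero_le) ?_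
  have : 1 + x = x + algebraMap E D 1 := by simp [add_comm]
  have hi : IsIntegral E x := .of_finite E x
  have hmin : minpoly E (x + algebraMap E D 1) = (minpoly E x).comp (X - C 1) := by
    symm
    refine minpoly.eq_of_irreducible_of_monic ?_ ?_ ((minpoly.monic hi).comp_X_sub_C 1)
    · have h7 := (MulEquiv.irreducible_iff (Polynomial.algEquivAevalXAddC (-1 : E))).2 (minpoly.irreducible hi)
      simpa [aeval_def, comp, sub_eq_add_neg] using h7
    · simp [aeval_comp, minpoly.aeval]
  rw [this, hmin, coeff_zero_eq_eval_zero, eval_comp]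
  simp only [eval_sub, eval_X, eval_C]
  rw [eval_eq_sum_range]
  refine Valuation.map_sum_le V fun i _ => ?_
  rw [map_mul, map_pow]
  simpa using hc i

/-- the valuation on the division algebra -/
noncomputable def WV : Valuation D ℤᵐ⁰ where
  toFun x := V (Algebra.norm E x)
  map_zero' := by
    have : Nontrivial D := inferInstance
    obtain ⟨r, h1, h2, h3, h4, h5⟩ := minpoly_data' hD hm (0 : D)
    have hpos : 0 < finrank E D := Module.finrank_pos
    have hr : r ≠ 0 := by rintro rfl; simp at h1; rw [hm] at hpos; rw [← h1] at hpos; simp at hpos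
    rw [h4, minpoly.zero]; simp [hr]
  map_one' := by simp
  map_mul' x y := by simp
  map_add_le_max' x y := by
    have key : ∀ x y : D, V (Algebra.norm E y) ≤ V (Algebra.norm E x) → V (Algebra.norm E (x + y)) ≤ V (Algebra.norm E x) := by
      intro x y hxy
      by_cases hx : x = 0
      · subst hx
        obtain ⟨r, h1, h2, h3, h4, h5⟩ := minpoly_data' hD hm (0 : D)
        simpa using hxy
      have e : x + y = x * (1 + x⁻¹ * y) := by rw [mul_add, mul_one, ← mul_assoc, mul_inv_cancel₀ hx, one_mul]
      rw [e, map_mul, map_mul]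
      refine mul_le_of_le_one_right zero_le (W_one_add hV hD hm ?_)
      rw [map_mul, map_mul]
      have : V (Algebra.norm E x⁻¹) * V (Algebra.norm E x) = 1 := by
        rw [← map_mul, ← map_mul, inv_mul_cancel₀ hx]; simp
      rw [← this]
      gcongr
    rcases le_total (V (Algebra.norm E y)) (V (Algebra.norm E x)) with h | h
    · exact le_max_of_le_left (key x y h)
    · rw [add_comm]; exact le_max_of_le_right (key y x h)

lemma WV_apply (x : D) : WV hV hD hm x = V (Algebra.norm E x) := rfl

lemma WV_alg (e : E) : WV hV hD hm (algebraMap E D e) = V e ^ (m ^ 2) := by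
  rw [WV_apply, Algebra.norm_algebraMap, map_pow, hm]

lemma WV_ne {x : D} (hx : x ≠ 0) : WV hV hD hm x ≠ 0 := by
  intro h
  have : WV hV hD hm (x * x⁻¹) = 0 := by rw [map_mul, h, zero_mul]
  rw [mul_inv_cancel₀ hx, map_one] at this
  exact one_ne_zero this

lemma lt_one_exp {x : ℤᵐ⁰} (h : x < 1) : x ≤ exp (-1 : ℤ) := by
  by_cases h0 : x = 0
  · simp [h0]
  rw [← exp_log h0] at h ⊢
  rw [← exp_zero, exp_lt_exp] at h
  rw [exp_le_exp]; omega

lemma WV_gap {x : D} (h : WV hV hD hm x < 1) : WV hV hD hm x ≤ exp (-(m : ℤ)) := by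
  obtain ⟨r, h1, h2, h3, h4, h5⟩ := minpoly_data' hD hm x
  rw [WV_apply, h4] at h ⊢
  simp only [map_pow, map_mul, map_neg, Valuation.map_neg, map_one, one_pow, one_mul] at h ⊢
  have h6 : V ((minpoly E x).coeff 0) < 1 := by
    by_contra h7
    exact absurd h (not_lt.2 (one_le_pow₀ (not_lt.1 h7)))
  calc _ ≤ exp (-1 : ℤ) ^ r := by gcongr; exact lt_one_exp h6
    _ = exp (-(r : ℤ)) := by rw [← exp_nsmul]; simp
    _ ≤ _ := by rw [exp_le_exp]; omega
end
end Prf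
set_option linter.all false
set_option linter.unusedVariables false
set_option linter.unusedSimpArgs false
namespace Prf
open Module Polynomial TensorProduct WithZero

lemma res_iff {E : Type} [Field E] {V : Valuation E ℤᵐ⁰} (a : V.valuationSubring) :
    IsLocalRing.residue V.valuationSubring a = 0 ↔ V (a : E) < 1 := by
  rw [IsLocalRing.residue_eq_zero_iff, IsLocalRing.mem_maximalIdeal, mem_nonunits_iff]
  have ha : V (a : E) ≤ 1 := a.2
  constructor
  · intro h
    refine lt_of_le_of_ne ha fun h1 => h ?_
    have h0 : (a : E) ≠ 0 := by rintro h0; rw [h0] at h1; simp at h1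
    have hin : V ((a : E)⁻¹) ≤ 1 := by simp [h1]
    refine IsUnit.of_mul_eq_one ⟨(a : E)⁻¹, hin⟩ ?_
    ext; simp [h0]
  · rintro h hu
    obtain ⟨b, hb⟩ := hu.exists_right_inv
    have hb1 : V (b : E) ≤ 1 := b.2
    have h2 := congrArg (fun z : V.valuationSubring => V (z : E)) hb
    simp only [MulMemClass.coe_mul, map_mul, OneMemClass.coe_one, map_one] at h2
    have : V (a : E) * V (b : E) < 1 := mul_lt_one_of_lt_of_le h hb1
    exact this.ne h2

section
variable {E : Type} [Field E] {V : Valuation E ℤᵐ⁰} (hV : LF V) {D : Type} [DivisionRing D] [Algebra E D]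
  [FiniteDimensional E D] (hD : AS E D) {m : ℕ} (hm : finrank E D = m ^ 2)

lemma m_ne (hm : finrank E D = m ^ 2) : m ≠ 0 := by
  rintro rfl
  have hpos : 0 < finrank E D := Module.finrank_pos
  simp at hm; omega

lemma WV_smul (e : E) (x : D) : WV hV hD hm (e • x) = V e ^ (m ^ 2) * WV hV hD hm x := by
  rw [Algebra.smul_def, map_mul, WV_alg]

/-- residually independent families -/
def Ind (s : ℕ) (ω : Fin s → D) : Prop := (∀ i, WV hV hD hm (ω i) ≤ 1) ∧
  ∀ c : Fin s → E, (∀ i, V (c i) ≤ 1) → WV hV hD hm (∑ i, c i • ω i) < 1 → ∀ i, V (c i) < 1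

lemma Ind.le {s : ℕ} {ω : Fin s → D} (h : Ind hV hD hm s ω) : s ≤ m ^ 2 := by
  have : LinearIndependent E ω := by
    rw [Fintype.linearIndependent_iff]
    intro e he
    by_contra hne
    push Not at hne
    obtain ⟨j, hj⟩ := hne
    haveI : Nonempty (Fin s) := ⟨j⟩
    obtain ⟨i0, hi0⟩ := Finite.exists_max fun i => V (e i)
    have hne : e i0 ≠ 0 := by
      intro h0
      have := hi0 j
      rw [h0] at this; simp at this; exact hj this
    have hVne : V (e i0) ≠ 0 := by simpa using hne
    have := h.2 (fun i => (e i0)⁻¹ * e i) (fun i => by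
      rw [map_mul, map_inv₀]
      calc _ ≤ (V (e i0))⁻¹ * V (e i0) := by gcongr; exact hi0 i
        _ = 1 := inv_mul_cancel₀ hVne) (by
      have : ∑ i, ((e i0)⁻¹ * e i) • ω i = (e i0)⁻¹ • ∑ i, e i • ω i := by
        rw [Finset.smul_sum]; simp [mul_smul]
      rw [this, he]; simp) i0
    rw [inv_mul_cancel₀ hne] at this
    simp at this
  have h2 := this.fintype_card_le_finrank
  rw [hm] at h2
  simpa using h2

lemma exists_resbasis : ∃ s, ∃ ω : Fin s → D, (∀ i, WV hV hD hm (ω i) ≤ 1) ∧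
    ∀ x, WV hV hD hm x ≤ 1 → ∃ c : Fin s → E, (∀ i, V (c i) ≤ 1) ∧ WV hV hD hm (x - ∑ i, c i • ω i) < 1 := by
  classical
  set P : ℕ → Prop := fun s => ∃ ω : Fin s → D, Ind hV hD hm s ω with hP
  have h0 : P 0 := ⟨fun i => i.elim0, fun i => i.elim0, fun c _ _ i => i.elim0⟩
  obtain ⟨s, hs⟩ : ∃ s, s = Nat.findGreatest P (m ^ 2) := ⟨_, rfl⟩
  have hspec : P s := hs ▸ Nat.findGreatest_spec (P := P) (Nat.zero_le (m ^ 2)) h0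
  obtain ⟨ω, hω⟩ := hspec
  refine ⟨s, ω, hω.1, fun x hx => ?_⟩
  have hnot : ¬ Ind hV hD hm (s + 1) (Fin.cons x ω : Fin (s + 1) → D) := by
    intro h
    have hle := h.le
    exact Nat.findGreatest_is_greatest (P := P) (n := m ^ 2) (k := s + 1) (by rw [← hs]; omega) hle ⟨_, h⟩
  unfold Ind at hnot
  rw [not_and] at hnot
  have h2 := hnot (fun i => by
    refine Fin.cases ?_ (fun j => ?_) i
    · simpa using hx
    · simpa using hω.1 j)
  push Not at h2
  obtain ⟨c, hc1, hc2, i0, hi0⟩ := h2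
  rw [Fin.sum_univ_succ] at hc2
  simp only [Fin.cons_zero, Fin.cons_succ] at hc2
  have hm0 : m ^ 2 ≠ 0 := pow_ne_zero _ (m_ne hm)
  have hc0 : V (c 0) = 1 := by
    by_contra hne
    have hlt : V (c 0) < 1 := lt_of_le_of_ne (hc1 0) hne
    have h3 : WV hV hD hm (c 0 • x) < 1 := by
      rw [WV_smul]
      exact mul_lt_one_of_lt_of_le (pow_lt_one₀ zero_le hlt hm0) hx
    have h4 : WV hV hD hm (∑ i : Fin s, c i.succ • ω i) < 1 := by
      have := (WV hV hD hm).map_sub_lt hc2 h3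
      simpa using this
    have h5 := hω.2 (fun i => c i.succ) (fun i => hc1 _) h4
    revert hi0
    refine Fin.cases ?_ (fun j => ?_) i0
    · simpa using hlt
    · simpa using h5 j
  have hcne : c 0 ≠ 0 := by rintro h; rw [h] at hc0; simp at hc0
  refine ⟨fun i => -((c 0)⁻¹ * c i.succ), fun i => by simpa [hc0] using hc1 _, ?_⟩
  have e : x - ∑ i : Fin s, (-((c 0)⁻¹ * c i.succ)) • ω i = (c 0)⁻¹ • (c 0 • x + ∑ i : Fin s, c i.succ • ω i) := by
    rw [smul_add, smul_smul, inv_mul_cancel₀ hcne, one_smul, Finset.smul_sum]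
    simp [mul_smul]
  rw [e, WV_smul]
  simpa [hc0] using hc2

lemma exists_gen : ∃ α : D, WV hV hD hm α ≤ 1 ∧
    ∀ x, WV hV hD hm x ≤ 1 → WV hV hD hm x < 1 ∨ ∃ i : ℕ, WV hV hD hm (x - α ^ i) < 1 := by
  classical
  set W := WV hV hD hm with hW
  have hm0 : m ^ 2 ≠ 0 := pow_ne_zero _ (m_ne hm)
  let O : Subring D := W.integer
  let J : Ideal O :=
    { carrier := {x | W (x : D) < 1}
      add_mem' := fun {a b} ha hb => W.map_add_lt ha hb
      zero_mem' := by change W (0 : D) < 1; simp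
      smul_mem' := fun c x hx => by
        change W ((c : D) * x) < 1
        rw [map_mul, mul_comm]; exact mul_lt_one_of_lt_of_le hx c.2 }
  haveI : J.IsTwoSided := ⟨fun {a} b ha => by
        change W ((a : D) * b) < 1
        rw [map_mul]; exact mul_lt_one_of_lt_of_le ha b.2⟩
  have hJ : ∀ x : O, Ideal.Quotient.mk J x = 0 ↔ W (x : D) < 1 := fun x => Ideal.Quotient.eq_zero_iff_mem
  obtain ⟨s, ω, hω, hspan⟩ := exists_resbasis hV hD hm
  have hmem : ∀ c : Fin s → E, (∀ i, V (c i) ≤ 1) → W (∑ i, c i • ω i) ≤ 1 := fun c hc =>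
    Valuation.map_sum_le W fun i _ => by
      rw [hW, WV_smul]; exact mul_le_one₀ (pow_le_one₀ zero_le (hc i)) zero_le (hω i)
  haveI := hV.fin
  let out : IsLocalRing.ResidueField V.valuationSubring → V.valuationSubring :=
    Function.surjInv IsLocalRing.residue_surjective
  have hout : ∀ r, IsLocalRing.residue _ (out r) = r := Function.surjInv_eq IsLocalRing.residue_surjective
  let Φ : (Fin s → IsLocalRing.ResidueField V.valuationSubring) → O ⧸ J := fun r =>
    Ideal.Quotient.mk J ⟨∑ i, (out (r i) : E) • ω i, hmem _ fun i => (out (r i)).2⟩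
  have hΦ : Function.Surjective Φ := by
    intro z
    obtain ⟨y, rfl⟩ := Ideal.Quotient.mk_surjective z
    obtain ⟨c, hc, hlt⟩ := hspan y y.2
    refine ⟨fun i => IsLocalRing.residue _ ⟨c i, hc i⟩, ?_⟩
    rw [eq_comm, ← sub_eq_zero, ← map_sub, hJ]
    set d : Fin s → E := fun i => (out (IsLocalRing.residue _ ⟨c i, hc i⟩) : E) with hd
    change W ((y : D) - ∑ i, d i • ω i) < 1
    have e : (y : D) - ∑ i, d i • ω i = ((y : D) - ∑ i, c i • ω i) + ∑ i, (c i - d i) • ω i := by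
      simp [sub_smul]
    rw [e]
    refine W.map_add_lt hlt (Valuation.map_sum_lt W one_ne_zero fun i _ => ?_)
    rw [hW, WV_smul]
    refine mul_lt_one_of_lt_of_le (pow_lt_one₀ zero_le ?_ hm0) (hω i)
    have := (res_iff (⟨c i, hc i⟩ - out (IsLocalRing.residue _ ⟨c i, hc i⟩))).1 (by rw [map_sub, hout, sub_self])
    simpa using this
  haveI : Finite (O ⧸ J) := Finite.of_surjective Φ hΦ
  haveI : Nontrivial (O ⧸ J) := by
    refine ⟨⟨0, 1, fun h => ?_⟩⟩
    have := (hJ 1).1 (by rw [map_one]; exact h.symm)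
    simp at this
  haveI : NoZeroDivisors (O ⧸ J) := ⟨by
    intro a b
    obtain ⟨a, rfl⟩ := Ideal.Quotient.mk_surjective a
    obtain ⟨b, rfl⟩ := Ideal.Quotient.mk_surjective b
    rw [← map_mul, hJ, hJ, hJ]
    intro h
    by_contra hcon
    push Not at hcon
    have ha : W (a : D) = 1 := le_antisymm a.2 hcon.1
    have hb : W (b : D) = 1 := le_antisymm b.2 hcon.2
    have : W ((a : D) * b) < 1 := h
    rw [map_mul, ha, hb] at this
    simp at this⟩
  haveI : IsDomain (O ⧸ J) := NoZeroDivisors.to_isDomain _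
  have hf := Finite.isDomain_to_isField (O ⧸ J)
  letI : Field (O ⧸ J) := hf.toField
  have hcyc : IsCyclic (O ⧸ J)ˣ := inferInstance
  obtain ⟨g, hg⟩ := hcyc.exists_generator
  obtain ⟨α, hα⟩ := Ideal.Quotient.mk_surjective (g : O ⧸ J)
  refine ⟨α, α.2, fun x hx => ?_⟩
  by_cases h0 : W x < 1
  · exact Or.inl h0
  right
  have hne : Ideal.Quotient.mk J ⟨x, hx⟩ ≠ 0 := fun h => h0 ((hJ _).1 h)
  obtain ⟨u, hu⟩ := (isUnit_iff_ne_zero.2 hne)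
  obtain ⟨i, hi⟩ := mem_powers_iff_mem_zpowers.2 (hg u)
  refine ⟨i, ?_⟩
  have := (hJ (⟨x, hx⟩ - α ^ i)).1 (by
    rw [map_sub, map_pow, hα, ← hu, sub_eq_zero, ← hi]
    simp)
  simpa using this
end
end Prf
set_option linter.all false
set_option linter.unusedVariables false
set_option linter.unusedSimpArgs false
namespace Prf
open Module Polynomial TensorProduct WithZero

section
variable {E : Type} [Field E] {V : Valuation E ℤᵐ⁰} (hV : LF V) {D : Type} [DivisionRing D] [Algebra E D]
  [FiniteDimensional E D] (hD : AS E D) {m : ℕ} (hm : finrank E D = m ^ 2)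

lemma span_of_step {ι : Type} [Fintype ι] (b : ι → D) (hb : ∀ i, WV hV hD hm (b i) ≤ 1) {π : E} (hπ : V π = exp (-1 : ℤ))
    (hstep : ∀ x, WV hV hD hm x ≤ 1 → ∃ c : ι → E, (∀ i, V (c i) ≤ 1) ∧ ∃ y, WV hV hD hm y ≤ 1 ∧ x = ∑ i, c i • b i + π • y) :
    Submodule.span E (Set.range b) = ⊤ := by
  set W := WV hV hD hm with hW
  have hm0 : m ^ 2 ≠ 0 := pow_ne_zero _ (m_ne hm)
  have hπ0 : π ≠ 0 := by rintro rfl; rw [map_zero] at hπ; exact exp_ne_zero hπ.symm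
  have hπk : ∀ k : ℕ, V (π ^ k) = exp (-(k : ℤ)) := fun k => by rw [map_pow, hπ, ← exp_nsmul]; simp
  have hexp : ∀ k : ℕ, exp (-(k : ℤ)) ^ (m ^ 2) ≤ (exp (-(k : ℤ)) : ℤᵐ⁰) := fun k =>
    pow_le_of_le_one zero_le (by rw [← exp_zero, exp_le_exp]; omega) hm0
  have hsm : ∀ (e : E) (k : ℕ) (x : D), V e ≤ exp (-(k : ℤ)) → W x ≤ 1 → W (e • x) ≤ exp (-(k : ℤ)) := by
    intro e k x he hx
    rw [hW, WV_smul]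
    calc _ ≤ exp (-(k : ℤ)) ^ (m ^ 2) * 1 := by gcongr
      _ ≤ _ := by rw [mul_one]; exact hexp k
  have hO : ∀ x, W x ≤ 1 → x ∈ Submodule.span E (Set.range b) := by
    choose! C hC T hT hx using hstep
    intro x hx1
    let Y : ℕ → D := fun k => T^[k] x
    have hY : ∀ k, W (Y k) ≤ 1 := by
      intro k
      induction k with
      | zero => exact hx1
      | succ k ih =>
        change W (T^[k + 1] x) ≤ 1
        rw [Function.iterate_succ_apply']
        exact hT _ ih
    have hYs : ∀ k, Y (k + 1) = T (Y k) := fun k => Function.iterate_succ_apply' T k x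
    let S : ℕ → ι → E := fun k i => ∑ l ∈ Finset.range k, π ^ l * C (Y l) i
    have hS : ∀ k, x = ∑ i, S k i • b i + π ^ k • Y k := by
      intro k
      induction k with
      | zero => simp [S, Y]
      | succ k ih =>
        conv_lhs => rw [ih]
        conv_lhs => rw [hx (Y k) (hY k)]
        rw [hYs]
        simp only [S, Finset.sum_range_succ, add_smul, Finset.sum_add_distrib, smul_add, Finset.smul_sum, smul_smul, pow_succ]
        abel
    have hlim : ∀ i, ∃ l, ∀ k : ℕ, V (l - S k i) ≤ exp (-(k : ℤ)) := fun i => hV.complete (fun k => S k i) fun k => by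
      have : S (k + 1) i - S k i = π ^ k * C (Y k) i := by simp [S, Finset.sum_range_succ]
      rw [this, map_mul, hπk]
      exact mul_le_of_le_one_right zero_le (hC _ (hY k) i)
    choose l hl using hlim
    have hxl : x = ∑ i, l i • b i := by
      rw [← sub_eq_zero]
      by_contra hne
      have hk : ∀ k : ℕ, W (x - ∑ i, l i • b i) ≤ exp (-(k : ℤ)) := by
        intro k
        have e : x - ∑ i, l i • b i = π ^ k • Y k - ∑ i, (l i - S k i) • b i := by
          conv_lhs => rw [hS k]
          simp only [sub_smul, Finset.sum_sub_distrib]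
          abel
        rw [e]
        refine (W.map_sub _ _).trans (max_le (hsm _ k _ (hπk k).le (hY k)) ?_)
        exact Valuation.map_sum_le W fun i _ => hsm _ k _ (hl i k) (hb i)
      have hne' := WV_ne hV hD hm hne
      have h1 := hk (log (W (x - ∑ i, l i • b i))).natAbs.succ
      rw [← exp_log hne', exp_le_exp] at h1
      simp only [log_exp] at h1
      rw [← hW] at h1
      omega
    rw [hxl]
    exact Submodule.sum_mem _ fun i _ => Submodule.smul_mem _ _ (Submodule.subset_span ⟨i, rfl⟩)
  rw [eq_top_iff]
  intro x _
  by_cases hx0 : x = 0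
  · rw [hx0]; exact Submodule.zero_mem _
  have hne' := WV_ne hV hD hm hx0
  let N := (log (W x)).natAbs
  have h1 : W (π ^ N • x) ≤ 1 := by
    rw [hW, WV_smul, hπk]
    calc _ ≤ exp (-(N : ℤ)) * W x := by gcongr; exact hexp N
      _ = exp (-(N : ℤ)) * exp (log (W x)) := by rw [exp_log hne']
      _ = exp (-(N : ℤ) + log (W x)) := by rw [exp_add]
      _ ≤ exp 0 := by rw [exp_le_exp]; simp only [N]; omega
      _ = 1 := exp_zero
  have h2 := Submodule.smul_mem _ (π ^ N)⁻¹ (hO _ h1)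
  rwa [smul_smul, inv_mul_cancel₀ (pow_ne_zero _ hπ0), one_smul] at h2

lemma exists_Pi {π : E} (hπ : V π = exp (-1 : ℤ)) : ∃ ϖ : D, ϖ ≠ 0 ∧ WV hV hD hm ϖ < 1 ∧ ∀ x, WV hV hD hm x < 1 → WV hV hD hm x ≤ WV hV hD hm ϖ := by
  classical
  set W := WV hV hD hm with hW
  have hm0 : m ^ 2 ≠ 0 := pow_ne_zero _ (m_ne hm)
  let P : ℕ → Prop := fun j => 0 < j ∧ ∃ x : D, W x = exp (-(j : ℤ))
  have hex : ∃ j, P j := ⟨m ^ 2, Nat.pos_of_ne_zero hm0, algebraMap E D π, by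
    rw [hW, WV_alg, hπ, ← exp_nsmul]; simp⟩
  obtain ⟨h1, ϖ, h2⟩ := Nat.find_spec hex
  refine ⟨ϖ, by rintro rfl; rw [map_zero] at h2; exact exp_ne_zero h2.symm, by rw [h2, ← exp_zero, exp_lt_exp]; omega, fun x hx => ?_⟩
  by_cases hx0 : W x = 0
  · rw [hx0]; exact zero_le
  rw [h2]
  have e := exp_log hx0
  rw [← e, ← exp_zero, exp_lt_exp] at hx
  have hP : P (log (W x)).natAbs := ⟨by omega, x, by rw [← e, log_exp]; congr 1; omega⟩
  have := Nat.find_le hP (h := hex)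
  rw [← e, exp_le_exp]
  omega

variable {hV hD hm} in
lemma W_aeval {α : D} (hα : WV hV hD hm α ≤ 1) (f : E[X]) {t : ℤᵐ⁰} (hf : ∀ i, V (f.coeff i) ≤ 1) : WV hV hD hm (aeval α f) ≤ 1 := by
  rw [aeval_eq_sum_range]
  refine Valuation.map_sum_le _ fun i _ => ?_
  rw [WV_smul, map_pow]
  exact mul_le_one₀ (pow_le_one₀ zero_le (hf i)) zero_le (pow_le_one₀ zero_le hα)

noncomputable abbrev mp (V : Valuation E ℤᵐ⁰) : V.valuationSubring[X] →+* E[X] := mapRingHom (algebraMap V.valuationSubring E)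

variable {hV hD hm} in
lemma W_aeval' {α : D} (hα : WV hV hD hm α ≤ 1) (f : V.valuationSubring[X]) : WV hV hD hm (aeval α (mp V f)) ≤ 1 :=
  W_aeval hα _ (t := 1) fun i => by
    rw [coe_mapRingHom, coeff_map]; exact (f.coeff i).2

variable {hV hD hm} in
lemma span_deg {α : D} (hα : WV hV hD hm α ≤ 1)
    (hgen : ∀ x, WV hV hD hm x ≤ 1 → WV hV hD hm x < 1 ∨ ∃ i : ℕ, WV hV hD hm (x - α ^ i) < 1)
    (h : V.valuationSubring[X]) (hmon : h.Monic) (hh : WV hV hD hm (aeval α (mp V h)) < 1) : m ≤ h.natDegree := by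
  classical
  obtain ⟨π, hπ⟩ := hV.unif
  have hπ0 : π ≠ 0 := by rintro rfl; rw [map_zero] at hπ; exact exp_ne_zero hπ.symm
  have hpos : 0 < h.natDegree := by
    by_contra h0
    have : h = 1 := hmon.natDegree_eq_zero.1 (by omega)
    rw [this] at hh
    simp at hh
  obtain ⟨ϖ, hϖ0, hϖ1, hϖ⟩ := exists_Pi hV hD hm hπ
  have hm0 : m ^ 2 ≠ 0 := pow_ne_zero _ (m_ne hm)
  set W := WV hV hD hm with hW
  have s1 : ∀ x, W x ≤ 1 → ∃ r : V.valuationSubring[X], r.natDegree < h.natDegree ∧ W (x - aeval α (mp V r)) < 1 := by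
    intro x hx
    rcases hgen x hx with h1 | ⟨i, hi⟩
    · exact ⟨0, by simpa using hpos, by simpa using h1⟩
    · refine ⟨X ^ i %ₘ h, natDegree_modByMonic_lt _ hmon (by rintro rfl; simp at hpos), ?_⟩
      have e : α ^ i - aeval α (mp V (X ^ i %ₘ h)) = aeval α (mp V h) * aeval α (mp V (X ^ i /ₘ h)) := by
        rw [sub_eq_iff_eq_add', ← map_mul, ← map_mul, ← map_add, ← map_add, modByMonic_add_div]
        simp
      have e2 : x - aeval α (mp V (X ^ i %ₘ h)) = (x - α ^ i) + aeval α (mp V h) * aeval α (mp V (X ^ i /ₘ h)) := by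
        rw [← e]; abel
      rw [e2]
      refine W.map_add_lt hi ?_
      rw [map_mul]
      exact mul_lt_one_of_lt_of_le hh (W_aeval' hα _)
  have hdiv : ∀ x, W x < 1 → ∃ y, W y ≤ 1 ∧ x = y * ϖ := by
    intro x hx
    refine ⟨x * ϖ⁻¹, ?_, by rw [mul_assoc, inv_mul_cancel₀ hϖ0, mul_one]⟩
    have : W ϖ⁻¹ * W ϖ = 1 := by rw [← map_mul, inv_mul_cancel₀ hϖ0, map_one]
    rw [map_mul, ← this, mul_comm]
    gcongr
    exact hϖ x hx
  have s2 : ∀ (t : ℕ) (x : D), W x ≤ 1 → ∃ r : ℕ → V.valuationSubring[X], (∀ i, (r i).natDegree < h.natDegree) ∧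
      ∃ y, W y ≤ 1 ∧ x = ∑ i ∈ Finset.range t, aeval α (mp V (r i)) * ϖ ^ i + y * ϖ ^ t := by
    intro t
    induction t with
    | zero => exact fun x hx => ⟨0, fun i => by simpa using hpos, x, hx, by simp⟩
    | succ t ih =>
      intro x hx
      obtain ⟨r, hr, y, hy, e⟩ := ih x hx
      obtain ⟨r', hr', h3⟩ := s1 y hy
      obtain ⟨z, hz, e2⟩ := hdiv _ h3
      refine ⟨Function.update r t r', fun i => ?_, z, hz, ?_⟩
      · by_cases hi : i = t
        · subst hi; simpa using hr'
        · simpa [hi] using hr i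
      · rw [Finset.sum_range_succ, Finset.sum_congr rfl (g := fun i => aeval α (mp V (r i)) * ϖ ^ i)]
        · rw [Function.update_self, e]
          rw [sub_eq_iff_eq_add] at e2
          conv_lhs => rw [e2]
          rw [add_mul, mul_assoc, ← pow_succ']
          abel
        · intro i hi
          rw [Function.update_of_ne (by simp at hi; omega)]
  let b : Fin m × Fin h.natDegree → D := fun ij => α ^ (ij.2 : ℕ) * ϖ ^ (ij.1 : ℕ)
  have hspan := span_of_step hV hD hm b (fun ij => by
    simp only [b, map_mul, map_pow]
    exact mul_le_one₀ (pow_le_one₀ zero_le hα) zero_le (pow_le_one₀ zero_le hϖ1.le)) hπ (by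
    intro x hx
    obtain ⟨r, hr, y, hy, e⟩ := s2 m x hx
    refine ⟨fun ij => ((r ij.1).coeff ij.2 : E), fun ij => ((r ij.1).coeff ij.2).2, y * ϖ ^ m * algebraMap E D π⁻¹, ?_, ?_⟩
    · have h4 : W (ϖ ^ m) ≤ exp (-1 : ℤ) ^ (m ^ 2) := by
        rw [map_pow]
        calc _ ≤ exp (-(m : ℤ)) ^ m := by gcongr; exact WV_gap hV hD hm hϖ1
          _ = _ := by rw [← exp_nsmul, ← exp_nsmul]; congr 1; simp; ring
      rw [← hW, map_mul, map_mul, hW, WV_alg, ← hW, map_inv₀, hπ]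
      calc _ ≤ 1 * exp (-1 : ℤ) ^ (m ^ 2) * (exp (-1 : ℤ))⁻¹ ^ (m ^ 2) := by gcongr
        _ = 1 := by rw [one_mul, ← mul_pow, mul_inv_cancel₀ exp_ne_zero, one_pow]
    · have e1 : π • (y * ϖ ^ m * algebraMap E D π⁻¹) = y * ϖ ^ m := by
        rw [Algebra.smul_def, ← Algebra.commutes, ← mul_assoc, ← map_mul, mul_inv_cancel₀ hπ0, map_one, one_mul]
      rw [e1, Fintype.sum_prod_type, ← Fin.sum_univ_eq_sum_range (fun i => aeval α (mp V (r i)) * ϖ ^ i)] at *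
      conv_lhs => rw [e]
      congr 1
      refine Finset.sum_congr rfl fun i _ => ?_
      have hlt : (mp V (r i)).natDegree < h.natDegree := lt_of_le_of_lt natDegree_map_le (hr i)
      rw [aeval_eq_sum_range' hlt, Finset.sum_mul,
        ← Fin.sum_univ_eq_sum_range (fun j => (mp V (r i)).coeff j • α ^ j * ϖ ^ (i : ℕ))]
      refine Finset.sum_congr rfl fun j _ => ?_
      simp [b])
  have hfr := finrank_le_of_span_eq_top hspan
  rw [hm] at hfr
  simp at hfr
  have : 0 < m := Nat.pos_of_ne_zero (m_ne hm)
  nlinarith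
end
end Prf
set_option linter.all false
set_option linter.unusedVariables false
set_option linter.unusedSimpArgs false
namespace Prf
open Module Polynomial TensorProduct WithZero

lemma exists_unram {E : Type} [Field E] {V : Valuation E ℤᵐ⁰} (hV : LF V) {D : Type} [DivisionRing D] [Algebra E D]
    [FiniteDimensional E D] (hD : AS E D) {m : ℕ} (hm : finrank E D = m ^ 2) :
    ∃ (α : D) (g : V.valuationSubring[X]), g.Monic ∧ mp V g = minpoly E α ∧ g.natDegree = m ∧
      Irreducible (g.map (IsLocalRing.residue V.valuationSubring)) := by
  obtain ⟨α, hα, hgen⟩ := exists_gen hV hD hm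
  have hi : IsIntegral E α := .of_finite E α
  have hm0 : m ≠ 0 := m_ne hm
  obtain ⟨g, hg1, hg2, hg3⟩ := lifts_and_natDegree_eq_and_monic (f := algebraMap V.valuationSubring E)
    (p := minpoly E α) (by
      rw [lifts_iff_coeff_lifts]
      intro i
      exact ⟨⟨(minpoly E α).coeff i, W_le_one hV hD hm hα i⟩, rfl⟩) (minpoly.monic hi)
  have hdeg : g.natDegree = m := by
    refine le_antisymm ?_ (span_deg hα hgen g hg3 ?_)
    · rw [hg2]
      obtain ⟨r, h1, h2, h3, -⟩ := minpoly_data' hD hm α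
      exact h3
    · rw [coe_mapRingHom, hg1, minpoly.aeval]; simp
  refine ⟨α, g, hg3, hg1, hdeg, ?_⟩
  have hgm := hg3.map (IsLocalRing.residue V.valuationSubring)
  have hgd : (g.map (IsLocalRing.residue V.valuationSubring)).natDegree = m := by rw [hg3.natDegree_map, hdeg]
  rw [hgm.irreducible_iff_natDegree]
  refine ⟨fun h1 => by rw [h1] at hgd; simp at hgd; omega, fun a b ha hb hab => ?_⟩
  by_contra hcon
  push Not at hcon
  have hlift : ∀ a : (IsLocalRing.ResidueField V.valuationSubring)[X], a.Monic → ∃ A : V.valuationSubring[X],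
      A.map (IsLocalRing.residue _) = a ∧ A.natDegree = a.natDegree ∧ A.Monic := by
    intro a ha
    refine lifts_and_natDegree_eq_and_monic ?_ ha
    rw [lifts_iff_coeff_lifts]
    intro i
    exact IsLocalRing.residue_surjective _
  obtain ⟨A, hA1, hA2, hA3⟩ := hlift a ha
  obtain ⟨B, hB1, hB2, hB3⟩ := hlift b hb
  have hdeg2 : a.natDegree + b.natDegree = m := by rw [← hgd, ← hab, ha.natDegree_mul hb]
  have hAn : ¬ WV hV hD hm (aeval α (mp V A)) < 1 := fun h => by
    have := span_deg hα hgen A hA3 h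
    omega
  have hBn : ¬ WV hV hD hm (aeval α (mp V B)) < 1 := fun h => by
    have := span_deg hα hgen B hB3 h
    omega
  have hAB : WV hV hD hm (aeval α (mp V (A * B - g))) < 1 := by
    rw [aeval_eq_sum_range]
    refine Valuation.map_sum_lt _ one_ne_zero fun i _ => ?_
    rw [WV_smul, map_pow]
    refine mul_lt_one_of_lt_of_le (pow_lt_one₀ zero_le ?_ (pow_ne_zero _ hm0)) (pow_le_one₀ zero_le hα)
    rw [coe_mapRingHom, coeff_map]
    refine (res_iff _).1 ?_
    rw [← coeff_map, Polynomial.map_sub, Polynomial.map_mul, hA1, hB1, hab]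
    simp
  rw [map_sub, map_sub] at hAB
  have e : aeval α (mp V g) = 0 := by rw [coe_mapRingHom, hg1, minpoly.aeval]
  rw [e, sub_zero, map_mul, map_mul, map_mul, le_antisymm (W_aeval' hα A) (not_lt.1 hAn),
    le_antisymm (W_aeval' hα B) (not_lt.1 hBn)] at hAB
  simp at hAB

/-- an extension of valued fields -/
structure VExt {E E' : Type} [Field E] [Field E'] (V : Valuation E ℤᵐ⁰) (V' : Valuation E' ℤᵐ⁰) [Algebra E E'] : Prop where
  le : ∀ x, V x ≤ 1 → V' (algebraMap E E' x) ≤ 1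
  lt : ∀ x, V x < 1 → V' (algebraMap E E' x) < 1

lemma Spl_unram {E : Type} [Field E] {V : Valuation E ℤᵐ⁰} (hV : LF V) {D : Type} [DivisionRing D] [Algebra E D]
    [FiniteDimensional E D] (hD : AS E D) {m : ℕ} (hm : finrank E D = m ^ 2) {E' : Type} [Field E'] [Algebra E E']
    {V' : Valuation E' ℤᵐ⁰} (hV' : LF V') (hE : VExt V V') {f : ℕ}
    (hcard : Nat.card (IsLocalRing.ResidueField V'.valuationSubring) = Nat.card (IsLocalRing.ResidueField V.valuationSubring) ^ f)
    (hf : m ∣ f) : Spl E D E' m := by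
  classical
  obtain ⟨α, g, hg1, hg2, hg3, hirr⟩ := exists_unram hV hD hm
  have hm0 : m ≠ 0 := m_ne hm
  obtain ⟨r, h1, h2, h3, h4, h5⟩ := minpoly_data' hD hm α
  have hdeg : (minpoly E α).natDegree = m := by
    rw [← hg2, coe_mapRingHom, hg1.natDegree_map, hg3]
  obtain rfl : r = m := by
    rw [hdeg, pow_two] at h1
    exact Nat.eq_of_mul_eq_mul_left (Nat.pos_of_ne_zero hm0) h1
  let φ : V.valuationSubring →+* V'.valuationSubring :=
    ((algebraMap E E').comp (algebraMap V.valuationSubring E)).codRestrict V'.valuationSubring.toSubring (fun x => hE.le _ x.2)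
  have hφ : ∀ x, ((φ x : V'.valuationSubring) : E') = algebraMap E E' (x : E) := fun x => rfl
  haveI : IsLocalHom φ := ⟨fun a ha => by
    by_contra hna
    have h6 : V (a : E) < 1 := (res_iff a).1 ((IsLocalRing.residue_eq_zero_iff _).2 ((IsLocalRing.mem_maximalIdeal _).2 hna))
    have h7 := (res_iff (φ a)).2 (by rw [hφ]; exact hE.lt _ h6)
    exact (IsLocalRing.mem_maximalIdeal _).1 ((IsLocalRing.residue_eq_zero_iff _).1 h7) ha⟩
  set k := IsLocalRing.ResidueField V.valuationSubring
  set k' := IsLocalRing.ResidueField V'.valuationSubring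
  haveI : Finite k := hV.fin
  haveI : Finite k' := hV'.fin
  letI : Fintype k' := Fintype.ofFinite k'
  let φ' : k →+* k' := IsLocalRing.ResidueField.map φ
  set G := g.map (IsLocalRing.residue V.valuationSubring) with hG
  have hGd : G.natDegree ∣ f := by rw [hG, hg1.natDegree_map, hg3]; exact hf
  have hdvd := (hirr.natDegree_dvd_iff_dvd_X_pow_card_pow_sub_X (n := f)).1 hGd
  rw [← hcard] at hdvd
  have hdvd' : G.map φ' ∣ X ^ Nat.card k' - X := by
    have := Polynomial.map_dvd φ' hdvd
    simpa using this
  have hGm : (G.map φ').Monic := (hg1.map _).map _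
  have hsp : (X ^ Nat.card k' - X : k'[X]).Splits := by
    rw [Nat.card_eq_fintype_card]
    rw [splits_iff_card_roots, FiniteField.roots_X_pow_card_sub_X k',
      FiniteField.X_pow_card_sub_X_natDegree_eq k' Fintype.one_lt_card]
    simp
  have hne : (X ^ Nat.card k' - X : k'[X]) ≠ 0 := FiniteField.X_pow_card_sub_X_ne_zero _ Finite.one_lt_card
  have hsp2 : (G.map φ').Splits := hsp.of_dvd hne hdvd'
  obtain ⟨y, hy⟩ := hsp2.exists_eval_eq_zero (by
    rw [degree_eq_natDegree hGm.ne_zero, (hg1.map _).natDegree_map, hg1.natDegree_map, hg3]; exact_mod_cast hm0)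
  have hsep : (G.map φ').Separable := (PerfectField.separable_of_irreducible hirr).map
  obtain ⟨a0, rfl⟩ := IsLocalRing.residue_surjective y
  have hGφ : G.map φ' = (g.map φ).map (IsLocalRing.residue _) := by
    rw [hG, Polynomial.map_map, Polynomial.map_map]; rfl
  haveI := hV'.hensel
  obtain ⟨a, ha, -⟩ := HenselianLocalRing.is_henselian (g.map φ) (hg1.map φ) a0 (by
    rw [hGφ, eval_map, eval₂_at_apply] at hy
    exact (IsLocalRing.residue_eq_zero_iff _).1 hy) (by
    have h8 : (derivative (G.map φ')).eval (IsLocalRing.residue _ a0) ≠ 0 := by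
      have := hsep.aeval_derivative_ne_zero (x := IsLocalRing.residue _ a0) (by simpa using hy)
      simpa using this
    rw [hGφ, derivative_map, eval_map, eval₂_at_apply] at h8
    by_contra hn
    exact h8 ((IsLocalRing.residue_eq_zero_iff _).2 ((IsLocalRing.mem_maximalIdeal _).2 hn)))
  refine h5 E' (a : E') ?_
  have h9 := congrArg (fun z : V'.valuationSubring => (z : E')) ha.eq_zero
  rw [← hg2, coe_mapRingHom, aeval_def, eval₂_map]
  rw [eval_map] at h9
  have h10 := Polynomial.hom_eval₂ g φ (algebraMap V'.valuationSubring E') a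
  change algebraMap V'.valuationSubring E' _ = 0 at h9
  rw [h10] at h9
  exact h9
end Prf
set_option linter.all false
set_option linter.unusedVariables false
set_option linter.unusedSimpArgs false
namespace Prf
open Module Polynomial TensorProduct WithZero

lemma wedd (E A : Type) [Field E] [Ring A] [Algebra E A] [FiniteDimensional E A] [IsSimpleRing A] [Algebra.IsCentral E A] :
    ∃ (r : ℕ) (_ : NeZero r) (D : Type) (_ : DivisionRing D) (_ : Algebra E D) (_ : FiniteDimensional E D)
      (_ : Algebra.IsCentral E D), Nonempty (A ≃ₐ[E] Matrix (Fin r) (Fin r) D) := by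
  haveI : IsArtinianRing A := IsArtinianRing.of_finite E A
  obtain ⟨r, hr, D, _, _, _, ⟨e⟩⟩ := IsSimpleRing.exists_algEquiv_matrix_divisionRing_finite E A
  refine ⟨r, hr, D, _, _, ‹_›, ⟨fun d hd => ?_⟩, ⟨e⟩⟩
  have h1 : Matrix.scalar (Fin r) d ∈ Subalgebra.center E (Matrix (Fin r) (Fin r) D) := by
    rw [Subalgebra.mem_center_iff] at hd ⊢
    intro M
    ext i j
    simp [Matrix.mul_apply, Matrix.diagonal_apply, hd]
  have h2 : e.symm (Matrix.scalar (Fin r) d) ∈ Subalgebra.center E A := by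
    rw [Subalgebra.mem_center_iff] at h1 ⊢
    intro a
    apply e.injective
    rw [map_mul, map_mul, e.apply_symm_apply]
    exact h1 _
  obtain ⟨c, hc⟩ := Algebra.IsCentral.out h2
  refine ⟨c, ?_⟩
  have h3 : algebraMap E (Matrix (Fin r) (Fin r) D) c = Matrix.scalar (Fin r) d := by
    rw [← e.apply_symm_apply (Matrix.scalar (Fin r) d), ← hc]
    exact (e.commutes c).symm
  have h4 := congrFun (congrFun h3 0) 0
  simpa [Matrix.algebraMap_matrix_apply] using h4

lemma Spl_matrix {E A D E' : Type} [Field E] [Ring A] [Algebra E A] [Ring D] [Algebra E D] [Field E'] [Algebra E E'] {r m : ℕ}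
    (e : A ≃ₐ[E] Matrix (Fin r) (Fin r) D) (h : Spl E D E' m) : Spl E A E' (r * m) := by
  obtain ⟨f⟩ := h
  exact ⟨(((Matrix.reindexAlgEquiv E E' finProdFinEquiv).toAlgHom.comp (Matrix.compAlgEquiv (Fin r) (Fin m) E' E).toAlgHom).comp
    f.mapMatrix).comp e.toAlgHom⟩

/-- local splitting at arbitrary places by unramified extensions of large degree -/
lemma local_bad {E : Type} [Field E] {V : Valuation E ℤᵐ⁰} (hV : LF V) {A : Type} [Ring A] [Algebra E A]
    [FiniteDimensional E A] [IsSimpleRing A] [Algebra.IsCentral E A] {n : ℕ} (hn : finrank E A = n ^ 2)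
    {E' : Type} [Field E'] [Algebra E E']
    {V' : Valuation E' ℤᵐ⁰} (hV' : LF V') (hE : VExt V V') {f : ℕ}
    (hcard : Nat.card (IsLocalRing.ResidueField V'.valuationSubring) = Nat.card (IsLocalRing.ResidueField V.valuationSubring) ^ f)
    (hf : n ∣ f) : Spl E A E' n := by
  obtain ⟨r, hr, D, _, _, _, _, ⟨e⟩⟩ := wedd E A
  have hD := CSA_AS E D
  obtain ⟨m, hm0, hm, -⟩ := hD.sq
  have h1 : n ^ 2 = (r * m) ^ 2 := by
    rw [← hn, e.toLinearEquiv.finrank_eq, Module.finrank_matrix, hm]; simp; ring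
  have h2 : n = r * m := Nat.pow_left_injective (n := 2) (by norm_num) h1
  rw [h2]
  exact Spl_matrix e (Spl_unram hV hD hm hV' hE hcard ((Dvd.intro_left r h2.symm).trans hf))

/-- over a finite field -/
lemma finite_split {k A : Type} [Field k] [Finite k] [Ring A] [Algebra k A]
    [FiniteDimensional k A] [IsSimpleRing A] [Algebra.IsCentral k A] {n : ℕ} (hn : finrank k A = n ^ 2) :
    Nonempty (A ≃ₐ[k] Matrix (Fin n) (Fin n) k) := by
  obtain ⟨r, hr, D, _, _, _, _, ⟨e⟩⟩ := wedd k A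
  haveI : Finite D := Module.finite_of_finite k
  have hf := Finite.isDomain_to_isField D
  have hbij : Function.Bijective (algebraMap k D) := by
    refine ⟨(algebraMap k D).injective, fun d => ?_⟩
    have : d ∈ Subalgebra.center k D := Subalgebra.mem_center_iff.2 fun b => hf.mul_comm _ _
    exact Algebra.IsCentral.out this
  let e2 : k ≃ₐ[k] D := AlgEquiv.ofBijective (Algebra.ofId k D) hbij
  have h1 : n ^ 2 = r ^ 2 := by
    rw [← hn, e.toLinearEquiv.finrank_eq, Module.finrank_matrix, ← e2.toLinearEquiv.finrank_eq]; simp; ring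
  have h2 : n = r := Nat.pow_left_injective (n := 2) (by norm_num) h1
  subst h2
  exact ⟨e.trans e2.symm.mapMatrix⟩
end Prf
set_option linter.all false
set_option linter.unusedVariables false
set_option linter.unusedSimpArgs false
namespace Prf
open Module Polynomial TensorProduct WithZero

lemma minpoly_deg_le {E A : Type} [Field E] [Ring A] [Algebra E A] [FiniteDimensional E A] (hA : AS E A) {n : ℕ}
    (hn : finrank E A = n ^ 2) (x : A) : (minpoly E x).natDegree ≤ n := by
  obtain ⟨n', hn', hA', ⟨f⟩⟩ := hA.sq
  have hnn : n' = n := by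
    rw [hn] at hA'
    exact (Nat.pow_left_injective (n := 2) (by norm_num) hA').symm
  subst hnn
  set Ω := AlgebraicClosure E
  haveI := hA Ω
  have hnt : Nonempty (Fin n') := ⟨⟨0, hn'⟩⟩
  haveI : Nontrivial (Matrix (Fin n') (Fin n') Ω) := inferInstance
  have hinj : Function.Injective (ext f) := (ext f).toRingHom.injective
  let v : Fin (n' + 1) → A := fun i => x ^ (i : ℕ)
  have hdep : ¬ LinearIndependent E v := by
    intro hli
    have h1 : LinearIndependent Ω (fun i => (1 : Ω) ⊗ₜ[E] v i) := by
      let b := finBasis E A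
      let b' := b.baseChange Ω
      have h2 : LinearIndependent E (fun i => (b.repr (v i) : Fin (finrank E A) → E)) := by
        have := hli.map' b.equivFun.toLinearMap b.equivFun.ker
        exact this
      have h3 := linearIndependent_algebraMap_comp_iff (S := Ω) (v := fun i => (b.repr (v i) : Fin (finrank E A) → E)) |>.2 h2
      have h4 := h3.map' b'.equivFun.symm.toLinearMap b'.equivFun.symm.ker
      have heq : ∀ i, b'.equivFun.symm (algebraMap E Ω ∘ b.repr (v i)) = (1 : Ω) ⊗ₜ[E] v i := by
        intro i
        apply b'.equivFun.injective
        rw [LinearEquiv.apply_symm_apply]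
        funext j
        rw [Basis.equivFun_apply]
        refine Eq.trans ?_ (Basis.baseChange_repr_tmul Ω b 1 (v i) j).symm
        simp [Algebra.smul_def]
      have heq' : (fun i => (1 : Ω) ⊗ₜ[E] v i) = fun i => b'.equivFun.symm (algebraMap E Ω ∘ b.repr (v i)) :=
        funext fun i => (heq i).symm
      rw [heq']
      exact h4
    have h5 := h1.map' (ext f).toLinearMap (LinearMap.ker_eq_bot.2 hinj)
    have h6 : ∀ i, (ext f).toLinearMap ((1 : Ω) ⊗ₜ[E] v i) = (f x) ^ (i : ℕ) := by
      intro i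
      refine (ext_tmul f 1 (v i)).trans ?_
      simp [v]
    have h7 := Matrix.aeval_self_charpoly (f x)
    rw [aeval_eq_sum_range, Matrix.charpoly_natDegree_eq_dim, Fintype.card_fin,
      ← Fin.sum_univ_eq_sum_range (fun i => (f x).charpoly.coeff i • (f x) ^ i)] at h7
    have h8 := Fintype.linearIndependent_iff.1 h5 (fun i => (f x).charpoly.coeff i) (by
      rw [← h7]
      refine Finset.sum_congr rfl fun i _ => ?_
      congr 1
      exact h6 i) (Fin.last n')
    have h9 := (Matrix.charpoly_monic (f x)).leadingCoeff
    rw [leadingCoeff, Matrix.charpoly_natDegree_eq_dim, Fintype.card_fin] at h9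
    simp only [Fin.val_last] at h8
    rw [h8] at h9
    exact zero_ne_one h9
  rw [Fintype.linearIndependent_iff] at hdep
  push Not at hdep
  obtain ⟨c, hc, i, hi⟩ := hdep
  let p : E[X] := ∑ i : Fin (n' + 1), C (c i) * X ^ (i : ℕ)
  have hpc : ∀ j : Fin (n' + 1), p.coeff j = c j := by
    intro j
    simp only [p, finset_sum_coeff, coeff_C_mul_X_pow]
    simp [Fin.val_inj]
  have hp0 : p ≠ 0 := fun h => hi (by rw [← hpc i, h]; simp)
  have hpx : aeval x p = 0 := by
    simp only [p, map_sum, map_mul, aeval_C, map_pow, aeval_X]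
    rw [← hc]
    simp [v, Algebra.smul_def]
  refine (natDegree_le_natDegree (minpoly.degree_le_of_ne_zero E x hp0 hpx)).trans ?_
  refine natDegree_sum_le_of_forall_le _ _ fun i _ => ?_
  exact (natDegree_C_mul_X_pow_le _ _).trans (by omega)
end Prf
set_option linter.all false
set_option linter.unusedVariables false
set_option linter.unusedSimpArgs false
namespace Prf
open Module Polynomial TensorProduct WithZero

lemma rep_of_roots {E A : Type} [Field E] [Ring A] [Algebra E A] [FiniteDimensional E A] [IsSimpleRing A] {n : ℕ}
    (hn0 : 0 < n) (hn : finrank E A = n ^ 2) (x : A) (r : Fin n → E) (hr : Function.Injective r)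
    (hroot : ∀ i, (minpoly E x).IsRoot (r i)) : HasRep E A n := by
  let T : Module.End E A := LinearMap.mulRight E x
  have hne : ∀ i, ∃ y : A, y ≠ 0 ∧ y ∈ T.eigenspace (r i) := by
    intro i
    obtain ⟨h, hh⟩ := dvd_iff_isRoot.2 (hroot i)
    have hm := minpoly.monic (IsIntegral.of_finite E x)
    have h0 : h ≠ 0 := by
      rintro rfl
      rw [mul_zero] at hh
      exact hm.ne_zero hh
    refine ⟨aeval x h, fun h1 => ?_, ?_⟩
    · have h2 := minpoly.dvd E x h1
      have h3 := natDegree_le_of_dvd h2 h0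
      rw [hh, natDegree_mul (X_sub_C_ne_zero _) h0, natDegree_X_sub_C] at h3
      omega
    · rw [Module.End.mem_eigenspace_iff]
      have h1 : aeval x (h * (X - C (r i))) = 0 := by
        rw [mul_comm, ← hh, minpoly.aeval]
      simp only [map_mul, map_sub, aeval_X, aeval_C, mul_sub, sub_eq_zero] at h1
      change aeval x h * x = _
      rw [h1, Algebra.smul_def, Algebra.commutes]
  let I : Fin n → Submodule A A := fun i =>
    { carrier := {y | T y = r i • y}
      add_mem' := by
        intro a b ha hb
        simp only [Set.mem_ofPred_eq] at *
        rw [map_add, ha, hb, smul_add]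
      zero_mem' := by simp
      smul_mem' := by
        intro c y hy
        simp only [Set.mem_ofPred_eq] at *
        change (c • y) * x = _
        change y * x = _ at hy
        rw [smul_eq_mul, mul_assoc, hy, mul_smul_comm] }
  have hI : ∀ i, (I i).restrictScalars E = T.eigenspace (r i) := by
    intro i
    ext y
    rw [Module.End.mem_eigenspace_iff]
    rfl
  have hle : ∀ i, n ≤ finrank E (I i) := by
    intro i
    obtain ⟨y, hy0, hy⟩ := hne i
    rw [← hI i] at hy
    haveI : Nontrivial (I i) := ⟨⟨⟨y, hy⟩, 0, fun h => hy0 (congrArg Subtype.val h)⟩⟩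
    have hrep : HasRep E A (finrank E (I i)) := HasRep.of_end (Algebra.lsmul E (A := A) E (I i))
    exact HasRep.le finrank_pos hrep hn
  have hind : iSupIndep (fun i : Fin n => T.eigenspace (r i)) := (Module.End.eigenspaces_iSupIndep T).comp hr
  have hsum : ∑ i, finrank E (I i) ≤ n ^ 2 := by
    rw [← hn]
    have h1 := hind.dfinsupp_lsum_injective
    let e := DFinsupp.linearEquivFunOnFintype (R := E) (M := fun i : Fin n => T.eigenspace (r i))
    have h2 := LinearMap.finrank_le_finrank_of_injective
      (f := (DFinsupp.lsum ℕ fun i : Fin n => (T.eigenspace (r i)).subtype).comp e.symm.toLinearMap)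
      (h1.comp e.symm.injective)
    rw [finrank_pi_fintype] at h2
    refine le_trans (le_of_eq (Finset.sum_congr rfl fun i _ => ?_)) h2
    rw [← hI i]
    rfl
  have hex : ∃ i, finrank E (I i) = n := by
    by_contra hcon
    push Not at hcon
    have h1 : ∑ i : Fin n, (n + 1) ≤ ∑ i, finrank E (I i) :=
      Finset.sum_le_sum fun i _ => lt_of_le_of_ne (hle i) (hcon i).symm
    simp at h1
    nlinarith
  obtain ⟨i, hi⟩ := hex
  have hrep : HasRep E A (finrank E (I i)) := HasRep.of_end (Algebra.lsmul E (A := A) E (I i))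
  rwa [hi] at hrep

section
variable {ι R Λ : Type} [Fintype ι] [DecidableEq ι] [CommRing R] [Ring Λ] [Algebra R Λ]

/-- explicit Azumaya property -/
def Az (β : Basis ι R Λ) : Prop := ∀ i j, ∃ κ : ι → ι → R, ∀ l,
  ∑ s, ∑ t, κ s t • (β s * β l * β t) = if l = i then β j else 0

lemma Az.baseChange {β : Basis ι R Λ} (h : Az β) (S : Type) [CommRing S] [Algebra R S] :
    Az (β.baseChange S) := by
  intro i j
  obtain ⟨κ, hκ⟩ := h i j
  refine ⟨fun s t => algebraMap R S (κ s t), fun l => ?_⟩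
  have := congrArg (fun z : Λ => (1 : S) ⊗ₜ[R] z) (hκ l)
  simp only [Basis.baseChange_apply, Algebra.TensorProduct.tmul_mul_tmul, one_mul, algebraMap_smul]
  simp only [TensorProduct.tmul_sum, TensorProduct.tmul_smul] at this
  rw [this]
  split_ifs <;> simp

lemma Az.apply {β : Basis ι R Λ} (h : Az β) (i j : ι) : ∃ κ : ι → ι → R, ∀ x : Λ,
    ∑ s, ∑ t, κ s t • (β s * x * β t) = β.repr x i • β j := by
  obtain ⟨κ, hκ⟩ := h i j
  refine ⟨κ, fun x => ?_⟩
  have h1 : (∑ s, ∑ t, κ s t • ((LinearMap.mulLeft R (β s)).comp (LinearMap.mulRight R (β t)))) =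
    (LinearMap.toSpanSingleton R Λ (β j)).comp (β.coord i) := by
    refine β.ext fun l => ?_
    simp only [LinearMap.sum_apply, LinearMap.smul_apply, LinearMap.comp_apply, LinearMap.mulLeft_apply,
      LinearMap.mulRight_apply, ← mul_assoc, hκ, Basis.coord_apply, Basis.repr_self, LinearMap.toSpanSingleton_apply,
      Finsupp.single_apply]
    split_ifs <;> simp
  have h2 := LinearMap.congr_fun h1 x
  simpa only [LinearMap.sum_apply, LinearMap.smul_apply, LinearMap.comp_apply, LinearMap.mulLeft_apply,
      LinearMap.mulRight_apply, ← mul_assoc, Basis.coord_apply, LinearMap.toSpanSingleton_apply] using h2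
end

section
variable {ι k A : Type} [Fintype ι] [DecidableEq ι] [Field k] [Ring A] [Algebra k A] [Nontrivial A]

lemma Az.simple {β : Basis ι k A} (h : Az β) : IsSimpleRing A := by
  refine ⟨⟨fun I => ?_⟩⟩
  by_cases hI : I = ⊥
  · exact Or.inl hI
  right
  obtain ⟨x, hx, hx0⟩ : ∃ x ∈ I, x ≠ 0 := by
    by_contra hcon
    push Not at hcon
    exact hI (eq_bot_iff.2 fun x hx => by rw [TwoSidedIdeal.mem_bot]; exact hcon x hx)
  obtain ⟨i, hi⟩ : ∃ i, β.repr x i ≠ 0 := by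
    by_contra hcon
    push Not at hcon
    exact hx0 (β.repr.map_eq_zero_iff.1 (Finsupp.ext hcon))
  have hsm : ∀ (c : k) (y : A), y ∈ I → c • y ∈ I := by
    intro c y hy
    rw [Algebra.smul_def]; exact I.mul_mem_left _ _ hy
  have hb : ∀ j, β j ∈ I := by
    intro j
    obtain ⟨κ, hκ⟩ := h.apply i j
    have h1 : β.repr x i • β j ∈ I := by
      rw [← hκ x]
      refine sum_mem fun s _ => sum_mem fun t _ => hsm _ _ (I.mul_mem_right _ _ (I.mul_mem_left _ _ hx))
    have := hsm (β.repr x i)⁻¹ _ h1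
    rwa [inv_smul_smul₀ hi] at this
  refine eq_top_iff.2 fun y _ => ?_
  rw [← β.sum_repr y]
  exact sum_mem fun j _ => hsm _ _ (hb j)

lemma Az.central {β : Basis ι k A} (h : Az β) : Algebra.IsCentral k A := by
  refine ⟨fun x hx => ?_⟩
  rw [Subalgebra.mem_center_iff] at hx
  obtain ⟨i, hi⟩ : ∃ i, β.repr 1 i ≠ 0 := by
    by_contra hcon
    push Not at hcon
    exact one_ne_zero (β.repr.map_eq_zero_iff.1 (Finsupp.ext hcon))
  have key : ∀ j, β.repr x i • β j = β.repr 1 i • (β j * x) := by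
    intro j
    obtain ⟨κ, hκ⟩ := h.apply i j
    have h1 := hκ x
    have h2 := congrArg (· * x) (hκ 1)
    simp only [Finset.sum_mul, smul_mul_assoc, mul_one] at h2
    rw [← h1, ← h2]
    refine Finset.sum_congr rfl fun s _ => Finset.sum_congr rfl fun t _ => ?_
    rw [mul_assoc, ← hx (β t), ← mul_assoc]
  have h3 : ∀ y : A, β.repr x i • y = β.repr 1 i • (y * x) := by
    intro y
    have : (β.repr x i • LinearMap.id : A →ₗ[k] A) = β.repr 1 i • LinearMap.mulRight k x := β.ext fun j => by
      simpa using key j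
    simpa using LinearMap.congr_fun this y
  have h4 := h3 1
  rw [one_mul] at h4
  rw [Algebra.mem_bot]
  refine ⟨(β.repr 1 i)⁻¹ * β.repr x i, ?_⟩
  rw [Algebra.algebraMap_eq_smul_one, mul_smul, h4, inv_smul_smul₀ hi]
end
lemma Az.of_csa {ι K C : Type} [Fintype ι] [DecidableEq ι] [Field K] [Ring C] [Algebra K C] [IsSimpleRing C] [Algebra.IsCentral K C]
    [FiniteDimensional K C] (b : Basis ι K C) : Az b := by
  intro i j
  obtain ⟨t, ht⟩ := mulLR_surj K C ((LinearMap.toSpanSingleton K C (b j)).comp (b.coord i))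
  let B := b.tensorProduct (b.map (MulOpposite.opLinearEquiv K))
  refine ⟨fun s u => B.repr t (s, u), fun l => ?_⟩
  have h1 := LinearMap.congr_fun ht (b l)
  rw [← B.sum_repr t, Fintype.sum_prod_type] at h1
  simp only [map_sum, map_smul, LinearMap.sum_apply, LinearMap.smul_apply, B, Basis.tensorProduct_apply, Basis.map_apply] at h1
  simp at h1
  rw [h1]
  simp [Finsupp.single_apply]
end Prf
set_option linter.all false
set_option linter.unusedVariables false
set_option linter.unusedSimpArgs false
namespace Prf
open Module Polynomial TensorProduct WithZero

section
variable {E : Type} [Field E] {V : Valuation E ℤᵐ⁰}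
variable {ι A : Type} [Fintype ι] [DecidableEq ι] [Ring A] [Algebra E A] (β : Basis ι E A)

/-- the order spanned by a basis -/
def ordr (V : Valuation E ℤᵐ⁰) (β : Basis ι E A)
    (hmul : ∀ i j l, V (β.repr (β i * β j) l) ≤ 1) (hone : ∀ l, V (β.repr 1 l) ≤ 1) :
    Subalgebra V.valuationSubring A where
  carrier := {x | ∀ i, V (β.repr x i) ≤ 1}
  add_mem' := by
    intro a b ha hb i
    rw [map_add, Finsupp.add_apply]
    exact (V.map_add _ _).trans (max_le (ha i) (hb i))
  mul_mem' := by
    intro a b ha hb l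
    rw [← β.sum_repr a, ← β.sum_repr b, Finset.sum_mul_sum]
    simp only [map_sum, Finsupp.coe_finset_sum, Finset.sum_apply, smul_mul_smul_comm, map_smul, Finsupp.smul_apply, smul_eq_mul]
    refine V.map_sum_le fun i _ => V.map_sum_le fun j _ => ?_
    rw [map_mul, map_mul]
    exact mul_le_one' (mul_le_one' (ha i) (hb j)) (hmul i j l)
  algebraMap_mem' := by
    intro r l
    change V (β.repr (algebraMap E A r) l) ≤ 1
    rw [Algebra.algebraMap_eq_smul_one, map_smul, Finsupp.smul_apply, smul_eq_mul, map_mul]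
    exact mul_le_one' r.2 (hone l)

variable (hmul : ∀ i j l, V (β.repr (β i * β j) l) ≤ 1) (hone : ∀ l, V (β.repr 1 l) ≤ 1)

/-- basis of the order -/
noncomputable def ordrBasis : Basis ι V.valuationSubring (ordr V β hmul hone) :=
  Basis.ofEquivFun
    { toFun := fun x i => ⟨β.repr x.1 i, x.2 i⟩
      map_add' := by intro x y; funext i; apply Subtype.ext; simp
      map_smul' := by
        intro r x; funext i; apply Subtype.ext
        change β.repr ((r : E) • x.1) i = _
        simp
      invFun := fun c => ⟨∑ i, (c i : E) • β i, fun j => by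
        have := (c j).2
        rw [β.repr_sum_self]; exact this⟩
      left_inv := by intro x; apply Subtype.ext; exact β.sum_repr x.1
      right_inv := by
        intro c; funext i; apply Subtype.ext
        change β.repr (∑ i, (c i : E) • β i) i = _
        rw [β.repr_sum_self] }

lemma ordrBasis_coe (i : ι) : (ordrBasis β hmul hone i : A) = β i := by
  have : ordrBasis β hmul hone i = (ordrBasis β hmul hone).equivFun.symm (Pi.single i 1) := by
    simp
  rw [this]
  change ∑ j, ((Pi.single i (1 : V.valuationSubring) : ι → V.valuationSubring) j : E) • β j = β i
  rw [Finset.sum_eq_single i]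
  · simp
  · intro j _ hj; simp [Pi.single_apply, hj]
  · simp

lemma ordr_az (haz : ∀ i j, ∃ κ : ι → ι → E, (∀ s t, V (κ s t) ≤ 1) ∧ ∀ l,
    ∑ s, ∑ t, κ s t • (β s * β l * β t) = if l = i then β j else 0) : Az (ordrBasis β hmul hone) := by
  intro i j
  obtain ⟨κ, hκ1, hκ⟩ := haz i j
  refine ⟨fun s t => ⟨κ s t, hκ1 s t⟩, fun l => ?_⟩
  apply Subtype.ext
  have := hκ l
  rw [show ((if l = i then ordrBasis β hmul hone j else 0 : ordr V β hmul hone) : A) = if l = i then β j else 0 by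
    split_ifs
    · exact ordrBasis_coe β hmul hone j
    · rfl, ← this]
  simp only [AddSubmonoidClass.coe_finset_sum]
  refine Finset.sum_congr rfl fun s _ => Finset.sum_congr rfl fun t _ => ?_
  rw [← ordrBasis_coe β hmul hone s, ← ordrBasis_coe β hmul hone t, ← ordrBasis_coe β hmul hone l]
  rfl

lemma good_place (hmul : ∀ i j l, V (β.repr (β i * β j) l) ≤ 1) (hone : ∀ l, V (β.repr 1 l) ≤ 1) (hV : LF V) [IsSimpleRing A] [FiniteDimensional E A] (hA : AS E A) {n : ℕ} (hn0 : 0 < n)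
    (hn : finrank E A = n ^ 2)
    (haz : ∀ i j, ∃ κ : ι → ι → E, (∀ s t, V (κ s t) ≤ 1) ∧ ∀ l,
      ∑ s, ∑ t, κ s t • (β s * β l * β t) = if l = i then β j else 0)
    (hcard : n ≤ Nat.card (IsLocalRing.ResidueField V.valuationSubring)) : HasRep E A n := by
  let R := V.valuationSubring
  let k := IsLocalRing.ResidueField R
  haveI : Finite k := hV.fin
  let Λ := ordr V β hmul hone
  let b : Basis ι R Λ := ordrBasis β hmul hone
  have hb : Az b := ordr_az β hmul hone haz
  haveI tower : IsScalarTower R k (k ⊗[R] Λ) := TensorProduct.isScalarTower_left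
  let B := b.baseChange k
  have hB : Az B := hb.baseChange k
  have hcι : Fintype.card ι = n ^ 2 := by rw [← hn, finrank_eq_card_basis β]
  have hfr : finrank k (k ⊗[R] Λ) = n ^ 2 := by rw [finrank_eq_card_basis B, hcι]
  haveI : Module.Finite k (k ⊗[R] Λ) := Module.Finite.of_basis B
  haveI : Nontrivial (k ⊗[R] Λ) := by
    apply Module.nontrivial_of_finrank_pos (R := k); rw [hfr]; positivity
  haveI := hB.simple
  haveI := hB.central
  obtain ⟨e⟩ := finite_split (k := k) hfr
  haveI := Fintype.ofFinite k
  obtain ⟨lam⟩ : Nonempty (Fin n ↪ k) := Function.Embedding.nonempty_of_card_le (by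
    rw [Fintype.card_fin, ← Nat.card_eq_fintype_card]; exact hcard)
  let xb : k ⊗[R] Λ := e.symm (Matrix.diagonal lam)
  obtain ⟨x, hx⟩ : ∃ x : Λ, (1 : k) ⊗ₜ[R] x = xb := by
    choose c hc using fun i => IsLocalRing.residue_surjective (B.repr xb i)
    refine ⟨∑ i, c i • b i, ?_⟩
    rw [← B.sum_repr xb, TensorProduct.tmul_sum]
    refine Finset.sum_congr rfl fun i _ => ?_
    rw [TensorProduct.tmul_smul, ← hc i]
    simp only [B, Basis.baseChange_apply]
    rw [← algebraMap_smul k (c i)]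
    rfl
  have hred : ∀ G : R[X], aeval (x : A) G = 0 → ∀ i, (G.map (IsLocalRing.residue R)).eval (lam i) = 0 := by
    intro G hG i
    have h1 : aeval x G = 0 := by
      apply Subtype.ext
      have := Polynomial.aeval_algHom_apply Λ.val x G
      exact this.symm.trans hG
    have h2 : aeval xb G = 0 := by
      rw [← hx]
      have := Polynomial.aeval_algHom_apply (Algebra.TensorProduct.includeRight : Λ →ₐ[R] k ⊗[R] Λ) x G
      rw [h1, map_zero] at this
      exact this
    have h3 : aeval (Matrix.diagonal lam) (G.map (IsLocalRing.residue R)) = 0 := by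
      have h4 : aeval xb (G.map (algebraMap R k)) = 0 := by
        rw [aeval_map_algebraMap]; exact h2
      have h5 := Polynomial.aeval_algHom_apply e.toAlgHom xb (G.map (algebraMap R k))
      rw [h4, map_zero] at h5
      have h6 : e.toAlgHom xb = Matrix.diagonal lam := e.apply_symm_apply _
      rw [h6] at h5
      exact h5
    have h7 : aeval (Matrix.diagonal lam) (G.map (IsLocalRing.residue R)) =
        Matrix.diagonal (aeval (lam : Fin n → k) (G.map (IsLocalRing.residue R))) :=
      Polynomial.aeval_algHom_apply (Matrix.diagonalAlgHom k) (lam : Fin n → k) (G.map (IsLocalRing.residue R))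
    rw [h7] at h3
    have h8 := congrFun (congrFun h3 i) i
    rw [Matrix.diagonal_apply_eq] at h8
    rw [aeval_pi_apply] at h8
    have h9 : aeval (lam i) (G.map (IsLocalRing.residue R)) = 0 := h8
    rw [coe_aeval_eq_eval] at h9
    exact h9
  obtain ⟨G, hGm, hG⟩ : ∃ G : R[X], G.Monic ∧ G.map (algebraMap R E) = minpoly E (x : A) := by
    haveI : Module.Finite R Λ := Module.Finite.of_basis b
    obtain ⟨f, hf, hfx⟩ := IsIntegral.of_finite R x
    have hfx' : aeval (x : A) (f.map (algebraMap R E)) = 0 := by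
      rw [aeval_map_algebraMap]
      have := Polynomial.aeval_algHom_apply Λ.val x f
      rw [aeval_def x, hfx, map_zero] at this
      exact this
    have hd := minpoly.dvd E (x : A) hfx'
    obtain ⟨G, hG⟩ := IsIntegrallyClosed.eq_map_mul_C_of_dvd E hf hd
    have hm := minpoly.monic (IsIntegral.of_finite E (x : A))
    rw [hm.leadingCoeff, C_1, mul_one] at hG
    refine ⟨G, ?_, hG⟩
    rw [← hG] at hm
    exact Polynomial.monic_of_injective (IsFractionRing.injective R E) hm
  have hG0 : aeval (x : A) G = 0 := by
    rw [← aeval_map_algebraMap E, hG, minpoly.aeval]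
  have hr0 := hred G hG0
  let Gb := G.map (IsLocalRing.residue R)
  have hGbm : Gb.Monic := hGm.map _
  have hGbd : Gb.natDegree ≤ n := by
    rw [hGm.natDegree_map, ← hGm.natDegree_map (algebraMap R E), hG]
    exact minpoly_deg_le hA hn _
  have hprod : Gb = ∏ i, (X - C (lam i)) := by
    have hdvd : (∏ i, (X - C (lam i))) ∣ Gb :=
      Finset.prod_dvd_of_coprime (fun i _ j _ hij => isCoprime_X_sub_C_of_isUnit_sub (by
        rw [isUnit_iff_ne_zero, sub_ne_zero]; exact fun h => hij (lam.injective h)))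
        (fun i _ => dvd_iff_isRoot.2 (hr0 i))
    refine (Polynomial.eq_of_monic_of_dvd_of_natDegree_le ?_ hGbm hdvd ?_)
    · exact monic_prod_of_monic _ _ fun i _ => monic_X_sub_C _
    · rw [natDegree_finset_prod_X_sub_C_eq_card]; simpa using hGbd
  have hsep : Gb.Separable := by
    rw [hprod]; exact separable_prod_X_sub_C_iff.2 lam.injective
  haveI := hV.hensel
  have hroots : ∀ i, ∃ r : R, G.IsRoot r ∧ IsLocalRing.residue R r = lam i := by
    intro i
    obtain ⟨a0, ha0⟩ := IsLocalRing.residue_surjective (lam i)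
    obtain ⟨r, hr, hr2⟩ := HenselianLocalRing.is_henselian G hGm a0 (by
      rw [← IsLocalRing.residue_eq_zero_iff, ← Polynomial.eval₂_at_apply, ← eval_map, ha0]
      exact hr0 i) (by
      rw [← IsLocalRing.residue_ne_zero_iff_isUnit, ← Polynomial.eval₂_at_apply, ← eval_map, ha0, ← derivative_map]
      exact Polynomial.Separable.eval₂_derivative_ne_zero (RingHom.id k) hsep (hr0 i))
    refine ⟨r, hr, ?_⟩
    rw [← IsLocalRing.residue_eq_zero_iff, map_sub, sub_eq_zero] at hr2
    rw [hr2, ha0]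
  choose r hr hrl using hroots
  refine rep_of_roots hn0 hn (x : A) (fun i => (r i : E)) (fun i j hij => lam.injective ?_) fun i => ?_
  · rw [← hrl i, ← hrl j]
    congr 1
    exact Subtype.ext hij
  · rw [← hG]
    exact (hr i).map
end
end Prf
set_option linter.all false
set_option linter.unusedVariables false
set_option linter.unusedSimpArgs false
namespace Prf
open Module Polynomial TensorProduct WithZero NumberField IsDedekindDomain
open scoped Topology

lemma hensel_of {E : Type} [Field E] {V : Valuation E ℤᵐ⁰} (hu : ∃ π, V π = exp (-1 : ℤ))
    (hc : ∀ c : ℕ → E, (∀ k : ℕ, V (c (k+1) - c k) ≤ exp (-(k : ℤ))) → ∃ l, ∀ k : ℕ, V (l - c k) ≤ exp (-(k : ℤ))) :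
    HenselianLocalRing V.valuationSubring := by
  obtain ⟨π, hπ⟩ := hu
  let R := V.valuationSubring
  have hπ1 : V π < 1 := by rw [hπ, ← exp_zero, exp_lt_exp]; omega
  have hπ0 : π ≠ 0 := by
    rintro rfl
    rw [map_zero] at hπ
    exact exp_ne_zero hπ.symm
  let ϖ : R := ⟨π, hπ1.le⟩
  have hm : IsLocalRing.maximalIdeal R = Ideal.span {ϖ} := by
    ext x
    rw [Ideal.mem_span_singleton, ← IsLocalRing.residue_eq_zero_iff, res_iff]
    constructor
    · intro h
      refine ⟨⟨π⁻¹ * x, ?_⟩, Subtype.ext ?_⟩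
      · change V (π⁻¹ * x) ≤ 1
        rw [map_mul, map_inv₀, hπ]
        rcases eq_or_ne (V (x : E)) 0 with h0 | h0
        · rw [h0]; simp
        · rw [← exp_log h0] at h ⊢
          rw [← exp_zero, exp_lt_exp] at h
          rw [← exp_neg, ← exp_add, ← exp_zero, exp_le_exp]; omega
      · change (x : E) = π * (π⁻¹ * x)
        field_simp
    · rintro ⟨y, rfl⟩
      change V (π * y) < 1
      rw [map_mul]
      exact mul_lt_one_of_lt_of_le hπ1 y.2
  have hpow : ∀ (n : ℕ) (x : R), x ∈ IsLocalRing.maximalIdeal R ^ n ↔ V (x : E) ≤ exp (-(n : ℤ)) := by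
    intro n x
    have hVn : V (π ^ n) = exp (-(n : ℤ)) := by rw [map_pow, hπ, ← exp_nsmul]; simp
    rw [hm, Ideal.span_singleton_pow, Ideal.mem_span_singleton]
    constructor
    · rintro ⟨y, rfl⟩
      change V (π ^ n * y) ≤ _
      rw [map_mul, hVn]
      exact mul_le_of_le_one_right' y.2
    · intro h
      refine ⟨⟨(π ^ n)⁻¹ * x, ?_⟩, Subtype.ext ?_⟩
      · change V ((π ^ n)⁻¹ * x) ≤ 1
        rw [map_mul, map_inv₀, hVn]
        refine (mul_le_mul_right h _).trans ?_
        rw [inv_mul_cancel₀ exp_ne_zero]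
      · change (x : E) = π ^ n * ((π ^ n)⁻¹ * x)
        field_simp
  haveI : IsAdicComplete (IsLocalRing.maximalIdeal R) R :=
    { haus' := by
        intro x hx
        by_contra hx0
        have h0 : V (x : E) ≠ 0 := by
          rw [ne_eq, map_eq_zero]; exact fun h => hx0 (Subtype.ext h)
        have := hx ((-log (V (x : E))).toNat + 1)
        rw [SModEq.zero, smul_eq_mul, Ideal.mul_top, hpow] at this
        rw [← exp_log h0, exp_le_exp] at this
        push_cast at this
        simp only [log_exp] at this
        omega
      prec' := by
        intro f hf
        obtain ⟨l, hl⟩ := hc (fun k => (f k : E)) (by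
          intro k
          have := hf (Nat.le_succ k)
          rw [SModEq.sub_mem, smul_eq_mul, Ideal.mul_top, hpow] at this
          rw [V.map_sub_swap]
          exact this)
        have hl1 : V l ≤ 1 := by
          have h1 := hl 0
          simp only [Nat.cast_zero, neg_zero, exp_zero] at h1
          have : l = (l - f 0) + f 0 := by ring
          rw [this]
          exact (V.map_add _ _).trans (max_le h1 (f 0).2)
        refine ⟨⟨l, hl1⟩, fun n => ?_⟩
        rw [SModEq.sub_mem, smul_eq_mul, Ideal.mul_top, hpow]
        have := hl n
        rw [V.map_sub_swap] at this
        exact this }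
  haveI := IsAdicComplete.henselianRing R (IsLocalRing.maximalIdeal R)
  exact ⟨fun f hf a ha ha' => HenselianRing.is_henselian f hf a ha (ha'.map _)⟩

variable {K : Type} [Field K] [NumberField K]

lemma norm_le_one_iff (v : HeightOneSpectrum (𝓞 K)) (x : v.adicCompletion K) : ‖x‖ ≤ 1 ↔ Valued.v x ≤ 1 := by
  rw [FinitePlace.norm_def]
  exact_mod_cast WithZeroMulInt.toNNReal_le_one_iff (HeightOneSpectrum.one_lt_absNorm_nnreal v)

lemma adic_hint (v : HeightOneSpectrum (𝓞 K)) (f : (v.adicCompletion K)[X]) (hf : f.Monic) (hi : Irreducible f)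
    (h0 : Valued.v (f.coeff 0) ≤ 1) (i : ℕ) : Valued.v (f.coeff i) ≤ 1 := by
  obtain ⟨c, hc⟩ := v.valuedAdicCompletion_surjective K (WithZero.exp (-1))
  haveI : IsUltrametricDist (v.adicCompletion K) := inferInstance
  letI : NontriviallyNormedField (v.adicCompletion K) := NontriviallyNormedField.ofNormNeOne ⟨c, by
    rintro rfl
    rw [map_zero] at hc
    exact exp_ne_zero hc.symm, by
    intro hn
    have h1 : ‖c⁻¹‖ ≤ 1 := by rw [norm_inv, hn]; simp
    rw [norm_le_one_iff, map_inv₀, hc, ← exp_neg, ← exp_zero, exp_le_exp] at h1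
    omega⟩
  haveI : CompleteSpace (v.adicCompletion K) := inferInstance
  haveI := Fact.mk hi
  haveI : FiniteDimensional (v.adicCompletion K) (AdjoinRoot f) := (AdjoinRoot.powerBasis hf.ne_zero).finite
  haveI : Algebra.IsAlgebraic (v.adicCompletion K) (AdjoinRoot f) := Algebra.IsAlgebraic.of_finite _ _
  have h1 := spectralNorm.spectralNorm_eq_norm_coeff_zero_rpow (K := v.adicCompletion K) (L := AdjoinRoot f) (AdjoinRoot.root f)
  have h2 : minpoly (v.adicCompletion K) (AdjoinRoot.root f) = f := by
    rw [AdjoinRoot.minpoly_root hf.ne_zero, hf.leadingCoeff]; simp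
  rw [spectralNorm, h2] at h1
  rw [← norm_le_one_iff] at h0 ⊢
  have h3 : spectralValue f ≤ 1 := by
    rw [h1]; exact Real.rpow_le_one (norm_nonneg _) h0 (by positivity)
  exact (spectralValue_le_one_iff hf).1 h3 i

end Prf
set_option linter.all false
set_option linter.unusedVariables false
set_option linter.unusedSimpArgs false
namespace Prf
open Module Polynomial TensorProduct WithZero NumberField IsDedekindDomain
open scoped Topology

section
variable {K : Type} [Field K] [NumberField K]

lemma adic_complete (v : HeightOneSpectrum (𝓞 K)) (c : ℕ → v.adicCompletion K)
    (hc : ∀ k : ℕ, Valued.v (c (k+1) - c k) ≤ exp (-(k : ℤ))) :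
    ∃ l, ∀ k : ℕ, Valued.v (l - c k) ≤ exp (-(k : ℤ)) := by
  have hmn : ∀ k d : ℕ, Valued.v (c (k + d) - c k) ≤ exp (-(k : ℤ)) := by
    intro k d
    induction d with
    | zero => simp
    | succ d ih =>
      have : c (k + (d + 1)) - c k = (c (k + d + 1) - c (k + d)) + (c (k + d) - c k) := by
        rw [← add_assoc]; ring
      rw [this]
      refine (Valuation.map_add _ _ _).trans (max_le ((hc _).trans ?_) ih)
      rw [exp_le_exp]; push_cast; omega
  have hcau : CauchySeq c := by
    refine NonarchimedeanAddGroup.cauchySeq_of_tendsto_sub_nhds_zero ?_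
    intro s hs
    obtain ⟨n, hn⟩ := (nhds_adic v 0 s).1 hs
    refine Filter.mem_map.2 (Filter.mem_atTop_sets.2 ⟨n + 1, fun k hk => hn ?_⟩)
    simp only [Set.mem_ofPred_eq, sub_zero]
    refine (hc k).trans_lt ?_
    rw [exp_lt_exp]; omega
  obtain ⟨l, hl⟩ := cauchySeq_tendsto_of_complete hcau
  refine ⟨l, fun k => ?_⟩
  have h1 := hl ((nhds_adic v l _).2 ⟨k, subset_rfl⟩)
  obtain ⟨N, hN⟩ := Filter.mem_atTop_sets.1 (Filter.mem_map.1 h1)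
  have h2 : Valued.v (c (k + N) - l) < exp (-(k : ℤ)) := hN (k + N) (by omega)
  have : l - c k = (c (k + N) - c k) - (c (k + N) - l) := by ring
  rw [this]
  exact (Valuation.map_sub _ _ _).trans (max_le (hmn k N) h2.le)

/-- reduction map -/
noncomputable def redMap (v : HeightOneSpectrum (𝓞 K)) :
    𝓞 K →+* IsLocalRing.ResidueField (Valued.v : Valuation (v.adicCompletion K) ℤᵐ⁰).valuationSubring :=
  (IsLocalRing.residue _).comp ((algebraMap K (v.adicCompletion K)).comp (algebraMap (𝓞 K) K) |>.codRestrict _ (fun x => by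
    change Valued.v (algebraMap K (v.adicCompletion K) x) ≤ 1
    rw [v_alg]; exact v.valuation_le_one x))

lemma redMap_surj (v : HeightOneSpectrum (𝓞 K)) : Function.Surjective (redMap v) := by
  intro y
  obtain ⟨y, rfl⟩ := IsLocalRing.residue_surjective y
  obtain ⟨z, hz⟩ := dense_adic v y.1 0
  simp only [Nat.cast_zero, neg_zero, exp_zero] at hz
  have hz1 : v.valuation K z ≤ 1 := by
    rw [← v_alg]
    have : algebraMap K (v.adicCompletion K) z = (algebraMap K (v.adicCompletion K) z - y.1) + y.1 := by ring
    rw [this]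
    exact (Valuation.map_add _ _ _).trans (max_le hz.le y.2)
  obtain ⟨a, ha⟩ := v.exists_valuation_sub_lt_of_integer hz1 1
  refine ⟨a, ?_⟩
  rw [← sub_eq_zero]
  refine Eq.trans (map_sub (IsLocalRing.residue _) _ _).symm ?_
  rw [res_iff]
  change Valued.v (algebraMap K (v.adicCompletion K) (algebraMap (𝓞 K) K a) - y.1) < 1
  have : algebraMap K (v.adicCompletion K) (algebraMap (𝓞 K) K a) - y.1 =
    algebraMap K (v.adicCompletion K) (algebraMap (𝓞 K) K a - z) + (algebraMap K (v.adicCompletion K) z - y.1) := by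
    rw [map_sub]; ring
  rw [this]
  refine Valuation.map_add_lt _ ?_ hz
  rw [v_alg]; simpa using ha

lemma redMap_ker (v : HeightOneSpectrum (𝓞 K)) : RingHom.ker (redMap v) = v.asIdeal := by
  ext a
  rw [RingHom.mem_ker]
  refine (res_iff _).trans ?_
  change Valued.v (algebraMap K (v.adicCompletion K) (algebraMap (𝓞 K) K a)) < 1 ↔ _
  rw [v_alg, v.valuation_lt_one_iff_mem]

lemma card_res (v : HeightOneSpectrum (𝓞 K)) :
    Nat.card (IsLocalRing.ResidueField (Valued.v : Valuation (v.adicCompletion K) ℤᵐ⁰).valuationSubring) =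
      Nat.card (𝓞 K ⧸ v.asIdeal) := by
  rw [← redMap_ker v]
  exact (Nat.card_congr (RingHom.quotientKerEquivOfSurjective (redMap_surj v)).toEquiv).symm

lemma fin_quot (v : HeightOneSpectrum (𝓞 K)) : Finite (𝓞 K ⧸ v.asIdeal) :=
  Ideal.finiteQuotientOfFreeOfNeBot _ v.ne_bot

lemma adic_LF (v : HeightOneSpectrum (𝓞 K)) : LF (Valued.v : Valuation (v.adicCompletion K) ℤᵐ⁰) where
  unif := v.valuedAdicCompletion_surjective K _
  complete := adic_complete v
  hintg := adic_hint v
  fin := by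
    haveI := fin_quot v
    rw [← redMap_ker v] at this
    exact Finite.of_equiv _ (RingHom.quotientKerEquivOfSurjective (redMap_surj v)).toEquiv
  hensel := hensel_of (v.valuedAdicCompletion_surjective K _) (adic_complete v)

variable {L : Type} [Field L] [NumberField L] [Algebra K L]

lemma exists_cmap (w : HeightOneSpectrum (𝓞 L)) :
    ∃ φ : (below K w).adicCompletion K →+* w.adicCompletion L,
      (∀ x : K, φ (algebraMap K _ x) = algebraMap L _ (algebraMap K L x)) ∧
      ∀ x, Valued.v (φ x) = Valued.v x ^ ram K w := by
  let v := below K w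
  let i := algebraMap K (v.adicCompletion K)
  let f : K →+* w.adicCompletion L := (algebraMap L (w.adicCompletion L)).comp (algebraMap K L)
  have hfi : ∀ x, Valued.v (f x) = Valued.v (i x) ^ ram K w := by
    intro x
    rw [v_alg, ← val_map]; exact v_alg w _
  letI : UniformSpace K := UniformSpace.comap i inferInstance
  haveI : IsUniformAddGroup K := IsUniformAddGroup.comap i
  have hi : IsUniformInducing i := ⟨rfl⟩
  have hd : DenseRange i := HeightOneSpectrum.denseRange_algebraMap K v
  have hpw : ∀ (n : ℕ) (y : ℤᵐ⁰), y < exp (-(n : ℤ)) → y ^ ram K w < exp (-(n : ℤ)) := by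
    intro n y hy
    have hy1 : y ≤ 1 := hy.le.trans (by rw [← exp_zero, exp_le_exp]; omega)
    exact (pow_le_of_le_one zero_le hy1 (ram_ne_zero w)).trans_lt hy
  have hf : UniformContinuous f := by
    refine uniformContinuous_of_continuousAt_zero f ?_
    rw [ContinuousAt, map_zero]
    intro s hs
    obtain ⟨n, hn⟩ := (nhds_adic w 0 s).1 hs
    rw [Filter.mem_map, hi.isInducing.nhds_eq_comap, Filter.mem_comap]
    refine ⟨_, (nhds_adic v (i 0) _).2 ⟨n, subset_rfl⟩, fun x hx => hn ?_⟩
    simp only [Set.mem_preimage, Set.mem_ofPred_eq, map_zero, sub_zero] at hx ⊢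
    rw [hfi]
    exact hpw n _ hx
  let φ := IsDenseInducing.extendRingHom hi hd hf
  have hφ : ∀ x, φ (i x) = f x := fun x => IsDenseInducing.extend_eq (hi.isDenseInducing hd) hf.continuous x
  have hφc : Continuous φ := (uniformContinuous_uniformly_extend hi hd hf).continuous
  refine ⟨φ, hφ, fun x => ?_⟩
  rcases eq_or_ne x 0 with rfl | hx
  · simp [ram_ne_zero]
  have hx0 : Valued.v x ≠ 0 := by simpa using hx
  have hy0 : Valued.v (φ x) ≠ 0 := by simpa using hx
  let n := (-log (Valued.v x)).toNat
  let m := (-log (Valued.v (φ x))).toNat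
  have h1 := (hφc.tendsto x) ((nhds_adic w _ _).2 ⟨m, subset_rfl⟩)
  obtain ⟨n', hn'⟩ := (nhds_adic v _ _).1 (Filter.mem_map.1 h1)
  obtain ⟨z, hz⟩ := dense_adic v x (max n n')
  have h2 : Valued.v (i z - x) < exp (-(n' : ℤ)) := hz.trans_le (by rw [exp_le_exp]; push_cast; omega)
  have h3 : Valued.v (i z - x) < Valued.v x := hz.trans_le (by
    rw [← exp_log hx0, exp_le_exp]; simp only [n]; push_cast; omega)
  have h4 : Valued.v (φ (i z) - φ x) < Valued.v (φ x) := by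
    have : Valued.v (φ (i z) - φ x) < exp (-(m : ℤ)) := hn' h2
    refine this.trans_le ?_
    rw [← exp_log hy0, exp_le_exp]; simp only [m]; omega
  have h5 : Valued.v (i z) = Valued.v x := Valuation.map_eq_of_sub_lt _ h3
  have h6 : Valued.v (φ (i z)) = Valued.v (φ x) := Valuation.map_eq_of_sub_lt _ h4
  rw [← h6, hφ, hfi, h5]
end
end Prf
set_option linter.all false
set_option linter.unusedVariables false
set_option linter.unusedSimpArgs false
namespace Prf
open Module Polynomial TensorProduct WithZero NumberField IsDedekindDomain
section
variable {K : Type} [Field K] [NumberField K]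

/-- cardinality of the residue field -/
noncomputable def cd (v : HeightOneSpectrum (𝓞 K)) : ℕ := Nat.card (𝓞 K ⧸ v.asIdeal)

lemma cd_gt (v : HeightOneSpectrum (𝓞 K)) : 1 < cd v := by
  haveI := fin_quot v
  haveI := v.isPrime
  exact Finite.one_lt_card

lemma cd_finite (n : ℕ) : {v : HeightOneSpectrum (𝓞 K) | cd v ≤ n}.Finite := by
  have h := Ideal.finite_setOfPred_absNorm_le (S := 𝓞 K) n
  refine Set.Finite.of_finite_image (f := HeightOneSpectrum.asIdeal) (h.subset ?_) ?_
  · rintro _ ⟨v, hv, rfl⟩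
    exact hv
  · intro v _ w _ h
    exact HeightOneSpectrum.ext h

lemma cd_pow {L : Type} [Field L] [NumberField L] [Algebra K L] (w : HeightOneSpectrum (𝓞 L)) :
    cd w = cd (below K w) ^ finrank (𝓞 K ⧸ (below K w).asIdeal) (𝓞 L ⧸ w.asIdeal) := by
  haveI := (below K w).isMaximal
  letI := Ideal.Quotient.field (below K w).asIdeal
  haveI := fin_quot w
  haveI : Module.Finite (𝓞 K ⧸ (below K w).asIdeal) (𝓞 L ⧸ w.asIdeal) := Module.Finite.of_finite
  exact Module.natCard_eq_pow_finrank

lemma cd_le {L : Type} [Field L] [NumberField L] [Algebra K L] (w : HeightOneSpectrum (𝓞 L)) :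
    cd (below K w) ≤ cd w := by
  have h := cd_pow (K := K) w
  have h1 := cd_gt w
  rw [h]
  refine Nat.le_self_pow ?_ _
  intro h0
  rw [h0, pow_zero] at h
  omega

lemma exists_bad (C : Type) [Ring C] [Algebra K C] [IsSimpleRing C] [Algebra.IsCentral K C]
    [FiniteDimensional K C] {n : ℕ} (hn0 : 0 < n) (hn : finrank K C = n ^ 2) :
    ∃ B : Finset (HeightOneSpectrum (𝓞 K)), ∀ (L : Type) [Field L] [NumberField L] [Algebra K L]
      (w : HeightOneSpectrum (𝓞 L)), below K w ∉ B → Spl K C (w.adicCompletion L) n := by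
  classical
  let b := finBasis K C
  have haz := Az.of_csa b
  unfold Az at haz
  choose κ hκ using haz
  let Z : Set (HeightOneSpectrum (𝓞 K)) := {v | cd v ≤ n} ∪
    (⋃ i, ⋃ j, ⋃ l, HeightOneSpectrum.Support (𝓞 K) (b.repr (b i * b j) l)) ∪
    (⋃ l, HeightOneSpectrum.Support (𝓞 K) (b.repr 1 l)) ∪
    (⋃ i, ⋃ j, ⋃ s, ⋃ t, HeightOneSpectrum.Support (𝓞 K) (κ i j s t))
  have hZ : Z.Finite := by
    refine ((Set.Finite.union (cd_finite n) ?_).union ?_).union ?_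
    · exact Set.finite_iUnion fun i => Set.finite_iUnion fun j => Set.finite_iUnion fun l =>
        HeightOneSpectrum.Support.finite _ _
    · exact Set.finite_iUnion fun l => HeightOneSpectrum.Support.finite _ _
    · exact Set.finite_iUnion fun i => Set.finite_iUnion fun j => Set.finite_iUnion fun l =>
        Set.finite_iUnion fun t => HeightOneSpectrum.Support.finite _ _
  refine ⟨hZ.toFinset, fun L _ _ _ w hw => ?_⟩
  rw [Set.Finite.mem_toFinset] at hw
  simp only [Z, Set.mem_union, not_or, Set.mem_iUnion, not_exists] at hw
  obtain ⟨⟨⟨hw1, hw2⟩, hw3⟩, hw4⟩ := hw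
  have hv : ∀ x : K, below K w ∉ HeightOneSpectrum.Support (𝓞 K) x →
      Valued.v (algebraMap K (w.adicCompletion L) x) ≤ 1 := by
    intro x hx
    have hx' : (below K w).valuation K x ≤ 1 := not_lt.1 hx
    rw [IsScalarTower.algebraMap_apply K L, v_alg, val_map]
    exact pow_le_one₀ zero_le hx'
  let E := w.adicCompletion L
  rw [Spl_iff]
  haveI : IsSimpleRing (E ⊗[K] C) := CSA_AS K C E
  have hsm : ∀ (x : K) (z : E), x • z = algebraMap K E x * z := fun x z => Algebra.smul_def x z
  refine good_place (V := (Valued.v : Valuation E ℤᵐ⁰)) (b.baseChange E) ?_ ?_ (adic_LF w) ((CSA_AS K C).baseChange E) hn0 ?_ ?_ ?_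
  · intro i j l
    rw [Basis.baseChange_apply, Basis.baseChange_apply, Algebra.TensorProduct.tmul_mul_tmul, Basis.baseChange_repr_tmul,
      hsm, mul_one, mul_one]
    exact hv _ (hw2 i j l)
  · intro l
    rw [Algebra.TensorProduct.one_def, Basis.baseChange_repr_tmul, hsm, mul_one]
    exact hv _ (hw3 l)
  · rw [finrank_baseChange, hn]
  · intro i j
    refine ⟨fun s t => algebraMap K E (κ i j s t), fun s t => hv _ (hw4 i j s t), fun l => ?_⟩
    have h := congrArg (fun x : C => (1 : E) ⊗ₜ[K] x) (hκ i j l)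
    simp only [tmul_sum] at h
    simp only [Basis.baseChange_apply, Algebra.TensorProduct.tmul_mul_tmul, mul_one, algebraMap_smul,
      ← tmul_smul]
    rw [h]
    split_ifs <;> simp
  · rw [card_res]
    change ¬ cd (below K w) ≤ n at hw1
    have := cd_le (K := K) w
    change n ≤ cd w
    omega

lemma split_bad (C : Type) [Ring C] [Algebra K C] [IsSimpleRing C] [Algebra.IsCentral K C]
    [FiniteDimensional K C] {n : ℕ} (hn : finrank K C = n ^ 2)
    {L : Type} [Field L] [NumberField L] [Algebra K L]
    (w : HeightOneSpectrum (𝓞 L)) {f : ℕ} (hf : cd w = cd (below K w) ^ f) (hnf : n ∣ f) : Spl K C (w.adicCompletion L) n := by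
  classical
  obtain ⟨φ, hφ, hφv⟩ := exists_cmap (K := K) w
  letI : Algebra ((below K w).adicCompletion K) (w.adicCompletion L) := φ.toAlgebra
  haveI : IsScalarTower K ((below K w).adicCompletion K) (w.adicCompletion L) :=
    IsScalarTower.of_algebraMap_eq fun x => by
      rw [IsScalarTower.algebraMap_apply K L]; exact (hφ x).symm
  let E := (below K w).adicCompletion K
  rw [← Spl_tower (F := (below K w).adicCompletion K)]
  haveI : IsSimpleRing (E ⊗[K] C) := CSA_AS K C E
  haveI : Algebra.IsCentral E (E ⊗[K] C) := ((Az.of_csa (finBasis K C)).baseChange E).central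
  refine local_bad (adic_LF (below K w)) ?_ (adic_LF w) ⟨?_, ?_⟩ (f := f) ?_ hnf
  · rw [finrank_baseChange, hn]
  · intro x hx
    change Valued.v (φ x) ≤ 1
    rw [hφv]; exact pow_le_one₀ zero_le hx
  · intro x hx
    change Valued.v (φ x) < 1
    rw [hφv]; exact pow_lt_one₀ zero_le hx (ram_ne_zero w)
  · rw [card_res, card_res]; exact hf
end
end Prf
set_option linter.all false
set_option linter.unusedVariables false
set_option linter.unusedSimpArgs false
namespace Prf
open Module Polynomial TensorProduct WithZero NumberField IsDedekindDomain
section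

lemma exists_irr (k : Type) [Field k] [Finite k] {d : ℕ} (hd : 0 < d) :
    ∃ h : k[X], h.Monic ∧ Irreducible h ∧ h.natDegree = d := by
  haveI : NeZero d := ⟨hd.ne'⟩
  obtain ⟨p, _⟩ := CharP.exists k
  haveI : Fact p.Prime := ⟨CharP.char_is_prime k p⟩
  let F := FiniteField.Extension k p d
  obtain ⟨a, ha⟩ := Field.exists_primitive_element k F
  have hi : IsIntegral k a := IsIntegral.of_finite k a
  refine ⟨minpoly k a, minpoly.monic hi, minpoly.irreducible hi, ?_⟩
  rw [← IntermediateField.adjoin.finrank hi, ha, IntermediateField.finrank_top', FiniteField.finrank_extension]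

lemma bdd_below {P : ℝ[X]} (hm : P.Monic) (hd : 0 < P.natDegree) (he : Even P.natDegree) :
    ∃ M : ℕ, ∀ x, -(M : ℝ) < P.eval x := by
  have hd' : 0 < P.degree := natDegree_pos_iff_degree_pos.1 hd
  have hlim : Filter.Tendsto (fun x => P.eval x) (Filter.cocompact ℝ) Filter.atTop := by
    rw [cocompact_eq_atBot_atTop, Filter.tendsto_sup]
    refine ⟨?_, P.tendsto_atTop_of_leadingCoeff_nonneg hd' (by rw [hm.leadingCoeff]; exact zero_le_one)⟩
    have h1 : Filter.Tendsto (fun x => (P.comp (-X)).eval x) Filter.atTop Filter.atTop := by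
      refine (P.comp (-X)).tendsto_atTop_of_leadingCoeff_nonneg ?_ ?_
      · rw [← natDegree_pos_iff_degree_pos, natDegree_comp]; simpa using hd
      · rw [leadingCoeff_comp (by simp), hm.leadingCoeff]; simp [he.neg_one_pow]
    have h2 := h1.comp Filter.tendsto_neg_atBot_atTop
    simpa [Function.comp_def] using h2
  obtain ⟨x, hx⟩ := P.continuous.exists_forall_le hlim
  obtain ⟨M, hM⟩ := exists_nat_gt (-(P.eval x))
  exact ⟨M, fun y => by have := hx y; linarith⟩

variable {K : Type} [Field K] [NumberField K]

lemma crt_poly (B : Finset (HeightOneSpectrum (𝓞 K))) {d : ℕ} (G : HeightOneSpectrum (𝓞 K) → (𝓞 K)[X])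
    (hG : ∀ v ∈ B, (G v).Monic ∧ (G v).natDegree = d) :
    ∃ g : (𝓞 K)[X], g.Monic ∧ g.natDegree = d ∧
      ∀ v ∈ B, g.map (Ideal.Quotient.mk v.asIdeal) = (G v).map (Ideal.Quotient.mk v.asIdeal) := by
  classical
  have h1 : ∀ i : ℕ, ∃ y : 𝓞 K, ∀ v ∈ B, y - (G v).coeff i ∈ v.asIdeal := by
    intro i
    obtain ⟨y, hy⟩ := IsDedekindDomain.exists_forall_sub_mem_ideal (s := B) (fun v => v.asIdeal) (fun _ => 1)
      (fun v _ => v.prime) (fun v _ w _ h h' => h (HeightOneSpectrum.ext h')) (fun v => (G v.1).coeff i)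
    exact ⟨y, fun v hv => by simpa using hy v hv⟩
  choose c hc using h1
  let r : (𝓞 K)[X] := ∑ i ∈ Finset.range d, C (c i) * X ^ i
  have hr : r.degree < d := by
    refine (degree_sum_le _ _).trans_lt ?_
    refine (Finset.sup_lt_iff (WithBot.bot_lt_coe d)).2 fun i hi => ?_
    exact (degree_C_mul_X_pow_le _ _).trans_lt (Nat.cast_lt.2 (Finset.mem_range.1 hi))
  have hrc : ∀ i, r.coeff i = if i < d then c i else 0 := by
    intro i
    simp [r, finset_sum_coeff, coeff_C_mul, coeff_X_pow]
  refine ⟨X ^ d + r, monic_X_pow_add hr, ?_, fun v hv => ?_⟩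
  · refine natDegree_eq_of_degree_eq_some ?_
    rw [degree_add_eq_left_of_degree_lt (by rwa [degree_X_pow]), degree_X_pow]
  · ext i
    rw [coeff_map, coeff_map, Ideal.Quotient.eq, coeff_add, coeff_X_pow, hrc]
    obtain ⟨hm, hdg⟩ := hG v hv
    rcases lt_trichotomy i d with h | h | h
    · simpa [h, h.ne] using hc i v hv
    · subst h
      have : (G v).coeff i = 1 := by rw [← hdg]; exact hm
      simp [this]
    · rw [coeff_eq_zero_of_natDegree_lt (by omega)]
      simp [h.ne', h.not_gt]

lemma inert_ext (B : Finset (HeightOneSpectrum (𝓞 K))) (hB : B.Nonempty) {d : ℕ} (hd : 0 < d) :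
    ∃ (L : Type) (_ : Field L) (_ : NumberField L) (_ : Algebra K L), finrank K L = d ∧
      (∀ w : HeightOneSpectrum (𝓞 L), below K w ∈ B → ∃ f, cd w = cd (below K w) ^ f ∧ d ∣ f) ∧
      (Even d → IsTotallyComplex L) := by
  classical
  have h1 : ∀ v : HeightOneSpectrum (𝓞 K), ∃ G : (𝓞 K)[X], G.Monic ∧ G.natDegree = d ∧
      Irreducible (G.map (Ideal.Quotient.mk v.asIdeal)) := by
    intro v
    haveI := v.isMaximal
    letI := Ideal.Quotient.field v.asIdeal
    haveI := fin_quot v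
    obtain ⟨h, hm, hi, hdg⟩ := exists_irr (𝓞 K ⧸ v.asIdeal) hd
    obtain ⟨G, hG, hGd, hGm⟩ := lifts_and_natDegree_eq_and_monic (f := Ideal.Quotient.mk v.asIdeal) (p := h)
      ((mem_lifts _).2 (map_surjective _ Ideal.Quotient.mk_surjective h)) hm
    exact ⟨G, hGm, hGd.trans hdg, hG ▸ hi⟩
  choose G hGm hGd hGi using h1
  obtain ⟨g₀, hg₀m, hg₀d, hg₀⟩ := crt_poly B G (fun v _ => ⟨hGm v, hGd v⟩)
  let m : ℕ := ∏ v ∈ B, cd v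
  have hm1 : 0 < m := Finset.prod_pos (f := cd) (s := B) fun v _ => by have := cd_gt v; omega
  have hmB : ∀ v ∈ B, (m : 𝓞 K) ∈ v.asIdeal := by
    intro v hv
    have h2 : ((cd v : ℕ) : 𝓞 K) ∈ v.asIdeal := Ideal.absNorm_mem v.asIdeal
    obtain ⟨e, he⟩ := Finset.dvd_prod_of_mem cd hv
    change (((∏ v ∈ B, cd v : ℕ)) : 𝓞 K) ∈ _
    rw [he, Nat.cast_mul]
    exact Ideal.mul_mem_right _ _ h2
  have hN : ∃ N : ℕ, Even d → ∀ σ : K →+* ℝ, ∀ x, -(N : ℝ) < (g₀.map (σ.comp (algebraMap (𝓞 K) K))).eval x := by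
    by_cases he : Even d
    · have h3 : ∀ σ : K →+* ℝ, ∃ M : ℕ, ∀ x, -(M : ℝ) < (g₀.map (σ.comp (algebraMap (𝓞 K) K))).eval x := by
        intro σ
        refine bdd_below (hg₀m.map _) ?_ ?_ <;> rw [hg₀m.natDegree_map, hg₀d]
        exacts [hd, he]
      choose M hM using h3
      haveI : Finite (K →+* ℝ) := by
        refine Finite.of_injective (fun σ : K →+* ℝ => (Complex.ofRealHom.comp σ : K →+* ℂ)) ?_
        intro σ τ h
        ext x
        exact Complex.ofReal_injective (RingHom.congr_fun h x)
      haveI := Fintype.ofFinite (K →+* ℝ)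
      refine ⟨∑ σ, M σ, fun _ σ x => lt_of_le_of_lt ?_ (hM σ x)⟩
      have : M σ ≤ ∑ σ, M σ := Finset.single_le_sum (f := M) (fun _ _ => Nat.zero_le _) (Finset.mem_univ σ)
      have : (M σ : ℝ) ≤ ((∑ σ, M σ : ℕ) : ℝ) := by exact_mod_cast this
      linarith
    · exact ⟨0, fun h => absurd h he⟩
  obtain ⟨N, hN⟩ := hN
  let g : (𝓞 K)[X] := g₀ + C ((m * N : ℕ) : 𝓞 K)
  have hgd : g.natDegree = d := by rw [natDegree_add_C, hg₀d]
  have hgm : g.Monic := hg₀m.add_of_left (by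
    refine degree_C_le.trans_lt ?_
    rw [← natDegree_pos_iff_degree_pos, hg₀d]; exact hd)
  have hgB : ∀ v ∈ B, Irreducible (g.map (Ideal.Quotient.mk v.asIdeal)) := by
    intro v hv
    have : Ideal.Quotient.mk v.asIdeal ((m * N : ℕ) : 𝓞 K) = 0 := by
      rw [Ideal.Quotient.eq_zero_iff_mem, Nat.cast_mul]
      exact Ideal.mul_mem_right _ _ (hmB v hv)
    rw [Polynomial.map_add, map_C, this, C_0, add_zero, hg₀ v hv]
    exact hGi v
  obtain ⟨v₀, hv₀⟩ := hB
  haveI := v₀.isPrime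
  have hgi : Irreducible g := hgm.irreducible_of_irreducible_map _ _ (hgB v₀ hv₀)
  let P : K[X] := g.map (algebraMap (𝓞 K) K)
  have hPm : P.Monic := hgm.map _
  haveI : Fact (Irreducible P) := ⟨hgm.irreducible_iff_irreducible_map_fraction_map.1 hgi⟩
  let L := AdjoinRoot P
  let pb := AdjoinRoot.powerBasis hPm.ne_zero
  haveI : FiniteDimensional K L := pb.finite
  haveI hnf : NumberField L := NumberField.of_module_finite K L
  refine ⟨L, inferInstance, hnf, inferInstance, ?_, ?_, ?_⟩
  · rw [pb.finrank, AdjoinRoot.powerBasis_dim, hgm.natDegree_map, hgd]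
  · intro w hw
    refine ⟨_, cd_pow w, ?_⟩
    let v := below K w
    haveI := v.isMaximal
    letI := Ideal.Quotient.field v.asIdeal
    haveI := w.isMaximal
    letI := Ideal.Quotient.field w.asIdeal
    haveI := fin_quot w
    haveI : Module.Finite (𝓞 K ⧸ v.asIdeal) (𝓞 L ⧸ w.asIdeal) := Module.Finite.of_finite
    have hroot : aeval (AdjoinRoot.root P) g = 0 := by
      have := AdjoinRoot.aeval_eq (f := P) P
      rw [AdjoinRoot.mk_self] at this
      rwa [aeval_map_algebraMap] at this
    have hintg : IsIntegral ℤ (AdjoinRoot.root P : L) := isIntegral_trans (A := 𝓞 K) _ ⟨g, hgm, hroot⟩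
    let α : 𝓞 L := ⟨AdjoinRoot.root P, hintg⟩
    have hα : aeval α g = 0 := by
      apply FaithfulSMul.algebraMap_injective (𝓞 L) L
      rw [← aeval_algebraMap_apply, map_zero]
      exact hroot
    let β : 𝓞 L ⧸ w.asIdeal := Ideal.Quotient.mk _ α
    have hβ : aeval β (g.map (Ideal.Quotient.mk v.asIdeal)) = 0 := by
      have h5 : (algebraMap (𝓞 K ⧸ v.asIdeal) (𝓞 L ⧸ w.asIdeal)).comp (Ideal.Quotient.mk v.asIdeal) =
        (Ideal.Quotient.mk w.asIdeal).comp (algebraMap (𝓞 K) (𝓞 L)) := rfl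
      rw [aeval_def, eval₂_map, h5, ← hom_eval₂, ← aeval_def, hα, map_zero]
    have h6 := minpoly.eq_of_irreducible_of_monic (hgB v hw) hβ (hgm.map _)
    have h7 := minpoly.degree_dvd (K := 𝓞 K ⧸ v.asIdeal) (IsIntegral.of_finite (𝓞 K ⧸ v.asIdeal) β)
    rw [← h6, hgm.natDegree_map, hgd] at h7
    exact h7
  · intro he
    refine ⟨fun u => ?_⟩
    rw [← InfinitePlace.not_isReal_iff_isComplex]
    intro hu
    let τ : L →+* ℝ := InfinitePlace.embedding_of_isReal hu
    have h8 := hN he (τ.comp (algebraMap K L)) (τ (AdjoinRoot.root P))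
    have h9 : (P.map (τ.comp (algebraMap K L))).eval (τ (AdjoinRoot.root P)) = 0 := by
      rw [eval_map, ← hom_eval₂]
      have := AdjoinRoot.eval₂_root P
      rw [show algebraMap K L = AdjoinRoot.of P from rfl, this, map_zero]
    have h10 : (P.map (τ.comp (algebraMap K L))) = g₀.map ((τ.comp (algebraMap K L)).comp (algebraMap (𝓞 K) K)) + C ((m * N : ℕ) : ℝ) := by
      simp only [P, Polynomial.map_map, g, Polynomial.map_add, map_C, map_natCast, Polynomial.map_natCast]
    rw [h10, eval_add, eval_C] at h9
    have h11 : (N : ℝ) ≤ ((m * N : ℕ) : ℝ) := by exact_mod_cast Nat.le_mul_of_pos_left N hm1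
    linarith

lemma below_below (K : Type) [Field K] [NumberField K] (L : Type) [Field L] [NumberField L] [Algebra K L] {M : Type} [Field M] [NumberField M]
    [Algebra K M] [Algebra L M] [IsScalarTower K L M] (w : HeightOneSpectrum (𝓞 M)) :
    below K (below L w) = below K w := by
  apply HeightOneSpectrum.ext
  exact Ideal.under_under (A := 𝓞 K) (B := 𝓞 L) w.asIdeal

lemma above_finite (B : Finset (HeightOneSpectrum (𝓞 K))) (L : Type) [Field L] [NumberField L] [Algebra K L] :
    {w : HeightOneSpectrum (𝓞 L) | below K w ∈ B}.Finite := by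
  have h : ∀ v : HeightOneSpectrum (𝓞 K), ∃ x : 𝓞 K, x ∈ v.asIdeal ∧ x ≠ 0 := fun v =>
    Submodule.exists_mem_ne_zero_of_ne_bot v.ne_bot
  choose x hx hx0 using h
  refine (Set.Finite.biUnion B.finite_toSet (fun v _ =>
    HeightOneSpectrum.Support.finite (𝓞 L) ((algebraMap K L (x v))⁻¹))).subset ?_
  intro w hw
  rw [Set.mem_iUnion₂]
  refine ⟨below K w, hw, ?_⟩
  change 1 < w.valuation L _
  rw [map_inv₀, one_lt_inv₀ (by
    rw [zero_lt_iff, ne_eq, map_eq_zero, map_eq_zero]; exact_mod_cast hx0 _), val_map_lt_one]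
  exact (HeightOneSpectrum.valuation_lt_one_iff_mem _ _).2 (hx _)
end
end Prf
set_option linter.all false
set_option linter.unusedVariables false
set_option linter.unusedSimpArgs false
namespace Prf
open Module Polynomial TensorProduct WithZero NumberField IsDedekindDomain
section
variable {K : Type} [Field K] [NumberField K]

lemma totC_of_root {q : ℕ} (hq : q.Prime) (hq2 : q ≠ 2) {ζ : K} (hζ : IsPrimitiveRoot ζ q) : IsTotallyComplex K := by
  refine ⟨fun u => ?_⟩
  rw [← InfinitePlace.not_isReal_iff_isComplex]
  intro hu
  have h1 := hζ.map_of_injective (InfinitePlace.embedding_of_isReal hu).injective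
  have h2 : InfinitePlace.embedding_of_isReal hu ζ = 1 :=
    (hq.odd_of_ne_two hq2).strictMono_pow.injective (by simpa using h1.pow_eq_one)
  rw [h2] at h1
  exact hq.one_lt.ne' (h1.unique IsPrimitiveRoot.one)

lemma split_glob (C : Type) [Ring C] [Algebra K C] [IsSimpleRing C] [Algebra.IsCentral K C]
    [FiniteDimensional K C] {n : ℕ} (hn0 : 0 < n) (hn : finrank K C = n ^ 2)
    (B : Finset (HeightOneSpectrum (𝓞 K))) (hB : ∀ (L : Type) [Field L] [NumberField L] [Algebra K L]
      (w : HeightOneSpectrum (𝓞 L)), below K w ∉ B → Spl K C (w.adicCompletion L) n)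
    (F : Type) [Field F] [NumberField F] [Algebra K F]
    (hF : ∀ w : HeightOneSpectrum (𝓞 F), below K w ∈ B → ∃ f, cd w = cd (below K w) ^ f ∧ n ∣ f)
    (hc : Even n → IsTotallyComplex F) : Spl K C F n := by
  classical
  by_contra hns
  rw [← Spl_tower (F := F)] at hns
  obtain ⟨q, hq, hqn, K', _, _, _, ζ, a, b, hζ, ha, hb, hNF, hE⟩ := thmS ((CSA_AS K C).baseChange F) hn0
    (by rw [finrank_baseChange, hn]) hns
  haveI : NumberField K' := NumberField.of_module_finite F K'
  letI : Algebra K K' := ((algebraMap F K').comp (algebraMap K F)).toAlgebra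
  haveI : IsScalarTower K F K' := IsScalarTower.of_algebraMap_eq fun x => rfl
  haveI : IsTotallyComplex K' := by
    by_cases h2 : q = 2
    · subst h2
      haveI := hc (even_iff_two_dvd.2 hqn)
      exact isTotallyComplex_of_algebra F K'
    · exact totC_of_root hq h2 hζ
  refine hNF (thmH hq hζ (Units.mk0 a ha) (Units.mk0 b hb) fun w => ?_)
  refine hE (w.adicCompletion K') ?_
  haveI : IsScalarTower K F (w.adicCompletion K') := IsScalarTower.of_algebraMap_eq fun x => by
    rw [IsScalarTower.algebraMap_apply K K', IsScalarTower.algebraMap_apply F K', ← IsScalarTower.algebraMap_apply K F K']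
  rw [Spl_tower]
  by_cases hw : below K w ∈ B
  · rw [← below_below K F w] at hw
    obtain ⟨f, hf, hnf⟩ := hF _ hw
    have h3 := cd_pow (K := F) w
    rw [hf, below_below K F w, ← pow_mul] at h3
    exact split_bad C hn w h3 (hnf.mul_right _)
  · exact hB K' w hw

lemma embed_step {p : ℕ} (hp : p.Prime) (C : Type) [Ring C] [Algebra K C] [IsSimpleRing C] [Algebra.IsCentral K C]
    [FiniteDimensional K C] {n : ℕ} (hn0 : 0 < n) (hn : finrank K C = n ^ 2) (hpn : p ∣ n)
    (B : Finset (HeightOneSpectrum (𝓞 K))) (hBne : B.Nonempty)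
    (hB : ∀ (L : Type) [Field L] [NumberField L] [Algebra K L]
      (w : HeightOneSpectrum (𝓞 L)), below K w ∉ B → Spl K C (w.adicCompletion L) n)
    (L : Type) [Field L] [NumberField L] [Algebra K L] (hLp : finrank K L = p)
    (hL : ∀ w : HeightOneSpectrum (𝓞 L), below K w ∈ B → ∃ f, cd w = cd (below K w) ^ f ∧ p ∣ f)
    (hc : Even p → IsTotallyComplex L) : ∃ f : L →ₐ[K] C, Function.Injective f := by
  classical
  obtain ⟨d, rfl⟩ := hpn
  have hd : 0 < d := Nat.pos_of_mul_pos_left hn0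
  have hfin := above_finite B L
  have hne : hfin.toFinset.Nonempty := by
    obtain ⟨v, hv⟩ := hBne
    obtain ⟨w, hw⟩ := exists_above (L := L) v
    exact ⟨w, by rw [Set.Finite.mem_toFinset]; change below K w ∈ B; rwa [hw]⟩
  obtain ⟨F, _, _, _, hFd, hF, hFc⟩ := inert_ext hfin.toFinset hne hd
  letI : Algebra K F := ((algebraMap L F).comp (algebraMap K L)).toAlgebra
  haveI : IsScalarTower K L F := IsScalarTower.of_algebraMap_eq fun x => rfl
  have hKF : finrank K F = p * d := by rw [← finrank_mul_finrank K L F, hLp, hFd]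
  have hspl : Spl K C F (p * d) := by
    refine split_glob C hn0 hn B hB F ?_ ?_
    · intro w hw
      rw [← below_below K L w] at hw
      obtain ⟨f, hf, hpf⟩ := hL _ hw
      obtain ⟨e, he, hde⟩ := hF w (by rw [Set.Finite.mem_toFinset]; exact hw)
      rw [hf, below_below K L w, ← pow_mul] at he
      exact ⟨_, he, mul_dvd_mul hpf hde⟩
    · intro h
      rcases Nat.even_mul.1 h with h | h
      · haveI := hc h
        exact isTotallyComplex_of_algebra L F
      · exact hFc h
  haveI : FiniteDimensional K F := Module.finite_of_finrank_pos (by rw [hKF]; exact hn0)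
  obtain ⟨f, hf⟩ := embed_of_Spl hn hKF hspl
  exact ⟨f.comp (IsScalarTower.toAlgHom K L F), hf.comp (algebraMap L F).injective⟩

end
end Prf

theorem stmt_1 (K : Type) [Field K] [NumberField K] (p : ℕ) (hp : p.Prime)
    (C₁ C₂ : Type) [Ring C₁] [Ring C₂] [Algebra K C₁] [Algebra K C₂]
    [IsSimpleRing C₁] [IsSimpleRing C₂] [Algebra.IsCentral K C₁] [Algebra.IsCentral K C₂]
    [FiniteDimensional K C₁] [FiniteDimensional K C₂]
    (h₁ : p ∣ Module.finrank K C₁) (h₂ : p ∣ Module.finrank K C₂) :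
    ∃ (L : Type) (_ : Field L) (_ : Algebra K L), Module.finrank K L = p ∧
      (∃ f : L →ₐ[K] C₁, Function.Injective f) ∧ (∃ g : L →ₐ[K] C₂, Function.Injective g) := by
  classical
  obtain ⟨n₁, hn₁, hd₁, -⟩ := (Prf.CSA_AS K C₁).sq
  obtain ⟨n₂, hn₂, hd₂, -⟩ := (Prf.CSA_AS K C₂).sq
  rw [hd₁] at h₁
  rw [hd₂] at h₂
  obtain ⟨B₁, hB₁⟩ := Prf.exists_bad C₁ hn₁ hd₁
  obtain ⟨B₂, hB₂⟩ := Prf.exists_bad C₂ hn₂ hd₂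
  obtain ⟨v, -⟩ := Prf.exists_place (K := K) ∅
  let B := insert v (B₁ ∪ B₂)
  have hB : B.Nonempty := ⟨v, Finset.mem_insert_self _ _⟩
  obtain ⟨L, _, _, _, hLp, hL, hc⟩ := Prf.inert_ext B hB hp.pos
  refine ⟨L, inferInstance, inferInstance, hLp, ?_, ?_⟩
  · refine Prf.embed_step hp C₁ hn₁ hd₁ (hp.dvd_of_dvd_pow h₁) B hB (fun M _ _ _ w hw => hB₁ M w fun h => hw ?_) L hLp hL hc
    exact Finset.mem_insert_of_mem (Finset.mem_union_left _ h)
  · refine Prf.embed_step hp C₂ hn₂ hd₂ (hp.dvd_of_dvd_pow h₂) B hB (fun M _ _ _ w hw => hB₂ M w fun h => hw ?_) L hLp hL hc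
    exact Finset.mem_insert_of_mem (Finset.mem_union_right _ h)
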